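/- For every N > 0 there exist τ(N) > 0 and an integer k(N) such that the following holds. Let Ω ⊂ ℝⁿ be a C^{1,1} domain, B a ball centred at a point of ∂Ω with ∂Ω ∩ B ∈ Lip(τ) for some τ < τ(N), and let Q ⊂ (1/64)B be a cube centred on ∂Ω as in the standard construction. Let h ∈ C(Ω̄) be a nonzero function harmonic in Ω with ∂h/∂ν = 0 on ∂Ω ∩ B and N*_h(Q) ≤ N. Then for every k ≥ k(N) there exists a boundary cube q ∈ 𝓑_k(Q) such that Z(h) ∩ q = ∅. -/

import Mathlib

noncomputable section

open MeasureTheory Metric Set Filter Asymptotics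
open scoped Topology NNReal ENNReal RealInnerProductSpace

namespace NodalNeumann

/-- Euclidean space `ℝⁿ`. -/
abbrev Euc (n : ℕ) : Type := EuclideanSpace ℝ (Fin n)

/-- The first `n` coordinates `y'` of a point `y = (y', y'') ∈ ℝ^{n+1}`. -/
def front {n : ℕ} (y : Euc (n + 1)) : Euc n :=
  (EuclideanSpace.equiv (Fin n) ℝ).symm fun i => y i.castSucc

/-- The last coordinate `y''` of a point `y = (y', y'') ∈ ℝ^{n+1}`. -/
def lastc {n : ℕ} (y : Euc (n + 1)) : ℝ := y (Fin.last n)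

/-- `(v, a) ∈ ℝ^{n+1}` built from `v ∈ ℝⁿ` and `a ∈ ℝ`. -/
def snocVec {n : ℕ} (v : Euc n) (a : ℝ) : Euc (n + 1) :=
  (EuclideanSpace.equiv (Fin (n + 1)) ℝ).symm
    fun i => if h : i = Fin.last n then a else v (i.castPred h)

/-- The Laplacian of `u : ℝⁿ → ℝ`. -/
def laplacian {n : ℕ} (u : Euc n → ℝ) (x : Euc n) : ℝ :=
  ∑ i : Fin n, fderiv ℝ (fun y => fderiv ℝ u y (EuclideanSpace.single i 1)) x
    (EuclideanSpace.single i 1)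

/-- `u` is harmonic on `s`. -/
def HarmonicOn {n : ℕ} (u : Euc n → ℝ) (s : Set (Euc n)) : Prop :=
  ContDiffOn ℝ 2 u s ∧ ∀ x ∈ s, laplacian u x = 0

/-- `ν` is the outward unit normal vector of `Ω` at the boundary point `x`:
it is a unit vector, points out of `Ω`, `-ν` points into `Ω`, and it is
orthogonal to the boundary at `x` (in the little-o sense). -/
def OutwardNormalAt {n : ℕ} (Ω : Set (Euc n)) (x ν : Euc n) : Prop :=
  ‖ν‖ = 1 ∧
  (∀ᶠ t : ℝ in 𝓝[>] (0 : ℝ), x + t • ν ∉ closure Ω) ∧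
  (∀ᶠ t : ℝ in 𝓝[>] (0 : ℝ), x - t • ν ∈ Ω) ∧
  (fun y : Euc n => (⟪ν, y - x⟫)) =o[𝓝[frontier Ω] x] fun y => ‖y - x‖

/-- `ν` is an outward unit normal field of `Ω` along `∂Ω ∩ s`. -/
def OutwardNormalFieldOn {n : ℕ} (Ω : Set (Euc n)) (ν : Euc n → Euc n)
    (s : Set (Euc n)) : Prop :=
  ∀ x ∈ frontier Ω ∩ s, OutwardNormalAt Ω x (ν x)

/-- The homogeneous Neumann boundary condition `∂h/∂ν = 0` on `∂Ω ∩ s`. -/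
def NeumannBC {n : ℕ} (Ω : Set (Euc n)) (ν : Euc n → Euc n) (h : Euc n → ℝ)
    (s : Set (Euc n)) : Prop :=
  ∀ x ∈ frontier Ω ∩ s, DifferentiableWithinAt ℝ h (closure Ω) x ∧
    fderivWithin ℝ h (closure Ω) x (ν x) = 0

/-- `f : ℝⁿ → ℝ` is `C^{1,1}` with character `M`: differentiable with `M`-Lipschitz
derivative (and itself `M`-Lipschitz). -/
def IsC11FunWith {n : ℕ} (M : ℝ≥0) (f : Euc n → ℝ) : Prop :=
  Differentiable ℝ f ∧ LipschitzWith M f ∧ LipschitzWith M fun x => fderiv ℝ f x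

/-- `Ω ∩ B(x,r)` is, after an isometry `T` of `ℝ^{n+1}` with `T 0 = x`, the region
in the ball above the graph of a function `f` with `f 0 = 0` satisfying `P`. -/
def IsGraphBall {n : ℕ} (Ω : Set (Euc (n + 1))) (x : Euc (n + 1)) (r : ℝ)
    (P : (Euc n → ℝ) → Prop) : Prop :=
  ∃ (T : Euc (n + 1) ≃ᵃⁱ[ℝ] Euc (n + 1)) (f : Euc n → ℝ), P f ∧ T 0 = x ∧ f 0 = 0 ∧
    Ω ∩ ball x r =
      ⇑T '' {y : Euc (n + 1) | y ∈ ball (0 : Euc (n + 1)) r ∧ f (front y) < lastc y}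

/-- `∂Ω ∩ B(x,r) ∈ Lip(τ)`. -/
def LipGraphBall {n : ℕ} (Ω : Set (Euc (n + 1))) (x : Euc (n + 1)) (r τ : ℝ) : Prop :=
  IsGraphBall Ω x r fun f => LipschitzWith (Real.toNNReal τ) f

/-- `Ω` is a `C^{1,1}` domain with character `(ρ, M)`. -/
def IsC11DomainWith {n : ℕ} (Ω : Set (Euc (n + 1))) (ρ : ℝ) (M : ℝ≥0) : Prop :=
  IsOpen Ω ∧ IsConnected Ω ∧ 0 < ρ ∧
    ∀ x ∈ frontier Ω, IsGraphBall Ω x ρ (IsC11FunWith M)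

/-- `Ω` is a `C^{1,1}` domain. -/
def IsC11Domain {n : ℕ} (Ω : Set (Euc (n + 1))) : Prop :=
  ∃ (ρ : ℝ) (M : ℝ≥0), IsC11DomainWith Ω ρ M

/-- `Ω` is a Lipschitz domain with character `(ρ, M)`. -/
def IsLipDomainWith {n : ℕ} (Ω : Set (Euc (n + 1))) (ρ : ℝ) (M : ℝ≥0) : Prop :=
  IsOpen Ω ∧ IsConnected Ω ∧ 0 < ρ ∧
    ∀ x ∈ frontier Ω, IsGraphBall Ω x ρ fun f => LipschitzWith M f

/-- The portion `∂Ω ∩ s` of the boundary has `C^{1,1}` character `(ρ, M)`. -/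
def HasC11CharacterOn {n : ℕ} (Ω : Set (Euc (n + 1))) (s : Set (Euc (n + 1)))
    (ρ : ℝ) (M : ℝ≥0) : Prop :=
  0 < ρ ∧ ∀ x ∈ frontier Ω ∩ s, IsGraphBall Ω x ρ (IsC11FunWith M)

/-- `H_h(x,r) = ∫_{B(x,r) ∩ Ω} h²`. -/
def Hfun {n : ℕ} (Ω : Set (Euc n)) (h : Euc n → ℝ) (x : Euc n) (r : ℝ) : ℝ :=
  ∫ y in ball x r ∩ Ω, h y ^ 2

/-- The doubling index `N_h(x,r) = log (H_h(x,2r) / H_h(x,r))`. -/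
def Nfun {n : ℕ} (Ω : Set (Euc n)) (h : Euc n → ℝ) (x : Euc n) (r : ℝ) : ℝ :=
  Real.log (Hfun Ω h x (2 * r) / Hfun Ω h x r)

/-- Closed axis-parallel cube with centre `c` and side length `s`. -/
def cube {n : ℕ} (c : Euc n) (s : ℝ) : Set (Euc n) :=
  {y : Euc n | ∀ i, |y i - c i| ≤ s / 2}

/-- Maximal doubling index `N*_h(Q)` over the cube of centre `c` and side `s`
(whose diameter is `√n · s`). -/
def Nstar {n : ℕ} (Ω : Set (Euc n)) (h : Euc n → ℝ) (c : Euc n) (s : ℝ) : ℝ :=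
  sSup {N : ℝ | ∃ x ∈ cube c s ∩ closure Ω, ∃ r : ℝ,
    0 < r ∧ r ≤ Real.sqrt n * s ∧ N = Nfun Ω h x r}

/-- The nodal set `Z(h) = {x ∈ Ω : h x = 0}`. -/
def zeroSet {n : ℕ} (Ω : Set (Euc n)) (h : Euc n → ℝ) : Set (Euc n) :=
  {x ∈ Ω | h x = 0}

/-- `sup_s g`. -/
def supOn {α : Type*} (g : α → ℝ) (s : Set α) : ℝ := sSup (g '' s)

/-- The open cylinder `S(x,r,t)` of radius `r` and height `t` whose lower face is
centred at `x`. -/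
def cyl {n : ℕ} (x : Euc (n + 1)) (r t : ℝ) : Set (Euc (n + 1)) :=
  {y : Euc (n + 1) | ‖front y - front x‖ < r ∧ 0 < lastc y - lastc x ∧
    lastc y - lastc x < t}

/-- In the chosen coordinates (centred at `x`, with `e_n = -ν(x)`), `Ω ∩ B(x,R)`
is the region above the graph of the `τ`-Lipschitz function `f` with `f 0 = 0`. -/
def AlignedLipGraphOn {n : ℕ} (Ω : Set (Euc (n + 1))) (x : Euc (n + 1)) (R τ : ℝ)
    (f : Euc n → ℝ) : Prop :=
  LipschitzWith (Real.toNNReal τ) f ∧ f 0 = 0 ∧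
    Ω ∩ ball x R = {y ∈ ball x R | f (front (y - x)) < lastc (y - x)}

/-- `z` is the centre of one of the boundary cubes `q ∈ 𝓑_k(Q)` of the standard
construction for the cube `Q` of centre `xQ` and side `s`: the projection of `z` is
the centre of one of the `2^{k·n}` subcubes of side `s/2^k` of the projection of
`Q`, and `z` lies on `∂Ω`. The cube `q` itself is `cube z (s/2^k)`. -/
def IsBdryCubeCenter {n : ℕ} (Ω : Set (Euc (n + 1))) (xQ : Euc (n + 1)) (s : ℝ)
    (k : ℕ) (z : Euc (n + 1)) : Prop :=
  z ∈ frontier Ω ∧ ∃ a : Fin n → ℕ, (∀ i, a i < 2 ^ k) ∧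
    ∀ i : Fin n, z i.castSucc = xQ i.castSucc - s / 2 + ((a i : ℝ) + 1 / 2) * (s / 2 ^ k)

/-- The infinite cylinder `Ω₀ × ℝ ⊂ ℝ^{n+1}` over `Ω₀ ⊂ ℝⁿ`. -/
def prodDomain {n : ℕ} (Ω₀ : Set (Euc n)) : Set (Euc (n + 1)) :=
  {y : Euc (n + 1) | front y ∈ Ω₀}

/-- The harmonic extension `h(x,t) = e^{√λ t} u(x)` of `u` to `Ω₀ × ℝ`. -/
def hExt {n : ℕ} (lam : ℝ) (u : Euc n → ℝ) : Euc (n + 1) → ℝ :=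
  fun y => Real.exp (Real.sqrt lam * lastc y) * u (front y)

set_option linter.all false

variable {E : Type*} [NormedAddCommGroup E] [InnerProductSpace ℝ E] [FiniteDimensional ℝ E]

/-- pointwise harmonicity -/
def HarmAt (h : E → ℝ) (x : E) : Prop :=
  ContDiffAt ℝ 2 h x ∧ Laplacian.laplacian h x = 0

lemma HarmAt.sum_eq {h : E → ℝ} {x : E} (H : HarmAt h x) {ι : Type*} [Fintype ι]
    (b : OrthonormalBasis ι ℝ E) : ∑ i, fderiv ℝ (fderiv ℝ h) x (b i) (b i) = 0 := by
  have := H.2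
  rw [InnerProductSpace.laplacian_eq_iteratedFDeriv_orthonormalBasis h b] at this
  simpa [iteratedFDeriv_two_apply] using this

lemma HarmAt.neg {h : E → ℝ} {x : E} (H : HarmAt h x) : HarmAt (fun y => - h y) x := by
  refine ⟨H.1.neg, ?_⟩
  have := congrFun (InnerProductSpace.laplacian_neg (f := h)) x
  have h2 := H.2
  have e : (fun y => - h y) = -h := rfl
  rw [e, this]; simp [h2]

/-- Second symmetric differences of a `C²` function. -/
lemma tendsto_second_diff {h : E → ℝ} {x : E} (H : ContDiffAt ℝ 2 h x) (v : E) :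
    Tendsto (fun s : ℝ => (h (x + s • v) + h (x - s • v) - 2 * h x) / s ^ 2) (𝓝[>] 0)
      (𝓝 (fderiv ℝ (fderiv ℝ h) x v v)) := by
  have hd : ∀ᶠ y in 𝓝 x, DifferentiableAt ℝ h y := by
    filter_upwards [H.eventually (by simp)] with y hy using hy.differentiableAt (by norm_num)
  have h2 : DifferentiableAt ℝ (fderiv ℝ h) x :=
    (H.fderiv_right (m := 1) (by norm_num)).differentiableAt (by norm_num)
  -- derivative of numerator
  have hl : ∀ w : E, Tendsto (fun s : ℝ => x + s • w) (𝓝 0) (𝓝 x) := by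
    intro w
    have : Continuous (fun s : ℝ => x + s • w) := by fun_prop
    simpa using this.tendsto 0
  have hdn : ∀ᶠ s : ℝ in 𝓝[>] 0, HasDerivAt (fun s : ℝ => h (x + s • v) + h (x - s • v) - 2 * h x)
      (fderiv ℝ h (x + s • v) v - fderiv ℝ h (x - s • v) v) s := by
    have h1 := (hl v).eventually hd
    have h3 := (hl (-v)).eventually hd
    refine nhdsWithin_le_nhds ?_
    filter_upwards [h1, h3] with s hs1 hs2
    have a1 : HasDerivAt (fun s : ℝ => x + s • v) v s := by
      simpa using ((hasDerivAt_id s).smul_const v).const_add x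
    have a2 : HasDerivAt (fun s : ℝ => x - s • v) (-v) s := by
      simpa using ((hasDerivAt_id s).smul_const v).const_sub x
    have hs2' : DifferentiableAt ℝ h (x - s • v) := by
      simpa [sub_eq_add_neg] using hs2
    have b1 := hs1.hasFDerivAt.comp_hasDerivAt s a1
    have b2 := hs2'.hasFDerivAt.comp_hasDerivAt s a2
    have := (b1.add b2).sub_const (2 * h x)
    simpa [sub_eq_add_neg, Function.comp_def] using this
  refine HasDerivAt.lhopital_zero_nhdsGT (f' := fun s => fderiv ℝ h (x + s • v) v - fderiv ℝ h (x - s • v) v)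
    (g' := fun s => 2 * s) hdn ?_ ?_ ?_ ?_ ?_
  · filter_upwards with s
    simpa using hasDerivAt_pow 2 s
  · filter_upwards [self_mem_nhdsWithin] with s hs
    have : (0:ℝ) < s := hs
    positivity
  · have c0 : ContinuousAt h x := H.continuousAt
    have := ((c0.tendsto.comp (hl v)).add (c0.tendsto.comp (hl (-v)))).sub_const (2 * h x)
    have := this.mono_left (nhdsWithin_le_nhds (s := Ioi 0))
    convert this using 2
    · simp [sub_eq_add_neg]
    · ring
  · have : Continuous (fun s : ℝ => s ^ 2) := by fun_prop
    have := (this.tendsto 0).mono_left (nhdsWithin_le_nhds (s := Ioi 0))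
    simpa using this
  · -- quotient limit
    have a1 : HasDerivAt (fun s : ℝ => x + s • v) v 0 := by
      simpa using ((hasDerivAt_id (0:ℝ)).smul_const v).const_add x
    have a2 : HasDerivAt (fun s : ℝ => x - s • v) (-v) 0 := by
      simpa using ((hasDerivAt_id (0:ℝ)).smul_const v).const_sub x
    have hφ : HasFDerivAt (fun y => fderiv ℝ h y v)
        ((ContinuousLinearMap.apply ℝ ℝ v).comp (fderiv ℝ (fderiv ℝ h) x)) x :=
      (ContinuousLinearMap.apply ℝ ℝ v).hasFDerivAt.comp x h2.hasFDerivAt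
    have e1 : HasFDerivAt (fun y => fderiv ℝ h y v)
        ((ContinuousLinearMap.apply ℝ ℝ v).comp (fderiv ℝ (fderiv ℝ h) x)) (x + (0:ℝ) • v) := by
      simpa using hφ
    have e2 : HasFDerivAt (fun y => fderiv ℝ h y v)
        ((ContinuousLinearMap.apply ℝ ℝ v).comp (fderiv ℝ (fderiv ℝ h) x)) (x - (0:ℝ) • v) := by
      simpa using hφ
    have b1 := e1.comp_hasDerivAt (0:ℝ) a1
    have b2 := e2.comp_hasDerivAt (0:ℝ) a2
    have b := b1.sub b2
    have := b.tendsto_slope_zero_right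
    simp only [Function.comp_def, zero_smul, add_zero, sub_zero, map_zero, map_neg, zero_add,
      sub_self, sub_neg_eq_add, smul_eq_mul, Pi.sub_apply,
      ContinuousLinearMap.comp_apply, ContinuousLinearMap.apply_apply] at this
    have := this.const_mul (1/2:ℝ)
    have e3 : (1/2:ℝ) * (((fderiv ℝ (fderiv ℝ h) x) v) v + ((fderiv ℝ (fderiv ℝ h) x) v) v)
      = ((fderiv ℝ (fderiv ℝ h) x) v) v := by ring
    rw [e3] at this
    refine this.congr' ?_
    filter_upwards [self_mem_nhdsWithin] with s hs
    have : s ≠ 0 := ne_of_gt hs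
    field_simp

end NodalNeumann

end

noncomputable section
open MeasureTheory Metric Set Filter Asymptotics
open scoped Topology NNReal ENNReal RealInnerProductSpace
namespace NodalNeumann
set_option linter.all false
variable {E : Type*} [NormedAddCommGroup E] [InnerProductSpace ℝ E] [FiniteDimensional ℝ E]

lemma no_right_deriv_pos {γ : ℝ → ℝ} {c : ℝ} (hd : HasDerivWithinAt γ c (Ici 0) 0) (hc : 0 < c)
    (hle : ∀ᶠ s in 𝓝[>] (0:ℝ), γ s ≤ γ 0) : False := by
  have h1 := hd.Ioi_of_Ici
  rw [hasDerivWithinAt_iff_tendsto_slope' (by simp)] at h1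
  have h2 := h1.eventually (lt_mem_nhds hc)
  obtain ⟨s, ⟨hs1, hs2⟩, hs3⟩ := ((h2.and hle).and self_mem_nhdsWithin).exists
  have hs3 : (0:ℝ) < s := hs3
  rw [slope_def_field] at hs1
  have : (γ s - γ 0) / (s - 0) ≤ 0 := by
    apply div_nonpos_of_nonpos_of_nonneg <;> linarith
  linarith

lemma hasDerivAt_norm_comp {z : ℝ → E} {z' : E} {s : ℝ} (hz : HasDerivAt z z' s) (h0 : z s ≠ 0) :
    HasDerivAt (fun u => ‖z u‖) (⟪z s, z'⟫ / ‖z s‖) s := by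
  have h1 : HasDerivAt (fun u => ‖z u‖ ^ 2) (2 * ⟪z s, z'⟫) s := hz.norm_sq
  have h2 := h1.sqrt (by positivity)
  have e1 : (fun u => √(‖z u‖ ^ 2)) = fun u => ‖z u‖ := by
    funext u; exact Real.sqrt_sq (norm_nonneg _)
  rw [e1, Real.sqrt_sq (norm_nonneg _)] at h2
  convert h2 using 1
  have : ‖z s‖ ≠ 0 := by simpa using h0
  field_simp

/-- the penalised doubled function -/
def PhiL (h : E → ℝ) (e : E) (L ε M : ℝ) (x y : E) : ℝ :=
  h x - h y - L * ((‖x - y‖ - ‖x - y‖ ^ 2) * (2 - 5 * M * ⟪x + y, e⟫)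
    + 4 * ε * (2 - ⟪x + y, e⟫)) - 16 * (‖x‖ ^ 2 * (1 - 4 * M * ⟪x, e⟫))

set_option maxHeartbeats 800000 in
/-- the interior case -/
lemma lemL_interior {h : E → ℝ} {e : E} {L ε M : ℝ} (he : ‖e‖ = 1) (hM : 0 < M) (hM' : M ≤ 1 / 20)
    (hL : L = 20 * (Module.finrank ℝ E + 1)) {x y : E} (hx : ‖x‖ < 1 / 2) (hxy : ‖x - y‖ < 1 / 4)
    (hne : x ≠ y) (hhx : HarmAt h x) (hhy : HarmAt h y)
    (hmax : ∀ᶠ z in 𝓝 (x, y), PhiL h e L ε M z.1 z.2 ≤ PhiL h e L ε M x y) : False := by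
  set d := ‖x - y‖ with hd
  have hdpos : 0 < d := by rw [hd, norm_pos_iff, sub_ne_zero]; exact hne
  set ω : E := d⁻¹ • (x - y) with hω
  have hωn : ‖ω‖ = 1 := by
    rw [hω, norm_smul, norm_inv, Real.norm_of_nonneg hdpos.le, ← hd]; field_simp
  have hxyω : x - y = d • ω := by rw [hω, smul_smul]; field_simp; simp
  have hωω : ⟪ω, ω⟫ = 1 := by rw [real_inner_self_eq_norm_sq, hωn]; norm_num
  let Rf : E ≃ₗᵢ[ℝ] E := (Submodule.span ℝ {ω})ᗮ.reflection
  have hRf : ∀ v, Rf v = v - (2 * ⟪ω, v⟫) • ω := by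
    intro v
    have := Submodule.reflection_orthogonal_apply (K := Submodule.span ℝ {ω}) v
    simp only [Rf]
    rw [this, Submodule.reflection_singleton_apply]
    simp [hωn]
    module
  -- abbreviations
  set q := 2 - 5 * M * ⟪x + y, e⟫ with hq
  have hxe : |⟪x, e⟫| ≤ 1 / 2 := by
    have := abs_real_inner_le_norm x e; rw [he] at this; linarith
  have hye : |⟪y, e⟫| ≤ 3 / 4 := by
    have := abs_real_inner_le_norm y e; rw [he] at this
    have h2 : ‖y‖ ≤ ‖x‖ + ‖x - y‖ := by
      have := norm_sub_le x (x - y); simpa using this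
    linarith
  have hq1 : 1 ≤ q := by
    rw [hq, inner_add_left]
    have := abs_le.1 hxe; have := abs_le.1 hye
    nlinarith
  -- the inequality for each direction
  have key : ∀ v : E, ‖v‖ = 1 →
      fderiv ℝ (fderiv ℝ h) x v v - fderiv ℝ (fderiv ℝ h) y (Rf v) (Rf v)
      + L * (8 * ⟪ω, v⟫ ^ 2 * q + 20 * M * (1 - 2 * d) * ⟪ω, v⟫ * (2 * ⟪v, e⟫ - 2 * ⟪ω, v⟫ * ⟪ω, e⟫))
      - 16 * (2 * (1 - 4 * M * ⟪x, e⟫) - 16 * M * ⟪x, v⟫ * ⟪v, e⟫) ≤ 0 := by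
    intro v hv
    set σ := ⟪ω, v⟫ with hσ
    set c := 2 * ⟪v, e⟫ - 2 * σ * ⟪ω, e⟫ with hc
    have T1 := tendsto_second_diff hhx.1 v
    have T2 := tendsto_second_diff hhy.1 (Rf v)
    have T := ((T1.sub T2).add_const (L * (8 * σ ^ 2 * q + 20 * M * (1 - 2 * d) * σ * c))).sub_const
      (16 * (2 * (1 - 4 * M * ⟪x, e⟫) - 16 * M * ⟪x, v⟫ * ⟪v, e⟫))
    refine le_of_tendsto T ?_
    have hcont1 : Tendsto (fun s : ℝ => ((x + s • v, y + s • Rf v) : E × E)) (𝓝[>] 0) (𝓝 (x, y)) := by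
      have : Continuous (fun s : ℝ => ((x + s • v, y + s • Rf v) : E × E)) := by fun_prop
      have := this.tendsto 0
      simp only [zero_smul, add_zero] at this
      exact this.mono_left nhdsWithin_le_nhds
    have hcont2 : Tendsto (fun s : ℝ => ((x - s • v, y - s • Rf v) : E × E)) (𝓝[>] 0) (𝓝 (x, y)) := by
      have : Continuous (fun s : ℝ => ((x - s • v, y - s • Rf v) : E × E)) := by fun_prop
      have := this.tendsto 0
      simp only [zero_smul, sub_zero] at this
      exact this.mono_left nhdsWithin_le_nhds
    have hsm : ∀ᶠ s : ℝ in 𝓝[>] 0, 2 * s * |σ| < d := by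
      have : Continuous (fun s : ℝ => 2 * s * |σ|) := by fun_prop
      have h1 := this.tendsto 0
      simp only [mul_zero, zero_mul] at h1
      exact (h1.mono_left nhdsWithin_le_nhds).eventually (gt_mem_nhds hdpos)
    filter_upwards [hcont1.eventually hmax, hcont2.eventually hmax, hsm, self_mem_nhdsWithin]
      with s hs1 hs2 hs3 hs4
    have hs4 : (0:ℝ) < s := hs4
    simp only [PhiL] at hs1 hs2
    have aσ := abs_le.1 (le_refl |σ|)
    have n1 : ‖x + s • v - (y + s • Rf v)‖ = d + 2 * s * σ := by
      have : x + s • v - (y + s • Rf v) = (d + 2 * s * σ) • ω := by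
        rw [hRf, ← hσ, smul_sub, smul_smul, add_smul, ← hxyω]
        rw [show s * (2 * σ) = 2 * s * σ by ring]
        abel
      rw [this, norm_smul, hωn, mul_one, Real.norm_of_nonneg]
      nlinarith
    have n2 : ‖x - s • v - (y - s • Rf v)‖ = d - 2 * s * σ := by
      have : x - s • v - (y - s • Rf v) = (d - 2 * s * σ) • ω := by
        rw [hRf, ← hσ, smul_sub, smul_smul, sub_smul, ← hxyω]
        rw [show s * (2 * σ) = 2 * s * σ by ring]
        abel
      rw [this, norm_smul, hωn, mul_one, Real.norm_of_nonneg]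
      nlinarith
    have m1 : ‖x + s • v‖ ^ 2 = ‖x‖ ^ 2 + 2 * s * ⟪x, v⟫ + s ^ 2 := by
      rw [norm_add_sq_real, inner_smul_right, norm_smul, hv]; simp; ring
    have m2 : ‖x - s • v‖ ^ 2 = ‖x‖ ^ 2 - 2 * s * ⟪x, v⟫ + s ^ 2 := by
      rw [norm_sub_sq_real, inner_smul_right, norm_smul, hv]; simp; ring
    have i1 : ⟪x + s • v + (y + s • Rf v), e⟫ = ⟪x + y, e⟫ + s * c := by
      rw [hRf, ← hσ]
      simp only [inner_add_left, inner_smul_left, inner_sub_left, RCLike.conj_to_real]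
      rw [hc]; ring
    have i2 : ⟪x - s • v + (y - s • Rf v), e⟫ = ⟪x + y, e⟫ - s * c := by
      rw [hRf, ← hσ]
      simp only [inner_add_left, inner_smul_left, inner_sub_left, RCLike.conj_to_real]
      rw [hc]; ring
    have j1 : ⟪x + s • v, e⟫ = ⟪x, e⟫ + s * ⟪v, e⟫ := by
      simp only [inner_add_left, inner_smul_left, RCLike.conj_to_real]
    have j2 : ⟪x - s • v, e⟫ = ⟪x, e⟫ - s * ⟪v, e⟫ := by
      simp only [inner_sub_left, inner_smul_left, RCLike.conj_to_real]
    rw [n1, m1, i1, j1, ← hd] at hs1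
    rw [n2, m2, i2, j2, ← hd] at hs2
    have hs5 : 0 < s ^ 2 := by positivity
    rw [← sub_div]
    rw [← mul_le_mul_iff_left₀ hs5, zero_mul, sub_mul, add_mul, div_mul_cancel₀ _ hs5.ne']
    rw [hq]
    clear_value σ c d ω
    generalize ⟪x + y, e⟫ = A1 at *
    generalize ⟪x, e⟫ = A2 at *
    generalize ⟪v, e⟫ = A3 at *
    generalize ⟪x, v⟫ = A4 at *
    generalize h (x + s • v) = B1 at *
    generalize h (x - s • v) = B2 at *
    generalize h (y + s • Rf v) = B3 at *
    generalize h (y - s • Rf v) = B4 at *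
    generalize ‖x‖ ^ 2 = B5 at *
    linarith [hs1, hs2]
  -- sum up
  let b := stdOrthonormalBasis ℝ E
  have hs := Finset.sum_nonpos (fun i (_ : i ∈ Finset.univ) => key (b i) (b.orthonormal.1 i))
  have s1 := hhx.sum_eq b
  have s2 := hhy.sum_eq (b.map Rf)
  simp only [OrthonormalBasis.map_apply] at s2
  have s3 : ∑ i, ⟪ω, b i⟫ ^ 2 = 1 := by
    have := b.sum_inner_mul_inner ω ω
    rw [hωω] at this
    rw [← this]; congr 1; funext i; rw [real_inner_comm ω (b i)]; ring
  have s4 : ∑ i, ⟪ω, b i⟫ * ⟪b i, e⟫ = ⟪ω, e⟫ := b.sum_inner_mul_inner ω e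
  have s5 : ∑ i, ⟪x, b i⟫ * ⟪b i, e⟫ = ⟪x, e⟫ := b.sum_inner_mul_inner x e
  have hsum : ∑ i, (fderiv ℝ (fderiv ℝ h) x (b i) (b i) - fderiv ℝ (fderiv ℝ h) y (Rf (b i)) (Rf (b i))
      + L * (8 * ⟪ω, b i⟫ ^ 2 * q + 20 * M * (1 - 2 * d) * ⟪ω, b i⟫ * (2 * ⟪b i, e⟫ - 2 * ⟪ω, b i⟫ * ⟪ω, e⟫))
      - 16 * (2 * (1 - 4 * M * ⟪x, e⟫) - 16 * M * ⟪x, b i⟫ * ⟪b i, e⟫)) =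
      (∑ i, fderiv ℝ (fderiv ℝ h) x (b i) (b i)) - (∑ i, fderiv ℝ (fderiv ℝ h) y (Rf (b i)) (Rf (b i)))
      + L * (8 * (∑ i, ⟪ω, b i⟫ ^ 2) * q + 20 * M * (1 - 2 * d) * (2 * (∑ i, ⟪ω, b i⟫ * ⟪b i, e⟫)
        - 2 * (∑ i, ⟪ω, b i⟫ ^ 2) * ⟪ω, e⟫))
      - 16 * (2 * (1 - 4 * M * ⟪x, e⟫) * Module.finrank ℝ E - 16 * M * (∑ i, ⟪x, b i⟫ * ⟪b i, e⟫)) := by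
    have hcard : (Module.finrank ℝ E : ℝ) = ∑ i : Fin (Module.finrank ℝ E), (1:ℝ) := by simp
    rw [hcard]
    simp only [Finset.mul_sum, Finset.sum_mul, ← Finset.sum_sub_distrib, ← Finset.sum_add_distrib]
    congr 1; funext i; ring
  rw [hsum, s1, s2, s3, s4, s5, hL] at hs
  have := abs_le.1 hxe
  have hm : (0:ℝ) ≤ Module.finrank ℝ E := by positivity
  have hMx : |M * ⟪x, e⟫| ≤ 1 / 40 := by
    rw [abs_mul, abs_of_pos hM]; nlinarith
  have := abs_le.1 hMx
  nlinarith [mul_nonneg hm (sub_nonneg.2 hq1), mul_nonneg hm (sub_nonneg.2 this.1)]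

end NodalNeumann

end

noncomputable section
open MeasureTheory Metric Set Filter Asymptotics
open scoped Topology NNReal ENNReal RealInnerProductSpace
namespace NodalNeumann
set_option linter.all false
variable {E : Type*} [NormedAddCommGroup E] [InnerProductSpace ℝ E] [FiniteDimensional ℝ E]

/-- derivative of the penalty when the first variable moves -/
lemma PhiL_deriv_x {h : E → ℝ} {e : E} {L ε M : ℝ} {x y v : E} (hne : x ≠ y) (hve : ⟪v, e⟫ = 1)
    (hh : HasDerivWithinAt (fun s : ℝ => h (x + s • v)) 0 (Ici 0) 0) :
    HasDerivWithinAt (fun s : ℝ => PhiL h e L ε M (x + s • v) y)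
      (- L * ((1 - 2 * ‖x - y‖) * (⟪x - y, v⟫ / ‖x - y‖) * (2 - 5 * M * ⟪x + y, e⟫)
        - (‖x - y‖ - ‖x - y‖ ^ 2) * (5 * M) - 4 * ε)
        - 16 * (2 * ⟪x, v⟫ * (1 - 4 * M * ⟪x, e⟫) - ‖x‖ ^ 2 * (4 * M))) (Ici 0) 0 := by
  have a1 : HasDerivAt (fun s : ℝ => x + s • v) v 0 := by
    simpa using ((hasDerivAt_id (0:ℝ)).smul_const v).const_add x
  have a2 : HasDerivAt (fun s : ℝ => x + s • v - y) v 0 := a1.sub_const y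
  have a3 := hasDerivAt_norm_comp a2 (by simpa [sub_eq_zero] using hne)
  have a4 : HasDerivAt (fun s : ℝ => ⟪x + s • v + y, e⟫) 1 0 := by
    have e1 : (fun s : ℝ => ⟪x + s • v + y, e⟫) = fun s : ℝ => ⟪x + y, e⟫ + s := by
      funext s
      simp only [inner_add_left, inner_smul_left, RCLike.conj_to_real, hve]; ring
    rw [e1]; simpa using (hasDerivAt_id (0:ℝ)).const_add ⟪x + y, e⟫
  have a5 : HasDerivAt (fun s : ℝ => ⟪x + s • v, e⟫) 1 0 := by
    have e1 : (fun s : ℝ => ⟪x + s • v, e⟫) = fun s : ℝ => ⟪x, e⟫ + s := by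
      funext s
      simp only [inner_add_left, inner_smul_left, RCLike.conj_to_real, hve]; ring
    rw [e1]; simpa using (hasDerivAt_id (0:ℝ)).const_add ⟪x, e⟫
  have a6 : HasDerivAt (fun s : ℝ => ‖x + s • v‖ ^ 2) (2 * ⟪x + (0:ℝ) • v, v⟫) 0 := a1.norm_sq
  have b1 := ((a3.sub (a3.pow 2)).mul ((a4.const_mul (5 * M)).const_sub 2)).add
    (((a4.const_sub 2)).const_mul (4 * ε))
  have b2 := (a6.mul ((a5.const_mul (4 * M)).const_sub 1)).const_mul 16
  have b3 := ((hh.sub_const (h y)).sub (b1.const_mul L).hasDerivWithinAt).sub b2.hasDerivWithinAt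
  have b4 : HasDerivWithinAt (fun s : ℝ => PhiL h e L ε M (x + s • v) y) _ (Ici 0) 0 := b3
  refine b4.congr_deriv ?_
  simp; ring

/-- derivative of the penalty when the second variable moves -/
lemma PhiL_deriv_y {h : E → ℝ} {e : E} {L ε M : ℝ} {x y v : E} (hne : x ≠ y) (hve : ⟪v, e⟫ = 1)
    (hh : HasDerivWithinAt (fun s : ℝ => h (y + s • v)) 0 (Ici 0) 0) :
    HasDerivWithinAt (fun s : ℝ => PhiL h e L ε M x (y + s • v))
      (- L * ((1 - 2 * ‖x - y‖) * (⟪y - x, v⟫ / ‖x - y‖) * (2 - 5 * M * ⟪x + y, e⟫)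
        - (‖x - y‖ - ‖x - y‖ ^ 2) * (5 * M) - 4 * ε)) (Ici 0) 0 := by
  have a1 : HasDerivAt (fun s : ℝ => y + s • v) v 0 := by
    simpa using ((hasDerivAt_id (0:ℝ)).smul_const v).const_add y
  have a2 : HasDerivAt (fun s : ℝ => x - (y + s • v)) (-v) 0 := a1.const_sub x
  have a3 := hasDerivAt_norm_comp a2 (by simpa [sub_eq_zero] using hne)
  have a4 : HasDerivAt (fun s : ℝ => ⟪x + (y + s • v), e⟫) 1 0 := by
    have e1 : (fun s : ℝ => ⟪x + (y + s • v), e⟫) = fun s : ℝ => ⟪x + y, e⟫ + s := by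
      funext s
      simp only [inner_add_left, inner_smul_left, RCLike.conj_to_real, hve]; ring
    rw [e1]; simpa using (hasDerivAt_id (0:ℝ)).const_add ⟪x + y, e⟫
  have b1 := ((a3.sub (a3.pow 2)).mul ((a4.const_mul (5 * M)).const_sub 2)).add
    (((a4.const_sub 2)).const_mul (4 * ε))
  have b3 := ((hh.const_sub (h x)).sub (b1.const_mul L).hasDerivWithinAt).sub_const
    (16 * (‖x‖ ^ 2 * (1 - 4 * M * ⟪x, e⟫)))
  have e3 : ⟪y - x, v⟫ = - ⟪x - y, v⟫ := by rw [← inner_neg_left, neg_sub]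
  have b4 : HasDerivWithinAt (fun s : ℝ => PhiL h e L ε M x (y + s • v)) _ (Ici 0) 0 := b3
  refine b4.congr_deriv ?_
  have e4 : ⟪x - y, -v⟫ = - ⟪x - y, v⟫ := inner_neg_right _ _
  rw [e3]; simp only [zero_smul, add_zero, e4, Pi.sub_apply, Pi.pow_apply]; push_cast; ring

set_option maxHeartbeats 800000 in
/-- Normalised doubling-of-variables estimate. -/
lemma lemL {t h : E → ℝ} {n : E → E} {e : E} {ε M : ℝ} (he : ‖e‖ = 1) (hε : 0 ≤ ε) (hM : 0 < M)
    (hεM : ε + M ≤ 1 / 20)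
    (ht : Continuous t) (hc : ContinuousOn h ({x | 0 ≤ t x} ∩ ball 0 1))
    (hb : ∀ x ∈ ball (0:E) 1, 0 ≤ t x → |h x| ≤ 1)
    (hh : ∀ x ∈ ball (0:E) 1, 0 < t x → HarmAt h x)
    (hn : ∀ x ∈ ball (0:E) 1, t x = 0 → ⟪n x, e⟫ = 1 ∧
      HasDerivWithinAt (fun s : ℝ => h (x + s • n x)) 0 (Ici 0) 0 ∧
      (∀ᶠ s : ℝ in 𝓝[>] 0, 0 ≤ t (x + s • n x)) ∧
      ∀ y ∈ ball (0:E) 1, 0 ≤ t y → -(ε * ‖y - x‖ + M * ‖y - x‖ ^ 2) ≤ ⟪n x, y - x⟫)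
    (h0 : 0 ≤ t 0) {y0 : E} (hy0 : ‖y0‖ ≤ 1 / 4) (hty : 0 ≤ t y0) :
    h 0 - h y0 ≤ 20 * (Module.finrank ℝ E + 1) * (3 * ‖y0‖ + 9 * ε) := by
  set L : ℝ := 20 * (Module.finrank ℝ E + 1) with hL
  have hm : (0:ℝ) ≤ Module.finrank ℝ E := by positivity
  have hL20 : 20 ≤ L := by rw [hL]; linarith
  by_contra hcon
  push Not at hcon
  -- the compact set
  let K : Set (E × E) := {z | ‖z.1‖ ≤ 1 / 2 ∧ ‖z.1 - z.2‖ ≤ 1 / 4 ∧ 0 ≤ t z.1 ∧ 0 ≤ t z.2}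
  have hynorm : ∀ z ∈ K, ‖z.2‖ ≤ 3 / 4 := by
    rintro ⟨x, y⟩ ⟨h1, h2, -, -⟩
    have := norm_sub_le x (x - y)
    simp only [sub_sub_cancel] at this
    simp only at *
    linarith
  have hKc : IsCompact K := by
    refine IsCompact.of_isClosed_subset
      ((isCompact_closedBall (0:E) 1).prod (isCompact_closedBall (0:E) 1)) ?_ ?_
    · have c1 : IsClosed {z : E × E | ‖z.1‖ ≤ 1 / 2} := isClosed_le (by fun_prop) (by fun_prop)
      have c2 : IsClosed {z : E × E | ‖z.1 - z.2‖ ≤ 1 / 4} := isClosed_le (by fun_prop) (by fun_prop)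
      have c3 : IsClosed {z : E × E | 0 ≤ t z.1} := isClosed_le (by fun_prop) (by fun_prop)
      have c4 : IsClosed {z : E × E | 0 ≤ t z.2} := isClosed_le (by fun_prop) (by fun_prop)
      exact c1.inter (c2.inter (c3.inter c4))
    · intro z hz
      have := hynorm z hz
      have h1 := hz.1
      constructor <;> simp only [mem_closedBall, dist_zero_right] <;> linarith
  have hKb1 : ∀ z ∈ K, z.1 ∈ {x | 0 ≤ t x} ∩ ball (0:E) 1 := by
    intro z hz
    refine ⟨hz.2.2.1, ?_⟩
    have := hz.1
    simp only [mem_ball, dist_zero_right]; linarith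
  have hKb2 : ∀ z ∈ K, z.2 ∈ {x | 0 ≤ t x} ∩ ball (0:E) 1 := by
    intro z hz
    refine ⟨hz.2.2.2, ?_⟩
    have := hynorm z hz
    simp only [mem_ball, dist_zero_right]; linarith
  have hcΦ : ContinuousOn (fun z : E × E => PhiL h e L ε M z.1 z.2) K := by
    unfold PhiL
    have c1 : ContinuousOn (fun z : E × E => h z.1) K := hc.comp continuousOn_fst hKb1
    have c2 : ContinuousOn (fun z : E × E => h z.2) K := hc.comp continuousOn_snd hKb2
    refine ContinuousOn.sub (ContinuousOn.sub (c1.sub c2) ?_) ?_ <;>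
      exact Continuous.continuousOn (by fun_prop)
  have h0K : ((0, y0) : E × E) ∈ K := ⟨by simp, by simpa using hy0, h0, hty⟩
  obtain ⟨⟨x, y⟩, hzK, hzmax⟩ := hKc.exists_isMaxOn ⟨_, h0K⟩ hcΦ
  have hxn : ‖x‖ ≤ 1 / 2 := hzK.1
  have hxyn : ‖x - y‖ ≤ 1 / 4 := hzK.2.1
  have htx : 0 ≤ t x := hzK.2.2.1
  have hty' : 0 ≤ t y := hzK.2.2.2
  have hyn : ‖y‖ ≤ 3 / 4 := hynorm _ hzK
  have hin : ∀ z : E, |⟪z, e⟫| ≤ ‖z‖ := by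
    intro z
    have := abs_real_inner_le_norm z e
    rwa [he, mul_one] at this
  -- positivity at the max
  have hpos : 0 < PhiL h e L ε M x y := by
    have h1 : PhiL h e L ε M 0 y0 ≤ PhiL h e L ε M x y := hzmax h0K
    refine lt_of_lt_of_le ?_ h1
    unfold PhiL
    have h2 := abs_le.1 (hin y0)
    simp only [zero_sub, norm_neg, zero_add, norm_zero]
    have h3 : (‖y0‖ - ‖y0‖ ^ 2) * (2 - 5 * M * ⟪y0, e⟫) + 4 * ε * (2 - ⟪y0, e⟫) ≤
        3 * ‖y0‖ + 9 * ε := by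
      have n0 := norm_nonneg y0
      have k1 : 2 - 5 * M * ⟪y0, e⟫ ≤ 3 := by nlinarith
      have k2 : 0 ≤ ‖y0‖ - ‖y0‖ ^ 2 := by nlinarith
      have k3 : (‖y0‖ - ‖y0‖ ^ 2) * (2 - 5 * M * ⟪y0, e⟫) ≤ (‖y0‖ - ‖y0‖ ^ 2) * 3 := by gcongr
      have k4 : 4 * ε * (2 - ⟪y0, e⟫) ≤ 4 * ε * (9 / 4) := by gcongr; linarith
      nlinarith
    have h4 : L * ((‖y0‖ - ‖y0‖ ^ 2) * (2 - 5 * M * ⟪y0, e⟫) + 4 * ε * (2 - ⟪y0, e⟫)) ≤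
        L * (3 * ‖y0‖ + 9 * ε) := by gcongr
    simp
    linarith
  have hx1 := abs_le.1 (hin x)
  have hy1 := abs_le.1 (hin y)
  have hhx := abs_le.1 (hb x (hKb1 _ hzK).2 htx)
  have hhy := abs_le.1 (hb y (hKb2 _ hzK).2 hty')
  have hsum : |⟪x + y, e⟫| ≤ 5 / 4 := by
    rw [inner_add_left, abs_le]; constructor <;> linarith
  have hsum := abs_le.1 hsum
  have hMn : M ≤ 1 / 20 := by linarith
  have hq1 : 1 ≤ 2 - 5 * M * ⟪x + y, e⟫ := by nlinarith
  have hq3 : 2 - 5 * M * ⟪x + y, e⟫ ≤ 3 := by nlinarith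
  set d := ‖x - y‖ with hd
  have hd0 : 0 ≤ d := norm_nonneg _
  have hMx : |M * ⟪x, e⟫| ≤ 1 / 40 := by
    rw [abs_mul, abs_of_pos hM]
    have := hin x
    nlinarith [abs_nonneg ⟪x, e⟫]
  have hMx := abs_le.1 hMx
  have pen1 : 0 ≤ (d - d ^ 2) * (2 - 5 * M * ⟪x + y, e⟫) := by
    apply mul_nonneg <;> nlinarith
  have pen2 : 0 ≤ 4 * ε * (2 - ⟪x + y, e⟫) := by
    apply mul_nonneg <;> linarith
  have pen3 : ‖x‖ ^ 2 / 2 ≤ ‖x‖ ^ 2 * (1 - 4 * M * ⟪x, e⟫) := by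
    nlinarith [sq_nonneg ‖x‖]
  have hpos' := hpos
  unfold PhiL at hpos'
  rw [← hd] at hpos'
  have hLpen : 0 ≤ L * ((d - d ^ 2) * (2 - 5 * M * ⟪x + y, e⟫) + 4 * ε * (2 - ⟪x + y, e⟫)) := by
    positivity
  have hne : x ≠ y := by
    rintro rfl
    nlinarith [sq_nonneg ‖x‖]
  have hdpos : 0 < d := by rw [hd, norm_pos_iff, sub_ne_zero]; exact hne
  have hxlt : ‖x‖ < 1 / 2 := by
    by_contra hx2
    have : ‖x‖ = 1 / 2 := le_antisymm hxn (not_lt.1 hx2)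
    rw [this] at pen3 hpos'
    nlinarith
  have hdlt : d < 1 / 4 := by
    by_contra hx2
    have h14 : d = 1 / 4 := le_antisymm hxyn (not_lt.1 hx2)
    have k1 : (3 / 16 : ℝ) ≤ (d - d ^ 2) * (2 - 5 * M * ⟪x + y, e⟫) := by
      rw [h14]; nlinarith
    have k2 : 20 * (3 / 16 : ℝ) ≤ L * ((d - d ^ 2) * (2 - 5 * M * ⟪x + y, e⟫) + 4 * ε * (2 - ⟪x + y, e⟫)) := by
      apply mul_le_mul hL20 (by linarith) (by norm_num) (by linarith)
    nlinarith [sq_nonneg ‖x‖]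
  have hnear : ∀ᶠ z : E × E in 𝓝 (x, y), ‖z.1‖ ≤ 1 / 2 ∧ ‖z.1 - z.2‖ ≤ 1 / 4 := by
    have c1 : Continuous (fun z : E × E => ‖z.1‖) := by fun_prop
    have c2 : Continuous (fun z : E × E => ‖z.1 - z.2‖) := by fun_prop
    filter_upwards [(c1.tendsto (x, y)).eventually_lt_const (u := 1 / 2) hxlt,
      (c2.tendsto (x, y)).eventually_lt_const (u := 1 / 4) hdlt] with z h1 h2 using ⟨h1.le, h2.le⟩
  have hψ : 3 / 4 * d ≤ d - d ^ 2 := by nlinarith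
  -- common boundary estimate
  have hbd : ∀ I : ℝ, I ≤ ε * d + M * d ^ 2 →
      (1 - 2 * d) * (I / d) * (2 - 5 * M * ⟪x + y, e⟫) - (d - d ^ 2) * (5 * M) - 4 * ε ≤
        - ε - 3 / 4 * M * d := by
    intro I hI
    have k1 : I / d ≤ ε + M * d := by
      rw [div_le_iff₀ hdpos]; linarith [hI, show (ε + M * d) * d = ε * d + M * d ^ 2 by ring]
    have k2 : (1 - 2 * d) * (I / d) ≤ (1 - 2 * d) * (ε + M * d) := by
      apply mul_le_mul_of_nonneg_left k1; linarith
    have k3 : (1 - 2 * d) * (ε + M * d) ≤ ε + M * d := by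
      have : 0 ≤ ε + M * d := by positivity
      nlinarith
    have k4 : (1 - 2 * d) * (I / d) * (2 - 5 * M * ⟪x + y, e⟫) ≤ (ε + M * d) * 3 := by
      have : 0 ≤ ε + M * d := by positivity
      calc _ ≤ (ε + M * d) * (2 - 5 * M * ⟪x + y, e⟫) := by
            apply mul_le_mul_of_nonneg_right (k2.trans k3); linarith
        _ ≤ _ := by gcongr
    have k5 : 3 / 4 * d * (5 * M) ≤ (d - d ^ 2) * (5 * M) := by gcongr
    linarith
  rcases htx.eq_or_lt with hx0 | hxpos
  · -- boundary at x
    obtain ⟨n1, n2, n3, n4⟩ := hn x (hKb1 _ hzK).2 hx0.symm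
    have hD := PhiL_deriv_x (L := L) (ε := ε) (M := M) hne n1 n2
    refine no_right_deriv_pos hD ?_ ?_
    · rw [← hd]
      have i1 : ⟪x - y, n x⟫ ≤ ε * d + M * d ^ 2 := by
        have := n4 y (hKb2 _ hzK).2 hty'
        rw [norm_sub_rev, ← hd] at this
        rw [real_inner_comm, ← neg_sub y x, inner_neg_right]; linarith
      have i2 : ⟪x, n x⟫ ≤ ε * ‖x‖ + M * ‖x‖ ^ 2 := by
        have := n4 0 (by simp) h0
        simp only [zero_sub, norm_neg, inner_neg_right] at this
        rw [real_inner_comm]; linarith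
      have B := hbd _ i1
      have xn := norm_nonneg x
      have i3 : 2 * ⟪x, n x⟫ * (1 - 4 * M * ⟪x, e⟫) - ‖x‖ ^ 2 * (4 * M) ≤ 1.1 * ε := by
        have j1 : 2 * ⟪x, n x⟫ * (1 - 4 * M * ⟪x, e⟫) ≤ 2 * (ε * ‖x‖ + M * ‖x‖ ^ 2) * (1 - 4 * M * ⟪x, e⟫) := by
          apply mul_le_mul_of_nonneg_right <;> linarith
        have j2 : 2 * (ε * ‖x‖ + M * ‖x‖ ^ 2) * (1 - 4 * M * ⟪x, e⟫) ≤ 2 * (ε * ‖x‖ + M * ‖x‖ ^ 2) * 1.1 := by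
          apply mul_le_mul_of_nonneg_left; linarith; positivity
        have j3 : ε * ‖x‖ ≤ ε * (1 / 2) := by gcongr
        have j4 : 0 ≤ M * ‖x‖ ^ 2 := by positivity
        linarith
      have i4 : L * ((1 - 2 * d) * (⟪x - y, n x⟫ / d) * (2 - 5 * M * ⟪x + y, e⟫) - (d - d ^ 2) * (5 * M) - 4 * ε)
          ≤ L * (- ε - 3 / 4 * M * d) := by gcongr
      have i5 : 20 * (ε + 3 / 4 * M * d) ≤ L * (ε + 3 / 4 * M * d) := by gcongr
      have i6 : 0 < M * d := by positivity
      linarith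
    · have T : Tendsto (fun s : ℝ => ((x + s • n x, y) : E × E)) (𝓝[>] 0) (𝓝 (x, y)) := by
        have : Continuous (fun s : ℝ => ((x + s • n x, y) : E × E)) := by fun_prop
        have := this.tendsto 0
        simp only [zero_smul, add_zero] at this
        exact this.mono_left nhdsWithin_le_nhds
      filter_upwards [T.eventually hnear, n3] with s hs1 hs2
      have : ((x + s • n x, y) : E × E) ∈ K := ⟨hs1.1, hs1.2, hs2, hty'⟩
      have := hzmax this
      simpa using this
  · rcases hty'.eq_or_lt with hy0' | hypos
    · obtain ⟨n1, n2, n3, n4⟩ := hn y (hKb2 _ hzK).2 hy0'.symm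
      have hD := PhiL_deriv_y (L := L) (ε := ε) (M := M) hne n1 n2
      refine no_right_deriv_pos hD ?_ ?_
      · rw [← hd]
        have i1 : ⟪y - x, n y⟫ ≤ ε * d + M * d ^ 2 := by
          have := n4 x (hKb1 _ hzK).2 htx
          rw [← hd] at this
          rw [real_inner_comm, ← neg_sub x y, inner_neg_right]; linarith
        have B := hbd _ i1
        have i4 : L * ((1 - 2 * d) * (⟪y - x, n y⟫ / d) * (2 - 5 * M * ⟪x + y, e⟫) - (d - d ^ 2) * (5 * M) - 4 * ε)
          ≤ L * (- ε - 3 / 4 * M * d) := by gcongr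
        have i5 : 20 * (ε + 3 / 4 * M * d) ≤ L * (ε + 3 / 4 * M * d) := by gcongr
        have i6 : 0 < M * d := by positivity
        linarith
      · have T : Tendsto (fun s : ℝ => ((x, y + s • n y) : E × E)) (𝓝[>] 0) (𝓝 (x, y)) := by
          have : Continuous (fun s : ℝ => ((x, y + s • n y) : E × E)) := by fun_prop
          have := this.tendsto 0
          simp only [zero_smul, add_zero] at this
          exact this.mono_left nhdsWithin_le_nhds
        filter_upwards [T.eventually hnear, n3] with s hs1 hs2
        have : ((x, y + s • n y) : E × E) ∈ K := ⟨hs1.1, hs1.2, htx, hs2⟩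
        have := hzmax this
        simpa using this
    · refine lemL_interior (ε := ε) he hM hMn hL hxlt hdlt hne (hh x (hKb1 _ hzK).2 hxpos)
        (hh y (hKb2 _ hzK).2 hypos) ?_
      have c1 : ∀ᶠ z : E × E in 𝓝 (x, y), 0 < t z.1 :=
        ((ht.comp continuous_fst).tendsto (x, y)).eventually_const_lt hxpos
      have c2 : ∀ᶠ z : E × E in 𝓝 (x, y), 0 < t z.2 :=
        ((ht.comp continuous_snd).tendsto (x, y)).eventually_const_lt hypos
      filter_upwards [hnear, c1, c2] with z h1 h2 h3
      exact hzmax (show z ∈ K from ⟨h1.1, h1.2, h2.le, h3.le⟩)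

end NodalNeumann

end

noncomputable section
open MeasureTheory Metric Set Filter Asymptotics
open scoped Topology NNReal ENNReal RealInnerProductSpace
namespace NodalNeumann
set_option linter.all false
variable {E : Type*} [NormedAddCommGroup E] [InnerProductSpace ℝ E] [FiniteDimensional ℝ E]

lemma harmAt_iff {h : E → ℝ} {x : E} {ι : Type*} [Fintype ι] (b : OrthonormalBasis ι ℝ E) :
    HarmAt h x ↔ ContDiffAt ℝ 2 h x ∧ ∑ i, fderiv ℝ (fderiv ℝ h) x (b i) (b i) = 0 := by
  constructor
  · intro H; exact ⟨H.1, H.sum_eq b⟩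
  · rintro ⟨h1, h2⟩
    refine ⟨h1, ?_⟩
    rw [InnerProductSpace.laplacian_eq_iteratedFDeriv_orthonormalBasis h b, ← h2]
    simp [iteratedFDeriv_two_apply]

lemma _root_.ContDiffAt.eventually_differentiableAt_two {h : E → ℝ} {x : E} (H : ContDiffAt ℝ 2 h x) :
    ∀ᶠ y in 𝓝 x, DifferentiableAt ℝ h y := by
  filter_upwards [H.eventually (by simp)] with y hy
  exact hy.differentiableAt (by norm_num)

lemma _root_.ContDiffAt.fderiv_differentiableAt_two {h : E → ℝ} {x : E} (H : ContDiffAt ℝ 2 h x) :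
    DifferentiableAt ℝ (fderiv ℝ h) x :=
  (H.fderiv_right (m := 1) (by norm_num)).differentiableAt (by norm_num)

lemma HarmAt.affine {h : E → ℝ} {q x : E} {l κ : ℝ} (H : HarmAt h (q + l • x)) :
    HarmAt (fun y => κ * h (q + l • y)) x := by
  have b := stdOrthonormalBasis ℝ E
  rw [harmAt_iff b] at H ⊢
  have hco : ContDiff ℝ 2 (fun y : E => q + l • y) := by fun_prop
  refine ⟨contDiffAt_const.mul (H.1.comp x hco.contDiffAt), ?_⟩
  have hcont : Tendsto (fun y : E => q + l • y) (𝓝 x) (𝓝 (q + l • x)) := by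
    exact (by fun_prop : Continuous fun y : E => q + l • y).tendsto x
  have a1 : ∀ y, HasFDerivAt (fun x : E => q + l • x) (l • ContinuousLinearMap.id ℝ E) y :=
    fun y => ((hasFDerivAt_id y).const_smul l).const_add q
  have e1 : fderiv ℝ (fun y => κ * h (q + l • y)) =ᶠ[𝓝 x]
      fun y => (κ * l) • fderiv ℝ h (q + l • y) := by
    filter_upwards [hcont.eventually H.1.eventually_differentiableAt_two] with y hy
    have := ((hy.hasFDerivAt.comp y (a1 y)).const_mul κ).fderiv
    simp only [Function.comp_def] at this
    rw [this]
    ext v; simp; ring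
  have e2 : fderiv ℝ (fderiv ℝ (fun y => κ * h (q + l • y))) x =
      (κ * l) • ((fderiv ℝ (fderiv ℝ h) (q + l • x)).comp (l • ContinuousLinearMap.id ℝ E)) := by
    rw [e1.fderiv_eq]
    exact ((H.1.fderiv_differentiableAt_two.hasFDerivAt.comp x (a1 x)).const_smul (κ * l)).fderiv
  rw [e2]
  have : ∀ i, ((κ * l) • ((fderiv ℝ (fderiv ℝ h) (q + l • x)).comp (l • ContinuousLinearMap.id ℝ E))) (b i) (b i)
     = (κ * l * l) * (fderiv ℝ (fderiv ℝ h) (q + l • x) (b i) (b i)) := by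
    intro i; simp; ring
  simp only [this, ← Finset.mul_sum, H.2, mul_zero]

lemma HarmAt.sub_affine {h : E → ℝ} {x : E} (H : HarmAt h x) (ℓ : E →L[ℝ] ℝ) (p : E) (k : ℝ) :
    HarmAt (fun y => h y - ℓ (y - p) - k) x := by
  have b := stdOrthonormalBasis ℝ E
  rw [harmAt_iff b] at H ⊢
  have hℓ : ContDiff ℝ 2 (fun y : E => ℓ (y - p)) := by fun_prop
  refine ⟨(H.1.sub hℓ.contDiffAt).sub contDiffAt_const, ?_⟩
  have e1 : fderiv ℝ (fun y => h y - ℓ (y - p) - k) =ᶠ[𝓝 x] fun y => fderiv ℝ h y - ℓ := by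
    filter_upwards [H.1.eventually_differentiableAt_two] with y hy
    have a1 : HasFDerivAt (fun y : E => ℓ (y - p)) ℓ y := by
      exact ℓ.hasFDerivAt.comp y ((hasFDerivAt_id y).sub_const p)
    exact ((hy.hasFDerivAt.sub a1).sub_const k).fderiv
  rw [e1.fderiv_eq, fderiv_sub_const]
  exact H.2

/-- Local configuration: a `C^{1,1}` graph domain `{t > 0}` and a harmonic function with zero
Neumann data, in the ball `B(p,R)`. -/
structure Cfg (t h : E → ℝ) (n : E → E) (e : E) (p : E) (R τ M : ℝ) : Prop where
  he : ‖e‖ = 1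
  te : ∀ x u, t (x + u • e) = t x + u
  tlip : ∀ x y, |t x - t y - ⟪x - y, e⟫| ≤ τ * ‖x - y‖
  τ0 : 0 ≤ τ
  τ1 : τ ≤ 1 / 100
  M0 : 0 ≤ M
  tn : ∀ x ∈ ball p R, ∀ y ∈ ball p R, |t y - t x - ⟪n x, y - x⟫| ≤ M * ‖y - x‖ ^ 2
  hc : ContinuousOn h ({x | 0 ≤ t x} ∩ ball p R)
  hh : ∀ x ∈ ball p R, 0 < t x → HarmAt h x
  hN : ∀ x ∈ ball p R, t x = 0 → ∃ ℓ : E →L[ℝ] ℝ, HasFDerivWithinAt h ℓ {y | 0 ≤ t y} x ∧ ℓ (n x) = 0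

namespace Cfg
variable {t h : E → ℝ} {n : E → E} {e p : E} {R τ M : ℝ}

lemma mono (c : Cfg t h n e p R τ M) {q : E} {r : ℝ} (hs : ball q r ⊆ ball p R) :
    Cfg t h n e q r τ M :=
  ⟨c.he, c.te, c.tlip, c.τ0, c.τ1, c.M0, fun x hx y hy => c.tn x (hs hx) y (hs hy),
    c.hc.mono (inter_subset_inter_right _ hs), fun x hx => c.hh x (hs hx), fun x hx => c.hN x (hs hx)⟩

lemma tlip' (c : Cfg t h n e p R τ M) (x y : E) : |t x - t y| ≤ 2 * ‖x - y‖ := by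
  have h1 := abs_le.1 (c.tlip x y)
  have h2 := abs_real_inner_le_norm (x - y) e
  rw [c.he, mul_one] at h2
  have h2 := abs_le.1 h2
  have : τ * ‖x - y‖ ≤ 1 * ‖x - y‖ := by
    gcongr; have := c.τ1; linarith
  rw [abs_le]; constructor <;> linarith

lemma cont (c : Cfg t h n e p R τ M) : Continuous t := by
  have : LipschitzWith 2 t := LipschitzWith.of_dist_le_mul fun x y => by
    rw [Real.dist_eq, dist_eq_norm]; exact c.tlip' x y
  exact this.continuous

/-- a quadratic one-sided control on a linear functional forces it to vanish -/
lemma _root_.NodalNeumann.lin_zero_of_quad {a C δ : ℝ} (hδ : 0 < δ) (h : ∀ u : ℝ, 0 < u → u < δ → u * a ≤ C * u ^ 2) :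
    a ≤ 0 := by
  by_contra hc
  push Not at hc
  have hC : 0 < |C| + 1 := by positivity
  set u := min (δ / 2) (a / (2 * (|C| + 1))) with hu
  have hu0 : 0 < u := lt_min (by linarith) (by positivity)
  have hu1 : u < δ := lt_of_le_of_lt (min_le_left _ _) (by linarith)
  have h1 := h u hu0 hu1
  have h2 : u ≤ a / (2 * (|C| + 1)) := min_le_right _ _
  rw [le_div_iff₀ (by positivity)] at h2
  have h3 : a ≤ C * u := by
    have : u * a ≤ u * (C * u) := by nlinarith
    exact le_of_mul_le_mul_left this hu0
  have h4 : C * u ≤ |C| * u := by gcongr; exact le_abs_self C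
  nlinarith

lemma exists_small (c : Cfg t h n e p R τ M) {x : E} (hx : x ∈ ball p R) (v : E) :
    ∃ δ > 0, ∀ u : ℝ, 0 ≤ u → u < δ → x + u • v ∈ ball p R := by
  have : Tendsto (fun u : ℝ => x + u • v) (𝓝 0) (𝓝 x) := by
    have : Continuous (fun u : ℝ => x + u • v) := by fun_prop
    simpa using this.tendsto 0
  obtain ⟨δ, hδ, hb⟩ := Metric.eventually_nhds_iff.1 (this.eventually (isOpen_ball.mem_nhds hx))
  exact ⟨δ, hδ, fun u h0 h1 => hb (by simpa [Real.dist_eq, abs_of_nonneg h0] using h1)⟩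

lemma n_inner_le (c : Cfg t h n e p R τ M) {x : E} (hx : x ∈ ball p R) (v : E) :
    ⟪n x, v⟫ - ⟪v, e⟫ ≤ τ * ‖v‖ := by
  obtain ⟨δ, hδ, hb⟩ := c.exists_small hx v
  suffices ⟪n x, v⟫ - ⟪v, e⟫ - τ * ‖v‖ ≤ 0 by linarith
  refine lin_zero_of_quad hδ (C := M * ‖v‖ ^ 2) fun u h0 h1 => ?_
  have h2 := c.tn x hx _ (hb u h0.le h1)
  have h3 := c.tlip (x + u • v) x
  simp only [add_sub_cancel_left, inner_smul_left, inner_smul_right, norm_smul, Real.norm_eq_abs,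
    abs_of_pos h0, RCLike.conj_to_real] at h2 h3
  have h2 := abs_le.1 h2
  have h3 := abs_le.1 h3
  nlinarith

lemma n_inner_abs (c : Cfg t h n e p R τ M) {x : E} (hx : x ∈ ball p R) (v : E) :
    |⟪n x, v⟫ - ⟪v, e⟫| ≤ τ * ‖v‖ := by
  have h1 := c.n_inner_le hx v
  have h2 := c.n_inner_le hx (-v)
  simp only [inner_neg_left, inner_neg_right, norm_neg] at h2
  rw [abs_le]; constructor <;> linarith

lemma n_sub_e (c : Cfg t h n e p R τ M) {x : E} (hx : x ∈ ball p R) : ‖n x - e‖ ≤ τ := by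
  have h1 := c.n_inner_le hx (n x - e)
  rw [real_inner_comm _ (n x - e), ← inner_sub_left, real_inner_self_eq_norm_sq] at h1
  by_contra h2
  push Not at h2
  nlinarith [c.τ0]

lemma n_e (c : Cfg t h n e p R τ M) {x : E} (hx : x ∈ ball p R) : ⟪n x, e⟫ = 1 := by
  have key : ∀ σ : ℝ, (σ = 1 ∨ σ = -1) → σ * (1 - ⟪n x, e⟫) ≤ 0 := by
    intro σ hσ
    obtain ⟨δ, hδ, hb⟩ := c.exists_small hx (σ • e)
    refine lin_zero_of_quad hδ (C := M) fun u h0 h1 => ?_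
    have h2 := c.tn x hx _ (hb u h0.le h1)
    rw [smul_smul, c.te] at h2
    simp only [add_sub_cancel_left, inner_smul_right, norm_smul, Real.norm_eq_abs, c.he] at h2
    have h2 := abs_le.1 h2
    rcases hσ with rfl | rfl <;> simp [abs_of_pos h0] at h2 ⊢ <;> nlinarith
  have := key 1 (Or.inl rfl)
  have := key (-1) (Or.inr rfl)
  linarith

lemma n_norm (c : Cfg t h n e p R τ M) {x : E} (hx : x ∈ ball p R) : ‖n x‖ ≤ 1 + τ := by
  have h1 := c.n_sub_e hx
  have h2 := norm_add_le (n x - e) e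
  rw [sub_add_cancel, c.he] at h2
  linarith

lemma n_lip (c : Cfg t h n e p R τ M) {x y : E} (hx : x ∈ ball p (R / 3)) (hy : y ∈ ball p (R / 3)) :
    ‖n x - n y‖ ≤ 6 * M * ‖x - y‖ := by
  have hR : 0 < R := by
    have := (dist_nonneg.trans_lt hx); linarith
  have hx' : x ∈ ball p R := ball_subset_ball (by linarith) hx
  have hy' : y ∈ ball p R := ball_subset_ball (by linarith) hy
  rcases eq_or_ne (n x) (n y) with h0 | h0
  · rw [h0, sub_self, norm_zero]; have := c.M0; positivity
  set v := n x - n y with hv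
  have hv0 : 0 < ‖v‖ := norm_pos_iff.2 (sub_ne_zero.2 h0)
  set d := ‖x - y‖ with hd
  set z := y + (d / ‖v‖) • v with hz
  have hzy : ‖z - y‖ = d := by
    rw [hz, add_sub_cancel_left, norm_smul, Real.norm_eq_abs, abs_of_nonneg (by positivity)]
    field_simp
  have hdR : d < 2 * R / 3 := by
    have := dist_triangle_right x y p
    rw [dist_eq_norm x y] at this
    have h1 := mem_ball.1 hx
    have h2 := mem_ball.1 hy
    linarith
  have hz' : z ∈ ball p R := by
    rw [mem_ball]
    have := dist_triangle z y p
    rw [dist_eq_norm z y, hzy] at this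
    have h2 := mem_ball.1 hy
    linarith
  have hzx : ‖z - x‖ ≤ 2 * d := by
    have := norm_sub_le_norm_sub_add_norm_sub z y x
    rw [hzy, norm_sub_rev y x] at this
    linarith
  have h1 := abs_le.1 (c.tn x hx' z hz')
  have h2 := abs_le.1 (c.tn y hy' z hz')
  have h3 := abs_le.1 (c.tn x hx' y hy')
  rw [hzy] at h2
  rw [norm_sub_rev y x, ← hd] at h3
  have h4 : ‖z - x‖ ^ 2 ≤ 4 * d ^ 2 := by
    nlinarith [norm_nonneg (z - x)]
  have h5 : ⟪n x, z - x⟫ = ⟪n x, z - y⟫ + ⟪n x, y - x⟫ := by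
    rw [← inner_add_right]; congr 1; abel
  have h6 : ⟪n x, z - y⟫ - ⟪n y, z - y⟫ = d * ‖v‖ := by
    rw [← inner_sub_left, ← hv, hz, add_sub_cancel_left, inner_smul_right, real_inner_self_eq_norm_sq]
    field_simp
  have h7 : M * ‖z - x‖ ^ 2 ≤ M * (4 * d ^ 2) := by have := c.M0; gcongr
  have h8 : d * ‖v‖ ≤ d * (6 * M * d) := by nlinarith
  rcases (norm_nonneg (x - y)).eq_or_lt with hd0 | hd0
  · exfalso; apply h0
    have : x = y := by rwa [eq_comm, norm_eq_zero, sub_eq_zero] at hd0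
    rw [this]
  · exact le_of_mul_le_mul_left h8 hd0

lemma hasFDerivAt_t (c : Cfg t h n e p R τ M) {x : E} (hx : x ∈ ball p R) :
    HasFDerivAt t (innerSL ℝ (n x)) x := by
  rw [hasFDerivAt_iff_isLittleO]
  have : (fun y => t y - t x - innerSL ℝ (n x) (y - x)) =O[𝓝 x] fun y => ‖y - x‖ ^ 2 := by
    refine IsBigO.of_bound M ?_
    filter_upwards [isOpen_ball.mem_nhds hx] with y hy
    have := c.tn x hx y hy
    simpa using this
  refine this.trans_isLittleO ?_
  have : (fun y : E => ‖y - x‖ ^ 2) =o[𝓝 x] fun y => y - x := by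
    have := isLittleO_norm_pow_id (E' := E) one_lt_two
    have h2 := this.comp_tendsto (k := fun y => y - x) (l' := 𝓝 x) (by
      have : Continuous (fun y : E => y - x) := by fun_prop
      simpa using this.tendsto x)
    exact h2
  exact this

/-- translation/scaling of a configuration -/
lemma scale (c : Cfg t h n e p R τ M) (q : E) {l : ℝ} (hl : 0 < l) (κ : ℝ) :
    Cfg (fun x => t (q + l • x) / l) (fun x => κ * h (q + l • x)) (fun x => n (q + l • x)) e
      (l⁻¹ • (p - q)) (R / l) τ (M * l) := by
  have hball : ∀ x, x ∈ ball (l⁻¹ • (p - q)) (R / l) → q + l • x ∈ ball p R := by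
    intro x hx
    rw [mem_ball, dist_eq_norm] at hx ⊢
    have : q + l • x - p = l • (x - l⁻¹ • (p - q)) := by
      rw [smul_sub, smul_smul, mul_inv_cancel₀ hl.ne', one_smul]; abel
    rw [this, norm_smul, Real.norm_eq_abs, abs_of_pos hl]
    rwa [lt_div_iff₀ hl, mul_comm] at hx
  have hsub : ∀ x y : E, q + l • x - (q + l • y) = l • (x - y) := by
    intro x y; rw [smul_sub]; abel
  have hco : Continuous (fun x : E => q + l • x) := by fun_prop
  refine ⟨c.he, ?_, ?_, c.τ0, c.τ1, mul_nonneg c.M0 hl.le, ?_, ?_, ?_, ?_⟩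
  · intro x u
    have := c.te (q + l • x) (l * u)
    rw [smul_add, smul_smul, ← add_assoc, this]; field_simp
  · intro x y
    have := c.tlip (q + l • x) (q + l • y)
    rw [hsub, inner_smul_left, norm_smul, Real.norm_eq_abs, abs_of_pos hl] at this
    simp only [RCLike.conj_to_real] at this
    have e1 : t (q + l • x) / l - t (q + l • y) / l - ⟪x - y, e⟫ =
      (t (q + l • x) - t (q + l • y) - l * ⟪x - y, e⟫) / l := by field_simp
    rw [e1, abs_div, abs_of_pos hl, div_le_iff₀ hl]; linarith
  · intro x hx y hy
    have := c.tn _ (hball x hx) _ (hball y hy)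
    rw [hsub, inner_smul_right, norm_smul, Real.norm_eq_abs, abs_of_pos hl] at this
    have e1 : t (q + l • y) / l - t (q + l • x) / l - ⟪n (q + l • x), y - x⟫ =
      (t (q + l • y) - t (q + l • x) - l * ⟪n (q + l • x), y - x⟫) / l := by field_simp
    rw [e1, abs_div, abs_of_pos hl, div_le_iff₀ hl]; nlinarith
  · refine ContinuousOn.mul continuousOn_const (c.hc.comp hco.continuousOn ?_)
    rintro x ⟨hx1, hx2⟩
    refine ⟨?_, hball x hx2⟩
    simp only [mem_setOf_eq] at hx1 ⊢
    by_contra hneg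
    push Not at hneg
    have := div_neg_of_neg_of_pos hneg hl
    linarith
  · intro x hx htx
    have htx' : 0 < t (q + l • x) := by
      by_contra hneg
      push Not at hneg
      have := div_nonpos_of_nonpos_of_nonneg hneg hl.le
      linarith
    exact HarmAt.affine (c.hh _ (hball x hx) htx') 
  · intro x hx htx
    have htx' : t (q + l • x) = 0 := by
      rcases div_eq_zero_iff.1 htx with h | h
      · exact h
      · exact absurd h hl.ne'
    obtain ⟨ℓ, h1, h2⟩ := c.hN _ (hball x hx) htx'
    have a1 : HasFDerivAt (fun x : E => q + l • x) (l • ContinuousLinearMap.id ℝ E) x :=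
      ((hasFDerivAt_id x).const_smul l).const_add q
    have a2 := h1.comp (s := {y | 0 ≤ t (q + l • y) / l}) x a1.hasFDerivWithinAt (by
      intro y hy
      simp only [mem_setOf_eq] at hy ⊢
      by_contra hneg
      push Not at hneg
      have := div_neg_of_neg_of_pos hneg hl
      linarith)
    refine ⟨_, a2.const_mul κ, ?_⟩
    simp [h2]

end Cfg
end NodalNeumann

end

noncomputable section
open MeasureTheory Metric Set Filter Asymptotics
open scoped Topology NNReal ENNReal RealInnerProductSpace
namespace NodalNeumann
set_option linter.all false
variable {E : Type*} [NormedAddCommGroup E] [InnerProductSpace ℝ E] [FiniteDimensional ℝ E]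

/-- the basic dimensional constant -/
def LC (E : Type*) [NormedAddCommGroup E] [InnerProductSpace ℝ E] : ℝ := 20 * (Module.finrank ℝ E + 1)

lemma LC_ge : 20 ≤ LC E := by
  unfold LC; have : (0:ℝ) ≤ Module.finrank ℝ E := by positivity
  linarith

lemma LC_pos : 0 < LC E := lt_of_lt_of_le (by norm_num) LC_ge

/-- interior gradient estimate -/
lemma interior_grad {u : E → ℝ} {e x : E} (he : ‖e‖ = 1) {r S : ℝ} (hr : 0 < r) (hS : 0 < S)
    (hu : ∀ y ∈ ball x r, HarmAt u y) (hb : ∀ y ∈ ball x r, |u y| ≤ S) :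
    ‖fderiv ℝ u x‖ ≤ 3 * LC E * S / r := by
  have key : ∀ κ : ℝ, |κ| = S⁻¹ → ∀ z : E, ‖z‖ ≤ 1 / 4 → κ * u (x + r • 0) - κ * u (x + r • z) ≤ LC E * (3 * ‖z‖) := by
    intro κ hκ z hz
    have hmem : ∀ y ∈ ball (0:E) 1, x + r • y ∈ ball x r := by
      intro y hy
      rw [mem_ball, dist_eq_norm] at *
      rw [add_sub_cancel_left, norm_smul, Real.norm_eq_abs, abs_of_pos hr]
      simp only [sub_zero] at hy
      nlinarith
    have := lemL (t := fun _ => 1) (h := fun y => κ * u (x + r • y)) (n := fun _ => 0) (e := e) (ε := 0)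
      (M := 1 / 20) he le_rfl (by norm_num) (by norm_num) continuous_const ?_ ?_ ?_ ?_ (by norm_num) hz (by norm_num)
    · simpa [LC] using this
    · intro y hy
      have : HarmAt (fun y => κ * u (x + r • y)) y := HarmAt.affine (hu _ (hmem y hy.2))
      exact this.1.continuousAt.continuousWithinAt
    · intro y hy _
      rw [abs_mul, hκ]
      have := hb _ (hmem y hy)
      rw [inv_mul_le_iff₀ hS]; simpa using this
    · intro y hy _
      exact HarmAt.affine (hu _ (hmem y hy))
    · intro y hy h1
      norm_num at h1
  have hlip : ∀ᶠ y in 𝓝 x, ‖u y - u x‖ ≤ 3 * LC E * S / r * ‖y - x‖ := by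
    filter_upwards [ball_mem_nhds x (show 0 < r / 4 by positivity)] with y hy
    rw [mem_ball, dist_eq_norm] at hy
    set z := r⁻¹ • (y - x) with hz
    have e1 : x + r • z = y := by
      rw [hz, smul_smul, mul_inv_cancel₀ hr.ne', one_smul]; abel
    have e2 : ‖z‖ = ‖y - x‖ / r := by
      rw [hz, norm_smul, Real.norm_eq_abs, abs_of_pos (inv_pos.2 hr)]; field_simp
    have hz4 : ‖z‖ ≤ 1 / 4 := by
      rw [e2, div_le_iff₀ hr]; linarith
    have k1 := key S⁻¹ (abs_of_pos (inv_pos.2 hS)) z hz4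
    have k2 := key (-S⁻¹) (by rw [abs_neg]; exact abs_of_pos (inv_pos.2 hS)) z hz4
    rw [e1, smul_zero, add_zero, e2] at k1 k2
    have e3 : 3 * LC E * S / r * ‖y - x‖ = S * (LC E * (3 * (‖y - x‖ / r))) := by ring
    rw [e3, Real.norm_eq_abs, abs_le]
    have e4 : ∀ a : ℝ, S * (S⁻¹ * a) = a := fun a => by field_simp
    constructor
    · have := mul_le_mul_of_nonneg_left k1 hS.le
      rw [mul_sub, e4, e4] at this; linarith
    · have := mul_le_mul_of_nonneg_left k2 hS.le
      have e5 : S * (-S⁻¹ * u x - -S⁻¹ * u y) = u y - u x := by field_simp; ring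
      rw [e5] at this; linarith
  have hd : HasFDerivAt u (fderiv ℝ u x) x :=
    ((hu x (mem_ball_self hr)).1.differentiableAt (by norm_num)).hasFDerivAt
  exact hd.le_of_lip' (by have := LC_pos (E := E); positivity) hlip

namespace Cfg
variable {t h : E → ℝ} {n : E → E} {e p : E} {R τ M : ℝ}

/-- rescaled oscillation estimate -/
lemma osc (c : Cfg t h n e p R τ M) {x y : E} {r S ε M' : ℝ} (hr : 0 < r) (hS : 0 < S)
    (hε : 0 ≤ ε) (hM' : 0 < M') (hεM : ε + M' ≤ 1 / 20)
    (hsub : ball x r ⊆ ball p R) (hb : ∀ y ∈ ball x r, 0 ≤ t y → |h y| ≤ S)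
    (hn : ∀ a ∈ ball x r, t a = 0 → ∀ y ∈ ball x r, 0 ≤ t y →
      -(ε * ‖y - a‖ + M' / r * ‖y - a‖ ^ 2) ≤ ⟪n a, y - a⟫)
    (hx : 0 ≤ t x) (hy : 0 ≤ t y) (hxy : ‖y - x‖ ≤ r / 4) :
    |h x - h y| ≤ S * LC E * (3 * ‖y - x‖ / r + 9 * ε) := by
  have hmem : ∀ y ∈ ball (0:E) 1, x + r • y ∈ ball x r := by
    intro y hy
    rw [mem_ball, dist_eq_norm] at *
    rw [add_sub_cancel_left, norm_smul, Real.norm_eq_abs, abs_of_pos hr]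
    simp only [sub_zero] at hy
    nlinarith
  have htr : ∀ z, 0 ≤ t z / r → 0 ≤ t z := by
    intro z hz
    by_contra hneg
    push Not at hneg
    have := div_neg_of_neg_of_pos hneg hr
    linarith
  have key : ∀ κ : ℝ, |κ| = S⁻¹ → ∀ z : E, ‖z‖ ≤ 1 / 4 → 0 ≤ t (x + r • z) →
      κ * h (x + r • 0) - κ * h (x + r • z) ≤ LC E * (3 * ‖z‖ + 9 * ε) := by
    intro κ hκ z hz htz
    have c' := (c.mono hsub).scale x hr κ
    rw [sub_self, smul_zero, div_self hr.ne'] at c'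
    refine lemL (t := fun y => t (x + r • y) / r) (h := fun y => κ * h (x + r • y)) (n := fun y => n (x + r • y))
      (e := e) (ε := ε) (M := M') c.he hε hM' hεM c'.cont c'.hc ?_ c'.hh ?_ ?_ hz ?_
    · intro y hy hty
      rw [abs_mul, hκ]
      have := hb _ (hmem y hy) (htr _ hty)
      rw [inv_mul_le_iff₀ hS]; simpa using this
    · intro a ha hta
      have hne : ⟪n (x + r • a), e⟫ = 1 := c'.n_e ha
      have hin : ∀ s : ℝ, 0 ≤ s → 0 ≤ t (x + r • (a + s • n (x + r • a))) / r := by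
        intro s hs
        have h1 := abs_le.1 (c'.tlip (a + s • n (x + r • a)) a)
        rw [add_sub_cancel_left, inner_smul_left, hne, norm_smul, Real.norm_eq_abs, abs_of_nonneg hs] at h1
        simp only [RCLike.conj_to_real, mul_one] at h1
        have h2 : ‖n (x + r • a)‖ ≤ 1 + τ := c'.n_norm ha
        have h3 : τ * (s * ‖n (x + r • a)‖) ≤ 1 / 100 * (s * 2) := by
          have := c.τ1; have := c.τ0
          gcongr; linarith
        rw [hta] at h1
        linarith
      refine ⟨hne, ?_, ?_, ?_⟩
      · obtain ⟨ℓ, h1, h2⟩ := c'.hN a ha hta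
        have a1 : HasDerivAt (fun s : ℝ => a + s • n (x + r • a)) (n (x + r • a)) 0 := by
          simpa using ((hasDerivAt_id (0:ℝ)).smul_const (n (x + r • a))).const_add a
        have h1' : HasFDerivWithinAt (fun y => κ * h (x + r • y)) ℓ {y | 0 ≤ t (x + r • y) / r}
          (a + (0:ℝ) • n (x + r • a)) := by simpa using h1
        have a2 := h1'.comp_hasDerivWithinAt (s := Ici (0:ℝ)) 0 a1.hasDerivWithinAt (fun s hs => hin s hs)
        rw [h2] at a2
        exact a2
      · filter_upwards [self_mem_nhdsWithin] with s hs using hin s (le_of_lt hs)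
      · intro y hy hty
        have hta' : t (x + r • a) = 0 := by
          rcases div_eq_zero_iff.1 hta with h | h
          · exact h
          · exact absurd h hr.ne'
        have := hn _ (hmem a ha) hta' _ (hmem y hy) (htr _ hty)
        have e1 : x + r • y - (x + r • a) = r • (y - a) := by rw [smul_sub]; abel
        rw [e1, inner_smul_right, norm_smul, Real.norm_eq_abs, abs_of_pos hr] at this
        have e2 : -(ε * (r * ‖y - a‖) + M' / r * (r * ‖y - a‖) ^ 2) = r * (-(ε * ‖y - a‖ + M' * ‖y - a‖ ^ 2)) := by
          field_simp
        rw [e2] at this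
        exact le_of_mul_le_mul_left this hr
    · rw [smul_zero, add_zero]; positivity
    · positivity
  set z := r⁻¹ • (y - x) with hz
  have e1 : x + r • z = y := by
    rw [hz, smul_smul, mul_inv_cancel₀ hr.ne', one_smul]; abel
  have e2 : ‖z‖ = ‖y - x‖ / r := by
    rw [hz, norm_smul, Real.norm_eq_abs, abs_of_pos (inv_pos.2 hr)]; field_simp
  have hz4 : ‖z‖ ≤ 1 / 4 := by
    rw [e2, div_le_iff₀ hr]; linarith
  have k1 := key S⁻¹ (abs_of_pos (inv_pos.2 hS)) z hz4 (by rwa [e1])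
  have k2 := key (-S⁻¹) (by rw [abs_neg]; exact abs_of_pos (inv_pos.2 hS)) z hz4 (by rwa [e1])
  rw [e1, smul_zero, add_zero, e2] at k1 k2
  have e3 : S * LC E * (3 * ‖y - x‖ / r + 9 * ε) = S * (LC E * (3 * (‖y - x‖ / r) + 9 * ε)) := by ring
  rw [e3, abs_le]
  have e4 : ∀ a : ℝ, S * (S⁻¹ * a) = a := fun a => by field_simp
  constructor
  · have := mul_le_mul_of_nonneg_left k2 hS.le
    have e5 : S * (-S⁻¹ * h x - -S⁻¹ * h y) = h y - h x := by field_simp; ring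
    rw [e5] at this; linarith
  · have := mul_le_mul_of_nonneg_left k1 hS.le
    rw [mul_sub, e4, e4] at this; linarith

lemma osc_eps (c : Cfg t h n e p R τ M) {x y : E} {r S : ℝ} (hr : 0 < r) (hS : 0 < S)
    (hsub : ball x r ⊆ ball p R) (hb : ∀ y ∈ ball x r, 0 ≤ t y → |h y| ≤ S)
    (hx : 0 ≤ t x) (hy : 0 ≤ t y) (hxy : ‖y - x‖ ≤ r / 4) :
    |h x - h y| ≤ S * LC E * (3 * ‖y - x‖ / r + 18 * τ) := by
  have := c.osc (M' := 1 / 50) hr hS (ε := 2 * τ) (by linarith [c.τ0]) (by norm_num) (by linarith [c.τ1])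
    hsub hb ?_ hx hy hxy
  · convert this using 2; ring
  · intro a ha hta y hy hty
    have h1 := abs_le.1 (c.n_inner_abs (hsub ha) (y - a))
    have h2 := abs_le.1 (c.tlip y a)
    have h3 : 0 ≤ 1 / 50 / r * ‖y - a‖ ^ 2 := by positivity
    linarith

lemma osc_M (c : Cfg t h n e p R τ M) {x y : E} {r S : ℝ} (hr : 0 < r) (hS : 0 < S) (hMr : M * r ≤ 1 / 20)
    (hsub : ball x r ⊆ ball p R) (hb : ∀ y ∈ ball x r, 0 ≤ t y → |h y| ≤ S)
    (hx : 0 ≤ t x) (hy : 0 ≤ t y) (hxy : ‖y - x‖ ≤ r / 4) :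
    |h x - h y| ≤ 3 * LC E * S / r * ‖y - x‖ := by
  have := c.osc (M' := 1 / 20) hr hS (ε := 0) le_rfl (by norm_num) (by norm_num)
    hsub hb ?_ hx hy hxy
  · convert this using 1; ring
  · intro a ha hta y hy hty
    have h1 := abs_le.1 (c.tn a (hsub ha) y (hsub hy))
    have h3 : M * ‖y - a‖ ^ 2 ≤ 1 / 20 / r * ‖y - a‖ ^ 2 := by
      gcongr; rw [le_div_iff₀ hr]; exact hMr
    linarith

lemma grad_M (c : Cfg t h n e p R τ M) {x : E} {r S : ℝ} (hr : 0 < r) (hS : 0 < S) (hMr : M * r ≤ 1 / 20)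
    (hsub : ball x r ⊆ ball p R) (hb : ∀ y ∈ ball x r, 0 ≤ t y → |h y| ≤ S)
    (hx : 0 < t x) : ‖fderiv ℝ h x‖ ≤ 3 * LC E * S / r := by
  have hd : HasFDerivAt h (fderiv ℝ h x) x :=
    ((c.hh x (hsub (mem_ball_self hr)) hx).1.differentiableAt (by norm_num)).hasFDerivAt
  refine hd.le_of_lip' (by have := LC_pos (E := E); positivity) ?_
  filter_upwards [ball_mem_nhds x (show 0 < r / 4 by positivity),
    (c.cont.tendsto x).eventually_const_lt hx] with y hy hty
  rw [mem_ball, dist_eq_norm] at hy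
  rw [norm_sub_rev, Real.norm_eq_abs]
  exact c.osc_M hr hS hMr hsub hb hx.le hty.le hy.le

/-- the gradient converges nontangentially at boundary points -/
lemma grad_tendsto (c : Cfg t h n e p R τ M) {b : E} (hb : b ∈ ball p R) (htb : t b = 0) :
    ∃ ℓ : E →L[ℝ] ℝ, ℓ (n b) = 0 ∧ Tendsto (fun s : ℝ => fderiv ℝ h (b + s • e)) (𝓝[>] 0) (𝓝 ℓ) := by
  obtain ⟨ℓ, h1, h2⟩ := c.hN b hb htb
  refine ⟨ℓ, h2, ?_⟩
  have hL := LC_pos (E := E)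
  rw [Metric.tendsto_nhds]
  intro η hη
  set δ := η / (24 * LC E) with hδ
  have hδ0 : 0 < δ := by positivity
  rw [hasFDerivWithinAt_iff_isLittleO] at h1
  have h3 := h1.def hδ0
  rw [eventually_nhdsWithin_iff] at h3
  obtain ⟨ρ, hρ, hρb⟩ := Metric.eventually_nhds_iff.1 (h3.and (isOpen_ball.mem_nhds hb))
  have : Ioo (0:ℝ) (ρ / 2) ∈ 𝓝[>] (0:ℝ) := Ioo_mem_nhdsGT (by positivity)
  filter_upwards [this] with s hs
  have hs0 := hs.1
  have hmem : ∀ y ∈ ball (b + s • e) (s / 2), 0 < t y ∧ ‖y - b‖ ≤ 2 * s ∧ dist y b < ρ := by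
    intro y hy
    rw [mem_ball, dist_eq_norm] at hy
    have k1 := abs_le.1 (c.tlip' y (b + s • e))
    rw [c.te, htb] at k1
    have k2 : ‖y - b‖ ≤ ‖y - (b + s • e)‖ + ‖s • e‖ := by
      have := norm_add_le (y - (b + s • e)) (s • e)
      rwa [show y - (b + s • e) + s • e = y - b by abel] at this
    rw [norm_smul, c.he, Real.norm_eq_abs, abs_of_pos hs0] at k2
    refine ⟨by linarith, by linarith, ?_⟩
    rw [dist_eq_norm]; linarith [hs.2]
  have hx : b + s • e ∈ ball (b + s • e) (s / 2) := mem_ball_self (by linarith)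
  have G := interior_grad (u := fun y => h y - ℓ (y - b) - h b) (x := b + s • e) c.he (r := s / 2)
    (S := δ * (2 * s)) (by linarith) (by positivity) ?_ ?_
  · have hd : HasFDerivAt h (fderiv ℝ h (b + s • e)) (b + s • e) :=
      ((c.hh _ (hρb (hmem _ hx).2.2).2 (hmem _ hx).1).1.differentiableAt (by norm_num)).hasFDerivAt
    have a1 : HasFDerivAt (fun y : E => ℓ (y - b)) ℓ (b + s • e) := by
      exact ℓ.hasFDerivAt.comp _ ((hasFDerivAt_id _).sub_const b)
    have a2 : HasFDerivAt (fun y => h y - ℓ (y - b) - h b) (fderiv ℝ h (b + s • e) - ℓ) (b + s • e) :=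
      (hd.sub a1).sub_const (h b)
    rw [a2.fderiv] at G
    rw [dist_eq_norm]
    have e1 : 3 * LC E * (δ * (2 * s)) / (s / 2) = η / 2 := by
      rw [hδ]; field_simp; norm_num
    rw [e1] at G
    linarith
  · intro y hy
    exact (c.hh _ (hρb (hmem _ hy).2.2).2 (hmem _ hy).1).sub_affine ℓ b (h b)
  · intro y hy
    have k := (hρb (hmem _ hy).2.2).1 (hmem _ hy).1.le
    rw [Real.norm_eq_abs] at k
    have e1 : h y - ℓ (y - b) - h b = h y - h b - ℓ (y - b) := by ring
    rw [e1]
    refine k.trans ?_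
    have := (hmem y hy).2.1
    gcongr

end Cfg
end NodalNeumann

end

noncomputable section
open MeasureTheory Metric Set Filter Asymptotics
open scoped Topology NNReal ENNReal RealInnerProductSpace
namespace NodalNeumann
set_option linter.all false
variable {E : Type*} [NormedAddCommGroup E] [InnerProductSpace ℝ E] [FiniteDimensional ℝ E]

/-- smallness threshold for the Lipschitz constant -/
def tau0 (E : Type*) [NormedAddCommGroup E] [InnerProductSpace ℝ E] : ℝ :=
  1 / (72 * 2 ^ (Module.finrank ℝ E) * LC E)

lemma tau0_pos : 0 < tau0 E := by
  unfold tau0; have := LC_pos (E := E); positivity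

variable [MeasurableSpace E] [BorelSpace E]

/-- constant in the growth lemma -/
def CG (E : Type*) [NormedAddCommGroup E] [InnerProductSpace ℝ E] [MeasurableSpace E] [BorelSpace E]
    [FiniteDimensional ℝ E] : ℝ :=
  4 * (192 * 2 ^ (Module.finrank ℝ E) * LC E) ^ (Module.finrank ℝ E) / volume.real (ball (0:E) 1)

lemma vol_ball_pos : 0 < volume.real (ball (0:E) 1) := by
  rw [measureReal_def, ENNReal.toReal_pos_iff]
  exact ⟨measure_ball_pos _ _ one_pos, measure_ball_lt_top⟩

lemma CG_pos : 0 < CG E := by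
  unfold CG; have := LC_pos (E := E); have := vol_ball_pos (E := E); positivity

lemma vol_ball (x : E) {r : ℝ} (hr : 0 < r) :
    volume.real (ball x r) = r ^ (Module.finrank ℝ E) * volume.real (ball (0:E) 1) := by
  rw [measureReal_def, Measure.addHaar_ball_of_pos _ _ hr, ENNReal.toReal_mul, ENNReal.toReal_ofReal (by positivity),
    measureReal_def]

namespace Cfg
variable {t h : E → ℝ} {n : E → E} {e p : E} {R τ M : ℝ}

lemma bdd (c : Cfg t h n e p R τ M) {q : E} {r : ℝ} (hsub : closedBall q r ⊆ ball p R) :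
    ∃ S > 0, ∀ y ∈ closedBall q r, 0 ≤ t y → |h y| ≤ S := by
  have hK : IsCompact ({x | 0 ≤ t x} ∩ closedBall q r) :=
    (isCompact_closedBall q r).inter_left (isClosed_le continuous_const c.cont)
  obtain ⟨S, hS⟩ := hK.exists_bound_of_continuousOn (c.hc.mono (inter_subset_inter_right _ hsub))
  refine ⟨max S 1, by positivity, fun y hy hty => ?_⟩
  exact (hS y ⟨hty, hy⟩).trans (le_max_left _ _)

lemma meas_U (c : Cfg t h n e p R τ M) : MeasurableSet {x | 0 < t x} :=
  (isOpen_lt continuous_const c.cont).measurableSet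

lemma integrable_of_bdd (c : Cfg t h n e p R τ M) {q : E} {r : ℝ} (hsub : closedBall q r ⊆ ball p R) 
    (k : ℕ) : IntegrableOn (fun y => h y ^ k) ({x | 0 < t x} ∩ ball q r) := by
  obtain ⟨S, hS0, hS⟩ := c.bdd hsub
  have hm : MeasurableSet ({x | 0 < t x} ∩ ball q r) := c.meas_U.inter measurableSet_ball
  refine IntegrableOn.of_bound ((measure_mono inter_subset_right).trans_lt measure_ball_lt_top) ?_ (S ^ k) ?_
  · refine ContinuousOn.aestronglyMeasurable (β := ℝ) ((c.hc.mono ?_).pow k) hm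
    rintro x ⟨h1, h2⟩
    exact ⟨show 0 ≤ t x from le_of_lt h1, hsub (ball_subset_closedBall h2)⟩
  · filter_upwards [ae_restrict_mem hm] with x hx
    rw [norm_pow]
    have := hS x (ball_subset_closedBall hx.2) (le_of_lt hx.1)
    gcongr
    exact this

/-- local boundedness -/
lemma growth (c : Cfg t h n e p R τ M) (hτ : τ ≤ tau0 E) {q : E} {r : ℝ} (hr : 0 < r)
    (hsub : closedBall q (2 * r) ⊆ ball p R) {x : E} (hx : x ∈ closedBall q r) (htx : 0 ≤ t x) :
    h x ^ 2 * r ^ (Module.finrank ℝ E) ≤ CG E * ∫ y in {x | 0 < t x} ∩ ball q (2 * r), h y ^ 2 := by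
  set m := Module.finrank ℝ E with hm
  have hL := LC_pos (E := E)
  have hLge := LC_ge (E := E)
  have hω := vol_ball_pos (E := E)
  have hI0 : 0 ≤ ∫ y in {x | 0 < t x} ∩ ball q (2 * r), h y ^ 2 :=
    integral_nonneg fun y => sq_nonneg _
  set K : Set E := {x | 0 ≤ t x} ∩ closedBall q (2 * r) with hKdef
  have hK : IsCompact K := (isCompact_closedBall q (2 * r)).inter_left (isClosed_le continuous_const c.cont)
  have hxK : x ∈ K := ⟨htx, closedBall_subset_closedBall (by linarith) hx⟩
  have hcw : ContinuousOn (fun y => (2 * r - ‖y - q‖) ^ m * h y ^ 2) K :=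
    ContinuousOn.mul (by fun_prop) ((c.hc.mono (inter_subset_inter_right _ hsub)).pow 2)
  obtain ⟨z, hzK, hzmax⟩ := hK.exists_isMaxOn ⟨x, hxK⟩ hcw
  have hxq : ‖x - q‖ ≤ r := by simpa [dist_eq_norm] using hx
  have hx1 : h x ^ 2 * r ^ m ≤ (2 * r - ‖x - q‖) ^ m * h x ^ 2 := by
    rw [mul_comm]; gcongr; linarith
  have hx2 : (2 * r - ‖x - q‖) ^ m * h x ^ 2 ≤ (2 * r - ‖z - q‖) ^ m * h z ^ 2 := hzmax hxK
  by_cases hhx : h x = 0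
  · rw [hhx]; have := CG_pos (E := E); simp; positivity
  have hlhs : 0 < h x ^ 2 * r ^ m := by positivity
  set d := 2 * r - ‖z - q‖ with hd
  have hzq : ‖z - q‖ ≤ 2 * r := by simpa [dist_eq_norm] using hzK.2
  have hd0 : 0 ≤ d := by linarith
  have hzpos : 0 < d ^ m * h z ^ 2 := by linarith
  have hhz : h z ≠ 0 := by rintro h0; rw [h0] at hzpos; simp at hzpos
  rcases hd0.eq_or_lt with hd00 | hdpos
  · -- m = 0 would be needed
    exfalso
    rw [← hd00] at hzpos
    have hm0 : m = 0 := by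
      by_contra hne
      rw [zero_pow hne] at hzpos; simp at hzpos
    have := Module.finrank_zero_iff.1 (hm ▸ hm0)
    have he := c.he
    rw [Subsingleton.elim e 0] at he
    simp at he
  set S := |h z| with hS
  have hS0 : 0 < S := abs_pos.2 hhz
  set A : ℝ := 2 ^ m with hA
  have hA1 : 1 ≤ A := one_le_pow₀ (by norm_num)
  have hballd : ∀ y ∈ ball z (d / 2), ‖y - q‖ ≤ 2 * r - d / 2 := by
    intro y hy
    rw [mem_ball, dist_eq_norm] at hy
    have := norm_sub_le_norm_sub_add_norm_sub y z q
    linarith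
  have hb : ∀ y ∈ ball z (d / 2), 0 ≤ t y → |h y| ≤ A * S := by
    intro y hy hty
    have hyq := hballd y hy
    have hyK : y ∈ K := ⟨hty, by rw [mem_closedBall, dist_eq_norm]; linarith⟩
    have h1 : (2 * r - ‖y - q‖) ^ m * h y ^ 2 ≤ d ^ m * h z ^ 2 := hzmax hyK
    have h2 : (d / 2) ^ m * h y ^ 2 ≤ (2 * r - ‖y - q‖) ^ m * h y ^ 2 := by
      gcongr; linarith
    rw [div_pow] at h2
    have h3 : h y ^ 2 ≤ A * h z ^ 2 := by
      have h4 := h2.trans h1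
      rw [div_mul_eq_mul_div, div_le_iff₀ (by positivity)] at h4
      have h5 : d ^ m * (h y ^ 2) ≤ d ^ m * (A * h z ^ 2) := by linarith
      exact le_of_mul_le_mul_left h5 (by positivity)
    have h6 : h y ^ 2 ≤ (A * S) ^ 2 := by
      rw [mul_pow, hS, sq_abs]
      refine h3.trans ?_
      have : A ≤ A ^ 2 := by nlinarith
      gcongr
    exact abs_le_of_sq_le_sq h6 (by positivity)
  have hsubz : ball z (d / 2) ⊆ ball p R := by
    intro y hy
    apply hsub
    rw [mem_closedBall, dist_eq_norm]
    have := hballd y hy; linarith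
  set θ := 1 / (12 * A * LC E) with hθ
  have hAL : 20 ≤ A * LC E := by nlinarith
  have hθ0 : 0 < θ := by positivity
  have hθ1 : θ ≤ 1 / 240 := by
    rw [hθ]; apply one_div_le_one_div_of_le (by norm_num); nlinarith
  set ρ := θ * (d / 2) with hρ
  have hρ0 : 0 < ρ := by positivity
  have hlow : ∀ y ∈ ball z ρ, 0 ≤ t y → S / 2 ≤ |h y| := by
    intro y hy hty
    rw [mem_ball, dist_eq_norm] at hy
    have := c.osc_eps (x := z) (y := y) (r := d / 2) (S := A * S) (by positivity) (by positivity) hsubz hb hzK.1 hty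
      (by nlinarith)
    have k1 : 3 * ‖y - z‖ / (d / 2) ≤ 3 * θ := by
      rw [div_le_iff₀ (by positivity)]; nlinarith
    have k2 : τ ≤ 1 / (72 * A * LC E) := hτ
    have k3 : A * S * LC E * (3 * ‖y - z‖ / (d / 2) + 18 * τ) ≤
        A * S * LC E * (3 * θ + 18 * (1 / (72 * A * LC E))) := by gcongr
    have k4 : A * S * LC E * (3 * θ + 18 * (1 / (72 * A * LC E))) = S / 2 := by
      rw [hθ]; field_simp; norm_num
    have k5 := abs_sub_abs_le_abs_sub (h z) (h y)
    linarith
  -- a ball in U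
  set w := z + (ρ / 2) • e with hw
  have hwb : ball w (ρ / 8) ⊆ ({x | 0 < t x} ∩ ball q (2 * r)) ∩ ball z ρ := by
    intro y hy
    rw [mem_ball, dist_eq_norm] at hy
    have k1 := abs_le.1 (c.tlip' y w)
    rw [hw, c.te, ← hw] at k1
    have k2 : ‖y - z‖ ≤ ‖y - w‖ + ‖(ρ / 2) • e‖ := by
      have := norm_add_le (y - w) ((ρ / 2) • e)
      rwa [show y - w + (ρ / 2) • e = y - z by rw [hw]; abel] at this
    rw [norm_smul, c.he, Real.norm_eq_abs, abs_of_pos (by positivity)] at k2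
    have htz : 0 ≤ t z := hzK.1
    have hyz : y ∈ ball z ρ := by rw [mem_ball, dist_eq_norm]; linarith
    have hyd : y ∈ ball z (d / 2) := ball_subset_ball (by rw [hρ]; nlinarith) hyz
    refine ⟨⟨?_, ?_⟩, hyz⟩
    · simp only [mem_setOf_eq]; linarith
    · rw [mem_ball, dist_eq_norm]; have := hballd y hyd; linarith
  have hintg : IntegrableOn (fun y => h y ^ 2) ({x | 0 < t x} ∩ ball q (2 * r)) := c.integrable_of_bdd hsub 2
  have hI1 : ∫ y in ball w (ρ / 8), (S / 2) ^ 2 ≤ ∫ y in {x | 0 < t x} ∩ ball q (2 * r), h y ^ 2 := by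
    have s1 : ball w (ρ / 8) ⊆ {x | 0 < t x} ∩ ball q (2 * r) := fun y hy => (hwb hy).1
    calc _ ≤ ∫ y in ball w (ρ / 8), h y ^ 2 := by
          refine setIntegral_mono_on ?_ (hintg.mono_set s1) measurableSet_ball ?_
          · exact integrableOn_const (measure_ball_lt_top.ne)
          · intro y hy
            have := hlow y (hwb hy).2 (le_of_lt (hwb hy).1.1)
            rw [← sq_abs (h y)]
            gcongr
      _ ≤ _ := setIntegral_mono_set hintg (Eventually.of_forall fun y => sq_nonneg _) s1.eventuallyLE
  rw [setIntegral_const, smul_eq_mul, vol_ball w (by positivity)] at hI1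
  have hfin : d ^ m * h z ^ 2 = CG E * ((ρ / 8) ^ m * volume.real (ball (0:E) 1) * (S / 2) ^ 2) := by
    have e1 : ρ / 8 = d / (192 * A * LC E) := by rw [hρ, hθ]; field_simp; norm_num
    rw [e1, div_pow, CG, ← hm, ← hA, div_pow, hS, sq_abs]
    field_simp
    norm_num
  calc _ ≤ d ^ m * h z ^ 2 := hx1.trans hx2
    _ = _ := hfin
    _ ≤ _ := by
      have := CG_pos (E := E)
      gcongr

end Cfg
end NodalNeumann

end

noncomputable section
open MeasureTheory Metric Set Filter Asymptotics
open scoped Topology NNReal ENNReal RealInnerProductSpace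
namespace NodalNeumann
set_option linter.all false
variable {E : Type*} [NormedAddCommGroup E] [InnerProductSpace ℝ E] [FiniteDimensional ℝ E]
variable [MeasurableSpace E] [BorelSpace E]

/-- averaging along the fibres of `e` -/
lemma fibre_lintegral {t : E → ℝ} {e : E} (te : ∀ x u, t (x + u • e) = t x + u) (ht : Continuous t)
    {F : E → ℝ≥0∞} (hF : Measurable F) :
    ∫⁻ x, F x = ∫⁻ z, ({z | 0 < t z ∧ t z < 1}).indicator 1 z * ∫⁻ u : ℝ, F (z + u • e) := by
  have hS : MeasurableSet {z | 0 < t z ∧ t z < 1} :=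
    (measurableSet_lt measurable_const ht.measurable).inter (measurableSet_lt ht.measurable measurable_const)
  have hind : Measurable (({z | 0 < t z ∧ t z < 1}).indicator (1 : E → ℝ≥0∞)) := measurable_one.indicator hS
  have h1 : ∀ x, F x = ∫⁻ u : ℝ, F x * ({z | 0 < t z ∧ t z < 1}).indicator 1 (x - u • e) := by
    intro x
    rw [lintegral_const_mul]
    · have : (fun u : ℝ => ({z | 0 < t z ∧ t z < 1}).indicator (1 : E → ℝ≥0∞) (x - u • e))
          = (Ioo (t x - 1) (t x)).indicator 1 := by
        ext u
        have e1 : t (x - u • e) = t x - u := by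
          rw [sub_eq_add_neg, ← neg_smul, te]; ring
        simp only [indicator, mem_setOf_eq, e1, mem_Ioo]
        congr 1
        apply propext; constructor <;> rintro ⟨a, b⟩ <;> constructor <;> linarith
      rw [this, lintegral_indicator_one measurableSet_Ioo]
      simp
    · exact hind.comp (by fun_prop)
  calc ∫⁻ x, F x = ∫⁻ x, ∫⁻ u : ℝ, F x * ({z | 0 < t z ∧ t z < 1}).indicator 1 (x - u • e) :=
        lintegral_congr h1
    _ = ∫⁻ u : ℝ, ∫⁻ x, F x * ({z | 0 < t z ∧ t z < 1}).indicator 1 (x - u • e) := by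
        apply lintegral_lintegral_swap
        apply Measurable.aemeasurable
        exact (hF.comp measurable_fst).mul (hind.comp (by fun_prop))
    _ = ∫⁻ u : ℝ, ∫⁻ z, F (z + u • e) * ({z | 0 < t z ∧ t z < 1}).indicator 1 z := by
        apply lintegral_congr; intro u
        rw [← lintegral_add_right_eq_self _ (u • e)]
        simp
    _ = ∫⁻ z, ∫⁻ u : ℝ, F (z + u • e) * ({z | 0 < t z ∧ t z < 1}).indicator 1 z := by
        apply lintegral_lintegral_swap
        apply Measurable.aemeasurable
        exact (hF.comp (by fun_prop)).mul (hind.comp measurable_snd)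
    _ = _ := by
        apply lintegral_congr; intro z
        rw [mul_comm, lintegral_mul_const]; exact hF.comp (by fun_prop)

lemma layer {t : E → ℝ} {e p : E} {ρ A κ : ℝ} (te : ∀ x u, t (x + u • e) = t x + u) (he : ‖e‖ = 1)
    (ht : Continuous t) {P : E → ℝ} (hP : Measurable P) (hA : ∀ x, |P x| ≤ A)
    (hs : ∀ x, x ∉ closedBall p ρ → P x = 0)
    (hf : ∀ z, t z = 0 → ∀ᶠ s in 𝓝[>] (0:ℝ), |P (z + s • e)| ≤ κ) :
    limsup (fun n : ℕ => ∫⁻ x in {x | 1 / ((n:ℝ) + 1) < t x ∧ t x < 2 / ((n:ℝ)+1)},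
      ENNReal.ofReal (((n:ℝ)+1) * |P x|)) atTop ≤ ENNReal.ofReal κ * volume (closedBall p (ρ + 3)) := by
  set S : ℕ → Set E := fun n => {x | 1 / ((n:ℝ) + 1) < t x ∧ t x < 2 / ((n:ℝ)+1)} with hSdef
  have hSm : ∀ n, MeasurableSet (S n) := fun n =>
    (measurableSet_lt measurable_const ht.measurable).inter (measurableSet_lt ht.measurable measurable_const)
  set F : ℕ → E → ℝ≥0∞ := fun n => (S n).indicator (fun x => ENNReal.ofReal (((n:ℝ)+1) * |P x|)) with hFdef
  have hFm : ∀ n, Measurable (F n) := fun n => by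
    refine Measurable.indicator ?_ (hSm n)
    exact ENNReal.measurable_ofReal.comp (measurable_const.mul hP.abs)
  set Φ : ℕ → E → ℝ≥0∞ := fun n z => ({z | 0 < t z ∧ t z < 1}).indicator 1 z * ∫⁻ u : ℝ, F n (z + u • e) with hΦ
  have hΦm : ∀ n, Measurable (Φ n) := by
    intro n
    have hS : MeasurableSet {z | 0 < t z ∧ t z < 1} :=
      (measurableSet_lt measurable_const ht.measurable).inter (measurableSet_lt ht.measurable measurable_const)
    refine (measurable_one.indicator hS).mul ?_
    exact Measurable.lintegral_prod_right' (f := fun q : E × ℝ => F n (q.1 + q.2 • e)) ((hFm n).comp (by fun_prop))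
  have key : ∀ (n : ℕ) z A', (∀ u : ℝ, 1 / ((n:ℝ) + 1) < t z + u → t z + u < 2 / ((n:ℝ)+1) → |P (z + u • e)| ≤ A') →
      ∫⁻ u : ℝ, F n (z + u • e) ≤ ENNReal.ofReal A' := by
    intro n z A' h
    have hn : (0:ℝ) < (n:ℝ) + 1 := by positivity
    calc ∫⁻ u : ℝ, F n (z + u • e) ≤ ∫⁻ u : ℝ, (Ioo (1 / ((n:ℝ) + 1) - t z) (2 / ((n:ℝ) + 1) - t z)).indicator
          (fun _ => ENNReal.ofReal (((n:ℝ)+1) * A')) u := by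
          apply lintegral_mono; intro u
          by_cases hu : z + u • e ∈ S n
          · have hu' := hu
            simp only [hSdef, mem_setOf_eq, te] at hu'
            have : u ∈ Ioo (1 / ((n:ℝ) + 1) - t z) (2 / ((n:ℝ) + 1) - t z) := ⟨by linarith [hu'.1], by linarith [hu'.2]⟩
            simp only [hFdef, indicator_of_mem hu, indicator_of_mem this]
            exact ENNReal.ofReal_le_ofReal (by have := h u hu'.1 hu'.2; gcongr)
          · simp only [hFdef, indicator_of_notMem hu]; exact zero_le
      _ = ENNReal.ofReal (((n:ℝ)+1) * A') * ENNReal.ofReal (1 / ((n:ℝ)+1)) := by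
          rw [lintegral_indicator_const measurableSet_Ioo, Real.volume_Ioo]
          congr 2; ring
      _ = ENNReal.ofReal A' := by
          rw [← ENNReal.ofReal_mul' (by positivity)]; congr 1; field_simp
  have hfar : ∀ n z, z ∉ closedBall p (ρ+3) → Φ n z = 0 := by
    intro n z hz
    simp only [hΦ]
    by_cases hz1 : z ∈ {z | 0 < t z ∧ t z < 1}
    · have h0 : ∫⁻ u : ℝ, F n (z + u • e) ≤ ENNReal.ofReal 0 := by
        apply key; intro u h1 h2
        rw [hs]; · simp
        intro h3
        apply hz
        have hn : (1:ℝ) ≤ (n:ℝ) + 1 := by linarith [Nat.cast_nonneg (α := ℝ) n]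
        have h4 : 2 / ((n:ℝ)+1) ≤ 2 := by rw [div_le_iff₀ (by linarith)]; linarith
        have h5 : 0 < 1 / ((n:ℝ)+1) := by positivity
        have hu : |u| ≤ 3 := abs_le.2 ⟨by linarith [hz1.1, hz1.2], by linarith [hz1.1, hz1.2]⟩
        rw [mem_closedBall, dist_eq_norm] at h3 ⊢
        calc ‖z - p‖ = ‖(z + u • e - p) - u • e‖ := by congr 1; abel
          _ ≤ ‖z + u • e - p‖ + ‖u • e‖ := norm_sub_le _ _
          _ ≤ ρ + 3 := by rw [norm_smul, he, mul_one, Real.norm_eq_abs]; linarith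
      simp at h0; simp [h0]
    · simp [hz1]
  have hbd : ∀ n z A', ∫⁻ u : ℝ, F n (z + u • e) ≤ A' → Φ n z ≤ (closedBall p (ρ+3)).indicator (fun _ => A') z := by
    intro n z A' h
    by_cases hz : z ∈ closedBall p (ρ+3)
    · rw [indicator_of_mem hz]
      refine le_trans ?_ h
      simp only [hΦ]
      by_cases hz1 : z ∈ {z | 0 < t z ∧ t z < 1}
      · simp [indicator_of_mem hz1]
      · simp [indicator_of_notMem hz1]
    · rw [hfar n z hz]; exact zero_le
  calc _ = limsup (fun n : ℕ => ∫⁻ z, Φ n z) atTop := by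
        congr 1; ext n
        rw [← lintegral_indicator (hSm n), ← fibre_lintegral te ht (hFm n)]
    _ ≤ ∫⁻ z, limsup (fun n => Φ n z) atTop := by
        refine limsup_lintegral_le ((closedBall p (ρ+3)).indicator (fun _ => ENNReal.ofReal A)) hΦm ?_ ?_
        · intro n; exact ae_of_all _ fun z => hbd n z _ (key n z A fun u _ _ => hA _)
        · rw [lintegral_indicator_const measurableSet_closedBall]
          exact ENNReal.mul_ne_top ENNReal.ofReal_ne_top measure_closedBall_lt_top.ne
    _ ≤ ∫⁻ z, (closedBall p (ρ+3)).indicator (fun _ => ENNReal.ofReal κ) z := by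
        apply lintegral_mono; intro z
        have h1 := hf (z + (-t z) • e) (by rw [te]; ring)
        rw [eventually_nhdsWithin_iff, Metric.eventually_nhds_iff] at h1
        obtain ⟨δ, hδ, h1⟩ := h1
        obtain ⟨n0, hn0⟩ := exists_nat_gt (2 / δ)
        refine limsup_le_of_le (by isBoundedDefault) ?_
        filter_upwards [eventually_ge_atTop n0] with n hn
        apply hbd; apply key
        intro u hu1 hu2
        have hn1 : (0:ℝ) < (n:ℝ) + 1 := by positivity
        have h5 : 0 < 1 / ((n:ℝ)+1) := by positivity
        have h6 : 2 / ((n:ℝ)+1) < δ := by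
          rw [div_lt_iff₀ hn1]; rw [div_lt_iff₀ hδ] at hn0
          have : (n0:ℝ) ≤ n := by exact_mod_cast hn
          nlinarith
        have := @h1 (t z + u) (by rw [Real.dist_eq, sub_zero, abs_of_pos (by linarith)]; linarith)
          (by rw [mem_Ioi]; linarith)
        rwa [show z + -t z • e + (t z + u) • e = z + u • e by module] at this
    _ = _ := by rw [lintegral_indicator_const measurableSet_closedBall]

/-- divergence -/
def dv (V : E → E) (x : E) : ℝ :=
  ∑ i, ⟪fderiv ℝ V x (stdOrthonormalBasis ℝ E i), stdOrthonormalBasis ℝ E i⟫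

lemma integral_dv_lip {W : E → E} {K : ℝ≥0} (hW : LipschitzWith K W) (hc : HasCompactSupport W) :
    ∫ x, dv W x = 0 := by
  unfold dv
  have hd : ∀ᵐ x : E, DifferentiableAt ℝ W x := hW.ae_differentiableAt
  have hintg : ∀ i, Integrable (fun x => ⟪fderiv ℝ W x (stdOrthonormalBasis ℝ E i), stdOrthonormalBasis ℝ E i⟫) := by
    intro i
    have hm : Measurable (fun x => ⟪fderiv ℝ W x (stdOrthonormalBasis ℝ E i), stdOrthonormalBasis ℝ E i⟫) :=
      (measurable_fderiv_apply_const ℝ W _).inner measurable_const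
    have hz : ∀ x, x ∉ tsupport W → ⟪fderiv ℝ W x (stdOrthonormalBasis ℝ E i), stdOrthonormalBasis ℝ E i⟫ = 0 := by
      intro x hx
      have : fderiv ℝ W x = 0 := by
        by_contra h
        exact hx (support_fderiv_subset ℝ h)
      simp [this]
    rw [← integrableOn_iff_integrable_of_support_subset (s := tsupport W)
      (fun x hx => by by_contra h; exact hx (hz x h))]
    refine IntegrableOn.of_bound hc.measure_lt_top hm.aestronglyMeasurable K (ae_of_all _ fun x => ?_)
    calc _ ≤ ‖fderiv ℝ W x (stdOrthonormalBasis ℝ E i)‖ * ‖stdOrthonormalBasis ℝ E i‖ := norm_inner_le_norm _ _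
      _ ≤ K := by
        rw [(stdOrthonormalBasis ℝ E).norm_eq_one, mul_one]
        refine (ContinuousLinearMap.le_opNorm _ _).trans ?_
        rw [(stdOrthonormalBasis ℝ E).norm_eq_one, mul_one]
        exact norm_fderiv_le_of_lipschitz ℝ hW
  rw [integral_finset_sum _ (fun i _ => hintg i)]
  apply Finset.sum_eq_zero
  intro i _
  set v := stdOrthonormalBasis ℝ E i with hv
  have hg : LipschitzWith (K * 1) (fun x => ⟪W x, v⟫) := by
    have : LipschitzWith 1 (fun y : E => ⟪y, v⟫) := by
      apply LipschitzWith.of_dist_le_mul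
      intro x y
      rw [Real.dist_eq, ← inner_sub_left]
      refine (abs_real_inner_le_norm _ _).trans ?_
      rw [hv, (stdOrthonormalBasis ℝ E).norm_eq_one, dist_eq_norm]; simp
    rw [mul_comm]; exact this.comp hW
  have hgc : HasCompactSupport (fun x => ⟪W x, v⟫) := by
    refine hc.mono ?_
    intro x hx h; apply hx; simp [h]
  have := LipschitzWith.integral_lineDeriv_mul_eq (μ := (volume : Measure E)) (LipschitzWith.const (1:ℝ)) hg hgc (-v)
  have hl0 : ∀ x : E, lineDeriv ℝ (fun _ : E => (1:ℝ)) x (-v) = 0 := fun x => by simp [lineDeriv]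
  simp only [hl0, zero_mul, integral_zero, mul_one, neg_neg] at this
  rw [eq_comm] at this
  rw [← this]
  apply integral_congr_ae
  filter_upwards [hd] with x hx
  have h1 : HasFDerivAt (fun x => ⟪W x, v⟫) ((innerSL ℝ v).comp (fderiv ℝ W x)) x := by
    have := (innerSL ℝ v).hasFDerivAt.comp x hx.hasFDerivAt
    refine this.congr_of_eventuallyEq (Eventually.of_forall fun y => ?_)
    simp [real_inner_comm]
  rw [(h1.hasLineDerivAt v).lineDeriv]
  simp [real_inner_comm]

/-- bound for the derivative of the cut-off -/
lemma exists_cut : ∃ C : ℝ, 0 < C ∧ ∀ x, |deriv Real.smoothTransition x| ≤ C ∧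
    (x ≤ 0 → deriv Real.smoothTransition x = 0) ∧ (1 ≤ x → deriv Real.smoothTransition x = 0) := by
  have h1 : ContDiff ℝ 1 Real.smoothTransition := Real.smoothTransition.contDiff (n := 1)
  have hc : Continuous (deriv Real.smoothTransition) := h1.continuous_deriv le_rfl
  have hl : ∀ x ≤ 0, deriv Real.smoothTransition x = 0 := by
    have : closure (Iio (0:ℝ)) ⊆ {x | deriv Real.smoothTransition x = 0} := by
      refine closure_minimal ?_ (isClosed_eq hc continuous_const)
      intro x hx
      have : Real.smoothTransition =ᶠ[𝓝 x] fun _ => 0 := by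
        filter_upwards [Iio_mem_nhds hx] with y hy using Real.smoothTransition.zero_of_nonpos (le_of_lt hy)
      simp [this.deriv_eq]
    rw [closure_Iio] at this; exact this
  have hr : ∀ x, 1 ≤ x → deriv Real.smoothTransition x = 0 := by
    have : closure (Ioi (1:ℝ)) ⊆ {x | deriv Real.smoothTransition x = 0} := by
      refine closure_minimal ?_ (isClosed_eq hc continuous_const)
      intro x hx
      have : Real.smoothTransition =ᶠ[𝓝 x] fun _ => 1 := by
        filter_upwards [Ioi_mem_nhds hx] with y hy using Real.smoothTransition.one_of_one_le (le_of_lt hy)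
      simp [this.deriv_eq]
    rw [closure_Ioi] at this; exact this
  obtain ⟨C, hC⟩ := (isCompact_Icc (a := (0:ℝ)) (b := 1)).exists_bound_of_continuousOn hc.continuousOn
  refine ⟨max C 1, by positivity, fun x => ⟨?_, hl x, hr x⟩⟩
  by_cases h0 : x ≤ 0
  · rw [hl x h0]; simp
  by_cases h1 : 1 ≤ x
  · rw [hr x h1]; simp
  · push Not at h0 h1
    exact (hC x ⟨h0.le, h1.le⟩).trans (le_max_left _ _)

def Ccut : ℝ := exists_cut.choose
lemma Ccut_pos : 0 < Ccut := exists_cut.choose_spec.1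
lemma Ccut_spec (x : ℝ) : |deriv Real.smoothTransition x| ≤ Ccut ∧
    (x ≤ 0 → deriv Real.smoothTransition x = 0) ∧ (1 ≤ x → deriv Real.smoothTransition x = 0) :=
  exists_cut.choose_spec.2 x

/-- local Lipschitz property at a point -/
def LL {X F : Type*} [PseudoMetricSpace X] [PseudoEMetricSpace F] (f : X → F) (x : X) : Prop :=
  ∃ K : ℝ≥0, ∃ s ∈ 𝓝 x, LipschitzOnWith K f s

namespace LL
variable {X : Type*} [PseudoMetricSpace X] {x : X}
variable {F F' F'' : Type*} [NormedAddCommGroup F] [NormedSpace ℝ F] [NormedAddCommGroup F'] [NormedSpace ℝ F']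
  [NormedAddCommGroup F''] [NormedSpace ℝ F'']

lemma continuousAt {f : X → F} (h : LL f x) : ContinuousAt f x := by
  obtain ⟨K, s, hs, h⟩ := h
  exact h.continuousOn.continuousAt hs

lemma comp {F : Type*} [PseudoMetricSpace F] {g : F → F'} {f : X → F} (hg : LL g (f x)) (hf : LL f x) : LL (fun y => g (f y)) x := by
  obtain ⟨K, s, hs, h⟩ := hf
  obtain ⟨K', s', hs', h'⟩ := hg
  have hc : ContinuousAt f x := h.continuousOn.continuousAt hs
  refine ⟨K' * K, s ∩ f ⁻¹' s', inter_mem hs (hc hs'), ?_⟩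
  exact h'.comp (h.mono inter_subset_left) (fun y hy => hy.2)

lemma of_contDiffAt {g : F → F'} {y : F} (hg : ContDiffAt ℝ 1 g y) : LL g y := hg.exists_lipschitzOnWith

lemma prodMk {f : X → F} {g : X → F'} (hf : LL f x) (hg : LL g x) : LL (fun y => (f y, g y)) x := by
  obtain ⟨K, s, hs, h⟩ := hf
  obtain ⟨K', s', hs', h'⟩ := hg
  exact ⟨max K K', s ∩ s', inter_mem hs hs', (h.mono inter_subset_left).prodMk (h'.mono inter_subset_right)⟩

lemma comp₂ {g : F × F' → F''} {f : X → F} {f' : X → F'} (hg : ContDiffAt ℝ 1 g (f x, f' x)) (hf : LL f x) (hf' : LL f' x) :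
    LL (fun y => g (f y, f' y)) x := comp (of_contDiffAt hg) (hf.prodMk hf')

lemma add {f g : X → F} (hf : LL f x) (hg : LL g x) : LL (fun y => f y + g y) x :=
  comp₂ (g := fun p => p.1 + p.2) (by fun_prop) hf hg
lemma sub {f g : X → F} (hf : LL f x) (hg : LL g x) : LL (fun y => f y - g y) x :=
  comp₂ (g := fun p => p.1 - p.2) (by fun_prop) hf hg
lemma smul {f : X → ℝ} {g : X → F} (hf : LL f x) (hg : LL g x) : LL (fun y => f y • g y) x :=
  comp₂ (g := fun p => p.1 • p.2) (by fun_prop) hf hg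
lemma mul {f g : X → ℝ} (hf : LL f x) (hg : LL g x) : LL (fun y => f y * g y) x :=
  comp₂ (g := fun p => p.1 * p.2) (by fun_prop) hf hg
lemma div {f g : X → ℝ} (hf : LL f x) (hg : LL g x) (h : g x ≠ 0) : LL (fun y => f y / g y) x :=
  comp₂ (g := fun p => p.1 / p.2) (by fun_prop (disch := exact h)) hf hg
lemma pow {f : X → ℝ} (hf : LL f x) (n : ℕ) : LL (fun y => f y ^ n) x :=
  comp (g := fun y => y ^ n) (of_contDiffAt (by fun_prop)) hf
lemma inner {F : Type*} [NormedAddCommGroup F] [InnerProductSpace ℝ F] {f g : X → F} (hf : LL f x) (hg : LL g x) :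
    LL (fun y => ⟪f y, g y⟫) x :=
  comp₂ (g := fun p : F × F => ⟪p.1, p.2⟫) (ContDiffAt.inner ℝ contDiffAt_fst contDiffAt_snd) hf hg
lemma const (c : F) : LL (fun _ : X => c) x := ⟨0, univ, univ_mem, (LipschitzWith.const c).lipschitzOnWith⟩
lemma of_lip {K : ℝ≥0} {f : X → F} (h : LipschitzWith K f) : LL f x := ⟨K, univ, univ_mem, h.lipschitzOnWith⟩
lemma congr {f g : X → F} (h : LL f x) (he : g =ᶠ[𝓝 x] f) : LL g x := by
  obtain ⟨K, s, hs, h⟩ := h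
  refine ⟨K, s ∩ {y | g y = f y}, inter_mem hs he, ?_⟩
  intro a ha b hb
  rw [ha.2, hb.2]; exact h ha.1 hb.1
lemma max {f : X → ℝ} (hf : LL f x) (c : ℝ) : LL (fun y => max (f y) c) x :=
  comp (g := fun y => Max.max y c) (of_lip (LipschitzWith.id.max_const c)) hf
end LL

lemma LL.lip_of_compactSupport {W : E → E} (h : ∀ x, LL W x) (hc : HasCompactSupport W) :
    ∃ K : ℝ≥0, LipschitzWith K W := by
  obtain ⟨r, hr⟩ := hc.isBounded.subset_closedBall 0
  set r' := |r| + 1 with hr'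
  have hr1 : closedBall (0:E) r ⊆ ball 0 r' := closedBall_subset_ball (by rw [hr']; linarith [le_abs_self r])
  have hr2 : 0 < r' := by positivity
  obtain ⟨K, hK⟩ := LocallyLipschitzOn.exists_lipschitzOnWith_of_compact (isCompact_closedBall (0:E) r') (f := W) (by
    intro x _
    obtain ⟨K, s, hs, h⟩ := h x
    exact ⟨K, s, mem_nhdsWithin_of_mem_nhds hs, h⟩)
  have hz : ∀ x, x ∉ ball (0:E) r' → W x = 0 := fun x hx => by
    by_contra h0; exact hx (hr1 (hr (subset_tsupport _ h0)))
  have aux : ∀ x y, x ∈ ball (0:E) r' → y ∉ closedBall (0:E) r' → dist (W x) (W y) ≤ K * dist x y := by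
    intro x y hx hy
    -- intermediate point on the sphere
    have hcont : ContinuousOn (fun s : ℝ => ‖x + s • (y - x)‖) (Icc 0 1) := by fun_prop
    have h0 : ‖x + (0:ℝ) • (y - x)‖ ≤ r' := by simpa using (mem_ball_zero_iff.1 hx).le
    have h1 : r' ≤ ‖x + (1:ℝ) • (y - x)‖ := by
      simp only [mem_closedBall_zero_iff, not_le] at hy; simpa using hy.le
    obtain ⟨s, hs, hs'⟩ := intermediate_value_Icc zero_le_one hcont ⟨h0, h1⟩
    simp only at hs'
    have h2 : W (x + s • (y - x)) = 0 := hz _ (by rw [mem_ball_zero_iff]; linarith)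
    have h3 : W y = 0 := hz _ (fun h => hy (ball_subset_closedBall h))
    rw [h3, ← h2]
    refine (hK.dist_le_mul x (ball_subset_closedBall hx) _ (by rw [mem_closedBall_zero_iff]; linarith)).trans ?_
    gcongr
    rw [dist_eq_norm, dist_eq_norm, show x - (x + s • (y - x)) = s • (x - y) by module, norm_smul, Real.norm_eq_abs,
      abs_of_nonneg hs.1]
    exact mul_le_of_le_one_left (norm_nonneg _) hs.2
  refine ⟨K, LipschitzWith.of_dist_le_mul fun x y => ?_⟩
  by_cases hx : x ∈ ball (0:E) r'
  · by_cases hy : y ∈ closedBall (0:E) r'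
    · exact hK.dist_le_mul x (ball_subset_closedBall hx) y hy
    · exact aux x y hx hy
  · by_cases hy : y ∈ ball (0:E) r'
    · by_cases hx' : x ∈ closedBall (0:E) r'
      · exact hK.dist_le_mul x hx' y (ball_subset_closedBall hy)
      · rw [dist_comm, dist_comm x]; exact aux y x hy hx'
    · rw [hz x hx, hz y hy, dist_self]; positivity

end NodalNeumann

end

noncomputable section
open MeasureTheory Metric Set Filter Asymptotics
open scoped Topology NNReal ENNReal RealInnerProductSpace
namespace NodalNeumann
set_option linter.all false
variable {E : Type*} [NormedAddCommGroup E] [InnerProductSpace ℝ E] [FiniteDimensional ℝ E]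
variable [MeasurableSpace E] [BorelSpace E]

lemma dv_measurable (V : E → E) : Measurable (dv V) := by
  unfold dv
  refine Finset.measurable_sum _ fun i _ => ?_
  exact (measurable_fderiv_apply_const ℝ V _).inner measurable_const

lemma dv_smul {φ : E → ℝ} {V : E → E} {x : E} (hφ : DifferentiableAt ℝ φ x) (hV : DifferentiableAt ℝ V x) :
    dv (fun y => φ y • V y) x = φ x * dv V x + fderiv ℝ φ x (V x) := by
  unfold dv
  have h := (hφ.hasFDerivAt.fun_smul hV.hasFDerivAt).fderiv
  rw [h, Finset.mul_sum]
  simp only [add_apply, ContinuousLinearMap.smul_apply, ContinuousLinearMap.smulRight_apply,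
    inner_add_left, Finset.sum_add_distrib, real_inner_smul_left]
  congr 1
  conv_rhs => rw [← (stdOrthonormalBasis ℝ E).sum_repr' (V x), map_sum]
  refine Finset.sum_congr rfl fun i _ => ?_
  rw [map_smul, smul_eq_mul, real_inner_comm, mul_comm]

/-- cut-off of a vector field near the boundary -/
def cutV (t : E → ℝ) (V : E → E) (N : ℝ) (x : E) : E := Real.smoothTransition (N * t x - 1) • V x

lemma stlip : ∃ K : ℝ≥0, LipschitzWith K Real.smoothTransition := by
  refine ⟨Real.toNNReal Ccut, lipschitzWith_of_nnnorm_deriv_le ?_ ?_⟩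
  · exact (Real.smoothTransition.contDiff (n := 1)).differentiable one_ne_zero
  · intro x
    rw [← NNReal.coe_le_coe, coe_nnnorm, Real.coe_toNNReal _ Ccut_pos.le]
    exact (Ccut_spec x).1

lemma cutV_lip {t : E → ℝ} {Kt : ℝ≥0} (ht : LipschitzWith Kt t) {V : E → E} (hV : ∀ x, 0 < t x → LL V x)
    {p : E} {ρ : ℝ} (hs : ∀ x, x ∉ closedBall p ρ → V x = 0) {N : ℝ} (hN : 0 < N) :
    ∃ K : ℝ≥0, LipschitzWith K (cutV t V N) := by
  obtain ⟨K, hK⟩ := stlip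
  apply LL.lip_of_compactSupport
  · intro x
    by_cases hx : 0 < t x
    · refine LL.smul (LL.comp (LL.of_lip hK) ?_) (hV x hx)
      exact ((LL.const N).mul (LL.of_lip ht)).sub (LL.const 1)
    · refine (LL.const (0:E)).congr ?_
      have : {y | t y < 1 / N} ∈ 𝓝 x := (isOpen_lt ht.continuous continuous_const).mem_nhds (by
        simp only [mem_setOf_eq]; push Not at hx; exact hx.trans_lt (by positivity))
      filter_upwards [this] with y hy
      simp only [mem_setOf_eq, lt_div_iff₀ hN] at hy
      rw [cutV, Real.smoothTransition.zero_of_nonpos (by linarith), zero_smul]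
  · refine HasCompactSupport.intro (isCompact_closedBall p ρ) fun x hx => ?_
    rw [cutV, hs x hx, smul_zero]

lemma ae_diff_of_LL {t : E → ℝ} {Kt : ℝ≥0} (ht : LipschitzWith Kt t) {V : E → E} (hV : ∀ x, 0 < t x → LL V x)
    {p : E} {ρ : ℝ} (hs : ∀ x, x ∉ closedBall p ρ → V x = 0) :
    ∀ᵐ x : E, 0 < t x → DifferentiableAt ℝ V x := by
  have h : ∀ n : ℕ, ∀ᵐ x : E, DifferentiableAt ℝ (cutV t V ((n:ℝ)+1)) x := fun n => by
    obtain ⟨K, hK⟩ := cutV_lip ht hV hs (N := (n:ℝ)+1) (by positivity)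
    exact hK.ae_differentiableAt
  rw [← ae_all_iff] at h
  filter_upwards [h] with x hx htx
  obtain ⟨n, hn⟩ := exists_nat_gt (2 / t x)
  refine (hx n).congr_of_eventuallyEq ?_
  rw [div_lt_iff₀ htx] at hn
  have : {y | 2 < ((n:ℝ)+1) * t y} ∈ 𝓝 x :=
    (isOpen_lt continuous_const (continuous_const.mul ht.continuous)).mem_nhds (by
      show 2 < ((n:ℝ)+1) * t x
      rw [add_mul]; linarith)
  filter_upwards [this] with y hy
  have hy : 2 < ((n:ℝ)+1) * t y := hy
  rw [cutV, Real.smoothTransition.one_of_one_le (by linarith), one_smul]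


/-- Divergence theorem above a Lipschitz graph. -/
lemma div_bound {t : E → ℝ} {e : E} {Kt : ℝ≥0} (te : ∀ x u, t (x + u • e) = t x + u) (he : ‖e‖ = 1)
    (ht : LipschitzWith Kt t) {V : E → E} (hV : ∀ x, 0 < t x → LL V x)
    {p : E} {ρ B B' κ : ℝ} (hs : ∀ x, x ∉ closedBall p ρ → V x = 0)
    (hB : ∀ x, 0 < t x → ‖V x‖ ≤ B)
    (hB' : ∀ᵐ x, 0 < t x → DifferentiableAt ℝ V x → |dv V x| ≤ B') (hκ : 0 ≤ κ)
    (hf : ∀ b, t b = 0 → ∀ᶠ s in 𝓝[>] (0:ℝ), |fderiv ℝ t b (V (b + s • e))| ≤ κ) :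
    |∫ x in {x | 0 < t x}, dv V x| ≤ Ccut * κ * volume.real (closedBall p (ρ + 3)) := by
  have htc := ht.continuous
  have hUm : MeasurableSet {x | 0 < t x} := measurableSet_lt measurable_const htc.measurable
  have hdz : ∀ x, x ∉ closedBall p ρ → dv V x = 0 := by
    intro x hx
    have : V =ᶠ[𝓝 x] fun _ => 0 := by
      filter_upwards [isClosed_closedBall.isOpen_compl.mem_nhds hx] with y hy using hs y hy
    simp [dv, this.fderiv_eq]
  have hBp : ∀ᵐ x, 0 < t x → |dv V x| ≤ |B'| := by
    filter_upwards [hB'] with x hB' hx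
    by_cases hd : DifferentiableAt ℝ V x
    · exact (hB' hx hd).trans (le_abs_self _)
    · simp [dv, fderiv_zero_of_not_differentiableAt hd]
  -- the flux density
  set P : E → ℝ := ({x | 0 < t x}).indicator (fun x => fderiv ℝ t x (V x)) with hPdef
  have hVm : Measurable (({x | 0 < t x}).indicator V) := by
    have : ContinuousOn V {x | 0 < t x} := fun x hx => (hV x hx).continuousAt.continuousWithinAt
    classical
    rw [← piecewise_eq_indicator]
    exact this.measurable_piecewise continuousOn_const hUm
  have hPm : Measurable P := by
    have : P = fun x => ∑ i, ⟪stdOrthonormalBasis ℝ E i, ({x | 0 < t x}).indicator V x⟫ * fderiv ℝ t x (stdOrthonormalBasis ℝ E i) := by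
      ext x
      by_cases hx : x ∈ {x | 0 < t x}
      · simp only [hPdef, indicator_of_mem hx]
        conv_lhs => rw [← (stdOrthonormalBasis ℝ E).sum_repr' (V x), map_sum]
        refine Finset.sum_congr rfl fun i _ => ?_
        rw [map_smul, smul_eq_mul]
      · simp [hPdef, indicator_of_notMem hx]
    rw [this]
    refine Finset.measurable_sum _ fun i _ => ?_
    exact (measurable_const.inner hVm).mul (measurable_fderiv_apply_const ℝ t _)
  have hPA : ∀ x, |P x| ≤ Kt * |B| := by
    intro x
    by_cases hx : x ∈ {x | 0 < t x}
    · simp only [hPdef, indicator_of_mem hx]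
      refine ((fderiv ℝ t x).le_opNorm _).trans ?_
      have := hB x hx
      have := norm_fderiv_le_of_lipschitz ℝ ht (x₀ := x)
      gcongr
      exact (hB x hx).trans (le_abs_self _)
    · simp only [hPdef, indicator_of_notMem hx]; rw [abs_zero]; positivity
  have hPs : ∀ x, x ∉ closedBall p ρ → P x = 0 := by
    intro x hx
    by_cases hx' : x ∈ {x | 0 < t x}
    · simp [hPdef, indicator_of_mem hx', hs x hx]
    · simp [hPdef, indicator_of_notMem hx']
  have htr : ∀ (b : E) (s : ℝ), fderiv ℝ t (b + s • e) = fderiv ℝ t b := by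
    intro b s
    have h1 : fderiv ℝ (fun y => t (y + s • e)) b = fderiv ℝ t (b + s • e) := fderiv_comp_add_right _
    rw [← h1, show (fun y => t (y + s • e)) = fun y => t y + s from funext fun y => te y s, fderiv_add_const]
  have hPf : ∀ z, t z = 0 → ∀ᶠ s in 𝓝[>] (0:ℝ), |P (z + s • e)| ≤ κ := by
    intro z hz
    filter_upwards [hf z hz, self_mem_nhdsWithin] with s h1 h2
    have : z + s • e ∈ {x | 0 < t x} := by
      show 0 < t (z + s • e); rw [te, hz, zero_add]; exact h2
    simp only [hPdef, indicator_of_mem this]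
    rw [htr]; exact h1
  have hlayer := layer te he htc hPm hPA hPs hPf
  set χ := Real.smoothTransition with hχ
  have hχd : Differentiable ℝ χ := (Real.smoothTransition.contDiff (n := 1)).differentiable one_ne_zero
  set L : ℕ → E → ℝ := fun n x => ((n:ℝ)+1) * deriv χ (((n:ℝ)+1) * t x - 1) * P x with hL
  set Af : ℕ → E → ℝ := fun n => ({x | 0 < t x}).indicator (fun x => χ (((n:ℝ)+1) * t x - 1) * dv V x) with hAf
  have hdV := ae_diff_of_LL ht hV hs
  have hdt : ∀ᵐ x : E, DifferentiableAt ℝ t x := ht.ae_differentiableAt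
  have hae : ∀ n : ℕ, ∀ᵐ x : E, dv (cutV t V ((n:ℝ)+1)) x = Af n x + L n x := by
    intro n
    have hn : (0:ℝ) < (n:ℝ) + 1 := by positivity
    filter_upwards [hdV, hdt] with x h1 h2
    by_cases hx : x ∈ {x | 0 < t x}
    · simp only [hAf, hL, hPdef, indicator_of_mem hx]
      have h3 : HasFDerivAt (fun y => χ (((n:ℝ)+1) * t y - 1)) ((deriv χ (((n:ℝ)+1) * t x - 1)) • (((n:ℝ)+1) • fderiv ℝ t x)) x := by
        have ha : HasFDerivAt (fun y => ((n:ℝ)+1) * t y - 1) (((n:ℝ)+1) • fderiv ℝ t x) x :=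
          (h2.hasFDerivAt.const_mul _).sub_const _
        exact ((hχd _).hasDerivAt.comp_hasFDerivAt x ha)
      have h4 := dv_smul h3.differentiableAt (h1 hx)
      unfold cutV
      rw [h4, h3.fderiv]
      simp [smul_eq_mul]; ring
    · simp only [hAf, hL, hPdef, indicator_of_notMem hx]
      have : cutV t V ((n:ℝ)+1) =ᶠ[𝓝 x] fun _ => 0 := by
        have : {y | t y < 1 / ((n:ℝ)+1)} ∈ 𝓝 x := (isOpen_lt ht.continuous continuous_const).mem_nhds (by
          have hx : ¬ 0 < t x := hx
          show t x < 1 / ((n:ℝ)+1)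
          push Not at hx; exact hx.trans_lt (by positivity))
        filter_upwards [this] with y hy
        have hy : t y < 1 / ((n:ℝ)+1) := hy
        rw [lt_div_iff₀ hn] at hy
        rw [cutV, Real.smoothTransition.zero_of_nonpos (by linarith), zero_smul]
      simp [dv, this.fderiv_eq]
  have hdvm := dv_measurable V
  have hAm : ∀ n, Measurable (Af n) := fun n =>
    (((Real.smoothTransition.continuous).measurable.comp ((measurable_const.mul htc.measurable).sub_const 1)).mul hdvm).indicator hUm
  have hbound : ∀ n, ∀ᵐ x, ‖Af n x‖ ≤ (closedBall p ρ).indicator (fun _ => |B'|) x := by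
    intro n
    filter_upwards [hBp] with x hBp
    by_cases hx : x ∈ {x | 0 < t x}
    · simp only [hAf, indicator_of_mem hx]
      by_cases hx' : x ∈ closedBall p ρ
      · rw [indicator_of_mem hx', norm_mul]
        have h1 : ‖χ (((n:ℝ)+1) * t x - 1)‖ ≤ 1 := by
          rw [Real.norm_eq_abs, abs_of_nonneg (Real.smoothTransition.nonneg _)]; exact Real.smoothTransition.le_one _
        calc _ ≤ 1 * |B'| := by gcongr; exact hBp hx
          _ = _ := one_mul _
      · rw [hdz x hx']; simp [hx']
    · simp only [hAf, indicator_of_notMem hx]; rw [norm_zero]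
      exact indicator_nonneg (fun _ _ => abs_nonneg _) _
  have hbi : Integrable ((closedBall p ρ).indicator (fun _ => |B'|)) :=
    (integrable_indicator_iff measurableSet_closedBall).2
      (integrableOn_const measure_closedBall_lt_top.ne)
  have hAi : ∀ n, Integrable (Af n) := fun n =>
    hbi.mono' (hAm n).aestronglyMeasurable (hbound n)
  have hlim : Tendsto (fun n => ∫ x, Af n x) atTop (𝓝 (∫ x in {x | 0 < t x}, dv V x)) := by
    rw [← integral_indicator hUm]
    refine tendsto_integral_filter_of_dominated_convergence _ (Eventually.of_forall fun n => (hAm n).aestronglyMeasurable)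
      (Eventually.of_forall fun n => hbound n) hbi (ae_of_all _ fun x => ?_)
    by_cases hx : x ∈ {x | 0 < t x}
    · simp only [hAf, indicator_of_mem hx]
      apply tendsto_const_nhds.congr'
      have htx : 0 < t x := hx
      obtain ⟨n0, hn0⟩ := exists_nat_gt (2 / t x)
      rw [div_lt_iff₀ htx] at hn0
      filter_upwards [eventually_ge_atTop n0] with n hn
      have : (n0:ℝ) ≤ n := by exact_mod_cast hn
      rw [hχ, Real.smoothTransition.one_of_one_le, one_mul]
      nlinarith
    · simp only [hAf, indicator_of_notMem hx]; exact tendsto_const_nhds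
  set J : ℕ → ℝ≥0∞ := fun n => ∫⁻ x in {x | 1 / ((n:ℝ) + 1) < t x ∧ t x < 2 / ((n:ℝ)+1)},
      ENNReal.ofReal (((n:ℝ)+1) * |P x|) with hJ
  have hAJ : ∀ n, J n ≠ ⊤ → |∫ x, Af n x| ≤ Ccut * (J n).toReal := by
    intro n hJn
    have hn : (0:ℝ) < (n:ℝ) + 1 := by positivity
    obtain ⟨K, hK⟩ := cutV_lip ht hV hs (N := (n:ℝ)+1) hn
    have h0 := integral_dv_lip hK (HasCompactSupport.intro (isCompact_closedBall p ρ) fun x hx => by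
      rw [cutV, hs x hx, smul_zero])
    rw [integral_congr_ae (hae n)] at h0
    have hLm : Measurable (L n) := by
      refine Measurable.mul (Measurable.mul measurable_const ?_) hPm
      exact (measurable_deriv _).comp ((measurable_const.mul htc.measurable).sub_const 1)
    have hSm : MeasurableSet {x | 1 / ((n:ℝ) + 1) < t x ∧ t x < 2 / ((n:ℝ)+1)} :=
      (measurableSet_lt measurable_const htc.measurable).inter (measurableSet_lt htc.measurable measurable_const)
    have hLJ : ∫⁻ x, ENNReal.ofReal ‖L n x‖ ≤ ENNReal.ofReal Ccut * J n := by
      simp only [hJ]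
      rw [← lintegral_indicator hSm, ← lintegral_const_mul' _ _ ENNReal.ofReal_ne_top]
      apply lintegral_mono; intro x
      by_cases hx : x ∈ {x | 1 / ((n:ℝ) + 1) < t x ∧ t x < 2 / ((n:ℝ)+1)}
      · simp only [indicator_of_mem hx]
        rw [← ENNReal.ofReal_mul Ccut_pos.le]
        apply ENNReal.ofReal_le_ofReal
        rw [hL]; simp only [norm_mul, Real.norm_eq_abs]
        rw [abs_of_pos hn]
        have := (Ccut_spec (((n:ℝ)+1) * t x - 1)).1
        calc _ ≤ ((n:ℝ)+1) * Ccut * |P x| := by gcongr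
          _ = _ := by ring
      · have : deriv χ (((n:ℝ)+1) * t x - 1) = 0 := by
          have hx : ¬ (1 / ((n:ℝ) + 1) < t x ∧ t x < 2 / ((n:ℝ)+1)) := hx
          rw [not_and_or, not_lt, not_lt, le_div_iff₀ hn, div_le_iff₀ hn] at hx
          rcases hx with hx | hx
          · exact (Ccut_spec _).2.1 (by linarith)
          · exact (Ccut_spec _).2.2 (by linarith)
        simp [hL, this]
    have hfin : ENNReal.ofReal Ccut * J n ≠ ⊤ := ENNReal.mul_ne_top ENNReal.ofReal_ne_top hJn
    have hLi : Integrable (L n) := by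
      refine ⟨hLm.aestronglyMeasurable, ?_⟩
      rw [hasFiniteIntegral_iff_norm]
      exact hLJ.trans_lt hfin.lt_top
    rw [integral_add (hAi n) hLi] at h0
    have h1 : |∫ x, Af n x| = |∫ x, L n x| := by
      rw [show ∫ x, Af n x = - ∫ x, L n x by linarith, abs_neg]
    rw [h1]
    calc |∫ x, L n x| ≤ (∫⁻ x, ENNReal.ofReal ‖L n x‖).toReal := by
            rw [← Real.norm_eq_abs]; exact norm_integral_le_lintegral_norm (L n)
      _ ≤ (ENNReal.ofReal Ccut * J n).toReal := ENNReal.toReal_mono hfin hLJ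
      _ = _ := by rw [ENNReal.toReal_mul, ENNReal.toReal_ofReal Ccut_pos.le]
  have hCp := Ccut_pos
  rw [mul_assoc]
  suffices h : ∀ Y, κ * volume.real (closedBall p (ρ+3)) < Y → |∫ x in {x | 0 < t x}, dv V x| ≤ Ccut * Y by
    refine le_of_forall_pos_le_add fun ε hε => ?_
    refine (h (κ * volume.real (closedBall p (ρ+3)) + ε / Ccut) (by have := div_pos hε hCp; linarith)).trans (le_of_eq ?_)
    field_simp
  intro Y hY
  have hY0 : 0 < Y := lt_of_le_of_lt (by positivity) hY
  have hlt : limsup J atTop < ENNReal.ofReal Y := by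
    refine hlayer.trans_lt ?_
    rw [← ENNReal.ofReal_toReal (measure_closedBall_lt_top (μ := (volume : Measure E)) (x := p) (r := ρ+3)).ne, ← ENNReal.ofReal_mul hκ]
    exact (ENNReal.ofReal_lt_ofReal_iff hY0).2 hY
  have hev := eventually_lt_of_limsup_lt hlt
  refine le_of_tendsto (hlim.abs) ?_
  filter_upwards [hev] with n hn
  refine (hAJ n hn.ne_top).trans ?_
  gcongr
  exact ENNReal.toReal_le_of_le_ofReal hY0.le hn.le

lemma div_zero' {t : E → ℝ} {e : E} {Kt : ℝ≥0} (te : ∀ x u, t (x + u • e) = t x + u) (he : ‖e‖ = 1)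
    (ht : LipschitzWith Kt t) {V : E → E} (hV : ∀ x, 0 < t x → LL V x)
    {p : E} {ρ B B' : ℝ} (hs : ∀ x, x ∉ closedBall p ρ → V x = 0)
    (hB : ∀ x, 0 < t x → ‖V x‖ ≤ B)
    (hB' : ∀ᵐ x, 0 < t x → DifferentiableAt ℝ V x → |dv V x| ≤ B')
    (hf : ∀ b, t b = 0 → Tendsto (fun s : ℝ => fderiv ℝ t b (V (b + s • e))) (𝓝[>] (0:ℝ)) (𝓝 0)) :
    ∫ x in {x | 0 < t x}, dv V x = 0 := by
  have hCp := Ccut_pos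
  have h : ∀ κ > 0, |∫ x in {x | 0 < t x}, dv V x| ≤ Ccut * κ * volume.real (closedBall p (ρ + 3)) := by
    intro κ hκ
    refine div_bound te he ht hV hs hB hB' hκ.le fun b hb => ?_
    have := (hf b hb).abs
    rw [abs_zero] at this
    exact (this.eventually_lt_const hκ).mono fun s hs => hs.le
  rw [← abs_nonpos_iff]
  refine le_of_forall_pos_le_add fun ε hε => ?_
  set v := volume.real (closedBall p (ρ+3))
  have hv : 0 ≤ v := measureReal_nonneg
  refine (h (ε / (Ccut * (v + 1))) (by positivity)).trans ?_
  rw [show Ccut * (ε / (Ccut * (v+1))) * v = ε * (v / (v+1)) by field_simp]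
  have : v / (v+1) ≤ 1 := by rw [div_le_one (by linarith)]; linarith
  nlinarith
end NodalNeumann

end

noncomputable section
open MeasureTheory Metric Set Filter Asymptotics
open scoped Topology NNReal ENNReal RealInnerProductSpace
namespace NodalNeumann
set_option linter.all false

lemma ode_freq {H I H' I' : ℝ → ℝ} {r0 C m : ℝ} (hr0 : 0 < r0) (hC : 0 ≤ C) (hm : 0 ≤ m)
    (hH : ∀ r ∈ Ioc 0 r0, HasDerivAt H (H' r) r) (hI : ∀ r ∈ Ioc 0 r0, HasDerivAt I (I' r) r)
    (hHn : ∀ r ∈ Ioc 0 r0, 0 ≤ H r) (hIn : ∀ r ∈ Ioc 0 r0, 0 ≤ I r) (hH'n : ∀ r ∈ Ioc 0 r0, 0 ≤ H' r)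
    (h1 : ∀ r ∈ Ioc 0 r0, r * H' r ≤ (m + 4 + C * r) * H r + I r / 3)
    (h2 : ∀ r ∈ Ioc 0 r0, -(2 * C * r * (I r * H r)) ≤ r * (I' r * H r - I r * H' r))
    (hp : 0 < H r0) {K : ℝ} (hK : m + 4 + C * r0 + Real.exp (2 * C * r0) * (I r0 / H r0) / 3 ≤ K) :
    ∀ r ∈ Ioc 0 r0, 0 < H r ∧ ∀ r' ∈ Icc r r0, H r' ≤ (r' / r) ^ K * H r := by
  have key : ∀ r ∈ Ioc 0 r0, 0 < H r → ∀ r' ∈ Icc r r0, H r' ≤ (r' / r) ^ K * H r := by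
    intro r hr hHr
    have hsub : Icc r r0 ⊆ Ioc 0 r0 := fun s hs => ⟨hr.1.trans_le hs.1, hs.2⟩
    have hmono : MonotoneOn H (Icc r r0) := by
      apply monotoneOn_of_deriv_nonneg (convex_Icc _ _)
      · exact fun s hs => (hH s (hsub hs)).continuousAt.continuousWithinAt
      · exact fun s hs => (hH s (hsub (interior_subset hs))).differentiableAt.differentiableWithinAt
      · intro s hs; rw [(hH s (hsub (interior_subset hs))).deriv]; exact hH'n s (hsub (interior_subset hs))
    have hpos : ∀ s ∈ Icc r r0, 0 < H s := fun s hs => hHr.trans_le (hmono (left_mem_Icc.2 hr.2) hs hs.1)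
    -- almost monotonicity of the frequency
    have hF : ∀ s ∈ Icc r r0, I s / H s ≤ Real.exp (2 * C * r0) * (I r0 / H r0) := by
      have hd : ∀ s ∈ Icc r r0, HasDerivAt (fun s => Real.exp (2 * C * s) * (I s / H s))
          (Real.exp (2 * C * s) * (2 * C) * (I s / H s) + Real.exp (2 * C * s) * ((I' s * H s - I s * H' s) / H s ^ 2)) s := by
        intro s hs
        have e1 : HasDerivAt (fun s => Real.exp (2 * C * s)) (Real.exp (2 * C * s) * (2 * C)) s := by
          have := ((hasDerivAt_id s).const_mul (2 * C)).exp
          simpa using this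
        exact e1.mul ((hI s (hsub hs)).div (hH s (hsub hs)) (hpos s hs).ne')
      have hm2 : MonotoneOn (fun s => Real.exp (2 * C * s) * (I s / H s)) (Icc r r0) := by
        apply monotoneOn_of_deriv_nonneg (convex_Icc _ _)
        · exact fun s hs => (hd s hs).continuousAt.continuousWithinAt
        · exact fun s hs => (hd s (interior_subset hs)).differentiableAt.differentiableWithinAt
        · intro s hs
          have hs := interior_subset hs
          rw [(hd s hs).deriv]
          have hs0 := (hsub hs).1
          have hp := hpos s hs
          have h3 := h2 s (hsub hs)
          have h4 : -(2 * C * (I s * H s)) ≤ I' s * H s - I s * H' s := by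
            have : s * (-(2 * C * (I s * H s))) ≤ s * (I' s * H s - I s * H' s) := by linarith
            exact le_of_mul_le_mul_left this hs0
          have h5 : -(2 * C) * (I s / H s) ≤ (I' s * H s - I s * H' s) / H s ^ 2 := by
            rw [le_div_iff₀ (by positivity)]
            calc _ = -(2 * C * (I s * H s)) := by field_simp
              _ ≤ _ := h4
          have h6 := Real.exp_pos (2 * C * s)
          nlinarith
      intro s hs
      have h3 := hm2 hs (right_mem_Icc.2 hr.2) hs.2
      simp only at h3
      refine le_trans ?_ h3
      have : 0 ≤ I s / H s := div_nonneg (hIn s (hsub hs)) (hpos s hs).le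
      have h7 : 1 ≤ Real.exp (2 * C * s) := Real.one_le_exp (by have := (hsub hs).1; positivity)
      nlinarith
    have hd2 : ∀ s ∈ Icc r r0, s * H' s ≤ K * H s := by
      intro s hs
      have hp := hpos s hs
      have h3 := h1 s (hsub hs)
      have h4 := hF s hs
      rw [div_le_iff₀ hp] at h4
      have h5 : C * s ≤ C * r0 := mul_le_mul_of_nonneg_left hs.2 hC
      nlinarith
    have hanti : AntitoneOn (fun s => s ^ (-K) * H s) (Icc r r0) := by
      have hd : ∀ s ∈ Icc r r0, HasDerivAt (fun s => s ^ (-K) * H s) ((-K) * s ^ (-K - 1) * H s + s ^ (-K) * H' s) s := by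
        intro s hs
        exact (Real.hasDerivAt_rpow_const (Or.inl (hsub hs).1.ne')).mul (hH s (hsub hs))
      apply antitoneOn_of_deriv_nonpos (convex_Icc _ _)
      · exact fun s hs => (hd s hs).continuousAt.continuousWithinAt
      · exact fun s hs => (hd s (interior_subset hs)).differentiableAt.differentiableWithinAt
      · intro s hs
        have hs := interior_subset hs
        have hs0 := (hsub hs).1
        rw [(hd s hs).deriv, show s ^ (-K) = s ^ (-K - 1) * s by
          rw [← Real.rpow_add_one hs0.ne']; congr 1; ring]
        have := hd2 s hs
        have h6 : 0 < s ^ (-K - 1) := Real.rpow_pos_of_pos hs0 _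
        nlinarith
    intro r' hr'
    have h3 := hanti (left_mem_Icc.2 hr.2) hr' hr'.1
    simp only at h3
    have hr'0 := (hsub hr').1
    rw [Real.div_rpow hr'0.le hr.1.le]
    rw [Real.rpow_neg hr'0.le, Real.rpow_neg hr.1.le] at h3
    have h4 : 0 < r' ^ K := Real.rpow_pos_of_pos hr'0 _
    have h5 : 0 < r ^ K := Real.rpow_pos_of_pos hr.1 _
    have h6 := mul_le_mul_of_nonneg_left h3 h4.le
    rw [← mul_assoc, mul_inv_cancel₀ h4.ne', one_mul] at h6
    refine h6.trans (le_of_eq ?_)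
    field_simp
  have hpos : ∀ r ∈ Ioc 0 r0, 0 < H r := by
    intro r hr
    by_contra hn
    set Z := {s ∈ Icc r r0 | H s ≤ 0} with hZ
    have hsub : Icc r r0 ⊆ Ioc 0 r0 := fun s hs => ⟨hr.1.trans_le hs.1, hs.2⟩
    have hcont : ContinuousOn H (Icc r r0) := fun s hs => (hH s (hsub hs)).continuousAt.continuousWithinAt
    have hZc : IsCompact Z := by
      have : IsClosed Z := hcont.preimage_isClosed_of_isClosed isClosed_Icc isClosed_Iic
      exact isCompact_Icc.of_isClosed_subset this (fun s hs => hs.1)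
    have hZn : Z.Nonempty := ⟨r, left_mem_Icc.2 hr.2, not_lt.1 hn⟩
    obtain ⟨s, hs, hmax⟩ := hZc.exists_isGreatest hZn
    have hs0 := hsub hs.1
    have hsr : s < r0 := lt_of_le_of_ne hs.1.2 (fun h => by have := hs.2; rw [h] at this; linarith)
    have hK0 : 0 ≤ K := le_trans (by have := hIn r0 ⟨hr0, le_rfl⟩; positivity) hK
    have hlow : ∀ s' ∈ Ioc s r0, H r0 * (r0 / s) ^ (-K) ≤ H s' := by
      intro s' hs'
      have hs'm : s' ∈ Ioc 0 r0 := ⟨hs0.1.trans hs'.1, hs'.2⟩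
      have hp' : 0 < H s' := by
        by_contra h
        have : s' ∈ Z := ⟨⟨hs.1.1.trans hs'.1.le, hs'.2⟩, not_lt.1 h⟩
        exact absurd (hmax this) (not_le.2 hs'.1)
      have h3 := key s' hs'm hp' r0 ⟨hs'.2, le_rfl⟩
      have h4 : (r0 / s') ^ K ≤ (r0 / s) ^ K := by
        apply Real.rpow_le_rpow _ _ hK0
        · have := hs'm.1; positivity
        · have := hs'.1; have := hs0.1; gcongr
      have h5 : 0 < (r0 / s) ^ K := Real.rpow_pos_of_pos (div_pos hr0 hs0.1) _
      rw [Real.rpow_neg (div_pos hr0 hs0.1).le, ← div_eq_mul_inv, div_le_iff₀ h5]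
      nlinarith
    have hten : Tendsto H (𝓝[>] s) (𝓝 (H s)) := (hH s hs0).continuousAt.continuousWithinAt
    have h6 : H r0 * (r0 / s) ^ (-K) ≤ H s := by
      refine ge_of_tendsto hten ?_
      filter_upwards [Ioc_mem_nhdsGT hsr] with s' hs' using hlow s' hs'
    have : 0 < H r0 * (r0 / s) ^ (-K) := mul_pos hp (Real.rpow_pos_of_pos (div_pos hr0 hs0.1) _)
    linarith [hs.2]
  exact fun r hr => ⟨hpos r hr, key r hr (hpos r hr)⟩
end NodalNeumann

end

noncomputable section
open MeasureTheory Metric Set Filter Asymptotics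
open scoped Topology NNReal ENNReal RealInnerProductSpace
namespace NodalNeumann
set_option linter.all false
variable {E : Type*} [NormedAddCommGroup E] [InnerProductSpace ℝ E] [FiniteDimensional ℝ E]

/-- the gradient -/
def gr (u : E → ℝ) (x : E) : E := (InnerProductSpace.toDual ℝ E).symm (fderiv ℝ u x)

lemma gr_inner (u : E → ℝ) (x v : E) : ⟪gr u x, v⟫ = fderiv ℝ u x v := by
  simp [gr]

lemma gr_norm (u : E → ℝ) (x : E) : ‖gr u x‖ = ‖fderiv ℝ u x‖ := by
  simp [gr]

/-- Riesz representation as a real continuous linear map -/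
def rz (E : Type*) [NormedAddCommGroup E] [InnerProductSpace ℝ E] [FiniteDimensional ℝ E] : (E →L[ℝ] ℝ) →L[ℝ] E :=
  ∑ i, (ContinuousLinearMap.apply ℝ ℝ (stdOrthonormalBasis ℝ E i)).smulRight (stdOrthonormalBasis ℝ E i)

lemma rz_inner (ℓ : E →L[ℝ] ℝ) (v : E) : ⟪rz E ℓ, v⟫ = ℓ v := by
  simp only [rz, ContinuousLinearMap.sum_apply, ContinuousLinearMap.smulRight_apply, ContinuousLinearMap.apply_apply,
    sum_inner, real_inner_smul_left]
  conv_rhs => rw [← (stdOrthonormalBasis ℝ E).sum_repr' v, map_sum]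
  refine Finset.sum_congr rfl fun i _ => ?_
  rw [map_smul, smul_eq_mul, mul_comm]

lemma gr_eq (u : E → ℝ) (x : E) : gr u x = rz E (fderiv ℝ u x) :=
  ext_inner_right ℝ fun v => by rw [gr_inner, rz_inner]

lemma HarmAt.gr_hasFDerivAt {u : E → ℝ} {x : E} (h : HarmAt u x) :
    HasFDerivAt (gr u) ((rz E).comp (fderiv ℝ (fderiv ℝ u) x)) x := by
  have h1 : DifferentiableAt ℝ (fderiv ℝ u) x := h.1.fderiv_differentiableAt_two
  rw [show gr u = fun x => rz E (fderiv ℝ u x) from funext (gr_eq u)]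
  exact (rz E).hasFDerivAt.comp x h1.hasFDerivAt

lemma HarmAt.gr_fderiv_inner {u : E → ℝ} {x : E} (h : HarmAt u x) (v w : E) :
    ⟪fderiv ℝ (gr u) x v, w⟫ = fderiv ℝ (fderiv ℝ u) x v w := by
  rw [h.gr_hasFDerivAt.fderiv]; simp [rz_inner]

lemma HarmAt.gr_symm {u : E → ℝ} {x : E} (h : HarmAt u x) (v w : E) :
    ⟪fderiv ℝ (gr u) x v, w⟫ = ⟪fderiv ℝ (gr u) x w, v⟫ := by
  rw [h.gr_fderiv_inner, h.gr_fderiv_inner]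
  exact (h.1.isSymmSndFDerivAt (by simp)).eq v w

lemma HarmAt.dv_gr {u : E → ℝ} {x : E} (h : HarmAt u x) : dv (gr u) x = 0 := by
  unfold dv
  simp only [h.gr_fderiv_inner]
  exact ((harmAt_iff (stdOrthonormalBasis ℝ E)).1 h).2

lemma HarmAt.LL_gr {u : E → ℝ} {x : E} (h : HarmAt u x) : LL (gr u) x := by
  apply LL.of_contDiffAt
  have : ContDiffAt ℝ 1 (fderiv ℝ u) x := h.1.fderiv_right (by norm_num)
  rw [show gr u = fun x => rz E (fderiv ℝ u x) from funext (gr_eq u)]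
  exact (rz E).contDiff.contDiffAt.comp x this

lemma HarmAt.LL {u : E → ℝ} {x : E} (h : HarmAt u x) : LL u x := LL.of_contDiffAt (h.1.of_le (by norm_num))

lemma HarmAt.hasFDerivAt {u : E → ℝ} {x : E} (h : HarmAt u x) : HasFDerivAt u (innerSL ℝ (gr u x)) x := by
  have : innerSL ℝ (gr u x) = fderiv ℝ u x := by ext v; simp [gr_inner]
  rw [this]; exact (h.1.differentiableAt (by norm_num)).hasFDerivAt

variable [MeasurableSpace E] [BorelSpace E]

/-- data for the frequency function -/
structure Frq (t u G μ : E → ℝ) (b β : E → E) (e c : E) (r1 C S : ℝ) : Prop where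
  te : ∀ x u, t (x + u • e) = t x + u
  he : ‖e‖ = 1
  tl : LipschitzWith 2 t
  r1p : 0 < r1
  C0 : 0 ≤ C
  harm : ∀ x ∈ ball c r1, 0 < t x → HarmAt u x
  uS : ∀ x ∈ ball c r1, 0 < t x → |u x| ≤ S
  gS : ∀ x ∈ ball c r1, 0 < t x → ‖gr u x‖ ≤ S
  hG : ∀ x ∈ ball c r1, 0 < t x → HasFDerivAt G ((2:ℝ) • innerSL ℝ (b x)) x
  GLL : ∀ x ∈ ball c r1, 0 < t x → LL G x
  bL : ∀ x ∈ ball c r1, 0 < t x → LL b x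
  βL : ∀ x ∈ ball c r1, 0 < t x → LL β x
  μL : ∀ x ∈ ball c r1, 0 < t x → LL μ x
  bβ : ∀ x ∈ ball c r1, 0 < t x → b x = μ x • β x
  Gb : ∀ x ∈ ball c r1, 0 < t x → ⟪b x, β x⟫ = G x
  Glo : ∀ x ∈ ball c r1, 0 < t x → ‖x - c‖ ^ 2 / 2 ≤ G x
  bup : ∀ x ∈ ball c r1, 0 < t x → ‖b x‖ ≤ 2 * ‖x - c‖
  βup : ∀ x ∈ ball c r1, 0 < t x → ‖β x‖ ≤ 2 * ‖x - c‖
  μlo : ∀ x ∈ ball c r1, 0 < t x → 1 / 2 ≤ μ x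
  μup : ∀ x ∈ ball c r1, 0 < t x → μ x ≤ 2
  Db : ∀ x ∈ ball c r1, 0 < t x → DifferentiableAt ℝ b x → |dv b x - Module.finrank ℝ E * μ x| ≤ C * ‖x - c‖
  Dβ : ∀ x ∈ ball c r1, 0 < t x → DifferentiableAt ℝ β x → |dv β x - Module.finrank ℝ E| ≤ C * ‖x - c‖
  Dβ2 : ∀ x ∈ ball c r1, 0 < t x → DifferentiableAt ℝ β x → ∀ v, |⟪fderiv ℝ β x v, v⟫ - ‖v‖ ^ 2| ≤ C * ‖x - c‖ * ‖v‖ ^ 2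
  bf : ∀ y ∈ ball c r1, t y = 0 → Tendsto (fun s : ℝ => fderiv ℝ t y (b (y + s • e))) (𝓝[>] (0:ℝ)) (𝓝 0)
  uf : ∀ y ∈ ball c r1, t y = 0 → Tendsto (fun s : ℝ => fderiv ℝ t y (gr u (y + s • e))) (𝓝[>] (0:ℝ)) (𝓝 0)

namespace Frq
variable {t u G μ : E → ℝ} {b β : E → E} {e c : E} {r1 C S : ℝ}

/-- the domain of integration -/
def dom (t : E → ℝ) (c : E) (r1 : ℝ) : Set E := {x | 0 < t x} ∩ ball c r1
/-- the weight -/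
def ph (G : E → ℝ) (r : ℝ) (x : E) : ℝ := max (r ^ 2 - G x) 0

lemma ph_nonneg (r : ℝ) (x : E) : 0 ≤ ph G r x := le_max_right _ _

lemma dom_meas (f : Frq t u G μ b β e c r1 C S) : MeasurableSet (dom t c r1) :=
  (measurableSet_lt measurable_const f.tl.continuous.measurable).inter measurableSet_ball

lemma dom_open (f : Frq t u G μ b β e c r1 C S) : IsOpen (dom t c r1) :=
  (isOpen_lt continuous_const f.tl.continuous).inter isOpen_ball

lemma dom_fin : volume (dom t c r1) < ⊤ := (measure_mono inter_subset_right).trans_lt measure_ball_lt_top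

lemma ph_zero (f : Frq t u G μ b β e c r1 C S) {r : ℝ} (hr : 0 < r) {x : E} (hx : x ∈ dom t c r1) (h : x ∉ ball c (2 * r)) : ph G r x = 0 := by
  rw [ph, max_eq_right]
  have h1 := f.Glo x hx.2 hx.1
  rw [mem_ball, dist_eq_norm, not_lt] at h
  have : (2*r)^2 ≤ ‖x - c‖^2 := pow_le_pow_left₀ (by positivity) h 2
  nlinarith

lemma ph_le (f : Frq t u G μ b β e c r1 C S) {r : ℝ} {x : E} (hx : x ∈ dom t c r1) : ph G r x ≤ r ^ 2 := by
  rw [ph]; apply max_le _ (by positivity)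
  have h1 := f.Glo x hx.2 hx.1
  have := sq_nonneg ‖x - c‖
  linarith

lemma ph_LL (f : Frq t u G μ b β e c r1 C S) (r : ℝ) {x : E} (hx : x ∈ dom t c r1) : LL (ph G r) x :=
  LL.max ((LL.const _).sub (f.GLL x hx.2 hx.1)) 0

lemma hasDerivAt_maxpow (k : ℕ) (hk : 2 ≤ k) (a : ℝ) :
    HasDerivAt (fun s : ℝ => max s 0 ^ k) (k * max a 0 ^ (k-1)) a := by
  rcases lt_trichotomy a 0 with h | h | h
  · have : (fun s : ℝ => max s 0 ^ k) =ᶠ[𝓝 a] fun _ => 0 := by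
      filter_upwards [Iio_mem_nhds h] with s hs
      rw [max_eq_right (le_of_lt hs), zero_pow (by omega)]
    rw [max_eq_right h.le, zero_pow (by omega), mul_zero]
    exact (hasDerivAt_const a 0).congr_of_eventuallyEq this
  · subst h
    simp only [max_self]
    rw [zero_pow (by omega), mul_zero]
    rw [hasDerivAt_iff_isLittleO]
    simp only [max_self, sub_zero, smul_zero]
    rw [zero_pow (by omega)]
    simp only [sub_zero]
    have h1 : (fun x : ℝ => max x 0 ^ k) =O[𝓝 0] fun x : ℝ => x ^ k := by
      refine IsBigO.of_bound 1 (Eventually.of_forall fun x => ?_)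
      rw [one_mul, norm_pow, norm_pow]
      gcongr
      rw [Real.norm_eq_abs, Real.norm_eq_abs, abs_of_nonneg (le_max_right _ _)]
      exact max_le (le_abs_self _) (abs_nonneg _)
    refine h1.trans_isLittleO ?_
    have := isLittleO_pow_pow (𝕜 := ℝ) (m := 1) (n := k) (by omega)
    simpa using this
  · have : (fun s : ℝ => max s 0 ^ k) =ᶠ[𝓝 a] fun s => s ^ k := by
      filter_upwards [Ioi_mem_nhds h] with s hs
      rw [max_eq_left (le_of_lt hs)]
    rw [max_eq_left h.le]
    exact (hasDerivAt_pow k a).congr_of_eventuallyEq this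

lemma ph_hasFDerivAt (f : Frq t u G μ b β e c r1 C S) (r : ℝ) {k : ℕ} (hk : 2 ≤ k) {x : E} (hx : x ∈ dom t c r1) :
    HasFDerivAt (fun y => ph G r y ^ k) ((-(2 * k * ph G r x ^ (k-1))) • innerSL ℝ (b x)) x := by
  have h1 := (f.hG x hx.2 hx.1).const_sub (r^2)
  have h2 := (hasDerivAt_maxpow k hk (r^2 - G x)).comp_hasFDerivAt x h1
  refine h2.congr_fderiv ?_
  ext v
  simp [ph]; ring

/-- integrability of bounded continuous functions -/
lemma integrable (f : Frq t u G μ b β e c r1 C S) {g : E → ℝ} (hg : ∀ x ∈ dom t c r1, ContinuousAt g x) {B : ℝ}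
    (hB : ∀ x ∈ dom t c r1, |g x| ≤ B) : IntegrableOn g (dom t c r1) := by
  refine IntegrableOn.of_bound dom_fin ?_ B ?_
  · exact ContinuousOn.aestronglyMeasurable (fun x hx => (hg x hx).continuousWithinAt) f.dom_meas
  · exact (ae_restrict_iff' f.dom_meas).2 (ae_of_all _ hB)

end Frq
end NodalNeumann

end

noncomputable section
open MeasureTheory Metric Set Filter Asymptotics
open scoped Topology NNReal ENNReal RealInnerProductSpace
namespace NodalNeumann
set_option linter.all false
variable {E : Type*} [NormedAddCommGroup E] [InnerProductSpace ℝ E] [FiniteDimensional ℝ E]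
variable [MeasurableSpace E] [BorelSpace E]
namespace Frq
variable {t u G μ : E → ℝ} {b β : E → E} {e c : E} {r1 C S : ℝ}

open Classical in
/-- the weighted field, cut off -/
def cw (t G : E → ℝ) (c : E) (r1 r : ℝ) (k : ℕ) (W : E → E) (x : E) : E :=
  if x ∈ dom t c r1 then ph G r x ^ k • W x else 0

lemma cw_zero (f : Frq t u G μ b β e c r1 C S) {r : ℝ} (hr : 0 < r) {k : ℕ} (hk : 2 ≤ k) (W : E → E) {x : E}
    (h : x ∉ ball c (2 * r)) : cw t G c r1 r k W x = 0 := by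
  unfold cw
  split_ifs with hx
  · rw [f.ph_zero hr hx h, zero_pow (by omega), zero_smul]
  · rfl

lemma cw_eq (f : Frq t u G μ b β e c r1 C S) {r : ℝ} {k : ℕ} (W : E → E) {x : E} (hx : x ∈ dom t c r1) :
    cw t G c r1 r k W =ᶠ[𝓝 x] fun y => ph G r y ^ k • W y := by
  filter_upwards [f.dom_open.mem_nhds hx] with y hy
  rw [cw, if_pos hy]

lemma cw_out (f : Frq t u G μ b β e c r1 C S) {r : ℝ} (hr : 0 < r) (hr1 : 4 * r ≤ r1) {k : ℕ} (hk : 2 ≤ k) (W : E → E) {x : E}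
    (hx : x ∉ ball c r1) : cw t G c r1 r k W =ᶠ[𝓝 x] fun y => 0 := by
  have : (closedBall c (2*r))ᶜ ∈ 𝓝 x := isClosed_closedBall.isOpen_compl.mem_nhds (by
    rw [mem_compl_iff, mem_closedBall]; rw [mem_ball] at hx; linarith)
  filter_upwards [this] with y hy
  exact f.cw_zero hr hk W fun h => hy (ball_subset_closedBall h)

lemma cw_LL (f : Frq t u G μ b β e c r1 C S) {r : ℝ} (hr : 0 < r) (hr1 : 4 * r ≤ r1) {k : ℕ} (hk : 2 ≤ k) {W : E → E}
    (hW : ∀ x ∈ dom t c r1, LL W x) (x : E) (hx : 0 < t x) : LL (cw t G c r1 r k W) x := by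
  by_cases hb : x ∈ ball c r1
  · exact LL.congr (((f.ph_LL r ⟨hx, hb⟩).pow k).smul (hW x ⟨hx, hb⟩)) (f.cw_eq W ⟨hx, hb⟩)
  · exact LL.congr (LL.const 0) (f.cw_out hr hr1 hk W hb)

lemma ae_diff (f : Frq t u G μ b β e c r1 C S) {r : ℝ} (hr : 0 < r) (hr1 : 4 * r ≤ r1) {W : E → E}
    (hW : ∀ x ∈ dom t c r1, LL W x) : ∀ᵐ x : E, x ∈ dom t c r1 → 0 < ph G r x → DifferentiableAt ℝ W x := by
  have := ae_diff_of_LL f.tl (f.cw_LL hr hr1 (k := 2) le_rfl hW) (p := c) (ρ := 2*r)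
    fun x hx => f.cw_zero hr le_rfl W fun h => hx (ball_subset_closedBall h)
  filter_upwards [this] with x hx hd hp
  have h1 := (hx hd.1).congr_of_eventuallyEq (f.cw_eq W hd).symm
  have h2 : DifferentiableAt ℝ (fun y => ph G r y ^ 2) x := (f.ph_hasFDerivAt r le_rfl hd).differentiableAt
  have h3 := (h2.fun_inv (by positivity)).fun_smul h1
  refine h3.congr_of_eventuallyEq ?_
  have hc : ∀ᶠ y in 𝓝 x, ph G r y ^ 2 ≠ 0 := h2.continuousAt.eventually_ne (by positivity)
  filter_upwards [hc] with y hy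
  rw [smul_smul, inv_mul_cancel₀ hy, one_smul]

lemma stokes (f : Frq t u G μ b β e c r1 C S) {r : ℝ} (hr : 0 < r) (hr1 : 4 * r ≤ r1) {k : ℕ} (hk : 2 ≤ k)
    {W : E → E} {dW : E → ℝ} {B B' : ℝ} (hW : ∀ x ∈ dom t c r1, LL W x) (hB : ∀ x ∈ dom t c r1, ‖W x‖ ≤ B)
    (hd : ∀ x ∈ dom t c r1, DifferentiableAt ℝ b x → DifferentiableAt ℝ β x →
      DifferentiableAt ℝ W x ∧ dv W x = dW x ∧ |dW x| ≤ B')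
    (hf : ∀ y ∈ ball c r1, t y = 0 → Tendsto (fun s : ℝ => fderiv ℝ t y (W (y + s • e))) (𝓝[>] (0:ℝ)) (𝓝 0)) :
    IntegrableOn (fun x => ph G r x ^ k * dW x) (dom t c r1) ∧
    ∫ x in dom t c r1, ph G r x ^ k * dW x = 2 * k * ∫ x in dom t c r1, ph G r x ^ (k-1) * ⟪b x, W x⟫ := by
  have hae1 := f.ae_diff hr hr1 (W := b) fun x hx => f.bL x hx.2 hx.1
  have hae2 := f.ae_diff hr hr1 (W := β) fun x hx => f.βL x hx.2 hx.1
  have hkey : ∀ᵐ x : E, x ∈ dom t c r1 → dv (cw t G c r1 r k W) x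
      = ph G r x ^ k * dW x - 2 * k * (ph G r x ^ (k-1) * ⟪b x, W x⟫) ∧ |ph G r x ^ k * dW x| ≤ (r^2)^k * |B'| := by
    filter_upwards [hae1, hae2] with x h1 h2 hx
    have hfd := f.ph_hasFDerivAt r hk hx
    rcases (ph_nonneg r x : 0 ≤ ph G r x).eq_or_lt with h0 | h0
    · rw [← h0, zero_pow (by omega), zero_pow (by omega)]
      refine ⟨?_, by simp; positivity⟩
      rw [zero_mul, zero_mul, mul_zero, sub_zero]
      have hz : HasFDerivAt (cw t G c r1 r k W) (0 : E →L[ℝ] E) x := by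
        refine HasFDerivAt.congr_of_eventuallyEq ?_ (f.cw_eq W hx)
        rw [← h0, zero_pow (by omega : k - 1 ≠ 0), mul_zero, neg_zero, zero_smul] at hfd
        rw [hasFDerivAt_iff_isLittleO] at hfd ⊢
        have hz0 : ph G r x ^ k = 0 := by rw [← h0, zero_pow (by omega : k ≠ 0)]
        simp only [hz0, zero_smul, sub_zero, ContinuousLinearMap.zero_apply] at hfd ⊢
        have : (fun y => W y) =O[𝓝 x] fun _ => (1:ℝ) := by
          refine IsBigO.of_bound B ?_
          filter_upwards [f.dom_open.mem_nhds hx] with y hy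
          simpa using hB y hy
        have := hfd.norm_right.smul_isBigO this
        simpa using this
      unfold dv
      rw [hz.fderiv]; simp
    · obtain ⟨g1, g2, g3⟩ := hd x hx (h1 hx h0) (h2 hx h0)
      constructor
      · have e1 : dv (cw t G c r1 r k W) x = dv (fun y => ph G r y ^ k • W y) x := by
          unfold dv; rw [(f.cw_eq W hx).fderiv_eq]
        rw [e1, dv_smul hfd.differentiableAt g1, hfd.fderiv, g2]
        simp; ring
      · rw [abs_mul, abs_pow, abs_of_pos h0]
        exact mul_le_mul (pow_le_pow_left₀ h0.le (f.ph_le hx) k) (g3.trans (le_abs_self _)) (abs_nonneg _) (by positivity)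
  have hbW : ∀ x ∈ dom t c r1, |ph G r x ^ (k-1) * ⟪b x, W x⟫| ≤ (r^2)^(k-1) * (2 * r1 * |B|) := by
    intro x hx
    rw [abs_mul, abs_pow, abs_of_nonneg (ph_nonneg r x)]
    have hb := f.bup x hx.2 hx.1
    have hxx : ‖x - c‖ ≤ r1 := by have := hx.2; rw [mem_ball, dist_eq_norm] at this; exact this.le
    refine mul_le_mul (pow_le_pow_left₀ (ph_nonneg r x) (f.ph_le hx) _) ?_ (abs_nonneg _) (by positivity)
    refine (abs_real_inner_le_norm _ _).trans ?_
    exact mul_le_mul (by linarith) ((hB x hx).trans (le_abs_self _)) (norm_nonneg _) (by have := f.r1p; positivity)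
  have hintb : IntegrableOn (fun x => ph G r x ^ (k-1) * ⟪b x, W x⟫) (dom t c r1) := by
    refine f.integrable (fun x hx => ?_) hbW
    exact ((f.ph_LL r hx).continuousAt.pow _).mul ((f.bL x hx.2 hx.1).continuousAt.inner (𝕜 := ℝ) (hW x hx).continuousAt)
  have hinta : IntegrableOn (fun x => ph G r x ^ k * dW x) (dom t c r1) := by
    have hm : AEStronglyMeasurable (fun x => dv (cw t G c r1 r k W) x + 2 * k * (ph G r x ^ (k-1) * ⟪b x, W x⟫))
        (volume.restrict (dom t c r1)) :=
      (dv_measurable _).aestronglyMeasurable.add (hintb.aestronglyMeasurable.const_mul _)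
    have heq : (fun x => dv (cw t G c r1 r k W) x + 2 * k * (ph G r x ^ (k-1) * ⟪b x, W x⟫))
        =ᵐ[volume.restrict (dom t c r1)] fun x => ph G r x ^ k * dW x := by
      rw [Filter.EventuallyEq, ae_restrict_iff' f.dom_meas]
      filter_upwards [hkey] with x hx hxd
      rw [(hx hxd).1]; ring
    refine IntegrableOn.of_bound dom_fin (hm.congr heq) ((r^2)^k * |B'|) ?_
    rw [ae_restrict_iff' f.dom_meas]
    filter_upwards [hkey] with x hx hxd
    exact (hx hxd).2
  refine ⟨hinta, ?_⟩
  have hz := div_zero' f.te f.he f.tl (f.cw_LL hr hr1 hk hW) (p := c) (ρ := 2*r) (B := (r^2)^k * |B|)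
    (B' := (r^2)^k * |B'| + 2 * k * ((r^2)^(k-1) * (2 * r1 * |B|)))
    (fun x hx => f.cw_zero hr hk W fun h => hx (ball_subset_closedBall h)) ?_ ?_ ?_
  · have h1 : ∫ x in {x | 0 < t x}, dv (cw t G c r1 r k W) x = ∫ x in dom t c r1, dv (cw t G c r1 r k W) x := by
      refine setIntegral_eq_of_subset_of_forall_diff_eq_zero (measurableSet_lt measurable_const f.tl.continuous.measurable)
        inter_subset_left ?_
      intro x hx
      have hx2 : x ∉ ball c r1 := fun h => hx.2 ⟨hx.1, h⟩
      unfold dv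
      rw [(f.cw_out hr hr1 hk W hx2).fderiv_eq]
      simp
    rw [h1] at hz
    have h2 : ∫ x in dom t c r1, dv (cw t G c r1 r k W) x = ∫ x in dom t c r1, (ph G r x ^ k * dW x - 2 * k * (ph G r x ^ (k-1) * ⟪b x, W x⟫)) := by
      refine setIntegral_congr_ae f.dom_meas ?_
      filter_upwards [hkey] with x hx hxd
      exact (hx hxd).1
    rw [h2, integral_sub hinta (hintb.const_mul _), integral_const_mul] at hz
    linarith
  · intro x hx
    unfold cw
    split_ifs with h
    · rw [norm_smul, norm_pow, Real.norm_eq_abs, abs_of_nonneg (ph_nonneg r x)]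
      exact mul_le_mul (pow_le_pow_left₀ (ph_nonneg r x) (f.ph_le h) _) ((hB x h).trans (le_abs_self _)) (norm_nonneg _) (by positivity)
    · rw [norm_zero]; positivity
  · filter_upwards [hkey] with x hx htx _
    have hr1' := f.r1p
    by_cases hb : x ∈ ball c r1
    · obtain ⟨h1, h2⟩ := hx ⟨htx, hb⟩
      rw [h1]
      refine (abs_sub _ _).trans (add_le_add h2 ?_)
      rw [abs_mul, abs_of_nonneg (by positivity : (0:ℝ) ≤ 2 * k)]
      exact mul_le_mul_of_nonneg_left (hbW x ⟨htx, hb⟩) (by positivity)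
    · unfold dv
      rw [(f.cw_out hr hr1 hk W hb).fderiv_eq]
      simp; positivity
  · intro y hy
    by_cases hb : y ∈ ball c r1
    · have h1 := hf y hb hy
      have hev : ∀ᶠ s : ℝ in 𝓝[>] 0, y + s • e ∈ dom t c r1 := by
        have h2 : ContinuousAt (fun s : ℝ => y + s • e) 0 := by fun_prop
        have h3 : ∀ᶠ s : ℝ in 𝓝 0, y + s • e ∈ ball c r1 := h2.eventually_mem (isOpen_ball.mem_nhds (by simpa using hb))
        filter_upwards [nhdsWithin_le_nhds h3, self_mem_nhdsWithin] with s hs hs0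
        exact ⟨by show 0 < t (y + s • e); rw [f.te, hy, zero_add]; exact hs0, hs⟩
      refine squeeze_zero_norm' (a := fun s => (r^2)^k * |fderiv ℝ t y (W (y + s • e))|) ?_ ?_
      · filter_upwards [hev] with s hs
        rw [cw, if_pos hs, map_smul, smul_eq_mul, norm_mul, norm_pow, Real.norm_eq_abs, Real.norm_eq_abs, abs_of_nonneg (ph_nonneg r _)]
        exact mul_le_mul_of_nonneg_right (pow_le_pow_left₀ (ph_nonneg r _) (f.ph_le hs) _) (abs_nonneg _)
      · have := h1.abs.const_mul ((r^2)^k)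
        simpa using this
    · have h2 : ContinuousAt (fun s : ℝ => y + s • e) 0 := by fun_prop
      have h3 : ∀ᶠ z in 𝓝 ((fun s : ℝ => y + s • e) 0), cw t G c r1 r k W z = 0 := by
        simp only [zero_smul, add_zero]; exact f.cw_out hr hr1 hk W hb
      have h4 := h2.eventually h3
      refine Tendsto.congr' (f₁ := fun _ => (0:ℝ)) ?_ tendsto_const_nhds
      filter_upwards [nhdsWithin_le_nhds h4] with s hs
      rw [hs, map_zero]
end Frq
end NodalNeumann

end

noncomputable section
open MeasureTheory Metric Set Filter Asymptotics
open scoped Topology NNReal ENNReal RealInnerProductSpace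
namespace NodalNeumann
set_option linter.all false
variable {E : Type*} [NormedAddCommGroup E] [InnerProductSpace ℝ E] [FiniteDimensional ℝ E]
variable [MeasurableSpace E] [BorelSpace E]
namespace Frq
variable {t u G μ : E → ℝ} {b β : E → E} {e c : E} {r1 C S : ℝ}

/-- weighted integral -/
def wi (t G : E → ℝ) (c : E) (r1 : ℝ) (k : ℕ) (g : E → ℝ) (r : ℝ) : ℝ := ∫ x in dom t c r1, ph G r x ^ k * g x

lemma wi_int (f : Frq t u G μ b β e c r1 C S) (k : ℕ) {g : E → ℝ} (hg : ∀ x ∈ dom t c r1, ContinuousAt g x) {B : ℝ}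
    (hB : ∀ x ∈ dom t c r1, |g x| ≤ B) (r : ℝ) : IntegrableOn (fun x => ph G r x ^ k * g x) (dom t c r1) := by
  refine f.integrable (B := (r^2)^k * B) (fun x hx => ((f.ph_LL r hx).continuousAt.pow k).mul (hg x hx)) fun x hx => ?_
  rw [abs_mul, abs_pow, abs_of_nonneg (ph_nonneg r x)]
  exact mul_le_mul (pow_le_pow_left₀ (ph_nonneg r x) (f.ph_le hx) _) (hB x hx) (abs_nonneg _) (by positivity)

lemma wi_deriv (f : Frq t u G μ b β e c r1 C S) {k : ℕ} (hk : 2 ≤ k) {g : E → ℝ} (hg : ∀ x ∈ dom t c r1, ContinuousAt g x) {B : ℝ}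
    (hB : ∀ x ∈ dom t c r1, |g x| ≤ B) (r : ℝ) :
    HasDerivAt (wi t G c r1 k g) (2 * k * r * wi t G c r1 (k-1) g r) r := by
  have hB0 : ∀ x ∈ dom t c r1, |g x| ≤ |B| := fun x hx => (hB x hx).trans (le_abs_self _)
  have hder : ∀ x, ∀ s : ℝ, HasDerivAt (fun s => ph G s x ^ k * g x) (2 * k * s * (ph G s x ^ (k-1) * g x)) s := by
    intro x s
    have h1 : HasDerivAt (fun s : ℝ => s^2 - G x) (2 * s) s := by
      simpa using (hasDerivAt_pow 2 s).sub_const (G x)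
    have := ((hasDerivAt_maxpow k hk (s^2 - G x)).comp s h1).mul_const (g x)
    refine this.congr_deriv ?_
    simp [ph]; ring
  have key := hasDerivAt_integral_of_dominated_loc_of_deriv_le (μ := volume.restrict (dom t c r1)) (F := fun s x => ph G s x ^ k * g x)
    (F' := fun s x => 2 * k * s * (ph G s x ^ (k-1) * g x)) (x₀ := r) (s := ball r 1) (bound := fun _ => 2 * k * (|r|+1) * (((|r|+1)^2)^(k-1) * |B|))
    (ball_mem_nhds r one_pos) (Eventually.of_forall fun s => (f.wi_int k hg hB s).aestronglyMeasurable)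
    (f.wi_int k hg hB r) ((f.wi_int (k-1) hg hB r).aestronglyMeasurable.const_mul _) ?_ ?_ ?_
  · refine key.2.congr_deriv ?_
    rw [wi, integral_const_mul]
  · rw [ae_restrict_iff' f.dom_meas]
    refine ae_of_all _ fun x hx s hs => ?_
    have hs' : |s| ≤ |r| + 1 := by
      rw [mem_ball, Real.dist_eq] at hs
      have := abs_sub_abs_le_abs_sub s r; linarith
    have hs2 : s^2 ≤ (|r|+1)^2 := by rw [← sq_abs s]; exact pow_le_pow_left₀ (abs_nonneg _) hs' 2
    rw [Real.norm_eq_abs, abs_mul, abs_mul (2 * (k:ℝ)), abs_mul (ph G s x ^ (k-1)), abs_pow, abs_of_nonneg (ph_nonneg s x), abs_of_nonneg (by positivity : (0:ℝ) ≤ 2 * k)]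
    exact mul_le_mul (by gcongr) (mul_le_mul (pow_le_pow_left₀ (ph_nonneg s x) ((f.ph_le hx).trans hs2) _) (hB0 x hx) (abs_nonneg _) (by positivity)) (by have := ph_nonneg (G := G) s x; positivity) (by positivity)
  · exact integrable_const_iff.2 (Or.inr ⟨by rw [Measure.restrict_apply_univ]; exact dom_fin⟩)
  · exact ae_of_all _ fun x s hs => hder x s

lemma cu (f : Frq t u G μ b β e c r1 C S) {x : E} (hx : x ∈ dom t c r1) : ContinuousAt u x := (f.harm x hx.2 hx.1).LL.continuousAt
lemma cg (f : Frq t u G μ b β e c r1 C S) {x : E} (hx : x ∈ dom t c r1) : ContinuousAt (gr u) x := (f.harm x hx.2 hx.1).LL_gr.continuousAt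
lemma cb (f : Frq t u G μ b β e c r1 C S) {x : E} (hx : x ∈ dom t c r1) : ContinuousAt b x := (f.bL x hx.2 hx.1).continuousAt
lemma cβ (f : Frq t u G μ b β e c r1 C S) {x : E} (hx : x ∈ dom t c r1) : ContinuousAt β x := (f.βL x hx.2 hx.1).continuousAt
lemma cμ (f : Frq t u G μ b β e c r1 C S) {x : E} (hx : x ∈ dom t c r1) : ContinuousAt μ x := (f.μL x hx.2 hx.1).continuousAt
lemma nx (f : Frq t u G μ b β e c r1 C S) {x : E} (hx : x ∈ dom t c r1) : ‖x - c‖ ≤ r1 := by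
  have := hx.2; rw [mem_ball, dist_eq_norm] at this; exact this.le
lemma bup' (f : Frq t u G μ b β e c r1 C S) {x : E} (hx : x ∈ dom t c r1) : ‖b x‖ ≤ 2 * r1 := by
  have := f.bup x hx.2 hx.1; have := f.nx hx; linarith
lemma βup' (f : Frq t u G μ b β e c r1 C S) {x : E} (hx : x ∈ dom t c r1) : ‖β x‖ ≤ 2 * r1 := by
  have := f.βup x hx.2 hx.1; have := f.nx hx; linarith
lemma S0 (f : Frq t u G μ b β e c r1 C S) {x : E} (hx : x ∈ dom t c r1) : 0 ≤ S := (abs_nonneg _).trans (f.uS x hx.2 hx.1)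

lemma ev_dom (f : Frq t u G μ b β e c r1 C S) {y : E} (hb : y ∈ ball c r1) (hy : t y = 0) :
    ∀ᶠ s : ℝ in 𝓝[>] 0, y + s • e ∈ dom t c r1 := by
  have h2 : ContinuousAt (fun s : ℝ => y + s • e) 0 := by fun_prop
  have h3 : ∀ᶠ s : ℝ in 𝓝 0, y + s • e ∈ ball c r1 := h2.eventually_mem (isOpen_ball.mem_nhds (by simpa using hb))
  filter_upwards [nhdsWithin_le_nhds h3, self_mem_nhdsWithin] with s hs hs0
  exact ⟨by show 0 < t (y + s • e); rw [f.te, hy, zero_add]; exact hs0, hs⟩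

lemma flux_mul (f : Frq t u G μ b β e c r1 C S) {y : E} (hb : y ∈ ball c r1) (hy : t y = 0) {W : E → E} {a : E → ℝ} {B : ℝ}
    (ha : ∀ x ∈ dom t c r1, |a x| ≤ B)
    (hW : Tendsto (fun s : ℝ => fderiv ℝ t y (W (y + s • e))) (𝓝[>] (0:ℝ)) (𝓝 0)) :
    Tendsto (fun s : ℝ => fderiv ℝ t y (a (y + s • e) • W (y + s • e))) (𝓝[>] (0:ℝ)) (𝓝 0) := by
  refine squeeze_zero_norm' (a := fun s => B * |fderiv ℝ t y (W (y + s • e))|) ?_ (by simpa using hW.abs.const_mul B)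
  filter_upwards [f.ev_dom hb hy] with s hs
  rw [map_smul, smul_eq_mul, norm_mul, Real.norm_eq_abs, Real.norm_eq_abs]
  exact mul_le_mul_of_nonneg_right (ha _ hs) (abs_nonneg _)

/-- identity (a) -/
lemma idA (f : Frq t u G μ b β e c r1 C S) {r : ℝ} (hr : 0 < r) (hr1 : 4 * r ≤ r1) :
    wi t G c r1 3 (fun x => ‖gr u x‖^2) r = 6 * wi t G c r1 2 (fun x => u x * ⟪b x, gr u x⟫) r := by
  have := (f.stokes hr hr1 (k := 3) (by norm_num) (W := fun x => u x • gr u x) (dW := fun x => ‖gr u x‖^2) (B := S * S) (B' := S^2)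
    (fun x hx => (f.harm x hx.2 hx.1).LL.smul (f.harm x hx.2 hx.1).LL_gr) ?_ ?_ ?_).2
  · rw [wi, this, wi]
    simp only [inner_smul_right]
    norm_num
  · intro x hx
    rw [norm_smul, Real.norm_eq_abs]
    exact mul_le_mul (f.uS x hx.2 hx.1) (f.gS x hx.2 hx.1) (norm_nonneg _) (f.S0 hx)
  · intro x hx _ _
    have hh := f.harm x hx.2 hx.1
    have h1 := hh.hasFDerivAt
    have h2 := hh.gr_hasFDerivAt
    refine ⟨h1.differentiableAt.fun_smul h2.differentiableAt, ?_, ?_⟩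
    · rw [dv_smul h1.differentiableAt h2.differentiableAt, hh.dv_gr, h1.fderiv]
      simp
    · rw [abs_of_nonneg (by positivity)]; exact pow_le_pow_left₀ (norm_nonneg _) (f.gS x hx.2 hx.1) 2
  · intro y hy hty
    exact f.flux_mul hy hty (a := u) (fun x hx => f.uS x hx.2 hx.1) (f.uf y hy hty)

lemma ph_mul_G (r : ℝ) (x : E) : ph G r x * G x = r^2 * ph G r x - ph G r x ^ 2 := by
  unfold ph
  rcases le_total (r^2 - G x) 0 with h | h
  · rw [max_eq_right h]; ring
  · rw [max_eq_left h]; ring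

lemma ph_pos_near (f : Frq t u G μ b β e c r1 C S) {r : ℝ} (hr : 0 < r) {x : E} (hx : x ∈ dom t c r1) (h : 0 < ph G r x) : ‖x - c‖ ≤ 2 * r := by
  by_contra hh
  have := f.ph_zero hr hx (by rw [mem_ball, dist_eq_norm]; linarith)
  linarith

/-- inequality (b) -/
lemma ineqB (f : Frq t u G μ b β e c r1 C S) {r : ℝ} (hr : 0 < r) (hr1 : 4 * r ≤ r1) :
    4 * r^2 * wi t G c r1 1 (fun x => u x ^ 2 * μ x) r ≤
      (Module.finrank ℝ E + 4 + 4 * C * r) * wi t G c r1 2 (fun x => u x ^ 2 * μ x) r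
        + 2 * wi t G c r1 2 (fun x => u x * ⟪b x, gr u x⟫) r := by
  set m : ℝ := ((Module.finrank ℝ E : ℕ) : ℝ) with hm
  have hC := f.C0
  have cH : ∀ x ∈ dom t c r1, ContinuousAt (fun x => u x ^ 2 * μ x) x := fun x hx => ((f.cu hx).pow 2).mul (f.cμ hx)
  have bH : ∀ x ∈ dom t c r1, |u x ^ 2 * μ x| ≤ S^2 * 2 := fun x hx => by
    have h1 := f.μlo x hx.2 hx.1; have h2 := f.μup x hx.2 hx.1
    rw [abs_of_nonneg (by positivity), ← sq_abs]
    exact mul_le_mul (pow_le_pow_left₀ (abs_nonneg _) (f.uS x hx.2 hx.1) 2) h2 (by linarith) (by positivity)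
  have cX : ∀ x ∈ dom t c r1, ContinuousAt (fun x => u x * ⟪b x, gr u x⟫) x := fun x hx =>
    (f.cu hx).mul ((f.cb hx).inner (𝕜 := ℝ) (f.cg hx))
  have bX' : ∀ x ∈ dom t c r1, |⟪b x, gr u x⟫| ≤ 2 * r1 * S := fun x hx =>
    (abs_real_inner_le_norm _ _).trans (mul_le_mul (f.bup' hx) (f.gS x hx.2 hx.1) (norm_nonneg _) (by have := f.r1p; positivity))
  have bX : ∀ x ∈ dom t c r1, |u x * ⟪b x, gr u x⟫| ≤ S * (2 * r1 * S) := fun x hx => by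
    rw [abs_mul]
    exact mul_le_mul (f.uS x hx.2 hx.1) (bX' x hx) (abs_nonneg _) (f.S0 hx)
  have hst := f.stokes hr hr1 (k := 2) le_rfl (W := fun x => u x ^ 2 • b x)
    (dW := fun x => u x ^ 2 * dv b x + 2 * (u x * ⟪b x, gr u x⟫)) (B := S^2 * (2 * r1)) (B' := S^2 * (m * 2 + C * r1) + 2 * (S * (2 * r1 * S)))
    (fun x hx => ((f.harm x hx.2 hx.1).LL.pow 2).smul (f.bL x hx.2 hx.1)) ?_ ?_ ?_
  · obtain ⟨hi, he⟩ := hst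
    have e1 : ∫ x in dom t c r1, ph G r x ^ (2-1) * ⟪b x, u x ^ 2 • b x⟫ =
        r^2 * wi t G c r1 1 (fun x => u x ^ 2 * μ x) r - wi t G c r1 2 (fun x => u x ^ 2 * μ x) r := by
      rw [wi, wi, ← integral_const_mul, ← integral_sub ((f.wi_int 1 cH bH r).const_mul _) (f.wi_int 2 cH bH r)]
      refine setIntegral_congr_fun f.dom_meas fun x hx => ?_
      have h1 := f.Gb x hx.2 hx.1
      have h2 : ⟪b x, b x⟫ = μ x * G x := by
        nth_rewrite 2 [f.bβ x hx.2 hx.1]; rw [inner_smul_right, h1]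
      simp only [inner_smul_right, h2]
      have := ph_mul_G (G := G) r x
      norm_num
      linear_combination (u x ^ 2 * μ x) * this
    have hX := (f.wi_int 2 cX bX r)
    have e2 : ∫ x in dom t c r1, ph G r x ^ 2 * (u x ^ 2 * dv b x + 2 * (u x * ⟪b x, gr u x⟫)) ≤
        (m + 4 * C * r) * wi t G c r1 2 (fun x => u x ^ 2 * μ x) r
        + 2 * wi t G c r1 2 (fun x => u x * ⟪b x, gr u x⟫) r := by
      rw [wi, wi, ← integral_const_mul, ← integral_const_mul, ← integral_add ((f.wi_int 2 cH bH r).const_mul _) (hX.const_mul _)]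
      refine setIntegral_mono_on_ae hi (((f.wi_int 2 cH bH r).const_mul _).add (hX.const_mul _)) f.dom_meas ?_
      have hae1 := f.ae_diff hr hr1 (W := b) fun x hx => f.bL x hx.2 hx.1
      filter_upwards [hae1] with x h1 hx
      rcases (ph_nonneg r x : 0 ≤ ph G r x).eq_or_lt with h0 | h0
      · rw [← h0]; simp
      · have h2 := (abs_le.1 (f.Db x hx.2 hx.1 (h1 hx h0))).2
        have h3 := f.ph_pos_near hr hx h0
        have h4 := f.μlo x hx.2 hx.1
        have h5 : dv b x ≤ (m + 4 * C * r) * μ x := by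
          have : C * ‖x - c‖ ≤ C * (2 * r) := mul_le_mul_of_nonneg_left h3 hC
          have : C * r * (1/2) ≤ C * r * μ x := mul_le_mul_of_nonneg_left h4 (by positivity)
          nlinarith
        have := mul_le_mul_of_nonneg_left h5 (by positivity : 0 ≤ ph G r x ^ 2 * u x ^ 2)
        show ph G r x ^ 2 * (u x ^ 2 * dv b x + 2 * (u x * ⟪b x, gr u x⟫)) ≤
          (m + 4 * C * r) * (ph G r x ^ 2 * (u x ^ 2 * μ x)) + 2 * (ph G r x ^ 2 * (u x * ⟪b x, gr u x⟫))
        linarith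
    rw [e1] at he
    rw [he] at e2
    norm_num at e2
    linarith
  · intro x hx
    rw [norm_smul, norm_pow, Real.norm_eq_abs]
    exact mul_le_mul (pow_le_pow_left₀ (abs_nonneg _) (f.uS x hx.2 hx.1) 2) (f.bup' hx) (norm_nonneg _) (by positivity)
  · intro x hx hb _
    have hh := f.harm x hx.2 hx.1
    have h1 := hh.hasFDerivAt
    refine ⟨(h1.differentiableAt.fun_pow 2).fun_smul hb, ?_, ?_⟩
    · rw [dv_smul (h1.differentiableAt.fun_pow 2) hb, show fderiv ℝ (fun y => u y ^ 2) x = (2 * u x) • innerSL ℝ (gr u x) from by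
        simpa using (h1.pow 2).fderiv]
      simp [real_inner_comm]; ring
    · refine (abs_add_le _ _).trans (add_le_add ?_ ?_)
      · rw [abs_mul, abs_pow]
        refine mul_le_mul (pow_le_pow_left₀ (abs_nonneg _) (f.uS x hx.2 hx.1) 2) ?_ (abs_nonneg _) (by positivity)
        have h2 := f.Db x hx.2 hx.1 hb
        have h3 := abs_sub_abs_le_abs_sub (dv b x) (m * μ x)
        have h4 := f.μlo x hx.2 hx.1; have h5 := f.μup x hx.2 hx.1
        have h6 : |m * μ x| ≤ m * 2 := by
          rw [abs_of_nonneg (by positivity)]; gcongr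
        have : C * ‖x - c‖ ≤ C * r1 := mul_le_mul_of_nonneg_left (f.nx hx) hC
        linarith
      · rw [abs_mul, abs_two]; linarith [bX x hx]
  · intro y hy hty
    exact f.flux_mul hy hty (a := fun x => u x ^ 2) (B := S^2) (fun x hx => by
      rw [abs_pow]; exact pow_le_pow_left₀ (abs_nonneg _) (f.uS x hx.2 hx.1) 2) (f.bf y hy hty)

/-- inequality (c) -/
lemma ineqC (f : Frq t u G μ b β e c r1 C S) {r : ℝ} (hr : 0 < r) (hr1 : 4 * r ≤ r1) :
    (Module.finrank ℝ E + 4 - 6 * C * r) * wi t G c r1 3 (fun x => ‖gr u x‖^2) r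
      + 12 * wi t G c r1 2 (fun x => μ x * ⟪β x, gr u x⟫^2) r ≤
     6 * r^2 * wi t G c r1 2 (fun x => ‖gr u x‖^2) r := by
  set m : ℝ := ((Module.finrank ℝ E : ℕ) : ℝ) with hm
  have hC := f.C0
  have hr1p := f.r1p
  have cI : ∀ x ∈ dom t c r1, ContinuousAt (fun x => ‖gr u x‖^2) x := fun x hx => (f.cg hx).norm.pow 2
  have bI : ∀ x ∈ dom t c r1, |‖gr u x‖^2| ≤ S^2 := fun x hx => by
    rw [abs_of_nonneg (by positivity)]; exact pow_le_pow_left₀ (norm_nonneg _) (f.gS x hx.2 hx.1) 2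
  have bβg : ∀ x ∈ dom t c r1, |⟪β x, gr u x⟫| ≤ 2 * r1 * S := fun x hx =>
    (abs_real_inner_le_norm _ _).trans (mul_le_mul (f.βup' hx) (f.gS x hx.2 hx.1) (norm_nonneg _) (by positivity))
  have cD : ∀ x ∈ dom t c r1, ContinuousAt (fun x => μ x * ⟪β x, gr u x⟫^2) x := fun x hx =>
    (f.cμ hx).mul (((f.cβ hx).inner (𝕜 := ℝ) (f.cg hx)).pow 2)
  have bD : ∀ x ∈ dom t c r1, |μ x * ⟪β x, gr u x⟫^2| ≤ 2 * (2 * r1 * S)^2 := fun x hx => by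
    rw [abs_mul, abs_pow]
    have h4 := f.μlo x hx.2 hx.1; have h5 := f.μup x hx.2 hx.1
    rw [abs_of_nonneg (by linarith : 0 ≤ μ x)]
    exact mul_le_mul h5 (pow_le_pow_left₀ (abs_nonneg _) (bβg x hx) 2) (by positivity) (by norm_num)
  have hst := f.stokes hr hr1 (k := 3) (by norm_num) (W := fun x => ‖gr u x‖^2 • β x - (2 * ⟪β x, gr u x⟫) • gr u x)
    (dW := fun x => ‖gr u x‖^2 * dv β x - 2 * ⟪fderiv ℝ β x (gr u x), gr u x⟫) (B := S^2 * (2*r1) + 2 * (2 * r1 * S) * S)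
    (B' := S^2 * (m + C * r1) + 2 * ((1 + C * r1) * S^2))
    (fun x hx => (((f.harm x hx.2 hx.1).LL_gr.inner (f.harm x hx.2 hx.1).LL_gr).congr
       (Eventually.of_forall fun y => by simp)).smul (f.βL x hx.2 hx.1) |>.sub
       (((LL.const 2).mul ((f.βL x hx.2 hx.1).inner (f.harm x hx.2 hx.1).LL_gr)).smul (f.harm x hx.2 hx.1).LL_gr)) ?_ ?_ ?_
  · obtain ⟨hi, he⟩ := hst
    have e1 : ∫ x in dom t c r1, ph G r x ^ (3-1) * ⟪b x, ‖gr u x‖^2 • β x - (2 * ⟪β x, gr u x⟫) • gr u x⟫ =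
        r^2 * wi t G c r1 2 (fun x => ‖gr u x‖^2) r - wi t G c r1 3 (fun x => ‖gr u x‖^2) r - 2 * wi t G c r1 2 (fun x => μ x * ⟪β x, gr u x⟫^2) r := by
      have i1 : IntegrableOn (fun x => r^2 * (ph G r x ^ 2 * ‖gr u x‖^2) - ph G r x ^ 3 * ‖gr u x‖^2) (dom t c r1) :=
        ((f.wi_int 2 cI bI r).const_mul _).sub (f.wi_int 3 cI bI r)
      rw [wi, wi, wi, ← integral_const_mul, ← integral_const_mul, ← integral_sub ((f.wi_int 2 cI bI r).const_mul _) (f.wi_int 3 cI bI r),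
        ← integral_sub i1 ((f.wi_int 2 cD bD r).const_mul _)]
      refine setIntegral_congr_fun f.dom_meas fun x hx => ?_
      have h1 := f.Gb x hx.2 hx.1
      have h2 : ⟪b x, gr u x⟫ = μ x * ⟪β x, gr u x⟫ := by
        rw [f.bβ x hx.2 hx.1, real_inner_smul_left]
      simp only [inner_sub_right, inner_smul_right, h2, h1]
      have := ph_mul_G (G := G) r x
      norm_num
      linear_combination (ph G r x * ‖gr u x‖ ^ 2) * this
    have e2 : (m - 2 - 6 * C * r) * wi t G c r1 3 (fun x => ‖gr u x‖^2) r ≤ 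
       ∫ x in dom t c r1, ph G r x ^ 3 * (‖gr u x‖^2 * dv β x - 2 * ⟪fderiv ℝ β x (gr u x), gr u x⟫) := by
      rw [wi, ← integral_const_mul]
      refine setIntegral_mono_on_ae ((f.wi_int 3 cI bI r).const_mul _) hi f.dom_meas ?_
      have hae1 := f.ae_diff hr hr1 (W := β) fun x hx => f.βL x hx.2 hx.1
      filter_upwards [hae1] with x h1 hx
      rcases (ph_nonneg r x : 0 ≤ ph G r x).eq_or_lt with h0 | h0
      · rw [← h0]; simp
      · have h2 := (abs_le.1 (f.Dβ x hx.2 hx.1 (h1 hx h0))).1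
        have h2' := (abs_le.1 (f.Dβ2 x hx.2 hx.1 (h1 hx h0) (gr u x))).2
        have h3 := f.ph_pos_near hr hx h0
        have h4 : C * ‖x - c‖ ≤ C * (2 * r) := mul_le_mul_of_nonneg_left h3 hC
        have h5 : (m - 2 - 6 * C * r) * ‖gr u x‖^2 ≤ ‖gr u x‖^2 * dv β x - 2 * ⟪fderiv ℝ β x (gr u x), gr u x⟫ := by
          have h6 : 0 ≤ ‖gr u x‖^2 := by positivity
          have := mul_le_mul_of_nonneg_right h4 h6
          have := mul_le_mul_of_nonneg_left h2 h6
          nlinarith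
        have := mul_le_mul_of_nonneg_left h5 (by positivity : 0 ≤ ph G r x ^ 3)
        show (m - 2 - 6 * C * r) * (ph G r x ^ 3 * ‖gr u x‖^2) ≤ _
        linarith
    rw [e1] at he
    rw [he] at e2
    norm_num at e2
    linarith
  · intro x hx
    have hS := f.S0 hx
    refine (norm_sub_le _ _).trans (add_le_add ?_ ?_)
    · rw [norm_smul, norm_pow, norm_norm]
      exact mul_le_mul (pow_le_pow_left₀ (norm_nonneg _) (f.gS x hx.2 hx.1) 2) (f.βup' hx) (norm_nonneg _) (by positivity)
    · rw [norm_smul, Real.norm_eq_abs, abs_mul, abs_two]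
      exact mul_le_mul (by linarith [bβg x hx]) (f.gS x hx.2 hx.1) (norm_nonneg _) (by positivity)
  · intro x hx _ hβ
    have hS := f.S0 hx
    have hh := f.harm x hx.2 hx.1
    have h2 := hh.gr_hasFDerivAt
    have h3 : HasFDerivAt (fun y => ‖gr u y‖^2) _ x := (h2.inner ℝ h2).congr_of_eventuallyEq (Eventually.of_forall fun y => by simp)
    have h4 := (hβ.hasFDerivAt.inner ℝ h2).const_mul 2
    refine ⟨(h3.differentiableAt.fun_smul hβ).fun_sub (h4.differentiableAt.fun_smul h2.differentiableAt), ?_, ?_⟩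
    · have e1 : dv (fun x => ‖gr u x‖^2 • β x - (2 * ⟪β x, gr u x⟫) • gr u x) x =
         dv (fun x => ‖gr u x‖^2 • β x) x - dv (fun x => (2 * ⟪β x, gr u x⟫) • gr u x) x := by
        unfold dv
        rw [fderiv_fun_sub (h3.differentiableAt.fun_smul hβ) (h4.differentiableAt.fun_smul h2.differentiableAt)]
        simp [inner_sub_left]
      rw [e1, dv_smul h3.differentiableAt hβ, dv_smul h4.differentiableAt h2.differentiableAt, hh.dv_gr, h3.fderiv, h4.fderiv]
      have hs := hh.gr_symm (β x) (gr u x)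
      rw [h2.fderiv] at hs
      simp [fderivInnerCLM_apply]
      simp [real_inner_comm] at hs ⊢
      linarith
    · refine (abs_sub _ _).trans (add_le_add ?_ ?_)
      · rw [abs_mul]
        have h6 := f.Dβ x hx.2 hx.1 hβ
        have h7 := abs_sub_abs_le_abs_sub (dv β x) m
        rw [abs_of_nonneg (by positivity : 0 ≤ m)] at h7
        have : C * ‖x - c‖ ≤ C * r1 := mul_le_mul_of_nonneg_left (f.nx hx) hC
        exact mul_le_mul (bI x hx) (by linarith) (abs_nonneg _) (by positivity)
      · rw [abs_mul, abs_two]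
        have h6 := f.Dβ2 x hx.2 hx.1 hβ (gr u x)
        have h7 := abs_sub_abs_le_abs_sub ⟪fderiv ℝ β x (gr u x), gr u x⟫ (‖gr u x‖^2)
        have h8 := bI x hx
        have : C * ‖x - c‖ * ‖gr u x‖^2 ≤ C * r1 * S^2 := by
          have := f.nx hx
          rw [abs_of_nonneg (by positivity)] at h8
          gcongr
        linarith
  · intro y hy hty
    have h1 := f.flux_mul hy hty (a := fun x => (2 * ⟪β x, gr u x⟫)) (B := 2 * (2 * r1 * S)) (fun x hx => by
      rw [abs_mul, abs_two]; linarith [bβg x hx]) (f.uf y hy hty)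
    have h2 := f.flux_mul hy hty (a := fun x => ‖gr u x‖^2 * (μ x)⁻¹) (B := S^2 * 2) (fun x hx => by
      rw [abs_mul]
      have h4 := f.μlo x hx.2 hx.1
      refine mul_le_mul (bI x hx) ?_ (abs_nonneg _) (by positivity)
      rw [abs_of_nonneg (by positivity)]
      rw [inv_le_comm₀ (by linarith) (by norm_num)]; linarith) (f.bf y hy hty)
    have h3 := h2.sub h1
    rw [sub_zero] at h3
    refine h3.congr' ?_
    filter_upwards [f.ev_dom hy hty] with s hs
    have h4 := f.μlo _ hs.2 hs.1
    rw [← map_sub]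
    congr 2
    nth_rewrite 1 [f.bβ _ hs.2 hs.1]
    rw [smul_smul, mul_assoc, inv_mul_cancel₀ (by linarith), mul_one]

/-- Cauchy-Schwarz -/
lemma ineqD (f : Frq t u G μ b β e c r1 C S) (r : ℝ) :
    (wi t G c r1 2 (fun x => u x * ⟪b x, gr u x⟫) r)^2 ≤
      wi t G c r1 2 (fun x => u x ^ 2 * μ x) r * wi t G c r1 2 (fun x => μ x * ⟪β x, gr u x⟫^2) r := by
  have hr1p := f.r1p
  have cH : ∀ x ∈ dom t c r1, ContinuousAt (fun x => u x ^ 2 * μ x) x := fun x hx => ((f.cu hx).pow 2).mul (f.cμ hx)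
  have bH : ∀ x ∈ dom t c r1, |u x ^ 2 * μ x| ≤ S^2 * 2 := fun x hx => by
    have h1 := f.μlo x hx.2 hx.1; have h2 := f.μup x hx.2 hx.1
    rw [abs_of_nonneg (by positivity), ← sq_abs]
    exact mul_le_mul (pow_le_pow_left₀ (abs_nonneg _) (f.uS x hx.2 hx.1) 2) h2 (by linarith) (by positivity)
  have cX : ∀ x ∈ dom t c r1, ContinuousAt (fun x => u x * ⟪b x, gr u x⟫) x := fun x hx =>
    (f.cu hx).mul ((f.cb hx).inner (𝕜 := ℝ) (f.cg hx))
  have bX : ∀ x ∈ dom t c r1, |u x * ⟪b x, gr u x⟫| ≤ S * (2 * r1 * S) := fun x hx => by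
    have hS := f.S0 hx
    rw [abs_mul]
    exact mul_le_mul (f.uS x hx.2 hx.1) ((abs_real_inner_le_norm _ _).trans (mul_le_mul (f.bup' hx) (f.gS x hx.2 hx.1) (norm_nonneg _) (by positivity))) (abs_nonneg _) hS
  have bβg : ∀ x ∈ dom t c r1, |⟪β x, gr u x⟫| ≤ 2 * r1 * S := fun x hx =>
    (abs_real_inner_le_norm _ _).trans (mul_le_mul (f.βup' hx) (f.gS x hx.2 hx.1) (norm_nonneg _) (by positivity))
  have cD : ∀ x ∈ dom t c r1, ContinuousAt (fun x => μ x * ⟪β x, gr u x⟫^2) x := fun x hx =>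
    (f.cμ hx).mul (((f.cβ hx).inner (𝕜 := ℝ) (f.cg hx)).pow 2)
  have bD : ∀ x ∈ dom t c r1, |μ x * ⟪β x, gr u x⟫^2| ≤ 2 * (2 * r1 * S)^2 := fun x hx => by
    rw [abs_mul, abs_pow]
    have h4 := f.μlo x hx.2 hx.1; have h5 := f.μup x hx.2 hx.1
    rw [abs_of_nonneg (by linarith : 0 ≤ μ x)]
    exact mul_le_mul h5 (pow_le_pow_left₀ (abs_nonneg _) (bβg x hx) 2) (by positivity) (by norm_num)
  set H := wi t G c r1 2 (fun x => u x ^ 2 * μ x) r with hH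
  set X := wi t G c r1 2 (fun x => u x * ⟪b x, gr u x⟫) r with hX
  set D := wi t G c r1 2 (fun x => μ x * ⟪β x, gr u x⟫^2) r with hD
  have key : ∀ z : ℝ, 0 ≤ H * (z * z) + (2 * X) * z + D := by
    intro z
    have : H * (z * z) + (2 * X) * z + D = ∫ x in dom t c r1, ph G r x ^ 2 * (μ x * (z * u x + ⟪β x, gr u x⟫)^2) := by
      have i1 : IntegrableOn (fun x => ph G r x ^ 2 * (u x ^ 2 * μ x) * (z * z) + 2 * (ph G r x ^ 2 * (u x * ⟪b x, gr u x⟫)) * z) (dom t c r1) :=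
        ((f.wi_int 2 cH bH r).mul_const _).add (((f.wi_int 2 cX bX r).const_mul _).mul_const _)
      rw [hH, hX, hD, wi, wi, wi, ← integral_const_mul, ← integral_mul_const, ← integral_mul_const,
        ← integral_add ((f.wi_int 2 cH bH r).mul_const _) (((f.wi_int 2 cX bX r).const_mul _).mul_const _),
        ← integral_add i1 (f.wi_int 2 cD bD r)]
      refine setIntegral_congr_fun f.dom_meas fun x hx => ?_
      have h2 : ⟪b x, gr u x⟫ = μ x * ⟪β x, gr u x⟫ := by
        rw [f.bβ x hx.2 hx.1, real_inner_smul_left]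
      simp only [h2]; ring
    rw [this]
    refine setIntegral_nonneg f.dom_meas fun x hx => ?_
    have h4 := f.μlo x hx.2 hx.1
    positivity
  have := discrim_le_zero key
  unfold discrim at this
  nlinarith

/-- the doubling inequality from the frequency function -/
theorem main (f : Frq t u G μ b β e c r1 C S) {r0 K : ℝ} (hr0 : 0 < r0) (hr1 : 4 * r0 ≤ r1)
    (hp : 0 < wi t G c r1 2 (fun x => u x ^ 2 * μ x) r0)
    (hK : Module.finrank ℝ E + 4 + 5 * C * r0 + Real.exp (2 * (5 * C) * r0) * (wi t G c r1 3 (fun x => ‖gr u x‖^2) r0 / wi t G c r1 2 (fun x => u x ^ 2 * μ x) r0) / 3 ≤ K) :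
    ∀ r ∈ Ioc 0 r0, 0 < wi t G c r1 2 (fun x => u x ^ 2 * μ x) r ∧ ∀ r' ∈ Icc r r0,
      wi t G c r1 2 (fun x => u x ^ 2 * μ x) r' ≤ (r' / r) ^ K * wi t G c r1 2 (fun x => u x ^ 2 * μ x) r := by
  have hC := f.C0
  have cH : ∀ x ∈ dom t c r1, ContinuousAt (fun x => u x ^ 2 * μ x) x := fun x hx => ((f.cu hx).pow 2).mul (f.cμ hx)
  have bH : ∀ x ∈ dom t c r1, |u x ^ 2 * μ x| ≤ S^2 * 2 := fun x hx => by
    have h1 := f.μlo x hx.2 hx.1; have h2 := f.μup x hx.2 hx.1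
    rw [abs_of_nonneg (by positivity), ← sq_abs]
    exact mul_le_mul (pow_le_pow_left₀ (abs_nonneg _) (f.uS x hx.2 hx.1) 2) h2 (by linarith) (by positivity)
  have cI : ∀ x ∈ dom t c r1, ContinuousAt (fun x => ‖gr u x‖^2) x := fun x hx => (f.cg hx).norm.pow 2
  have bI : ∀ x ∈ dom t c r1, |‖gr u x‖^2| ≤ S^2 := fun x hx => by
    rw [abs_of_nonneg (by positivity)]; exact pow_le_pow_left₀ (norm_nonneg _) (f.gS x hx.2 hx.1) 2
  have posH : ∀ k r, 0 ≤ wi t G c r1 k (fun x => u x ^ 2 * μ x) r := fun k r =>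
    setIntegral_nonneg f.dom_meas fun x hx => by
      have h4 := f.μlo x hx.2 hx.1
      exact mul_nonneg (pow_nonneg (ph_nonneg r x) _) (by positivity)
  have posI : ∀ k r, 0 ≤ wi t G c r1 k (fun x => ‖gr u x‖^2) r := fun k r =>
    setIntegral_nonneg f.dom_meas fun x hx => mul_nonneg (pow_nonneg (ph_nonneg r x) _) (by positivity)
  refine ode_freq (H := wi t G c r1 2 (fun x => u x ^ 2 * μ x)) (I := wi t G c r1 3 (fun x => ‖gr u x‖^2))
    (H' := fun r => 4 * r * wi t G c r1 1 (fun x => u x ^ 2 * μ x) r) (I' := fun r => 6 * r * wi t G c r1 2 (fun x => ‖gr u x‖^2) r)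
    (C := 5 * C) (m := Module.finrank ℝ E) hr0 (by positivity) (by positivity) ?_ ?_ ?_ ?_ ?_ ?_ ?_ hp hK
  · intro r hr
    refine (f.wi_deriv (k := 2) le_rfl cH bH r).congr_deriv ?_
    norm_num
  · intro r hr
    refine (f.wi_deriv (k := 3) (by norm_num) cI bI r).congr_deriv ?_
    norm_num
  · intro r hr; exact posH 2 r
  · intro r hr; exact posI 3 r
  · intro r hr; exact mul_nonneg (by linarith [hr.1]) (posH 1 r)
  · intro r hr
    have h1 := f.ineqB hr.1 (by linarith [hr.2])
    have h2 := f.idA hr.1 (by linarith [hr.2])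
    have := posH 2 r
    have : 0 ≤ C * r * wi t G c r1 2 (fun x => u x ^ 2 * μ x) r := by have := hr.1; positivity
    nlinarith
  · intro r hr
    have h1 := f.ineqB hr.1 (by linarith [hr.2])
    have h2 := f.idA hr.1 (by linarith [hr.2])
    have h3 := f.ineqC hr.1 (by linarith [hr.2])
    have h4 := f.ineqD r
    have pH := posH 2 r
    have pI := posI 3 r
    set H := wi t G c r1 2 (fun x => u x ^ 2 * μ x) r
    set I := wi t G c r1 3 (fun x => ‖gr u x‖^2) r
    set J := wi t G c r1 2 (fun x => ‖gr u x‖^2) r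
    set K := wi t G c r1 1 (fun x => u x ^ 2 * μ x) r
    set X := wi t G c r1 2 (fun x => u x * ⟪b x, gr u x⟫) r
    set D := wi t G c r1 2 (fun x => μ x * ⟪β x, gr u x⟫^2) r
    have k1 := mul_le_mul_of_nonneg_right h3 pH
    have k2 := mul_le_mul_of_nonneg_right h1 pI
    have hX : X = I / 6 := by linarith
    rw [hX] at k2 h4
    nlinarith

end Frq
end NodalNeumann

end

noncomputable section
open MeasureTheory Metric Set Filter Asymptotics
open scoped Topology NNReal ENNReal RealInnerProductSpace
namespace NodalNeumann
set_option linter.all false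
variable {E : Type*} [NormedAddCommGroup E] [InnerProductSpace ℝ E] [FiniteDimensional ℝ E]

section lc
variable {F F' : Type*} [NormedAddCommGroup F] [NormedSpace ℝ F] [NormedAddCommGroup F'] [NormedSpace ℝ F']

/-- infinitesimal Lipschitz constant -/
def Lc (L : ℝ) (f : E → F) (x : E) : Prop :=
  ∀ ε > 0, ∃ s ∈ 𝓝 x, ∀ y ∈ s, ∀ z ∈ s, ‖f y - f z‖ ≤ (L + ε) * ‖y - z‖

lemma Lc.mono {L L' : ℝ} {f : E → F} {x : E} (h : Lc L f x) (hL : L ≤ L') : Lc L' f x := fun ε hε => by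
  obtain ⟨s, hs, H⟩ := h ε hε
  exact ⟨s, hs, fun y hy z hz => (H y hy z hz).trans (by gcongr)⟩

lemma Lc.congr {L : ℝ} {f g : E → F} {x : E} (h : Lc L f x) (hg : g =ᶠ[𝓝 x] f) : Lc L g x := fun ε hε => by
  obtain ⟨s, hs, H⟩ := h ε hε
  refine ⟨s ∩ {y | g y = f y}, inter_mem hs hg, fun y hy z hz => ?_⟩
  rw [show g y = f y from hy.2, show g z = f z from hz.2]; exact H y hy.1 z hz.1

lemma Lc.of_lip {L : ℝ} {f : E → F} {x : E} {s : Set E} (hs : s ∈ 𝓝 x) (h : ∀ y ∈ s, ∀ z ∈ s, ‖f y - f z‖ ≤ L * ‖y - z‖) : Lc L f x :=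
  fun ε hε => ⟨s, hs, fun y hy z hz => (h y hy z hz).trans (by gcongr; linarith)⟩

lemma Lc.LL {L : ℝ} {f : E → F} {x : E} (h : Lc L f x) : LL f x := by
  obtain ⟨s, hs, H⟩ := h 1 one_pos
  refine ⟨Real.toNNReal (L + 1), s, hs, LipschitzOnWith.of_dist_le_mul fun y hy z hz => ?_⟩
  rw [dist_eq_norm, dist_eq_norm]
  refine (H y hy z hz).trans ?_
  gcongr; exact Real.le_coe_toNNReal _

lemma Lc.cont {L : ℝ} {f : E → F} {x : E} (h : Lc L f x) : ContinuousAt f x := h.LL.continuousAt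

lemma Lc.const (a : F) (x : E) : Lc 0 (fun _ : E => a) x :=
  Lc.of_lip univ_mem fun y _ z _ => by simp
lemma Lc.id (x : E) : Lc 1 (fun y : E => y) x := Lc.of_lip univ_mem fun y _ z _ => by simp

lemma Lc.add {L L' : ℝ} {f g : E → F} {x : E} (h : Lc L f x) (h' : Lc L' g x) : Lc (L + L') (fun y => f y + g y) x := fun ε hε => by
  obtain ⟨s, hs, H⟩ := h (ε/2) (by positivity)
  obtain ⟨s', hs', H'⟩ := h' (ε/2) (by positivity)
  refine ⟨s ∩ s', inter_mem hs hs', fun y hy z hz => ?_⟩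
  have h1 := H y hy.1 z hz.1; have h2 := H' y hy.2 z hz.2
  have : f y + g y - (f z + g z) = (f y - f z) + (g y - g z) := by abel
  rw [this]
  refine (norm_add_le _ _).trans ?_
  linarith

lemma Lc.neg {L : ℝ} {f : E → F} {x : E} (h : Lc L f x) : Lc L (fun y => - f y) x := fun ε hε => by
  obtain ⟨s, hs, H⟩ := h ε hε
  refine ⟨s, hs, fun y hy z hz => ?_⟩
  have : - f y - - f z = -(f y - f z) := by abel
  rw [this, norm_neg]; exact H y hy z hz

lemma Lc.sub {L L' : ℝ} {f g : E → F} {x : E} (h : Lc L f x) (h' : Lc L' g x) : Lc (L + L') (fun y => f y - g y) x := by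
  simpa [sub_eq_add_neg] using h.add h'.neg

lemma Lc.sum {ι : Type*} (s : Finset ι) {L : ι → ℝ} {f : ι → E → F} {x : E} (h : ∀ i ∈ s, Lc (L i) (f i) x) :
    Lc (∑ i ∈ s, L i) (fun y => ∑ i ∈ s, f i y) x := by
  classical
  induction s using Finset.induction_on with
  | empty => simpa using Lc.const (0:F) x
  | insert a s ha ih =>
    simp only [Finset.sum_insert ha]
    exact (h a (Finset.mem_insert_self _ _)).add (ih fun i hi => h i (Finset.mem_insert_of_mem hi))

/-- bilinear products -/
lemma Lc.bil {F₁ F₂ : Type*} [NormedAddCommGroup F₁] [NormedSpace ℝ F₁] [NormedAddCommGroup F₂] [NormedSpace ℝ F₂]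
    (B : F₁ → F₂ → F) (hB1 : ∀ a a' b, B (a - a') b = B a b - B a' b) (hB2 : ∀ a b b', B a (b - b') = B a b - B a b')
    (hB : ∀ a b, ‖B a b‖ ≤ ‖a‖ * ‖b‖)
    {L L' : ℝ} {f : E → F₁} {g : E → F₂} {x : E} (h : Lc L f x) (h' : Lc L' g x) (hL : 0 ≤ L) (hL' : 0 ≤ L') :
    Lc (‖f x‖ * L' + L * ‖g x‖) (fun y => B (f y) (g y)) x := fun ε hε => by
  obtain ⟨δ, hδ, hδ2⟩ : ∃ δ > 0, (‖f x‖ + δ) * (L' + δ) + (L + δ) * (‖g x‖ + δ) ≤ ‖f x‖ * L' + L * ‖g x‖ + ε := by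
    have hc : ContinuousAt (fun δ : ℝ => (‖f x‖ + δ) * (L' + δ) + (L + δ) * (‖g x‖ + δ)) 0 := by fun_prop
    have : ∀ᶠ δ : ℝ in 𝓝 0, (‖f x‖ + δ) * (L' + δ) + (L + δ) * (‖g x‖ + δ) < ‖f x‖ * L' + L * ‖g x‖ + ε :=
      hc.eventually_lt_const (by simp; linarith)
    obtain ⟨δ, h1, h2⟩ := ((Eventually.filter_mono (nhdsWithin_le_nhds (s := Ioi 0)) this).and self_mem_nhdsWithin).exists
    exact ⟨δ, h2, h1.le⟩
  obtain ⟨s, hs, H⟩ := h δ hδ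
  obtain ⟨s', hs', H'⟩ := h' δ hδ
  have c1 : ∀ᶠ y in 𝓝 x, ‖f y‖ < ‖f x‖ + δ := h.cont.norm.eventually_lt_const (by linarith)
  have c2 : ∀ᶠ y in 𝓝 x, ‖g y‖ < ‖g x‖ + δ := h'.cont.norm.eventually_lt_const (by linarith)
  refine ⟨(s ∩ s') ∩ ({y | ‖f y‖ < ‖f x‖ + δ} ∩ {y | ‖g y‖ < ‖g x‖ + δ}), inter_mem (inter_mem hs hs') (inter_mem c1 c2), fun y hy z hz => ?_⟩
  have h1 := H y hy.1.1 z hz.1.1; have h2 := H' y hy.1.2 z hz.1.2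
  have e : B (f y) (g y) - B (f z) (g z) = B (f y) (g y - g z) + B (f y - f z) (g z) := by
    rw [hB1, hB2]; abel
  rw [e]
  have k1 : ‖B (f y) (g y - g z)‖ ≤ (‖f x‖ + δ) * ((L' + δ) * ‖y - z‖) :=
    (hB _ _).trans (mul_le_mul (le_of_lt hy.2.1) h2 (norm_nonneg _) (by positivity))
  have k2 : ‖B (f y - f z) (g z)‖ ≤ ((L + δ) * ‖y - z‖) * (‖g x‖ + δ) :=
    (hB _ _).trans (mul_le_mul h1 (le_of_lt hz.2.2) (norm_nonneg _) (by positivity))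
  refine (norm_add_le _ _).trans ((add_le_add k1 k2).trans ?_)
  nlinarith [mul_le_mul_of_nonneg_right hδ2 (norm_nonneg (y - z))]

lemma Lc.smul {L L' : ℝ} {f : E → ℝ} {g : E → F} {x : E} (h : Lc L f x) (h' : Lc L' g x) (hL : 0 ≤ L) (hL' : 0 ≤ L') :
    Lc (|f x| * L' + L * ‖g x‖) (fun y => f y • g y) x :=
  Lc.bil (fun a b => a • b) (fun a a' b => sub_smul _ _ _) (fun a b b' => smul_sub _ _ _) (fun a b => (norm_smul _ _).le) h h' hL hL'

lemma Lc.mul {L L' : ℝ} {f g : E → ℝ} {x : E} (h : Lc L f x) (h' : Lc L' g x) (hL : 0 ≤ L) (hL' : 0 ≤ L') :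
    Lc (|f x| * L' + L * |g x|) (fun y => f y * g y) x := Lc.smul h h' hL hL'

lemma Lc.inner {L L' : ℝ} {f g : E → E} {x : E} (h : Lc L f x) (h' : Lc L' g x) (hL : 0 ≤ L) (hL' : 0 ≤ L') :
    Lc (‖f x‖ * L' + L * ‖g x‖) (fun y => ⟪f y, g y⟫) x :=
  Lc.bil (fun a b => ⟪a, b⟫) (fun a a' b => inner_sub_left _ _ _) (fun a b b' => inner_sub_right _ _ _) (fun a b => norm_inner_le_norm _ _) h h' hL hL'

lemma Lc.comp {L L' : ℝ} {f : E → F} {g : E → E} {x : E} (h : Lc L f (g x)) (h' : Lc L' g x) (hL : 0 ≤ L) (hL' : 0 ≤ L') :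
    Lc (L * L') (fun y => f (g y)) x := fun ε hε => by
  obtain ⟨δ, hδ, hδ2⟩ : ∃ δ > 0, (L + δ) * (L' + δ) ≤ L * L' + ε := by
    have hc : ContinuousAt (fun δ : ℝ => (L + δ) * (L' + δ)) 0 := by fun_prop
    have : ∀ᶠ δ : ℝ in 𝓝 0, (L + δ) * (L' + δ) < L * L' + ε := hc.eventually_lt_const (by simp; linarith)
    obtain ⟨δ, h1, h2⟩ := ((Eventually.filter_mono (nhdsWithin_le_nhds (s := Ioi 0)) this).and self_mem_nhdsWithin).exists
    exact ⟨δ, h2, h1.le⟩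
  obtain ⟨s, hs, H⟩ := h δ hδ
  obtain ⟨s', hs', H'⟩ := h' δ hδ
  refine ⟨s' ∩ g ⁻¹' s, inter_mem hs' (h'.cont hs), fun y hy z hz => ?_⟩
  refine (H _ hy.2 _ hz.2).trans ?_
  have := H' y hy.1 z hz.1
  calc (L + δ) * ‖g y - g z‖ ≤ (L + δ) * ((L' + δ) * ‖y - z‖) := by gcongr
    _ ≤ _ := by rw [← mul_assoc]; gcongr

lemma Lc.inv {L : ℝ} {f : E → ℝ} {x : E} (h : Lc L f x) (hL : 0 ≤ L) (h0 : 0 < f x) :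
    Lc (L / f x ^ 2) (fun y => (f y)⁻¹) x := fun ε hε => by
  obtain ⟨δ, hδ, hδf, hδ2⟩ : ∃ δ > 0, δ < f x ∧ (L + δ) / (f x - δ)^2 ≤ L / f x ^ 2 + ε := by
    have hc : ContinuousAt (fun δ : ℝ => (L + δ) / (f x - δ)^2) 0 := by
      refine ContinuousAt.div (by fun_prop) (by fun_prop) (by simp; exact h0.ne')
    have h3 : ∀ᶠ δ : ℝ in 𝓝 0, (L + δ) / (f x - δ)^2 < L / f x ^ 2 + ε := hc.eventually_lt_const (by simp; linarith)
    have h4 : ∀ᶠ δ : ℝ in 𝓝 0, δ < f x := Iio_mem_nhds h0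
    obtain ⟨δ, h1, h2⟩ := ((Eventually.filter_mono (nhdsWithin_le_nhds (s := Ioi 0)) (h3.and h4)).and self_mem_nhdsWithin).exists
    exact ⟨δ, h2, h1.2, h1.1.le⟩
  obtain ⟨s, hs, H⟩ := h δ hδ
  have c1 : ∀ᶠ y in 𝓝 x, f x - δ < f y := h.cont.eventually_const_lt (by linarith)
  refine ⟨s ∩ {y | f x - δ < f y}, inter_mem hs c1, fun y hy z hz => ?_⟩
  have h1 := H y hy.1 z hz.1
  have py : f x - δ < f y := hy.2
  have pz : f x - δ < f z := hz.2
  have p0 : 0 < f x - δ := by linarith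
  have p1 : 0 < f y := by linarith
  have p2 : 0 < f z := by linarith
  rw [inv_sub_inv p1.ne' p2.ne', norm_div, ← norm_neg (f z - f y), neg_sub, Real.norm_of_nonneg (by positivity : 0 ≤ f y * f z)]
  calc ‖f y - f z‖ / (f y * f z) ≤ ((L + δ) * ‖y - z‖) / ((f x - δ)^2) := by
        rw [sq]; gcongr
    _ = (L + δ) / (f x - δ)^2 * ‖y - z‖ := by ring
    _ ≤ _ := by gcongr

lemma Lc.of_deriv {f : E → ℝ} {V : E → E} {x : E} (hV : ContinuousAt V x) (h : ∀ᶠ y in 𝓝 x, HasFDerivAt f (innerSL ℝ (V y)) y) :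
    Lc ‖V x‖ f x := fun ε hε => by
  have c1 : ∀ᶠ y in 𝓝 x, ‖V y‖ < ‖V x‖ + ε := hV.norm.eventually_lt_const (by linarith)
  obtain ⟨r, hr, hb⟩ := Metric.eventually_nhds_iff_ball.1 (h.and c1)
  refine ⟨ball x r, ball_mem_nhds _ hr, fun y hy z hz => ?_⟩
  refine Convex.norm_image_sub_le_of_norm_hasFDerivWithin_le (f := f) (f' := fun y => innerSL ℝ (V y)) (s := ball x r)
    (fun w hw => (hb w hw).1.hasFDerivWithinAt) (fun w hw => ?_) (convex_ball _ _) hz hy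
  rw [innerSL_apply_norm]; exact (hb w hw).2.le

lemma Lc.fderiv_le {L : ℝ} {f : E → F} {x : E} (h : Lc L f x) (hL : 0 ≤ L) : ‖fderiv ℝ f x‖ ≤ L := by
  refine le_of_forall_pos_le_add fun ε hε => ?_
  obtain ⟨s, hs, H⟩ := h ε hε
  refine norm_fderiv_le_of_lip' ℝ (by linarith) ?_
  filter_upwards [hs] with y hy
  exact H y hy x (mem_of_mem_nhds hs)

end lc
end NodalNeumann

end

noncomputable section
open MeasureTheory Metric Set Filter Asymptotics
open scoped Topology NNReal ENNReal RealInnerProductSpace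
namespace NodalNeumann
set_option linter.all false
variable {E : Type*} [NormedAddCommGroup E] [InnerProductSpace ℝ E] [FiniteDimensional ℝ E]

/-- quantified `C^{1,1}` regularity -/
structure Reg (f : E → ℝ) (V : E → E) (K0 K1 K2 : ℝ) (x : E) : Prop where
  d : ∀ᶠ y in 𝓝 x, HasFDerivAt f (innerSL ℝ (V y)) y
  k0 : |f x| ≤ K0
  k1 : ‖V x‖ ≤ K1
  k2 : Lc K2 V x
  p2 : 0 ≤ K2

namespace Reg
variable {f g : E → ℝ} {V W : E → E} {K0 K1 K2 K0' K1' K2' : ℝ} {x : E}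

lemma p0 (h : Reg f V K0 K1 K2 x) : 0 ≤ K0 := (abs_nonneg _).trans h.k0
lemma p1 (h : Reg f V K0 K1 K2 x) : 0 ≤ K1 := (norm_nonneg _).trans h.k1
lemma lc (h : Reg f V K0 K1 K2 x) : Lc K1 f x := (Lc.of_deriv h.k2.cont h.d).mono h.k1

lemma mono (h : Reg f V K0 K1 K2 x) (h0 : |f x| ≤ K0') (h1 : ‖V x‖ ≤ K1') (h2 : K2 ≤ K2') : Reg f V K0' K1' K2' x :=
  ⟨h.d, h0, h1, h.k2.mono h2, h.p2.trans h2⟩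

lemma add (h : Reg f V K0 K1 K2 x) (h' : Reg g W K0' K1' K2' x) :
    Reg (fun y => f y + g y) (fun y => V y + W y) (K0 + K0') (K1 + K1') (K2 + K2') x :=
  ⟨by filter_upwards [h.d, h'.d] with y h1 h2; exact (h1.add h2).congr_fderiv (by ext v; simp [inner_add_left]),
   (abs_add_le _ _).trans (add_le_add h.k0 h'.k0), (norm_add_le _ _).trans (add_le_add h.k1 h'.k1), h.k2.add h'.k2, add_nonneg h.p2 h'.p2⟩

lemma sub (h : Reg f V K0 K1 K2 x) (h' : Reg g W K0' K1' K2' x) :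
    Reg (fun y => f y - g y) (fun y => V y - W y) (K0 + K0') (K1 + K1') (K2 + K2') x :=
  ⟨by filter_upwards [h.d, h'.d] with y h1 h2; exact (h1.sub h2).congr_fderiv (by ext v; simp [inner_sub_left]),
   (abs_sub _ _).trans (add_le_add h.k0 h'.k0), (norm_sub_le _ _).trans (add_le_add h.k1 h'.k1), h.k2.sub h'.k2, add_nonneg h.p2 h'.p2⟩

lemma sum {ι : Type*} (s : Finset ι) {f : ι → E → ℝ} {V : ι → E → E} {K0 K1 K2 : ι → ℝ} (h : ∀ i ∈ s, Reg (f i) (V i) (K0 i) (K1 i) (K2 i) x) :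
    Reg (fun y => ∑ i ∈ s, f i y) (fun y => ∑ i ∈ s, V i y) (∑ i ∈ s, K0 i) (∑ i ∈ s, K1 i) (∑ i ∈ s, K2 i) x := by
  classical
  induction s using Finset.induction_on with
  | empty => 
    simp only [Finset.sum_empty]
    exact ⟨Eventually.of_forall fun y => by simpa using hasFDerivAt_const (0:ℝ) y, by simp, by simp, Lc.const _ _, le_rfl⟩
  | insert a s ha ih =>
    simp only [Finset.sum_insert ha]
    exact (h a (Finset.mem_insert_self _ _)).add (ih fun i hi => h i (Finset.mem_insert_of_mem hi))

lemma mul (h : Reg f V K0 K1 K2 x) (h' : Reg g W K0' K1' K2' x) :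
    Reg (fun y => f y * g y) (fun y => f y • W y + g y • V y) (K0 * K0') (K0 * K1' + K1 * K0') (K0 * K2' + 2 * K1 * K1' + K2 * K0') x := by
  have p0 := h.p0; have p1 := h.p1; have p2 := h.p2; have p0' := h'.p0; have p1' := h'.p1; have p2' := h'.p2
  refine ⟨?_, ?_, ?_, ?_, by positivity⟩
  · filter_upwards [h.d, h'.d] with y h1 h2
    exact (h1.mul h2).congr_fderiv (by ext v; simp [inner_add_left, inner_smul_left])
  · rw [abs_mul]; exact mul_le_mul h.k0 h'.k0 (abs_nonneg _) p0
  · refine (norm_add_le _ _).trans ?_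
    rw [norm_smul, norm_smul, Real.norm_eq_abs, Real.norm_eq_abs]
    have := mul_le_mul h.k0 h'.k1 (norm_nonneg _) p0
    have := mul_le_mul h'.k0 h.k1 (norm_nonneg _) p0'
    linarith
  · refine ((h.lc.smul h'.k2 p1 p2').add (h'.lc.smul h.k2 p1' p2)).mono ?_
    have := mul_le_mul_of_nonneg_right h.k0 p2'
    have := mul_le_mul_of_nonneg_right h'.k0 p2
    have := mul_le_mul_of_nonneg_left h.k1 p1'
    have := mul_le_mul_of_nonneg_left h'.k1 p1
    linarith

lemma inv (h : Reg f V K0 K1 K2 x) (hf : 1 / 2 ≤ f x) :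
    Reg (fun y => (f y)⁻¹) (fun y => (-((f y)⁻¹ * (f y)⁻¹)) • V y) 2 (4 * K1) (4 * K2 + 16 * K1 ^ 2) x := by
  have p1 := h.p1; have p2 := h.p2
  have hf0 : 0 < f x := by linarith
  have hi : (f x)⁻¹ ≤ 2 := by rw [inv_le_comm₀ hf0 (by norm_num)]; linarith
  have hi0 : 0 < (f x)⁻¹ := by positivity
  have hii : (f x)⁻¹ * (f x)⁻¹ ≤ 4 := by nlinarith
  have hq : K1 / f x ^ 2 ≤ 4 * K1 := by
    have : K1 / f x ^ 2 = ((f x)⁻¹ * (f x)⁻¹) * K1 := by field_simp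
    rw [this]; gcongr
  refine ⟨?_, ?_, ?_, ?_, by positivity⟩
  · filter_upwards [h.d, h.lc.cont.eventually_const_lt hf0] with y h1 h2
    have := (hasDerivAt_inv h2.ne').comp_hasFDerivAt y h1
    refine this.congr_fderiv ?_
    ext v; simp [inner_smul_left]; left; ring
  · rw [abs_of_pos hi0]; exact hi
  · rw [norm_smul, norm_neg, Real.norm_of_nonneg (by positivity)]
    exact mul_le_mul hii h.k1 (norm_nonneg _) (by norm_num)
  · have l1 : Lc (4 * K1) (fun y => (f y)⁻¹) x := (h.lc.inv p1 hf0).mono hq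
    have l2 := ((l1.mul l1 (by positivity) (by positivity)).neg).smul h.k2 (by positivity) p2
    refine l2.mono ?_
    rw [abs_neg, abs_of_pos (by positivity : 0 < (f x)⁻¹ * (f x)⁻¹), abs_of_pos hi0]
    have k1 := h.k1
    have a1 : (f x)⁻¹ * (f x)⁻¹ * K2 ≤ 4 * K2 := by gcongr
    have a2 : ((f x)⁻¹ * (4 * K1) + 4 * K1 * (f x)⁻¹) * ‖V x‖ ≤ (2 * (4 * K1) + 4 * K1 * 2) * K1 := by gcongr
    nlinarith

lemma coord (v : E) (hv : ‖v‖ = 1) (c x : E) : Reg (fun y => ⟪y - c, v⟫) (fun _ => v) ‖x - c‖ 1 0 x := by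
  refine ⟨Eventually.of_forall fun y => ?_, ?_, hv.le, Lc.const _ _, le_rfl⟩
  · have : HasFDerivAt (fun y : E => ⟪v, y - c⟫) (innerSL ℝ v) y := 
      (innerSL ℝ v).hasFDerivAt.comp y ((hasFDerivAt_id y).sub_const c)
    exact this.congr_of_eventuallyEq (Eventually.of_forall fun z => real_inner_comm _ _)
  · have := abs_real_inner_le_norm (x - c) v
    rwa [hv, mul_one] at this
end Reg

namespace Cfg
variable {t h : E → ℝ} {n : E → E} {e p : E} {R τ M : ℝ}

/-- difference quotient -/
def aq (t : E → ℝ) (v y : E) : ℝ := (t y)⁻¹ * (t (y + t y • v) - t y)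
/-- its gradient -/
def wq (t : E → ℝ) (n : E → E) (v y : E) : E :=
  (t y)⁻¹ • (n (y + t y • v) - n y + (⟪n (y + t y • v), v⟫ - aq t v y) • n y)

lemma aq_reg (C : Cfg t h n e p R τ M) {c : E} {r1 : ℝ} (hc : t c = 0) (hsub : ball c (4 * r1) ⊆ ball p (R/3))
    (hM : 6 * M * r1 ≤ 1/100) {x : E} (hx : x ∈ ball c r1) (htx : 0 < t x) {v : E} (hv : ‖v‖ = 1) :
    Reg (aq t v) (wq t n v) 2 (4 * (6 * M)) (30 * (6 * M) / t x) x ∧ |aq t v x - ⟪n x, v⟫| ≤ M * t x := by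
  have hM0 := C.M0
  have τ0 := C.τ0; have τ1 := C.τ1
  have hsubR : ball p (R/3) ⊆ ball p R := by
    by_cases hR : 0 ≤ R
    · exact ball_subset_ball (by linarith)
    · rw [ball_eq_empty.2 (by linarith)]; exact empty_subset _
  have tcont : Continuous t := C.cont
  have hnear : ∀ y ∈ ball c r1, 0 < t y → y ∈ ball p (R/3) ∧ y + t y • v ∈ ball p (R/3) ∧ t y ≤ 2 * r1 := by
    intro y hy hty
    rw [mem_ball, dist_eq_norm] at hy
    have h1 := C.tlip' y c
    rw [hc, sub_zero, abs_of_pos hty] at h1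
    refine ⟨hsub ?_, hsub ?_, by linarith⟩
    · rw [mem_ball, dist_eq_norm]; linarith [norm_nonneg (y - c)]
    · rw [mem_ball, dist_eq_norm]
      have : y + t y • v - c = (y - c) + t y • v := by abel
      rw [this]
      refine (norm_add_le _ _).trans_lt ?_
      rw [norm_smul, hv, mul_one, Real.norm_of_nonneg hty.le]; linarith
  have hr1 : 0 < r1 := pos_of_mem_ball hx
  -- pointwise facts
  have fact : ∀ y ∈ ball c r1, 0 < t y → |aq t v y - ⟪n y, v⟫| ≤ M * t y ∧ ‖n (y + t y • v) - n y‖ ≤ 6 * M * t y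
      ∧ |⟪n (y + t y • v), v⟫ - aq t v y| ≤ 7 * M * t y ∧ ‖n y‖ ≤ 1.01 ∧ ‖wq t n v y‖ ≤ 4 * (6 * M) := by
    intro y hy hty
    obtain ⟨h1, h2, h3⟩ := hnear y hy hty
    have f1 : |aq t v y - ⟪n y, v⟫| ≤ M * t y := by
      have := C.tn y (hsubR h1) _ (hsubR h2)
      rw [add_sub_cancel_left, inner_smul_right, norm_smul, hv, mul_one, Real.norm_of_nonneg hty.le] at this
      have e1 : aq t v y - ⟪n y, v⟫ = (t y)⁻¹ * (t (y + t y • v) - t y - t y * ⟪n y, v⟫) := by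
        unfold aq; field_simp
      rw [e1, abs_mul, abs_of_pos (by positivity)]
      calc (t y)⁻¹ * |t (y + t y • v) - t y - t y * ⟪n y, v⟫| ≤ (t y)⁻¹ * (M * t y ^ 2) := by gcongr
        _ = _ := by field_simp
    have f2 : ‖n (y + t y • v) - n y‖ ≤ 6 * M * t y := by
      have := C.n_lip h2 h1
      rwa [add_sub_cancel_left, norm_smul, hv, mul_one, Real.norm_of_nonneg hty.le] at this
    have f3 : |⟪n (y + t y • v), v⟫ - aq t v y| ≤ 7 * M * t y := by
      have e1 : ⟪n (y + t y • v), v⟫ - aq t v y = ⟪n (y + t y • v) - n y, v⟫ - (aq t v y - ⟪n y, v⟫) := by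
        rw [inner_sub_left]; ring
      rw [e1]
      refine (abs_sub _ _).trans ?_
      have := abs_real_inner_le_norm (n (y + t y • v) - n y) v
      rw [hv, mul_one] at this
      linarith
    have f4 : ‖n y‖ ≤ 1.01 := by have := C.n_norm (hsubR h1); linarith
    refine ⟨f1, f2, f3, f4, ?_⟩
    unfold wq
    rw [norm_smul, Real.norm_of_nonneg (by positivity), inv_mul_le_iff₀ hty]
    refine (norm_add_le _ _).trans ?_
    rw [norm_smul, Real.norm_eq_abs]
    have := mul_le_mul f3 f4 (norm_nonneg _) (by positivity)
    nlinarith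
  have hdom : ∀ᶠ y in 𝓝 x, y ∈ ball c r1 ∧ 0 < t y :=
    Filter.inter_mem (isOpen_ball.mem_nhds hx) (tcont.continuousAt.eventually_const_lt htx)
  have hder : ∀ᶠ y in 𝓝 x, HasFDerivAt (aq t v) (innerSL ℝ (wq t n v y)) y := by
    filter_upwards [hdom] with y hy
    obtain ⟨h1, h2, h3⟩ := hnear y hy.1 hy.2
    have d1 := C.hasFDerivAt_t (hsubR h1)
    have d2 := C.hasFDerivAt_t (hsubR h2)
    have d3 : HasFDerivAt (fun y => y + t y • v) (ContinuousLinearMap.id ℝ E + (innerSL ℝ (n y)).smulRight v) y :=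
      (hasFDerivAt_id y).add (d1.smul_const v)
    have d4 := (d2.comp y d3).sub d1
    have d5 := ((hasDerivAt_inv hy.2.ne').comp_hasFDerivAt y d1).mul d4
    refine HasFDerivAt.congr_fderiv d5 ?_
    have ht0 := hy.2.ne'
    ext u
    simp [wq, aq, inner_smul_left, inner_add_left, inner_sub_left]
    field_simp
    ring
  obtain ⟨f1, f2, f3, f4, f5⟩ := fact x hx htx
  obtain ⟨h1, h2, h3⟩ := hnear x hx htx
  have hMt : 6 * M * t x ≤ 1/50 := by nlinarith
  refine ⟨⟨hder, ?_, f5, ?_, by positivity⟩, f1⟩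
  · have := abs_real_inner_le_norm (n x) v
    rw [hv, mul_one] at this
    have := abs_sub_abs_le_abs_sub (aq t v x) ⟪n x, v⟫
    linarith
  · -- Lipschitz bound of the gradient
    have ln : ∀ z ∈ ball p (R/3), Lc (6 * M) n z := fun z hz => Lc.of_lip (isOpen_ball.mem_nhds hz) fun y hy w hw => C.n_lip hy hw
    have lt : Lc 2 t x := Lc.of_lip univ_mem fun y _ z _ => by rw [Real.norm_eq_abs]; exact C.tlip' y z
    have ly : Lc 3 (fun y => y + t y • v) x := by
      refine ((Lc.id x).add (lt.smul (Lc.const v x) (by norm_num) le_rfl)).mono ?_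
      rw [hv]; norm_num
    have l1 : Lc (6 * M * 3) (fun y => n (y + t y • v)) x := Lc.comp (ln _ h2) ly (by positivity) (by norm_num)
    have l2 : Lc (18 * M) (fun y => ⟪n (y + t y • v), v⟫) x := by
      refine (l1.inner (Lc.const v x) (by positivity) le_rfl).mono ?_
      rw [hv]; linarith
    have hub : Lc (24 * M) (aq t v) x := by
      -- the derivative is bounded near x
      obtain ⟨r, hr, hb⟩ := Metric.eventually_nhds_iff_ball.1 (hder.and hdom)
      refine Lc.of_lip (ball_mem_nhds _ hr) fun y hy z hz => ?_
      refine Convex.norm_image_sub_le_of_norm_hasFDerivWithin_le (f := aq t v) (f' := fun y => innerSL ℝ (wq t n v y)) (s := ball x r)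
        (fun w hw => (hb w hw).1.hasFDerivWithinAt) (fun w hw => ?_) (convex_ball _ _) hz hy
      rw [innerSL_apply_norm]
      have := (fact w (hb w hw).2.1 (hb w hw).2.2).2.2.2.2
      linarith
    have l3 := (l2.sub hub).smul (ln x h1) (by positivity) (by positivity)
    have l4 := (l1.sub (ln x h1)).add l3
    have l5 := (lt.inv (by norm_num) htx).smul l4 (by positivity) (by positivity)
    refine l5.mono ?_
    have b1 : |⟪n (x + t x • v), v⟫ - aq t v x| * (6 * M) + (18 * M + 24 * M) * ‖n x‖ ≤ 43 * M := by
      have : |⟪n (x + t x • v), v⟫ - aq t v x| ≤ 1/40 := by linarith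
      have := mul_le_mul_of_nonneg_right this (by positivity : 0 ≤ 6 * M)
      have := mul_le_mul_of_nonneg_left f4 (by positivity : 0 ≤ 18 * M + 24 * M)
      linarith
    have b2 : ‖n (x + t x • v) - n x + (⟪n (x + t x • v), v⟫ - aq t v x) • n x‖ ≤ 4 * (6 * M) * t x := by
      have := f5
      unfold wq at this
      rw [norm_smul, Real.norm_of_nonneg (by positivity), inv_mul_le_iff₀ htx] at this
      linarith
    rw [abs_of_pos (by positivity : 0 < (t x)⁻¹)]
    calc _ ≤ (t x)⁻¹ * (6 * M * 3 + 6 * M + 43 * M) + 2 / t x ^ 2 * (4 * (6 * M) * t x) := by gcongr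
      _ = (115 * M) / t x := by field_simp; ring
      _ ≤ _ := div_le_div_of_nonneg_right (by linarith) htx.le
end Cfg
end NodalNeumann

end

noncomputable section
open MeasureTheory Metric Set Filter Asymptotics
open scoped Topology NNReal ENNReal RealInnerProductSpace
namespace NodalNeumann
set_option linter.all false
variable {E : Type*} [NormedAddCommGroup E] [InnerProductSpace ℝ E] [FiniteDimensional ℝ E]

namespace Cfg
variable {t h : E → ℝ} {n : E → E} {e p : E} {R τ M : ℝ}

/-- coordinates basis -/
def bv (i : Fin (Module.finrank ℝ E)) : E := stdOrthonormalBasis ℝ E i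
lemma bv_norm (i : Fin (Module.finrank ℝ E)) : ‖bv i‖ = 1 := (stdOrthonormalBasis ℝ E).orthonormal.1 i
lemma bv_sum (u v : E) : ∑ i, ⟪u, bv i⟫ * ⟪v, bv i⟫ = ⟪u, v⟫ := by
  rw [← (stdOrthonormalBasis ℝ E).sum_inner_mul_inner u v]
  exact Finset.sum_congr rfl fun i _ => by rw [real_inner_comm v]; rfl
lemma bv_repr (u : E) : ∑ i, ⟪u, bv i⟫ • bv i = u := by
  conv_rhs => rw [← (stdOrthonormalBasis ℝ E).sum_repr' u]
  exact Finset.sum_congr rfl fun i _ => by rw [real_inner_comm]; rfl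

def oq (t : E → ℝ) (c : E) (y : E) : ℝ := (∑ i, aq t (bv i) y * ⟪y - c, bv i⟫) - t y
def oqV (t : E → ℝ) (n : E → E) (c : E) (y : E) : E :=
  (∑ i, (aq t (bv i) y • bv i + ⟪y - c, bv i⟫ • wq t n (bv i) y)) - n y
def os (t : E → ℝ) (y : E) : ℝ := ∑ i, aq t (bv i : E) y * aq t (bv i) y
def osV (t : E → ℝ) (n : E → E) (y : E) : E :=
  ∑ i, (aq t (bv i : E) y • wq t n (bv i) y + aq t (bv i) y • wq t n (bv i) y)
def ok (t : E → ℝ) (c : E) (y : E) : ℝ := oq t c y * (os t y)⁻¹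
def okV (t : E → ℝ) (n : E → E) (c : E) (y : E) : E :=
  oq t c y • ((-((os t y)⁻¹ * (os t y)⁻¹)) • osV t n y) + (os t y)⁻¹ • oqV t n c y
def omg (t : E → ℝ) (c : E) (y : E) : ℝ := t y * ok t c y
def omV (t : E → ℝ) (n : E → E) (c : E) (y : E) : E := t y • okV t n c y + ok t c y • n y

set_option maxHeartbeats 2000000 in
lemma omg_reg (C : Cfg t h n e p R τ M) {c : E} {r1 a : ℝ} (hc : t c = 0) (hsub : ball c (4 * r1) ⊆ ball p (R/3))
    (ha : a = (Module.finrank ℝ E : ℝ) * (6 * M)) (hM : a * r1 ≤ 1/20000) {x : E} (hx : x ∈ ball c r1) (htx : 0 < t x) :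
    Reg (omg t c) (omV t n c) (200 * a * ‖x - c‖ ^ 3) (200 * a * ‖x - c‖ ^ 2) (200 * a * ‖x - c‖) x
    ∧ |⟪n x, x - c - omV t n c x⟫| ≤ 10 * t x := by
  have hM0 := C.M0
  have τ0 := C.τ0; have τ1 := C.τ1
  have hr1 : 0 < r1 := pos_of_mem_ball hx
  set m : ℝ := ((Module.finrank ℝ E : ℕ) : ℝ) with hm
  have hm1 : 1 ≤ m := by
    have : 0 < Module.finrank ℝ E := by
      rw [Module.finrank_pos_iff]
      exact ⟨⟨e, 0, fun h0 => by have := C.he; rw [h0, norm_zero] at this; norm_num at this⟩⟩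
    rw [hm]; exact_mod_cast this
  have ha0 : 0 ≤ a := by rw [ha]; positivity
  have hMa : 6 * M ≤ a := by rw [ha]; nlinarith
  have hsubR : ball p (R/3) ⊆ ball p R := by
    by_cases hR : 0 ≤ R
    · exact ball_subset_ball (by linarith)
    · rw [ball_eq_empty.2 (by linarith)]; exact empty_subset _
  have hxp : x ∈ ball p (R/3) := hsub (ball_subset_ball (by linarith) hx)
  have hcp : c ∈ ball p (R/3) := hsub (mem_ball_self (by linarith))
  obtain ⟨d, hd⟩ : ∃ d, d = ‖x - c‖ := ⟨_, rfl⟩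
  obtain ⟨T, hT⟩ : ∃ T, T = t x := ⟨_, rfl⟩
  have hd1 : d < r1 := by rw [hd, ← dist_eq_norm]; exact hx
  have hT2 : T ≤ 2 * d := by
    have := C.tlip' x c
    rw [hc, sub_zero, ← hT, ← hd] at this; linarith [le_abs_self T]
  rw [← hT] at htx ⊢
  rw [← hd]
  have hd0 : 0 < d := by linarith
  have had : a * d ≤ 1/20000 := by nlinarith
  have haT : a * T ≤ 1/10000 := by nlinarith
  have hM6 : 6 * M * r1 ≤ 1/100 := by nlinarith
  have AR : ∀ i : Fin (Module.finrank ℝ E), Reg (aq t (bv i)) (wq t n (bv i)) 2 (4 * (6 * M)) (30 * (6 * M) / T) x ∧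
      |aq t (bv i) x - ⟪n x, bv i⟫| ≤ M * T := fun i => by
    rw [hT]; exact C.aq_reg hc hsub hM6 hx (hT ▸ htx) (bv_norm i)
  have dT : 1 ≤ 2 * (d / T) := by rw [mul_div, le_div_iff₀ htx]; linarith
  have hn1 : ‖n x‖ ≤ 1.01 := by have := C.n_norm (hsubR hxp); linarith
  have hn2 : 1 ≤ ‖n x‖ := by
    have := real_inner_le_norm (n x) e
    rw [C.n_e (hsubR hxp), C.he, mul_one] at this; exact this
  have hni : ∀ i : Fin (Module.finrank ℝ E), |⟪n x, bv i⟫| ≤ 1.01 := fun i => by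
    have := abs_real_inner_le_norm (n x) (bv i)
    rw [bv_norm, mul_one] at this; linarith
  have hxi : ∀ i : Fin (Module.finrank ℝ E), |⟪x - c, bv i⟫| ≤ d := fun i => by
    have := abs_real_inner_le_norm (x - c) (bv i)
    rw [bv_norm, mul_one, ← hd] at this; linarith
  have ln : Lc (6 * M) n x := Lc.of_lip (isOpen_ball.mem_nhds hxp) fun y hy w hw => C.n_lip hy hw
  have Rt : Reg t n T 1.01 (6 * M) x := by
    refine ⟨?_, by rw [← hT, abs_of_pos htx], hn1, ln, by positivity⟩
    filter_upwards [isOpen_ball.mem_nhds hxp] with y hy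
    exact C.hasFDerivAt_t (hsubR hy)
  have cardm : ∀ z : ℝ, ∑ i : Fin (Module.finrank ℝ E), z = m * z := fun z => by simp [hm]
  -- inner estimate
  have hnx : |⟪n x, x - c⟫ - T| ≤ M * d ^ 2 := by
    have := C.tn x (hsubR hxp) c (hsubR hcp)
    rw [hc, ← hT, norm_sub_rev, ← hd] at this
    have e1 : ⟪n x, x - c⟫ - T = 0 - T - ⟪n x, c - x⟫ := by
      rw [← neg_sub c x, inner_neg_right]; ring
    rw [e1]; exact this
  have hq1 : |oq t c x - (⟪n x, x - c⟫ - T)| ≤ m * (M * T * d) := by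
    have e1 : oq t c x - (⟪n x, x - c⟫ - T) = ∑ i, (aq t (bv i) x - ⟪n x, bv i⟫) * ⟪x - c, bv i⟫ := by
      unfold oq; rw [← bv_sum (n x) (x - c), ← hT]
      simp only [sub_mul, Finset.sum_sub_distrib]; ring
    rw [e1, ← cardm]
    refine (Finset.abs_sum_le_sum_abs _ _).trans (Finset.sum_le_sum fun i _ => ?_)
    rw [abs_mul]; exact mul_le_mul (AR i).2 (hxi i) (abs_nonneg _) (by positivity)
  have hmM : m * M = a / 6 := by rw [ha]; ring
  have hMM : M ≤ a / 6 := by linarith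
  have hMdd : M * d ^ 2 ≤ a / 6 * d ^ 2 := by gcongr
  have hmMTd : m * (M * T * d) ≤ a / 3 * d ^ 2 := by
    have : m * (M * T * d) = (a / 6 * d) * T := by rw [← hmM]; ring
    rw [this]
    nlinarith [mul_nonneg ha0 hd0.le]
  have hq0 : |oq t c x| ≤ a * d ^ 2 := by
    have := abs_sub_abs_le_abs_sub (oq t c x) (⟪n x, x - c⟫ - T)
    have : 0 ≤ a * d ^ 2 := by positivity
    linarith
  have Rq : Reg (oq t c) (oqV t n c) (a * d ^ 2) (6 * a * d) (50 * a * (d / T)) x := by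
    have r1 := (Reg.sum Finset.univ fun i _ => (AR i).1.mul (Reg.coord (bv i) (bv_norm i) c x)).sub Rt
    refine Reg.mono r1 hq0 ?_ ?_
    · have e1 : oqV t n c x = ∑ i, ((aq t (bv i) x - ⟪n x, bv i⟫) • bv i + ⟪x - c, bv i⟫ • wq t n (bv i) x) := by
        unfold oqV
        conv_lhs => rw [← bv_repr (n x)]
        rw [← Finset.sum_sub_distrib]
        refine Finset.sum_congr rfl fun i _ => ?_
        rw [sub_smul]; abel
      change ‖oqV t n c x‖ ≤ _
      rw [e1]
      have : 6 * a * d = ∑ i : Fin (Module.finrank ℝ E), 36 * M * d := by rw [cardm, ha]; ring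
      rw [this]
      refine (norm_sum_le _ _).trans (Finset.sum_le_sum fun i _ => ?_)
      refine (norm_add_le _ _).trans ?_
      rw [norm_smul, norm_smul, bv_norm, mul_one, Real.norm_eq_abs, Real.norm_eq_abs]
      have a1 := mul_le_mul (hxi i) (AR i).1.k1 (norm_nonneg _) hd0.le
      have a2 := (AR i).2
      have a3 : M * T ≤ M * (2 * d) := by gcongr
      have : 0 ≤ M * d := by positivity
      linarith
    · rw [← hd, cardm]
      have e1 : m * (2 * 0 + 2 * (4 * (6 * M)) * 1 + 30 * (6 * M) / T * d) = 8 * a + 30 * (a * (d / T)) := by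
        rw [ha]; field_simp; ring
      rw [e1]
      have : a * 1 ≤ a * (2 * (d / T)) := by gcongr
      linarith
  have hs1 : |os t x - ‖n x‖ ^ 2| ≤ a * T := by
    have e1 : os t x - ‖n x‖ ^ 2 = ∑ i, (aq t (bv i) x - ⟪n x, bv i⟫) * (aq t (bv i) x + ⟪n x, bv i⟫) := by
      unfold os; rw [← real_inner_self_eq_norm_sq, ← bv_sum (n x) (n x), ← Finset.sum_sub_distrib]
      exact Finset.sum_congr rfl fun i _ => by ring
    have e2 : a * T = ∑ i : Fin (Module.finrank ℝ E), (M * T) * 6 := by rw [cardm, ha]; ring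
    rw [e1, e2]
    refine (Finset.abs_sum_le_sum_abs _ _).trans (Finset.sum_le_sum fun i _ => ?_)
    rw [abs_mul]
    refine mul_le_mul (AR i).2 ?_ (abs_nonneg _) (by positivity)
    have := abs_add_le (aq t (bv i) x) ⟪n x, bv i⟫
    linarith [(AR i).1.k0, hni i]
  have hs2 : 1 / 2 ≤ os t x := by
    have := (abs_le.1 hs1).1
    nlinarith
  have Rs0 : Reg (os t) (osV t n) (m * (2 * 2)) (16 * a) (121 * a / T) x := by
    have r1 := (Reg.sum Finset.univ fun i _ => (AR i).1.mul (AR i).1)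
    have r2 : Reg (os t) (osV t n) (m * (2 * 2)) (m * (2 * (4 * (6 * M)) + 4 * (6 * M) * 2))
      (m * (2 * (30 * (6 * M) / T) + 2 * (4 * (6 * M)) * (4 * (6 * M)) + 30 * (6 * M) / T * 2)) x := by
      rw [← cardm, ← cardm, ← cardm]; exact r1
    refine r2.mono r2.k0 (r2.k1.trans ?_) ?_
    · rw [ha]; apply le_of_eq; ring
    · have e1 : m * (2 * (30 * (6 * M) / T) + 2 * (4 * (6 * M)) * (4 * (6 * M)) + 30 * (6 * M) / T * 2) =
        (120 * a + 32 * a * (6 * M) * T) / T := by rw [ha]; field_simp; ring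
      rw [e1]
      apply div_le_div_of_nonneg_right _ htx.le
      have : 6 * M * T ≤ 1/10000 := le_trans (by gcongr) haT
      nlinarith
  have Rs : Reg (fun y => (os t y)⁻¹) (fun y => (-((os t y)⁻¹ * (os t y)⁻¹)) • osV t n y) 2 (64 * a) (1000 * a / T) x := by
    have r1 := Rs0.inv hs2
    refine r1.mono r1.k0 (r1.k1.trans (by linarith)) ?_
    have : 4 * (121 * a / T) + 16 * (16 * a) ^ 2 = (484 * a + 4096 * a * (a * T)) / T := by field_simp; ring
    rw [this]
    apply div_le_div_of_nonneg_right _ htx.le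
    nlinarith
  have Rk : Reg (ok t c) (okV t n c) (2 * a * d ^ 2) (13 * a * d) (110 * a * (d / T)) x := by
    have r1 : Reg (ok t c) (okV t n c) _ _ _ x := Rq.mul Rs
    refine r1.mono (r1.k0.trans (by linarith)) (r1.k1.trans ?_) ?_
    · have : a * d ^ 2 * (64 * a) = 64 * (a * d) * (a * d) := by ring
      have : 0 ≤ a * d := by positivity
      nlinarith
    · have e1 : a * d ^ 2 * (1000 * a / T) + 2 * (6 * a * d) * (64 * a) + 50 * a * (d / T) * 2 =
        (a * (d / T)) * (1000 * (a * d) + 768 * (a * T) + 100) := by field_simp; ring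
      rw [e1]
      have : 0 ≤ a * (d / T) := by positivity
      nlinarith
  have Rw : Reg (omg t c) (omV t n c) _ _ _ x := Rt.mul Rk
  constructor
  · refine Rw.mono (Rw.k0.trans ?_) (Rw.k1.trans ?_) ?_
    · have : 0 ≤ a * d ^ 2 := by positivity
      nlinarith [mul_le_mul_of_nonneg_right hT2 this, mul_nonneg this hd0.le]
    · have : 0 ≤ a * d := by positivity
      nlinarith [mul_le_mul_of_nonneg_right hT2 this]
    · have e1 : T * (110 * a * (d / T)) = 110 * (a * d) := by field_simp
      rw [e1]
      have h0 : 0 ≤ a * d := by positivity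
      have : 6 * M * (2 * a * d ^ 2) ≤ a * (2 * a * d ^ 2) := by gcongr
      have : a * (2 * a * d ^ 2) = 2 * (a * d) * (a * d) := by ring
      nlinarith
  · -- flux
    have hk0 := Rk.k0
    have hk1 := Rk.k1
    have e1 : ⟪n x, x - c - omV t n c x⟫ = (⟪n x, x - c⟫ - T - oq t c x) + T - T * ⟪n x, okV t n c x⟫ + (os t x - ‖n x‖ ^ 2) * ok t c x := by
      have : oq t c x = os t x * ok t c x := by unfold ok; field_simp
      unfold omV
      rw [inner_sub_right, inner_add_right, inner_smul_right, inner_smul_right, real_inner_self_eq_norm_sq, ← hT]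
      rw [this]
      ring
    have b1 : |⟪n x, x - c⟫ - T - oq t c x| ≤ T := by
      rw [abs_sub_comm]
      refine hq1.trans ?_
      have : m * (M * T * d) = (a * d) * T / 6 := by rw [ha]; ring
      rw [this]; nlinarith
    have b2 : |T * ⟪n x, okV t n c x⟫| ≤ T := by
      rw [abs_mul, abs_of_pos htx]
      have := (abs_real_inner_le_norm (n x) (okV t n c x)).trans (mul_le_mul hn1 hk1 (norm_nonneg _) (by norm_num))
      nlinarith
    have b3 : |(os t x - ‖n x‖ ^ 2) * ok t c x| ≤ T := by
      rw [abs_mul]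
      have := mul_le_mul hs1 hk0 (abs_nonneg _) (by positivity)
      refine this.trans ?_
      have e2 : a * T * (2 * a * d ^ 2) = 2 * (a * d) * (a * d) * T := by ring
      rw [e2]
      have : 2 * (a * d) * (a * d) ≤ 1 := by nlinarith [mul_nonneg ha0 hd0.le]
      nlinarith
    rw [e1]
    rw [abs_le] at *
    constructor <;> linarith [b1.1, b1.2, b2.1, b2.2, b3.1, b3.2]
end Cfg
end NodalNeumann

end

noncomputable section
open MeasureTheory Metric Set Filter Asymptotics
open scoped Topology NNReal ENNReal RealInnerProductSpace
namespace NodalNeumann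
set_option linter.all false
variable {E : Type*} [NormedAddCommGroup E] [InnerProductSpace ℝ E] [FiniteDimensional ℝ E]

/-- perturbation of the identity: quadratic form and divergence -/
lemma quad_of_Lc {V : E → E} {c x : E} {L : ℝ} (hL : 0 ≤ L) (h : Lc L (fun y => V y - (y - c)) x) (hd : DifferentiableAt ℝ V x) :
    (∀ v, |⟪fderiv ℝ V x v, v⟫ - ‖v‖ ^ 2| ≤ L * ‖v‖ ^ 2) ∧ |dv V x - Module.finrank ℝ E| ≤ Module.finrank ℝ E * L := by
  have h1 := h.fderiv_le hL
  have hdd : fderiv ℝ (fun y => V y - (y - c)) x = fderiv ℝ V x - ContinuousLinearMap.id ℝ E :=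
    (hd.hasFDerivAt.sub ((hasFDerivAt_id x).sub_const c)).fderiv
  rw [hdd] at h1
  have q : ∀ v, |⟪fderiv ℝ V x v, v⟫ - ‖v‖ ^ 2| ≤ L * ‖v‖ ^ 2 := fun v => by
    have e1 : ⟪fderiv ℝ V x v, v⟫ - ‖v‖ ^ 2 = ⟪(fderiv ℝ V x - ContinuousLinearMap.id ℝ E) v, v⟫ := by
      simp [inner_sub_left]
    rw [e1]
    refine (abs_real_inner_le_norm _ _).trans ?_
    have := ContinuousLinearMap.le_of_opNorm_le _ h1 v
    nlinarith [norm_nonneg v]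
  refine ⟨q, ?_⟩
  unfold dv
  have e1 : (∑ i, ⟪fderiv ℝ V x (stdOrthonormalBasis ℝ E i), stdOrthonormalBasis ℝ E i⟫) - (Module.finrank ℝ E : ℝ) =
     ∑ i, (⟪fderiv ℝ V x (stdOrthonormalBasis ℝ E i), stdOrthonormalBasis ℝ E i⟫ - 1) := by
    rw [Finset.sum_sub_distrib]; simp
  have e2 : (Module.finrank ℝ E : ℝ) * L = ∑ i : Fin (Module.finrank ℝ E), L := by simp
  rw [e1, e2]
  refine (Finset.abs_sum_le_sum_abs _ _).trans (Finset.sum_le_sum fun i _ => ?_)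
  have := q (stdOrthonormalBasis ℝ E i)
  rwa [(stdOrthonormalBasis ℝ E).orthonormal.1 i, one_pow, mul_one] at this

namespace Cfg
/-- weight function -/
def gG (ω : E → ℝ) (c y : E) : ℝ := ‖y - c‖ ^ 2 - 2 * ω y
def gb (w : E → E) (c y : E) : E := y - c - w y
def gam (ω : E → ℝ) (w : E → E) (c y : E) : ℝ := gG ω c y * (‖gb w c y‖ ^ 2)⁻¹
def gbe (ω : E → ℝ) (w : E → E) (c y : E) : E := gam ω w c y • gb w c y

set_option maxHeartbeats 1000000 in
lemma frq_loc {ω : E → ℝ} {w : E → E} {c x : E} {A d : ℝ} (hA : 0 ≤ A) (hd : d = ‖x - c‖) (hd0 : 0 < d) (hAd : A * d ≤ 1/100)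
    (r : Reg ω w (A * d ^ 3) (A * d ^ 2) (A * d) x) :
    HasFDerivAt (gG ω c) ((2:ℝ) • innerSL ℝ (gb w c x)) x ∧ LL (gG ω c) x ∧ LL (gb w c) x ∧ LL (gbe ω w c) x
    ∧ LL (fun y => (gam ω w c y)⁻¹) x ∧ 0 < gam ω w c x ∧ ⟪gb w c x, gbe ω w c x⟫ = gG ω c x ∧ ‖x - c‖ ^ 2 / 2 ≤ gG ω c x
    ∧ gG ω c x ≤ 2 * ‖x - c‖ ^ 2
    ∧ ‖gb w c x‖ ≤ 2 * ‖x - c‖ ∧ ‖gbe ω w c x‖ ≤ 2 * ‖x - c‖ ∧ 1/2 ≤ (gam ω w c x)⁻¹ ∧ (gam ω w c x)⁻¹ ≤ 2 ∧ |(gam ω w c x)⁻¹ - 1| ≤ 5 * A * d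
    ∧ Lc (A * d) (fun y => gb w c y - (y - c)) x ∧ Lc (25 * A * d) (fun y => gbe ω w c y - (y - c)) x := by
  have k0 := r.k0
  have k1 := r.k1
  have hAd0 : 0 ≤ A * d := by positivity
  have lX : Lc 1 (fun y : E => y - c) x := ((Lc.id x).sub (Lc.const c x)).mono (by norm_num)
  have lw : Lc (A * d) w x := r.k2
  have lω : Lc (A * d ^ 2) ω x := r.lc
  have lb : Lc (1 + A * d) (gb w c) x := lX.sub lw
  have lX2 : Lc (2 * d) (fun y : E => ‖y - c‖ ^ 2) x := by
    have := lX.inner lX zero_le_one zero_le_one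
    simp only [real_inner_self_eq_norm_sq] at this
    exact this.mono (by rw [← hd]; linarith)
  have lG : Lc (2 * d + 2 * (A * d ^ 2)) (gG ω c) x := by
    have := (Lc.const (2:ℝ) x).mul lω le_rfl (by positivity)
    refine (lX2.sub this).mono ?_
    norm_num
  have hw : ‖w x‖ ≤ d / 100 := by nlinarith
  have hb1 : ‖gb w c x‖ ≤ 1.01 * d := by
    have := norm_sub_le (x - c) (w x); unfold gb; linarith
  have hb2 : 0.99 * d ≤ ‖gb w c x‖ := by
    have := norm_sub_norm_le (x - c) (w x); unfold gb; linarith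
  have hbb : 0.98 * d ^ 2 ≤ ‖gb w c x‖ ^ 2 := by nlinarith
  have hbb0 : 0 < ‖gb w c x‖ ^ 2 := lt_of_lt_of_le (by positivity) hbb
  have lbb : Lc (2.05 * d) (fun y => ‖gb w c y‖ ^ 2) x := by
    have := lb.inner lb (by positivity) (by positivity)
    simp only [real_inner_self_eq_norm_sq] at this
    exact this.mono (by nlinarith)
  have linv : Lc (2.2 / d ^ 3) (fun y => (‖gb w c y‖ ^ 2)⁻¹) x := by
    refine (lbb.inv (by positivity) hbb0).mono ?_
    rw [div_le_div_iff₀ (by positivity) (by positivity)]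
    have : (0.98 * d ^ 2) ^ 2 ≤ (‖gb w c x‖ ^ 2) ^ 2 := pow_le_pow_left₀ (by positivity) hbb 2
    nlinarith [pow_pos hd0 4]
  -- eta
  have heta : ∀ y, gG ω c y - ‖gb w c y‖ ^ 2 = 2 * ⟪y - c, w y⟫ - 2 * ω y - ⟪w y, w y⟫ := fun y => by
    unfold gG gb; rw [norm_sub_sq_real (y - c) (w y), real_inner_self_eq_norm_sq]; ring
  have hXw : |⟪x - c, w x⟫| ≤ d * (A * d ^ 2) := by
    refine (abs_real_inner_le_norm _ _).trans ?_
    rw [← hd]; gcongr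
  have hww : |⟪w x, w x⟫| ≤ d / 100 * (A * d ^ 2) := by
    refine (abs_real_inner_le_norm _ _).trans ?_
    exact mul_le_mul hw k1 (norm_nonneg _) (by positivity)
  have eta0 : |gG ω c x - ‖gb w c x‖ ^ 2| ≤ 4.02 * (A * d ^ 3) := by
    rw [heta]
    have e1 : d * (A * d ^ 2) = A * d ^ 3 := by ring
    have e2 : d / 100 * (A * d ^ 2) = A * d ^ 3 / 100 := by ring
    rw [e1] at hXw; rw [e2] at hww
    have : 0 ≤ A * d ^ 3 := by positivity
    rw [abs_le] at *
    constructor <;> linarith [hXw.1, hXw.2, hww.1, hww.2, k0.1, k0.2]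
  have etaL : Lc (7 * (A * d ^ 2)) (fun y => gG ω c y - ‖gb w c y‖ ^ 2) x := by
    have l1 := (Lc.const (2:ℝ) x).mul (lX.inner lw zero_le_one hAd0) le_rfl (by positivity)
    have l2 := (Lc.const (2:ℝ) x).mul lω le_rfl (by positivity)
    have l3 := lw.inner lw hAd0 hAd0
    refine (((l1.sub l2).sub l3).congr (Eventually.of_forall fun y => heta y)).mono ?_
    rw [← hd]
    norm_num
    have a1 : ‖w x‖ * (A * d) ≤ d / 100 * (A * d) := by gcongr
    have : d / 100 * (A * d) = A * d ^ 2 / 100 := by ring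
    have e1 : d * (A * d) = A * d ^ 2 := by ring
    have : 0 ≤ A * d ^ 2 := by positivity
    linarith
  have hgam : ∀ᶠ y in 𝓝 x, gam ω w c y = 1 + (gG ω c y - ‖gb w c y‖ ^ 2) * (‖gb w c y‖ ^ 2)⁻¹ := by
    filter_upwards [lbb.cont.eventually_const_lt hbb0] with y hy
    have hy' : ‖gb w c y‖ ^ 2 ≠ 0 := ne_of_gt hy
    unfold gam; rw [sub_mul, mul_inv_cancel₀ hy']; ring
  have hi0 : (‖gb w c x‖ ^ 2)⁻¹ ≤ 1.03 * (d ^ 2)⁻¹ := by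
    rw [inv_le_comm₀ hbb0 (by positivity), mul_inv, inv_inv]
    refine le_trans ?_ hbb
    gcongr; norm_num
  have g1 : |gam ω w c x - 1| ≤ 4.2 * (A * d) := by
    rw [hgam.self_of_nhds, add_sub_cancel_left, abs_mul, abs_of_pos (inv_pos.2 hbb0)]
    have := mul_le_mul eta0 hi0 (inv_pos.2 hbb0).le (by positivity)
    refine this.trans ?_
    have e1 : 4.02 * (A * d ^ 3) * (1.03 * (d ^ 2)⁻¹) = (4.02 * 1.03) * (A * d) := by field_simp
    rw [e1]; nlinarith
  have lgam : Lc (17 * A) (gam ω w c) x := by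
    have l1 := etaL.mul linv (by positivity) (by positivity)
    have l2 := ((Lc.const (1:ℝ) x).add l1).congr hgam
    refine l2.mono ?_
    rw [abs_of_pos (inv_pos.2 hbb0)]
    have a1 : |gG ω c x - ‖gb w c x‖ ^ 2| * (2.2 / d ^ 3) ≤ 4.02 * (A * d ^ 3) * (2.2 / d ^ 3) := by gcongr
    have a2 : 7 * (A * d ^ 2) * (‖gb w c x‖ ^ 2)⁻¹ ≤ 7 * (A * d ^ 2) * (1.03 * (d ^ 2)⁻¹) := by gcongr
    have e1 : 4.02 * (A * d ^ 3) * (2.2 / d ^ 3) = 4.02 * 2.2 * A := by field_simp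
    have e2 : 7 * (A * d ^ 2) * (1.03 * (d ^ 2)⁻¹) = 7 * 1.03 * A := by field_simp
    linarith
  have gpos : 0.95 ≤ gam ω w c x := by have := (abs_le.1 g1).1; linarith
  have gup : gam ω w c x ≤ 1.05 := by have := (abs_le.1 g1).2; linarith
  have gp : 0 < gam ω w c x := by linarith
  have lbe : Lc (17 * A * (1.01 * d) + 1.05 * (1 + A * d)) (gbe ω w c) x := by
    refine (lgam.smul lb (by positivity) (by positivity)).mono ?_
    rw [abs_of_pos gp]
    have : gam ω w c x * (1 + A * d) ≤ 1.05 * (1 + A * d) := by gcongr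
    have : 17 * A * ‖gb w c x‖ ≤ 17 * A * (1.01 * d) := by gcongr
    linarith
  have kk : A * d ^ 3 ≤ d ^ 2 / 100 := by
    have : A * d ^ 3 = (A * d) * d ^ 2 := by ring
    rw [this]; nlinarith [sq_nonneg d]
  refine ⟨?_, lG.LL, lb.LL, lbe.LL, (lgam.inv (by positivity) gp).LL, gp, ?_, ?_, ?_, by rw [← hd]; linarith, ?_, ?_, ?_, ?_, ?_, ?_⟩
  · have h1 : HasFDerivAt (fun y : E => ‖y - c‖ ^ 2) ((2:ℝ) • innerSL ℝ (x - c)) x :=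
      (((hasFDerivAt_id x).sub_const c).norm_sq).congr_fderiv (by ext v; simp)
    have := h1.sub (r.d.self_of_nhds.const_mul 2)
    refine this.congr_fderiv ?_
    ext v; simp [gb, inner_sub_left]; ring
  · unfold gbe; rw [inner_smul_right, real_inner_self_eq_norm_sq]; unfold gam; rw [mul_assoc, inv_mul_cancel₀ hbb0.ne', mul_one]
  · rw [← hd]; unfold gG; rw [← hd]
    have := (abs_le.1 k0).2
    nlinarith
  · rw [← hd]; unfold gG; rw [← hd]
    have := (abs_le.1 k0).1
    nlinarith
  · unfold gbe; rw [norm_smul, Real.norm_of_nonneg gp.le, ← hd]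
    have := mul_le_mul gup hb1 (norm_nonneg _) (by norm_num)
    linarith
  · rw [le_inv_comm₀ (by norm_num) gp]; linarith
  · rw [inv_le_comm₀ gp (by norm_num)]; linarith
  · have e1 : (gam ω w c x)⁻¹ - 1 = (1 - gam ω w c x) * (gam ω w c x)⁻¹ := by field_simp
    have hi : (gam ω w c x)⁻¹ ≤ 1.06 := by
      rw [inv_le_comm₀ gp (by norm_num)]; refine le_trans ?_ gpos; norm_num
    rw [e1, abs_mul, abs_sub_comm, abs_of_pos (inv_pos.2 gp)]
    have := mul_le_mul g1 hi (inv_pos.2 gp).le (by positivity)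
    linarith
  · refine lw.neg.congr (Eventually.of_forall fun y => ?_)
    unfold gb; abel
  · have l1 := ((lgam.sub (Lc.const (1:ℝ) x)).smul lb (by positivity) (by positivity)).sub lw
    refine (l1.congr (Eventually.of_forall fun y => ?_)).mono ?_
    · simp only [gbe, gb, sub_smul, one_smul]; abel
    · have a1 : |gam ω w c x - 1| * (1 + A * d) ≤ 4.2 * (A * d) * 1.01 := mul_le_mul g1 (by linarith) (by positivity) (by positivity)
      have a2 : (17 * A + 0) * ‖gb w c x‖ ≤ (17 * A + 0) * (1.01 * d) := by gcongr
      linarith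

variable [MeasurableSpace E] [BorelSpace E]
variable {t h : E → ℝ} {n : E → E} {e p : E} {R τ M : ℝ}

lemma frq (C : Cfg t h n e p R τ M) {c : E} {r1 a S : ℝ} (hc : t c = 0) (hr1 : 0 < r1) (hsub : ball c (4 * r1) ⊆ ball p (R/3))
    (ha : a = (Module.finrank ℝ E : ℝ) * (6 * M)) (hM : a * r1 ≤ 1/20000) (hS : 0 < S)
    (hb : ∀ y ∈ ball c (2 * r1), 0 ≤ t y → |h y| ≤ S) :
    Frq t h (gG (omg t c) c) (fun y => (gam (omg t c) (omV t n c) c y)⁻¹) (gb (omV t n c) c) (gbe (omg t c) (omV t n c) c)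
      e c r1 (30 * (Module.finrank ℝ E : ℝ) * (200 * a)) (S * (1 + 3 * LC E / r1)) := by
  have hM0 := C.M0
  have hm1 : 1 ≤ (Module.finrank ℝ E : ℝ) := by
    have : 0 < Module.finrank ℝ E := by
      rw [Module.finrank_pos_iff]
      exact ⟨⟨e, 0, fun h0 => by have := C.he; rw [h0, norm_zero] at this; norm_num at this⟩⟩
    exact_mod_cast this
  have ha0 : 0 ≤ a := by rw [ha]; positivity
  have hMa : 6 * M ≤ a := by rw [ha]; nlinarith
  have hsubR : ball p (R/3) ⊆ ball p R := by
    by_cases hR : 0 ≤ R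
    · exact ball_subset_ball (by linarith)
    · rw [ball_eq_empty.2 (by linarith)]; exact empty_subset _
  have hLC := LC_pos (E := E)
  have sub1 : ball c r1 ⊆ ball p (R/3) := (ball_subset_ball (by linarith)).trans hsub
  have reg : ∀ x ∈ ball c r1, 0 < t x → _ := fun x hx htx => C.omg_reg hc hsub ha hM hx htx
  have loc : ∀ x ∈ ball c r1, 0 < t x → _ := fun x hx htx => by
    have hd0 : 0 < ‖x - c‖ := by
      rw [norm_pos_iff, sub_ne_zero]; rintro rfl; rw [hc] at htx; exact lt_irrefl _ htx
    have hdr : ‖x - c‖ < r1 := by rw [← dist_eq_norm]; exact hx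
    exact frq_loc (by positivity : 0 ≤ 200 * a) rfl hd0 (by nlinarith) (reg x hx htx).1
  have quad : ∀ x ∈ ball c r1, 0 < t x → DifferentiableAt ℝ (gbe (omg t c) (omV t n c) c) x → _ := fun x hx htx hd =>
    quad_of_Lc (by positivity) (loc x hx htx).2.2.2.2.2.2.2.2.2.2.2.2.2.2.2 hd
  refine ⟨C.te, C.he, LipschitzWith.of_dist_le_mul fun x y => ?_, hr1, by positivity, fun x hx htx => C.hh x (hsubR (sub1 hx)) htx,
    fun x hx htx => ?_, fun x hx htx => ?_, fun x hx htx => (loc x hx htx).1, fun x hx htx => (loc x hx htx).2.1, 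
    fun x hx htx => (loc x hx htx).2.2.1, fun x hx htx => (loc x hx htx).2.2.2.1, fun x hx htx => (loc x hx htx).2.2.2.2.1,
    fun x hx htx => ?_, fun x hx htx => (loc x hx htx).2.2.2.2.2.2.1, fun x hx htx => (loc x hx htx).2.2.2.2.2.2.2.1, 
    fun x hx htx => (loc x hx htx).2.2.2.2.2.2.2.2.2.1, fun x hx htx => (loc x hx htx).2.2.2.2.2.2.2.2.2.2.1,
    fun x hx htx => (loc x hx htx).2.2.2.2.2.2.2.2.2.2.2.1, fun x hx htx => (loc x hx htx).2.2.2.2.2.2.2.2.2.2.2.2.1,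
    fun x hx htx hd => ?_, fun x hx htx hd => ?_, fun x hx htx hd v => ?_, fun y hy hty => ?_, fun y hy hty => ?_⟩
  · rw [dist_eq_norm, dist_eq_norm]; exact_mod_cast C.tlip' x y
  · refine (hb x (ball_subset_ball (by linarith) hx) htx.le).trans ?_
    have : 0 ≤ 3 * LC E / r1 := by positivity
    nlinarith
  · rw [gr_norm]
    have hs2 : ball x r1 ⊆ ball c (2 * r1) := ball_subset_ball' (by rw [mem_ball] at hx; linarith)
    refine (C.grad_M hr1 hS (by nlinarith) (hs2.trans ((ball_subset_ball (by linarith)).trans (hsub.trans hsubR))) (fun y hy => hb y (hs2 hy)) htx).trans ?_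
    have : S * (1 + 3 * LC E / r1) = S + 3 * LC E * S / r1 := by ring
    rw [this]; linarith
  · have := (loc x hx htx).2.2.2.2.2.1
    unfold gbe; rw [smul_smul, inv_mul_cancel₀ this.ne', one_smul]
  · have l := (loc x hx htx).2.2.2.2.2.2.2.2.2.2.2.2.2
    have q := (quad_of_Lc (by positivity) l.2.1 hd).2
    have e1 : dv (gb (omV t n c) c) x - (Module.finrank ℝ E : ℝ) * (gam (omg t c) (omV t n c) c x)⁻¹ =
      (dv (gb (omV t n c) c) x - (Module.finrank ℝ E : ℝ)) - (Module.finrank ℝ E : ℝ) * ((gam (omg t c) (omV t n c) c x)⁻¹ - 1) := by ring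
    rw [e1]
    refine (abs_sub _ _).trans ?_
    rw [abs_mul, abs_of_nonneg (by positivity : 0 ≤ (Module.finrank ℝ E : ℝ))]
    have := mul_le_mul_of_nonneg_left l.1 (by positivity : 0 ≤ (Module.finrank ℝ E : ℝ))
    have : 0 ≤ (Module.finrank ℝ E : ℝ) * (200 * a) * ‖x - c‖ := by positivity
    nlinarith
  · refine (quad x hx htx hd).2.trans ?_
    have : 0 ≤ (Module.finrank ℝ E : ℝ) * (200 * a) * ‖x - c‖ := by positivity
    nlinarith
  · refine ((quad x hx htx hd).1 v).trans ?_
    have : 0 ≤ 200 * a * ‖x - c‖ := by positivity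
    gcongr
    nlinarith
  · rw [(C.hasFDerivAt_t (hsubR (sub1 hy))).fderiv]
    refine squeeze_zero_norm' (a := fun s : ℝ => (10 + 6 * M * (2 * r1)) * s) ?_ ?_
    · have hcont : ContinuousAt (fun s : ℝ => y + s • e) 0 := by fun_prop
      have h1 : ∀ᶠ s in 𝓝 (0:ℝ), y + s • e ∈ ball c r1 :=
        hcont.preimage_mem_nhds (isOpen_ball.mem_nhds (by simpa using hy))
      filter_upwards [nhdsWithin_le_nhds h1, self_mem_nhdsWithin] with s hs hs0
      have hts : t (y + s • e) = s := by rw [C.te, hty, zero_add]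
      have hs0' : 0 < s := hs0
      have f1 := (reg _ hs (by rw [hts]; exact hs0)).2
      rw [hts] at f1
      have f2 := (loc _ hs (by rw [hts]; exact hs0)).2.2.2.2.2.2.2.2.2.1
      have f3 := C.n_lip (sub1 hy) (sub1 hs)
      have e1 : y - (y + s • e) = -(s • e) := by abel
      rw [e1, norm_neg, norm_smul, C.he, mul_one, Real.norm_of_nonneg hs0'.le] at f3
      have hdr : ‖y + s • e - c‖ < r1 := by rw [← dist_eq_norm]; exact hs
      have e2 : ⟪n y, gb (omV t n c) c (y + s • e)⟫ = ⟪n (y + s • e), y + s • e - c - omV t n c (y + s • e)⟫ + ⟪n y - n (y + s • e), gb (omV t n c) c (y + s • e)⟫ := by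
        rw [inner_sub_left]; unfold gb; ring
      rw [innerSL_apply_apply, e2, Real.norm_eq_abs]
      refine (abs_add_le _ _).trans ?_
      have f4 := (abs_real_inner_le_norm (n y - n (y + s • e)) (gb (omV t n c) c (y + s • e))).trans 
        (mul_le_mul f3 (f2.trans (by linarith : _ ≤ 2 * r1)) (norm_nonneg _) (by positivity))
      linarith
    · have : Tendsto (fun s : ℝ => (10 + 6 * M * (2 * r1)) * s) (𝓝 0) (𝓝 ((10 + 6 * M * (2 * r1)) * 0)) := by
        exact tendsto_id.const_mul _
      rw [mul_zero] at this
      exact this.mono_left nhdsWithin_le_nhds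
  · obtain ⟨ℓ, h1, h2⟩ := C.grad_tendsto (hsubR (sub1 hy)) hty
    rw [(C.hasFDerivAt_t (hsubR (sub1 hy))).fderiv]
    have h3 : Tendsto (fun s : ℝ => fderiv ℝ h (y + s • e) (n y)) (𝓝[>] 0) (𝓝 (ℓ (n y))) :=
      ((ContinuousLinearMap.apply ℝ ℝ (n y)).continuous.tendsto ℓ).comp h2
    rw [h1] at h3
    refine h3.congr fun s => ?_
    rw [innerSL_apply_apply, real_inner_comm, gr_inner]
end Cfg
end NodalNeumann

end

noncomputable section
open MeasureTheory Metric Set Filter Asymptotics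
open scoped Topology NNReal ENNReal RealInnerProductSpace
namespace NodalNeumann
set_option linter.all false
variable {E : Type*} [NormedAddCommGroup E] [InnerProductSpace ℝ E] [FiniteDimensional ℝ E]
variable [MeasurableSpace E] [BorelSpace E]

/-- mass in a ball above the graph -/
def HH (t u : E → ℝ) (c : E) (r : ℝ) : ℝ := ∫ x in {x | 0 < t x} ∩ ball c r, u x ^ 2

namespace Frq
variable {t u G μ : E → ℝ} {b β : E → E} {e c : E} {r1 C S : ℝ}

lemma HH_int (f : Frq t u G μ b β e c r1 C S) {r : ℝ} (hr : r ≤ r1) : IntegrableOn (fun x => u x ^ 2) ({x | 0 < t x} ∩ ball c r) := by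
  have : IntegrableOn (fun x => u x ^ 2) (dom t c r1) :=
    f.integrable (B := S ^ 2) (fun x hx => (f.cu hx).pow 2) fun x hx => by
      rw [abs_pow]; exact pow_le_pow_left₀ (abs_nonneg _) (f.uS x hx.2 hx.1) 2
  exact this.mono_set (inter_subset_inter_right _ (ball_subset_ball hr))

lemma wi_lo (f : Frq t u G μ b β e c r1 C S) {r : ℝ} (hr : 0 < r) (hr1 : 4 * r ≤ r1) :
    r ^ 4 / 4 * HH t u c (r / 4) ≤ wi t G c r1 2 (fun x => u x ^ 2 * μ x) r := by
  unfold HH wi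
  rw [← integral_const_mul]
  have hsub : {x | 0 < t x} ∩ ball c (r/4) ⊆ dom t c r1 := inter_subset_inter_right _ (ball_subset_ball (by linarith))
  have hi : IntegrableOn (fun x => ph G r x ^ 2 * (u x ^ 2 * μ x)) (dom t c r1) :=
    f.wi_int 2 (g := fun x => u x ^ 2 * μ x) (B := S ^ 2 * 2) (fun x hx => ((f.cu hx).pow 2).mul (f.cμ hx)) (fun x hx => by
      rw [abs_mul, abs_pow, abs_of_nonneg (by linarith [f.μlo x hx.2 hx.1] : 0 ≤ μ x)]
      exact mul_le_mul (pow_le_pow_left₀ (abs_nonneg _) (f.uS x hx.2 hx.1) 2) (f.μup x hx.2 hx.1) (by linarith [f.μlo x hx.2 hx.1]) (by positivity)) r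
  have hp : ∀ x ∈ dom t c r1, 0 ≤ ph G r x ^ 2 * (u x ^ 2 * μ x) := fun x hx => by
    have := f.μlo x hx.2 hx.1
    exact mul_nonneg (sq_nonneg _) (mul_nonneg (sq_nonneg _) (by linarith))
  refine le_trans ?_ (setIntegral_mono_set hi ((ae_restrict_iff' f.dom_meas).2 (Eventually.of_forall hp)) hsub.eventuallyLE)
  have hm : MeasurableSet ({x | 0 < t x} ∩ ball c (r/4)) := (measurableSet_lt measurable_const f.tl.continuous.measurable).inter measurableSet_ball
  refine setIntegral_mono_on ((f.HH_int (by linarith)).const_mul _) (hi.mono_set hsub) hm fun x hx => ?_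
  have hx' := hsub hx
  have g1 : G x ≤ (2 * ‖x - c‖) * (2 * ‖x - c‖) := by
    rw [← f.Gb x hx'.2 hx'.1]
    exact (real_inner_le_norm _ _).trans (mul_le_mul (f.bup x hx'.2 hx'.1) (f.βup x hx'.2 hx'.1) (norm_nonneg _) (by positivity))
  have hd : ‖x - c‖ < r / 4 := by rw [← dist_eq_norm]; exact hx.2
  have g2 : 3 / 4 * r ^ 2 ≤ ph G r x := by
    refine le_trans ?_ (le_max_left _ _)
    nlinarith [norm_nonneg (x - c)]
  have g3 : (3 / 4 * r ^ 2) ^ 2 ≤ ph G r x ^ 2 := pow_le_pow_left₀ (by positivity) g2 2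
  have g4 := f.μlo x hx'.2 hx'.1
  have g5 : r ^ 4 / 2 ≤ ph G r x ^ 2 := by nlinarith [pow_pos hr 4]
  have : u x ^ 2 * (1 / 2) ≤ u x ^ 2 * μ x := by gcongr
  calc r ^ 4 / 4 * u x ^ 2 = r ^ 4 / 2 * (u x ^ 2 * (1 / 2)) := by ring
    _ ≤ _ := by gcongr

lemma wi_up (f : Frq t u G μ b β e c r1 C S) {r : ℝ} (hr : 0 < r) (hr1 : 4 * r ≤ r1) :
    wi t G c r1 2 (fun x => u x ^ 2 * μ x) r ≤ r ^ 4 * 2 * HH t u c (2 * r) := by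
  unfold HH wi
  rw [← integral_const_mul]
  have hsub : {x | 0 < t x} ∩ ball c (2*r) ⊆ dom t c r1 := inter_subset_inter_right _ (ball_subset_ball (by linarith))
  have e1 : ∫ x in dom t c r1, ph G r x ^ 2 * (u x ^ 2 * μ x) = ∫ x in {x | 0 < t x} ∩ ball c (2*r), ph G r x ^ 2 * (u x ^ 2 * μ x) := by
    apply setIntegral_eq_of_subset_of_forall_diff_eq_zero f.dom_meas hsub
    intro x hx
    have : x ∉ ball c (2 * r) := fun h => hx.2 ⟨hx.1.1, h⟩
    rw [f.ph_zero hr hx.1 this]; ring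
  rw [e1]
  have hi : IntegrableOn (fun x => ph G r x ^ 2 * (u x ^ 2 * μ x)) (dom t c r1) :=
    f.wi_int 2 (g := fun x => u x ^ 2 * μ x) (B := S ^ 2 * 2) (fun x hx => ((f.cu hx).pow 2).mul (f.cμ hx)) (fun x hx => by
      rw [abs_mul, abs_pow, abs_of_nonneg (by linarith [f.μlo x hx.2 hx.1] : 0 ≤ μ x)]
      exact mul_le_mul (pow_le_pow_left₀ (abs_nonneg _) (f.uS x hx.2 hx.1) 2) (f.μup x hx.2 hx.1) (by linarith [f.μlo x hx.2 hx.1]) (by positivity)) r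
  have hm : MeasurableSet ({x | 0 < t x} ∩ ball c (2*r)) := (measurableSet_lt measurable_const f.tl.continuous.measurable).inter measurableSet_ball
  refine setIntegral_mono_on (hi.mono_set hsub) ((f.HH_int (by linarith)).const_mul _) hm fun x hx => ?_
  have hx' := hsub hx
  have g1 := f.μup x hx'.2 hx'.1
  have g3 : ph G r x ^ 2 ≤ (r ^ 2) ^ 2 := pow_le_pow_left₀ (ph_nonneg r x) (f.ph_le hx') 2
  have g4 := f.μlo x hx'.2 hx'.1
  calc ph G r x ^ 2 * (u x ^ 2 * μ x) ≤ (r ^ 2) ^ 2 * (u x ^ 2 * 2) := by gcongr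
    _ = _ := by ring

lemma HH_nonneg (r : ℝ) : 0 ≤ HH t u c r := integral_nonneg fun x => sq_nonneg _

/-- doubling with explicit constant -/
def Kd (m C r0 S V κ : ℝ) : ℝ := m + 4 + 5 * C * r0 + Real.exp (2 * (5 * C) * r0) * ((r0 ^ 6 * S ^ 2 * V) / (r0 ^ 4 / 4 * κ)) / 3

lemma doub (f : Frq t u G μ b β e c r1 C S) {r0 κ V : ℝ} (hr0 : 0 < r0) (hr1 : 4 * r0 ≤ r1) (hκ : 0 < κ) (hκ' : κ ≤ HH t u c (r0/4))
    (hV : volume.real (ball c r1) ≤ V) :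
    ∀ r, 0 < r → 16 * r ≤ r0 → 0 < HH t u c r ∧ HH t u c (4 * r) ≤ 32 ^ (Kd (Module.finrank ℝ E) C r0 S V κ) * HH t u c r := by
  have h1 := f.wi_lo hr0 hr1
  have h2 : r0 ^ 4 / 4 * κ ≤ wi t G c r1 2 (fun x => u x ^ 2 * μ x) r0 := le_trans (by gcongr) h1
  have hp : 0 < wi t G c r1 2 (fun x => u x ^ 2 * μ x) r0 := lt_of_lt_of_le (by positivity) h2
  have hnum : wi t G c r1 3 (fun x => ‖gr u x‖^2) r0 ≤ r0 ^ 6 * S ^ 2 * V := by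
    unfold wi
    have : ‖∫ x in dom t c r1, ph G r0 x ^ 3 * ‖gr u x‖ ^ 2‖ ≤ (r0 ^ 6 * S ^ 2) * volume.real (dom t c r1) := by
      refine norm_setIntegral_le_of_norm_le_const dom_fin fun x hx => ?_
      rw [norm_mul, norm_pow, norm_pow, norm_norm, Real.norm_of_nonneg (ph_nonneg r0 x)]
      have : ph G r0 x ^ 3 ≤ (r0 ^ 2) ^ 3 := pow_le_pow_left₀ (ph_nonneg r0 x) (f.ph_le hx) 3
      have h3 : ‖gr u x‖ ^ 2 ≤ S ^ 2 := pow_le_pow_left₀ (norm_nonneg _) (f.gS x hx.2 hx.1) 2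
      calc _ ≤ (r0 ^ 2) ^ 3 * S ^ 2 := by gcongr
        _ = _ := by ring
    refine (le_abs_self _).trans (this.trans ?_)
    have : volume.real (dom t c r1) ≤ V := (measureReal_mono inter_subset_right measure_ball_lt_top.ne).trans hV
    gcongr
  have hC := f.C0
  have hV0 : 0 ≤ V := measureReal_nonneg.trans hV
  have M := f.main (K := Kd (Module.finrank ℝ E) C r0 S V κ) hr0 hr1 hp (by
    unfold Kd
    gcongr)
  set K := Kd (Module.finrank ℝ E) C r0 S V κ with hKd
  intro r hr hr16
  obtain ⟨p1, p2⟩ := M (r/2) ⟨by positivity, by linarith⟩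
  have a1 := f.wi_up (r := r/2) (by positivity) (by linarith)
  have a2 := f.wi_lo (r := 16 * r) (by positivity) (by linarith)
  have a3 := p2 (16 * r) ⟨by linarith, hr16⟩
  rw [show 2 * (r / 2) = r by ring] at a1
  rw [show 16 * r / 4 = 4 * r by ring] at a2
  rw [show 16 * r / (r / 2) = 32 by field_simp; norm_num] at a3
  have hK32 : 0 < (32:ℝ) ^ K := by positivity
  constructor
  · by_contra hcon
    have : HH t u c r ≤ 0 := not_lt.1 hcon
    have : (r/2) ^ 4 * 2 * HH t u c r ≤ 0 := mul_nonpos_of_nonneg_of_nonpos (by positivity) this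
    linarith
  · have a4 : (32:ℝ) ^ K * wi t G c r1 2 (fun x => u x ^ 2 * μ x) (r/2) ≤ (32:ℝ) ^ K * ((r/2) ^ 4 * 2 * HH t u c r) := by gcongr
    have a5 : (16 * r) ^ 4 / 4 * HH t u c (4 * r) ≤ (32:ℝ) ^ K * ((r/2) ^ 4 * 2 * HH t u c r) := by linarith
    have h0 : 0 ≤ (32:ℝ) ^ K * HH t u c r := mul_nonneg hK32.le (HH_nonneg r)
    have hr4 : 0 < r ^ 4 := by positivity
    have a6 : r ^ 4 * HH t u c (4 * r) ≤ r ^ 4 * ((32:ℝ) ^ K * HH t u c r) := by nlinarith [mul_nonneg hr4.le h0, mul_nonneg hr4.le (HH_nonneg (t := t) (u := u) (c := c) (4 * r))]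
    exact le_of_mul_le_mul_left a6 hr4
end Frq

lemma frq_interior {u : E → ℝ} {e c : E} (he : ‖e‖ = 1) {r1 S : ℝ} (hr1 : 0 < r1) (hh : ∀ x ∈ ball c r1, HarmAt u x)
    (hS : ∀ x ∈ ball c r1, |u x| ≤ S) (hS' : ∀ x ∈ ball c r1, ‖gr u x‖ ≤ S) :
    Frq (fun x => ⟪x - c, e⟫ + 2 * r1) u (fun x => ‖x - c‖ ^ 2) (fun _ => 1) (fun x => x - c) (fun x => x - c) e c r1 0 S := by
  have lX : ∀ x, LL (fun y : E => y - c) x := fun x => ((Lc.id x).sub (Lc.const c x)).LL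
  have hfd : ∀ x, fderiv ℝ (fun y : E => y - c) x = ContinuousLinearMap.id ℝ E := fun x => by
    rw [fderiv_sub_const]; exact fderiv_id'
  have hdv : ∀ x, dv (fun y : E => y - c) x = Module.finrank ℝ E := fun x => by
    unfold dv; rw [hfd]; simp
  have tpos : ∀ x ∈ ball c r1, 0 < ⟪x - c, e⟫ + 2 * r1 := fun x hx => by
    have := (abs_le.1 (abs_real_inner_le_norm (x - c) e)).1
    rw [mem_ball, dist_eq_norm] at hx
    rw [he, mul_one] at this; linarith
  refine ⟨fun x s => ?_, he, ?_, hr1, le_rfl, fun x hx _ => hh x hx, fun x hx _ => hS x hx, fun x hx _ => hS' x hx, fun x hx _ => ?_, fun x _ _ => ?_,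
    fun x _ _ => lX x, fun x _ _ => lX x, fun x _ _ => LL.const _, fun x _ _ => (one_smul _ _).symm, fun x _ _ => real_inner_self_eq_norm_sq _,
    fun x _ _ => by linarith [sq_nonneg ‖x - c‖], fun x _ _ => by linarith [norm_nonneg (x - c)], fun x _ _ => by linarith [norm_nonneg (x - c)], fun x _ _ => by norm_num, fun x _ _ => by norm_num,
    fun x _ _ _ => by rw [hdv]; simp, fun x _ _ _ => by rw [hdv]; simp, fun x _ _ _ v => by rw [hfd]; simp, fun y hy h0 => ?_, fun y hy h0 => ?_⟩
  · rw [show x + s • e - c = (x - c) + s • e by abel, inner_add_left, inner_smul_left, real_inner_self_eq_norm_sq, he]; simp; ring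
  · refine LipschitzWith.of_dist_le_mul fun x y => ?_
    rw [Real.dist_eq, dist_eq_norm, add_sub_add_right_eq_sub, ← inner_sub_left, sub_sub_sub_cancel_right]
    refine (abs_real_inner_le_norm _ _).trans ?_
    rw [he, mul_one]; push_cast; linarith [norm_nonneg (x - y)]
  · exact (((hasFDerivAt_id x).sub_const c).norm_sq).congr_fderiv (by ext v; simp)
  · have := (lX x).inner (lX x)
    exact this.congr (Eventually.of_forall fun y => (real_inner_self_eq_norm_sq _).symm)
  · exact absurd h0 (tpos y hy).ne'
  · exact absurd h0 (tpos y hy).ne'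
end NodalNeumann

end

noncomputable section
open MeasureTheory Metric Set Filter Asymptotics
open scoped Topology NNReal ENNReal RealInnerProductSpace
namespace NodalNeumann
set_option linter.all false
variable {E : Type*} [NormedAddCommGroup E] [InnerProductSpace ℝ E] [FiniteDimensional ℝ E]
variable [MeasurableSpace E] [BorelSpace E]

/-- interior goodness -/
structure IGd (u : E → ℝ) (c : E) (r1 S : ℝ) : Prop where
  hh : ∀ x ∈ ball c r1, HarmAt u x
  hS : ∀ x ∈ ball c r1, |u x| ≤ S
  hS' : ∀ x ∈ ball c r1, ‖gr u x‖ ≤ S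

/-- interior mass -/
def IM (u : E → ℝ) (c : E) (r : ℝ) : ℝ := ∫ x in ball c r, u x ^ 2

lemma IM_nonneg (u : E → ℝ) (c : E) (r : ℝ) : 0 ≤ IM u c r := integral_nonneg fun x => sq_nonneg _

lemma IGd.int {u : E → ℝ} {c : E} {r1 S : ℝ} (g : IGd u c r1 S) : IntegrableOn (fun x => u x ^ 2) (ball c r1) := by
  refine IntegrableOn.of_bound measure_ball_lt_top ?_ (S ^ 2) ?_
  · refine ContinuousOn.aestronglyMeasurable (β := ℝ) (fun x hx => ?_) measurableSet_ball
    exact ((g.hh x hx).LL.continuousAt.pow 2).continuousWithinAt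
  · refine (ae_restrict_iff' measurableSet_ball).2 (Eventually.of_forall fun x hx => ?_)
    rw [norm_pow, Real.norm_eq_abs]; exact pow_le_pow_left₀ (abs_nonneg _) (g.hS x hx) 2

lemma IGd.IM_mono {u : E → ℝ} {c c' : E} {r1 S r r' : ℝ} (g : IGd u c r1 S) (hs : ball c' r' ⊆ ball c r) (hr : r ≤ r1) : IM u c' r' ≤ IM u c r :=
  setIntegral_mono_set (g.int.mono_set (ball_subset_ball hr)) (Eventually.of_forall fun x => sq_nonneg _) hs.eventuallyLE

lemma int_doub {r1 S κ : ℝ} (hr1 : 0 < r1) (hκ : 0 < κ) : ∃ D : ℝ, 1 ≤ D ∧ ∀ (u : E → ℝ) (e c : E), ‖e‖ = 1 → IGd u c r1 S →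
    κ ≤ IM u c (r1/16) → ∀ r, 0 < r → 64 * r ≤ r1 → 0 < IM u c r ∧ IM u c (4 * r) ≤ D * IM u c r := by
  obtain ⟨V, hV⟩ : ∃ V, V = r1 ^ (Module.finrank ℝ E) * volume.real (ball (0:E) 1) := ⟨_, rfl⟩
  have hV0 : 0 ≤ V := by rw [hV]; positivity
  refine ⟨32 ^ (Frq.Kd (Module.finrank ℝ E) 0 (r1/4) S V κ), ?_, fun u e c he g hk r hr hr64 => ?_⟩
  · apply Real.one_le_rpow (by norm_num)
    unfold Frq.Kd; positivity
  · have f := frq_interior he hr1 g.hh g.hS g.hS'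
    have tpos : ∀ x ∈ ball c r1, 0 < ⟪x - c, e⟫ + 2 * r1 := fun x hx => by
      have := (abs_le.1 (abs_real_inner_le_norm (x - c) e)).1
      rw [mem_ball, dist_eq_norm] at hx
      rw [he, mul_one] at this; linarith
    have eq : ∀ r, r ≤ r1 → HH (fun x => ⟪x - c, e⟫ + 2 * r1) u c r = IM u c r := fun r hr => by
      unfold HH IM
      congr 2
      ext x
      simp only [mem_inter_iff, mem_setOf_eq, and_iff_right_iff_imp]
      exact fun hx => tpos x (ball_subset_ball hr hx)
    have := f.doub (r0 := r1/4) (κ := κ) (V := V) (by positivity) (by linarith) hκ (by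
      rw [eq _ (by linarith), show r1/4/4 = r1/16 by ring]; exact hk) (by rw [vol_ball c hr1, hV]) r hr (by linarith)
    rwa [eq _ (by linarith), eq _ (by linarith)] at this

lemma IGd.mono {u : E → ℝ} {c c' : E} {r1 r1' S : ℝ} (g : IGd u c r1 S) (h : ball c' r1' ⊆ ball c r1) : IGd u c' r1' S :=
  ⟨fun x hx => g.hh x (h hx), fun x hx => g.hS x (h hx), fun x hx => g.hS' x (h hx)⟩

/-- propagation of mass -/
lemma chain {r1 S : ℝ} (hr1 : 0 < r1) (N : ℕ) : ∀ κ : ℝ, 0 < κ → ∃ κ' > 0, ∀ (u : E → ℝ) (e z w : E), ‖e‖ = 1 →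
    (∀ x ∈ segment ℝ z w, IGd u x r1 S) → ‖w - z‖ ≤ N * (r1 / 32) → κ ≤ IM u z (r1/32) → κ' ≤ IM u w (r1/32) := by
  induction N with
  | zero =>
    intro κ hκ
    refine ⟨κ, hκ, fun u e z w he g hd hk => ?_⟩
    have : w = z := by
      rw [Nat.cast_zero, zero_mul] at hd
      exact sub_eq_zero.1 (norm_le_zero_iff.1 hd)
    rwa [this]
  | succ N ih =>
    intro κ hκ
    obtain ⟨κ1, hκ1, h1⟩ := ih κ hκ
    obtain ⟨D, hD, h2⟩ := int_doub (E := E) (S := S) hr1 hκ1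
    refine ⟨κ1 / D, by positivity, fun u e z w he g hd hk => ?_⟩
    set w' : E := z + ((N:ℝ) / (N + 1)) • (w - z) with hw'
    have hN1 : (0:ℝ) < N + 1 := by positivity
    have hl : (N:ℝ) / (N + 1) ≤ 1 := by rw [div_le_one hN1]; linarith
    have hws : w' ∈ segment ℝ z w := by
      rw [segment_eq_image']; exact ⟨_, ⟨by positivity, hl⟩, rfl⟩
    push_cast at hd
    have a1 := h1 u e z w' he (fun x hx => g x ((convex_segment z w).segment_subset (left_mem_segment ℝ z w) hws hx)) (by
      rw [hw', add_sub_cancel_left, norm_smul, Real.norm_of_nonneg (by positivity)]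
      rw [div_mul_eq_mul_div, div_le_iff₀ hN1]
      have : (0:ℝ) ≤ N := by positivity
      nlinarith) hk
    have hdw : ‖w' - w‖ ≤ r1 / 32 := by
      have : w' - w = -(((1:ℝ) / (N + 1)) • (w - z)) := by
        rw [hw', ← smul_neg, neg_sub]
        have : (N:ℝ) / (N+1) = 1 - 1 / (N+1) := by field_simp; ring
        rw [this, sub_smul, one_smul, smul_sub, smul_sub]; abel
      rw [this, norm_neg, norm_smul, Real.norm_of_nonneg (by positivity), div_mul_eq_mul_div, one_mul, div_le_iff₀ hN1]
      linarith
    have gw := g w (right_mem_segment ℝ z w)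
    have a2 : κ1 ≤ IM u w (r1/16) := a1.trans (gw.IM_mono (ball_subset_ball' (by rw [dist_eq_norm]; linarith)) (by linarith))
    have a3 := (h2 u e w he gw a2 (r1/64) (by positivity) (by linarith)).2
    have a4 : IM u w (r1/64) ≤ IM u w (r1/32) := gw.IM_mono (ball_subset_ball (by linarith)) (by linarith)
    rw [show 4 * (r1/64) = r1/16 by ring] at a3
    rw [div_le_iff₀ (by linarith)]
    have : D * IM u w (r1/64) ≤ D * IM u w (r1/32) := by gcongr
    linarith

/-- unique continuation -/
lemma harm_uc {u : E → ℝ} {U : Set E} {e : E} (he : ‖e‖ = 1) (hU : IsOpen U) (hc : IsPreconnected U) (hh : ∀ x ∈ U, HarmAt u x) {a : E} (ha : a ∈ U)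
    (h0 : ∀ᶠ x in 𝓝 a, u x = 0) : ∀ x ∈ U, u x = 0 := by
  set A : Set E := {x | ∀ᶠ y in 𝓝 x, u y = 0} with hA
  have hAo : IsOpen A := isOpen_iff_mem_nhds.2 fun x hx => by
    exact (eventually_eventually_nhds.2 hx)
  have key : ∀ x ∈ U, x ∈ closure A → x ∈ A := by
    intro x hx hxA
    obtain ⟨r, hr, hrU⟩ := Metric.isOpen_iff.1 hU x hx
    have hcb : closedBall x (r/2) ⊆ U := (closedBall_subset_ball (by linarith)).trans hrU
    have c1 : ContinuousOn u (closedBall x (r/2)) := fun y hy => (hh y (hcb hy)).LL.continuousAt.continuousWithinAt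
    have c2 : ContinuousOn (gr u) (closedBall x (r/2)) := fun y hy => (hh y (hcb hy)).LL_gr.continuousAt.continuousWithinAt
    obtain ⟨S1, hS1⟩ := (isCompact_closedBall x (r/2)).exists_bound_of_continuousOn c1
    obtain ⟨S2, hS2⟩ := (isCompact_closedBall x (r/2)).exists_bound_of_continuousOn c2
    set r1 := r/4 with hr1
    obtain ⟨y, hyA, hyx⟩ := Metric.mem_closure_iff.1 hxA (r1/32) (by positivity)
    have hsub : ball y r1 ⊆ closedBall x (r/2) := by
      intro z hz; rw [mem_ball] at hz; rw [mem_closedBall]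
      have := dist_triangle z y x
      rw [dist_comm x y] at hyx; linarith
    have g : IGd u y r1 (max S1 S2) := ⟨fun z hz => hh z (hcb (hsub hz)), fun z hz => (hS1 z (hsub hz)).trans (le_max_left _ _),
      fun z hz => (hS2 z (hsub hz)).trans (le_max_right _ _)⟩
    -- mass vanishes
    have hm : IM u y (r1/16) = 0 := by
      by_contra hne
      have hpos : 0 < IM u y (r1/16) := lt_of_le_of_ne (IM_nonneg _ _ _) (Ne.symm hne)
      obtain ⟨D, hD, h2⟩ := int_doub (E := E) (S := max S1 S2) (show 0 < r1 by positivity) hpos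
      obtain ⟨ε, hε, hb⟩ := Metric.eventually_nhds_iff_ball.1 (show ∀ᶠ z in 𝓝 y, u z = 0 from hyA)
      have := (h2 u e y he g le_rfl (min ε (r1/64)) (by positivity) (by linarith [min_le_right ε (r1/64)])).1
      have h3 : IM u y (min ε (r1/64)) = 0 := by
        unfold IM
        refine setIntegral_eq_zero_of_forall_eq_zero fun z hz => ?_
        rw [hb z (ball_subset_ball (min_le_left _ _) hz)]; norm_num
      linarith
    have hx' : x ∈ ball y (r1/16) := by rw [mem_ball]; linarith
    -- so u vanishes on the ball
    have hz : ∀ z ∈ ball y (r1/16), u z = 0 := by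
      have hi := g.int.mono_set (ball_subset_ball (by linarith : r1/16 ≤ r1))
      have h1 := (setIntegral_eq_zero_iff_of_nonneg_ae (Eventually.of_forall fun z => sq_nonneg (u z)) hi).1 hm
      have h2 : ContinuousOn (fun z => u z ^ 2) (ball y (r1/16)) := fun z hz => 
        ((hh z (hcb (hsub (ball_subset_ball (by linarith) hz)))).LL.continuousAt.pow 2).continuousWithinAt
      have h3 := Measure.eqOn_open_of_ae_eq (f := fun z => u z ^ 2) (g := fun _ => (0:ℝ)) h1 isOpen_ball h2 continuousOn_const
      intro z hz
      exact pow_eq_zero_iff (two_ne_zero) |>.1 (h3 hz)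
    exact eventually_of_mem (isOpen_ball.mem_nhds hx') hz
  have hsub : U ⊆ A := hc.subset_of_closure_inter_subset hAo ⟨a, ha, h0⟩ fun x hx => key x hx.2 hx.1
  exact fun x hx => (hsub hx).self_of_nhds
end NodalNeumann

end

noncomputable section
open MeasureTheory Metric Set Filter Asymptotics
open scoped Topology NNReal ENNReal RealInnerProductSpace
namespace NodalNeumann
set_option linter.all false
variable {E : Type*} [NormedAddCommGroup E] [InnerProductSpace ℝ E] [FiniteDimensional ℝ E]
variable [MeasurableSpace E] [BorelSpace E]

lemma HH_nonneg (t u : E → ℝ) (c : E) (r : ℝ) : 0 ≤ HH t u c r := integral_nonneg fun x => sq_nonneg _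

lemma HH_scale (t u : E → ℝ) (q c : E) {l : ℝ} (hl : 0 < l) (κ r : ℝ) :
    HH (fun x => t (q + l • x) / l) (fun x => κ * u (q + l • x)) c r
      = κ ^ 2 * (l ^ Module.finrank ℝ E)⁻¹ * HH t u (q + l • c) (l * r) := by
  have key : ∀ x, {x | 0 < t (q + l • x) / l} x ↔ 0 < t (q + l • x) := fun x => by
    show 0 < t (q + l • x) / l ↔ _
    constructor
    · intro h; by_contra h'; have := div_nonpos_of_nonpos_of_nonneg (not_lt.1 h') hl.le; linarith
    · intro h; positivity
  have hsets : ({x | 0 < t (q + l • x) / l} ∩ ball c r) = (fun x => q + l • x) ⁻¹' ({x | 0 < t x} ∩ ball (q + l • c) (l * r)) := by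
    ext x
    simp only [mem_inter_iff, mem_preimage, mem_setOf_eq, mem_ball, dist_eq_norm]
    have : q + l • x - (q + l • c) = l • (x - c) := by rw [smul_sub]; abel
    rw [this, norm_smul, Real.norm_of_nonneg hl.le]
    exact and_congr (key x) (mul_lt_mul_iff_right₀ hl).symm
  unfold HH
  rw [hsets]
  have hmap : Topology.IsClosedEmbedding (fun x : E => q + l • x) := 
    ((Homeomorph.smulOfNeZero l hl.ne').trans (Homeomorph.addLeft q)).isClosedEmbedding
  have h1 : ∀ (A : Set E) (f : E → ℝ), ∫ x in (fun x => q + l • x) ⁻¹' A, f (q + l • x) = (l ^ Module.finrank ℝ E)⁻¹ * ∫ x in A, f x := by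
    intro A f
    have hm : Measure.map (fun x : E => q + l • x) volume = ENNReal.ofReal (l ^ Module.finrank ℝ E)⁻¹ • volume := by
      have := Measure.map_addHaar_smul (volume : Measure E) hl.ne'
      have h2 : (fun x : E => q + l • x) = (fun x => q + x) ∘ (fun x => l • x) := rfl
      rw [h2, ← Measure.map_map (measurable_const_add q) (measurable_const_smul l), this, Measure.map_smul]
      rw [(measurePreserving_add_left volume q).map_eq, abs_of_pos (by positivity)]
    have := hmap.measurableEmbedding.setIntegral_map (μ := volume) f A
    rw [← this, hm, Measure.restrict_smul, integral_smul_measure, smul_eq_mul, ENNReal.toReal_ofReal (by positivity)]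
  rw [h1 _ (fun y => (κ * u y) ^ 2)]
  simp_rw [mul_pow]
  rw [integral_const_mul]; ring

namespace Cfg
variable {t h : E → ℝ} {n : E → E} {e p : E} {R τ M : ℝ}

lemma HH_mono (C : Cfg t h n e p R τ M) {c c' : E} {r r' : ℝ} (hs : ball c r ⊆ ball c' r') (hsub : closedBall c' r' ⊆ ball p R) :
    HH t h c r ≤ HH t h c' r' :=
  setIntegral_mono_set (C.integrable_of_bdd hsub 2) (Eventually.of_forall fun x => sq_nonneg _)
    (Eventually.of_forall (inter_subset_inter_right _ hs))

lemma exists_big (C : Cfg t h n e p R τ M) {q : E} {r κ : ℝ} (hr : 0 < r) (hsub : closedBall q r ⊆ ball p R) (hκ : 0 < κ)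
    (hk : κ ≤ HH t h q r) : ∃ x ∈ ball q r, 0 < t x ∧ κ / (2 * volume.real (ball q r)) ≤ h x ^ 2 := by
  by_contra! hcon
  have hv : 0 < volume.real (ball q r) := by rw [vol_ball q hr]; have := vol_ball_pos (E := E); positivity
  have hm : MeasurableSet ({x | 0 < t x} ∩ ball q r) := C.meas_U.inter measurableSet_ball
  have hfin : volume ({x | 0 < t x} ∩ ball q r) < ⊤ := (measure_mono inter_subset_right).trans_lt measure_ball_lt_top
  have h1 := norm_setIntegral_le_of_norm_le_const (f := fun x => h x ^ 2) (C := κ / (2 * volume.real (ball q r))) hfin 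
    (fun x hx => by rw [Real.norm_of_nonneg (sq_nonneg _)]; exact (hcon x hx.2 hx.1).le)
  have h2 : volume.real ({x | 0 < t x} ∩ ball q r) ≤ volume.real (ball q r) := measureReal_mono inter_subset_right measure_ball_lt_top.ne
  have h3 : κ / (2 * volume.real (ball q r)) * volume.real ({x | 0 < t x} ∩ ball q r) ≤ κ / 2 := by
    calc _ ≤ κ / (2 * volume.real (ball q r)) * volume.real (ball q r) := by gcongr
      _ = κ / 2 := by field_simp
  have h4 := (le_abs_self _).trans (h1.trans h3)
  have : HH t h q r = ∫ x in {x | 0 < t x} ∩ ball q r, h x ^ 2 := rfl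
  linarith

lemma HH_eq_IM {c : E} {r : ℝ} (hs : ∀ x ∈ ball c r, 0 < t x) : HH t h c r = IM h c r := by
  unfold HH IM; congr 2; exact inter_eq_right.2 hs

end Cfg

set_option maxHeartbeats 1000000 in
lemma mid1 {κ : ℝ} (hκ : 0 < κ) : ∃ B : ℝ, ∀ (t h : E → ℝ) (n : E → E) (e p : E) (R τ M : ℝ), Cfg t h n e p R τ M → t 0 = 0 →
    ball 0 16 ⊆ ball p R → τ ≤ tau0 E → M ≤ 1/400 → HH t h 0 8 ≤ 1 → κ ≤ HH t h 0 (1/8) → 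
    ∀ r, 0 < r → r < 2 → 0 < HH t h e r ∧ HH t h e (2 * r) ≤ B * HH t h e r := by
  have hL := LC_pos (E := E)
  have hcg := CG_pos (E := E)
  obtain ⟨S, hS0, hS⟩ : ∃ S > 0, S ^ 2 = CG E := ⟨√(CG E), by positivity, Real.sq_sqrt hcg.le⟩
  have hω := vol_ball_pos (E := E)
  have hv0 : 0 < volume.real (ball (0:E) (1/8)) := by rw [vol_ball 0 (by norm_num)]; positivity
  obtain ⟨c1, hc0, hc1⟩ : ∃ c > 0, c ^ 2 = κ / (2 * volume.real (ball (0:E) (1/8))) := ⟨√(κ / (2 * volume.real (ball (0:E) (1/8)))), by positivity, Real.sq_sqrt (by positivity)⟩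
  obtain ⟨ε, hε0, hε1, hε2⟩ : ∃ ε > 0, ε ≤ 1/8 ∧ 3 * LC E * S * (2 * ε) ≤ c1 / 2 := by
    refine ⟨min (1/8) (c1 / (12 * LC E * S)), by positivity, min_le_left _ _, ?_⟩
    calc _ ≤ 3 * LC E * S * (2 * (c1 / (12 * LC E * S))) := by gcongr; exact min_le_right _ _
      _ = c1 / 2 := by field_simp; norm_num
  set r1 := ε / 8 with hr1
  have hr10 : 0 < r1 := by positivity
  set S' := S + 3 * LC E * S with hS'
  obtain ⟨N, hN⟩ := exists_nat_ge (2 / (r1 / 32))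
  set κ0 := (c1/2)^2 * ((r1/32)^Module.finrank ℝ E * volume.real (ball (0:E) 1)) with hκ0
  have hκ00 : 0 < κ0 := by positivity
  obtain ⟨κ1, hκ10, hch⟩ := chain (E := E) (S := S') hr10 N κ0 hκ00
  obtain ⟨D, hD1, hD⟩ := int_doub (E := E) (S := S') hr10 hκ10
  refine ⟨D + D / κ1, ?_⟩
  intro t h n e p R τ M C ht0 hball hτ hM hH8 hHk r hr0 hr2
  have hnb : ∀ (q : E) (r : ℝ), ‖q‖ + r < 16 → closedBall q r ⊆ ball p R := fun q r hqr x hx => hball (by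
    rw [mem_closedBall, dist_eq_norm] at hx; rw [mem_ball_zero_iff]
    have := norm_add_le q (x - q); rw [add_sub_cancel] at this; linarith)
  have hb4 : ∀ y, ‖y‖ ≤ 4 → 0 ≤ t y → |h y| ≤ S := by
    intro y hy hty
    have := C.growth hτ (q := 0) (r := 4) (by norm_num) (hnb _ _ (by norm_num)) (x := y) (by simpa using hy) hty
    have h2 : ∫ y in {x | 0 < t x} ∩ ball 0 (2 * 4), h y ^ 2 ≤ 1 := by 
      norm_num; exact hH8
    have h4 : (1:ℝ) ≤ 4 ^ Module.finrank ℝ E := one_le_pow₀ (by norm_num)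
    refine abs_le_of_sq_le_sq ?_ hS0.le
    rw [hS]
    nlinarith [sq_nonneg (h y)]
  obtain ⟨x, hx, htx, hxv⟩ := C.exists_big (by norm_num) (hnb 0 (1/8) (by norm_num)) hκ hHk
  rw [← hc1] at hxv
  rw [mem_ball_zero_iff] at hx
  have hxc : c1 ≤ |h x| := abs_le_abs_of_nonneg hc0.le (le_refl c1) |>.trans (sq_le_sq.1 hxv) |> (by simpa [abs_of_pos hc0] using ·)
  have he := C.he
  have hnear : ∀ w, ‖w - x‖ ≤ 2 * ε → 0 < t w → c1/2 ≤ |h w| := by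
    intro w hw htw
    have := C.osc_M (x := x) (y := w) (r := 1) one_pos hS0 (by linarith) (ball_subset_closedBall.trans (hnb x 1 (by linarith))) (fun y hy hty => hb4 y (by
      rw [mem_ball, dist_eq_norm] at hy
      have := norm_add_le x (y - x); rw [add_sub_cancel] at this; linarith) hty) htx.le htw.le (by linarith)
    have h3 : 3 * LC E * S / 1 * ‖w - x‖ ≤ 3 * LC E * S * (2 * ε) := by rw [div_one]; gcongr
    have := abs_sub_abs_le_abs_sub (h x) (h w)
    linarith
  set z := x + ε • e with hz
  have htz : ε < t z := by rw [hz, C.te]; linarith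
  have hzx : ‖z - x‖ = ε := by rw [hz, add_sub_cancel_left, norm_smul, he, Real.norm_of_nonneg hε0.le, mul_one]
  have hzn : ‖z‖ ≤ 1/4 := by
    have := norm_add_le x (z - x); rw [add_sub_cancel, hzx] at this; linarith
  have hpos : ∀ y, ε ≤ t y → ∀ w ∈ ball y r1, 0 < t w := by
    intro y hy w hw
    rw [mem_ball, dist_eq_norm] at hw
    have := (abs_le.1 (C.tlip' w y)).1
    linarith
  have hIG : ∀ y, ‖y‖ ≤ 1 → ε ≤ t y → IGd h y r1 S' := by
    intro y hy1 hty
    have hwn : ∀ w ∈ ball y r1, ‖w‖ ≤ 2 := fun w hw => by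
      rw [mem_ball, dist_eq_norm] at hw
      have := norm_add_le y (w - y); rw [add_sub_cancel] at this; linarith
    refine ⟨fun w hw => C.hh w (hball (by rw [mem_ball_zero_iff]; linarith [hwn w hw])) (hpos y hty w hw), 
      fun w hw => (hb4 w (by linarith [hwn w hw]) (hpos y hty w hw).le).trans (by have : 0 < 3 * LC E * S := by positivity
                                                                                  linarith), fun w hw => ?_⟩
    rw [gr_norm]
    have := C.grad_M (x := w) (r := 1) one_pos hS0 (by linarith) (ball_subset_closedBall.trans (hnb w 1 (by linarith [hwn w hw]))) (fun y hy hty => hb4 y (by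
      rw [mem_ball, dist_eq_norm] at hy
      have := norm_add_le w (y - w); rw [add_sub_cancel] at this; linarith [hwn w hw]) hty) (hpos y hty w hw)
    rw [div_one] at this; linarith
  have hte : t e = 1 := by have := C.te 0 1; simpa [ht0] using this
  have hseg : ∀ y ∈ segment ℝ z e, IGd h y r1 S' := by
    intro y hy
    refine hIG y ?_ ?_
    · have := (convex_closedBall (0:E) 1).segment_subset (x := z) (y := e) (by simp; linarith) (by simp [he]) hy
      simpa using this
    · rw [segment_eq_image'] at hy
      obtain ⟨θ, hθ, rfl⟩ := hy
      have h1 := (abs_le.1 (C.tlip (z + θ • (e - z)) z)).1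
      rw [add_sub_cancel_left, norm_smul, Real.norm_of_nonneg hθ.1, inner_smul_left, inner_sub_left, real_inner_self_eq_norm_sq, he] at h1
      have h2 := abs_le.1 (abs_real_inner_le_norm z e)
      rw [he, mul_one] at h2
      have h3 : ‖e - z‖ ≤ 2 := by have := norm_sub_le e z; linarith
      have h4 : τ * (θ * ‖e - z‖) ≤ 1/100 * (θ * 2) := by 
        have := hθ.1
        have := C.τ1
        have := C.τ0
        gcongr
      simp at h1
      have := hθ.1
      nlinarith [h2.2]
  have hmass : κ0 ≤ IM h z (r1/32) := by
    have hg := hIG z (by linarith) htz.le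
    have : κ0 = ∫ w in ball z (r1/32), (c1/2)^2 := by
      rw [setIntegral_const, smul_eq_mul, vol_ball _ (by positivity), hκ0]; ring
    rw [this]
    refine setIntegral_mono_on (integrableOn_const (measure_ball_lt_top.ne)) (hg.int.mono_set (ball_subset_ball (by linarith))) measurableSet_ball fun w hw => ?_
    have hw' := hw
    rw [mem_ball, dist_eq_norm] at hw
    have h5 := hnear w (by 
      have := norm_add_le (w - z) (z - x); rw [sub_add_sub_cancel, hzx] at this; linarith) (hpos z htz.le w (ball_subset_ball (by linarith) hw'))
    rw [← sq_abs (h w)]; gcongr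
  have hez : ‖e - z‖ ≤ N * (r1/32) := by
    have h1 : ‖e - z‖ ≤ 2 := by have := norm_sub_le e z; linarith
    have := (div_le_iff₀ (by positivity)).1 hN
    linarith
  have hm1 := hch h e z e he hseg hez hmass
  have hge := hIG e (by rw [he]) (by rw [hte]; linarith)
  have hm2 : κ1 ≤ IM h e (r1/16) := hm1.trans (hge.IM_mono (ball_subset_ball (by linarith)) (by linarith))
  have hdd := hD h e e he hge hm2
  have hposE : ∀ ρ, ρ ≤ 1/4 → HH t h e ρ = IM h e ρ := fun ρ hρ => Cfg.HH_eq_IM (fun w hw => by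
    rw [mem_ball, dist_eq_norm] at hw
    have := (abs_le.1 (C.tlip' w e)).1
    linarith)
  have hDk : 0 < D / κ1 := by positivity
  by_cases hc : 64 * r ≤ r1
  · obtain ⟨h1, h2⟩ := hdd r hr0 hc
    rw [hposE r (by linarith), hposE (2 * r) (by linarith)]
    refine ⟨h1, ?_⟩
    have := hge.IM_mono (ball_subset_ball (show 2 * r ≤ 4 * r by linarith)) (by linarith)
    nlinarith
  · obtain ⟨h1, h2⟩ := hdd (r1/64) (by positivity) (by linarith)
    have h3 : HH t h e (r1/64) ≤ HH t h e r := C.HH_mono (ball_subset_ball (by linarith)) (hnb _ _ (by linarith))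
    rw [hposE _ (by linarith)] at h3
    rw [show 4 * (r1/64) = r1/16 by ring] at h2
    have h4 : HH t h e (2 * r) ≤ 1 := le_trans (C.HH_mono (fun w hw => by
      rw [mem_ball, dist_eq_norm] at hw
      rw [mem_ball_zero_iff]
      have := norm_add_le e (w - e); rw [add_sub_cancel] at this; linarith) (hnb _ _ (by norm_num))) hH8
    refine ⟨h1.trans_le h3, h4.trans ?_⟩
    have h5 : κ1 ≤ D * HH t h e r := by nlinarith
    have h6 : 1 ≤ D / κ1 * HH t h e r := by rw [div_mul_eq_mul_div, le_div_iff₀ hκ10]; linarith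
    nlinarith

lemma mid {K : ℝ} (hK : 0 < K) : ∃ B : ℝ, ∀ (t h : E → ℝ) (n : E → E) (e p : E) (R τ M : ℝ), Cfg t h n e p R τ M → τ ≤ tau0 E →
    ∀ (b : E) (d : ℝ), t b = 0 → 0 < d → ball b (16 * d) ⊆ ball p R → M * d ≤ 1/400 → 0 < HH t h b (d/8) → 
    HH t h b (8 * d) ≤ K * HH t h b (d/8) → 
    ∀ r, 0 < r → r < 2 * d → 0 < HH t h (b + d • e) r ∧ HH t h (b + d • e) (2 * r) ≤ B * HH t h (b + d • e) r := by
  obtain ⟨B, hB⟩ := mid1 (E := E) (κ := 1 / K) (by positivity)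
  refine ⟨B, ?_⟩
  intro t h n e p R τ M C hτ b d htb hd hball hMd h0 hK8 r hr0 hr2
  have h8' := C.HH_mono (c := b) (c' := b) (r := d/8) (r' := 8*d) (ball_subset_ball (by linarith))
    ((closedBall_subset_ball (by linarith)).trans hball)
  have h8 : 0 < HH t h b (8 * d) := h0.trans_le h8'
  obtain ⟨w, hw⟩ : ∃ w : ℝ, w ^ 2 = d ^ Module.finrank ℝ E / HH t h b (8 * d) := ⟨_, Real.sq_sqrt (by positivity)⟩
  have hsc : ∀ c r, HH (fun x => t (b + d • x) / d) (fun x => w * h (b + d • x)) c r = (HH t h b (8 * d))⁻¹ * HH t h (b + d • c) (d * r) := by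
    intro c r
    rw [HH_scale t h b c hd w r, hw]; field_simp
  have C' := C.scale b hd w
  have := hB _ _ _ _ _ _ _ _ C' (by simp [htb]) ?_ hτ hMd ?_ ?_ (r / d) (by positivity) (by rw [div_lt_iff₀ hd]; exact hr2)
  · rw [hsc, hsc, show d * (r / d) = r by field_simp, show d * (2 * (r / d)) = 2 * r by field_simp] at this
    obtain ⟨h1, h2⟩ := this
    refine ⟨pos_of_mul_pos_right h1 (by positivity), ?_⟩
    have : (HH t h b (8 * d))⁻¹ * HH t h (b + d • e) (2 * r) ≤ (HH t h b (8 * d))⁻¹ * (B * HH t h (b + d • e) r) := by linarith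
    exact le_of_mul_le_mul_left this (by positivity)
  · intro x hx
    have h1 : b + d • x ∈ ball p R := hball (by
      rw [mem_ball_zero_iff] at hx
      rw [mem_ball, dist_eq_norm, add_sub_cancel_left, norm_smul, Real.norm_of_nonneg hd.le]; nlinarith)
    rw [mem_ball, dist_eq_norm] at h1 ⊢
    have : x - d⁻¹ • (p - b) = d⁻¹ • (b + d • x - p) := by
      rw [smul_sub, smul_sub, smul_add, smul_smul, inv_mul_cancel₀ hd.ne', one_smul]; abel
    rw [this, norm_smul, Real.norm_of_nonneg (by positivity), lt_div_iff₀ hd]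
    field_simp; exact h1
  · rw [hsc, smul_zero, add_zero, mul_comm d 8, inv_mul_cancel₀ h8.ne']
  · rw [hsc, smul_zero, add_zero, show d * (1/8) = d/8 by ring, inv_mul_eq_div, div_le_div_iff₀ hK h8]
    linarith

set_option maxHeartbeats 1000000 in
/-- uniform doubling near a boundary point -/
lemma partA_bdry {t h : E → ℝ} {n : E → E} {e p : E} {R τ M : ℝ} (C : Cfg t h n e p R τ M) (hτ : τ ≤ tau0 E) (hR : 0 < R) (htp : t p = 0)
    (hpos : ∀ r, 0 < r → r < R → 0 < HH t h p r) : ∃ δ > 0, ∃ B : ℝ, ∀ y ∈ ball p δ, 0 ≤ t y → ∀ r, 0 < r → r < δ → 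
      0 < HH t h y r ∧ HH t h y (2 * r) ≤ B * HH t h y r := by
  have hM0 := C.M0
  set m : ℝ := ((Module.finrank ℝ E : ℕ) : ℝ) with hm
  have hm0 : 0 ≤ m := Nat.cast_nonneg _
  set a : ℝ := m * (6 * M) with ha
  have ha0 : 0 ≤ a := by positivity
  obtain ⟨S, hS0, hS⟩ := C.bdd (q := p) (r := R/2) (closedBall_subset_ball (by linarith))
  obtain ⟨r1, hr10, hr1R, hr1a, hr1M⟩ : ∃ r1 > 0, r1 ≤ R / 100 ∧ a * r1 ≤ 1/20000 ∧ M * r1 ≤ 1/400 := by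
    refine ⟨min (R/100) (min (1 / (20000 * (a + 1))) (1 / (400 * (M + 1)))), by positivity, min_le_left _ _, ?_, ?_⟩
    · calc _ ≤ a * (1 / (20000 * (a + 1))) := by gcongr; exact (min_le_right _ _).trans (min_le_left _ _)
        _ ≤ 1 / 20000 := by rw [mul_one_div, div_le_div_iff₀ (by positivity) (by norm_num)]; nlinarith
    · calc _ ≤ M * (1 / (400 * (M + 1))) := by gcongr; exact (min_le_right _ _).trans (min_le_right _ _)
        _ ≤ 1 / 400 := by rw [mul_one_div, div_le_div_iff₀ (by positivity) (by norm_num)]; nlinarith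
  set r0 := r1 / 4 with hr0
  have hr00 : 0 < r0 := by positivity
  have hdoub : ∃ D > 0, ∀ c ∈ ball p (r0/8), t c = 0 → ∀ r, 0 < r → 16 * r ≤ r0 → 0 < HH t h c r ∧ HH t h c (4 * r) ≤ D * HH t h c r := by
    refine ⟨32 ^ (Frq.Kd m (30 * m * (200 * a)) r0 (S * (1 + 3 * LC E / r1)) (volume.real (ball p r1)) (HH t h p (r0/8))), ?_, fun c hc htc => ?_⟩
    rotate_left
    · have hcp := hc
      rw [mem_ball] at hc
      have f := C.frq htc hr10 (fun x hx => by
        rw [mem_ball] at hx ⊢; have := dist_triangle x c p; linarith) ha hr1a hS0 (fun y hy hty => hS y (by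
        rw [mem_ball] at hy; rw [mem_closedBall]; have := dist_triangle y c p; linarith) hty)
      refine f.doub hr00 (by linarith) (hpos _ (by positivity) (by linarith)) (C.HH_mono (fun x hx => ?_) (fun x hx => ?_)) (by rw [vol_ball _ hr10, vol_ball _ hr10])
      · rw [mem_ball] at hx ⊢; have := dist_triangle x p c; rw [dist_comm p c] at this; linarith
      · rw [mem_closedBall] at hx; rw [mem_ball]; have := dist_triangle x c p; linarith
    · positivity
  obtain ⟨D, hD0, hD⟩ := hdoub
  obtain ⟨B, hB⟩ := mid (E := E) (K := D ^ 3) (by positivity)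
  have he := C.he
  refine ⟨r0 / 128, by positivity, max B (D^2), ?_⟩
  intro y hy hty r hr hrδ
  rw [mem_ball, dist_eq_norm] at hy
  set d := t y with hd
  have hd2 : d ≤ 2 * (r0/128) := by
    have := (abs_le.1 (C.tlip' y p)).2
    rw [htp] at this; linarith
  set b := y - d • e with hb
  have hyb : y = b + d • e := by rw [hb]; abel
  have htb : t b = 0 := by
    have := C.te b d; rw [← hyb] at this; linarith
  have hbp : b ∈ ball p (r0/8) := by
    rw [mem_ball, dist_eq_norm, hb, sub_right_comm]
    have := norm_sub_le (y - p) (d • e)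
    rw [norm_smul, he, Real.norm_of_nonneg hty] at this
    linarith
  have hyb' : dist y b = d := by rw [dist_eq_norm, hb, sub_sub_cancel, norm_smul, he, Real.norm_of_nonneg hty, mul_one]
  have hDb := hD b hbp htb
  have hsubp : ∀ ρ, ρ ≤ R/2 → closedBall b ρ ⊆ ball p R := fun ρ hρ x hx => by
    rw [mem_closedBall] at hx; rw [mem_ball] at hbp ⊢; have := dist_triangle x b p; linarith
  have hsubp' : ∀ ρ, ρ ≤ R/4 → closedBall y ρ ⊆ ball p R := fun ρ hρ x hx => by
    rw [mem_closedBall] at hx; rw [← dist_eq_norm] at hy; rw [mem_ball]; have := dist_triangle x y p; linarith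
  by_cases hc : r < 2 * d
  · have hd0 : 0 < d := by linarith
    have h1 := hDb (d/8) (by linarith) (by linarith)
    have h2 := hDb (4 * (d/8)) (by linarith) (by linarith)
    have h3 := hDb (4 * (4 * (d/8))) (by linarith) (by linarith)
    have h4 := hB t h n e p R τ M C hτ b d htb hd0 (ball_subset_closedBall.trans (hsubp _ (by linarith))) (by nlinarith) h1.1 (by
      rw [show 8 * d = 4 * (4 * (4 * (d/8))) by ring]
      calc _ ≤ D * (D * (D * HH t h b (d/8))) := h3.2.trans (mul_le_mul_of_nonneg_left (h2.2.trans (mul_le_mul_of_nonneg_left h1.2 hD0.le)) hD0.le)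
        _ = _ := by ring) r hr hc
    rw [← hyb] at h4
    exact ⟨h4.1, h4.2.trans (mul_le_mul_of_nonneg_right (le_max_left _ _) h4.1.le)⟩
  · push Not at hc
    have h1 := hDb (r/2) (by linarith) (by linarith)
    have h2 := hDb (4 * (r/2)) (by linarith) (by linarith)
    have h3 : HH t h b (r/2) ≤ HH t h y r := C.HH_mono (fun x hx => by
      rw [mem_ball] at hx ⊢; have := dist_triangle x b y; rw [dist_comm b y] at this; linarith) (hsubp' _ (by linarith))
    have h4 : HH t h y (2 * r) ≤ HH t h b (4 * (4 * (r/2))) := C.HH_mono (fun x hx => by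
      rw [mem_ball] at hx ⊢; have := dist_triangle x y b; linarith) (hsubp _ (by linarith))
    refine ⟨h1.1.trans_le h3, ?_⟩
    calc _ ≤ D * (D * HH t h b (r/2)) := h4.trans (h2.2.trans (mul_le_mul_of_nonneg_left h1.2 hD0.le))
      _ = D^2 * HH t h b (r/2) := by ring
      _ ≤ D^2 * HH t h y r := by gcongr
      _ ≤ _ := mul_le_mul_of_nonneg_right (le_max_right _ _) (HH_nonneg _ _ _ _)
end NodalNeumann

end

noncomputable section
open MeasureTheory Metric Set Filter Asymptotics
open scoped Topology NNReal ENNReal RealInnerProductSpace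
namespace NodalNeumann
set_option linter.all false
variable {E : Type*} [NormedAddCommGroup E] [InnerProductSpace ℝ E] [FiniteDimensional ℝ E]
variable [MeasurableSpace E] [BorelSpace E]

def HO (Ω : Set E) (h : E → ℝ) (x : E) (r : ℝ) : ℝ := ∫ y in ball x r ∩ Ω, h y ^ 2

lemma HO_nonneg (Ω : Set E) (h : E → ℝ) (x : E) (r : ℝ) : 0 ≤ HO Ω h x r := integral_nonneg fun x => sq_nonneg _

/-- global data -/
structure Gl (Ω : Set E) (h : E → ℝ) (e : E) : Prop where
  he : ‖e‖ = 1
  ho : IsOpen Ω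
  hconn : IsPreconnected Ω
  hc : ContinuousOn h (closure Ω)
  hh : ∀ x ∈ Ω, HarmAt h x
  hne : ∃ y ∈ Ω, h y ≠ 0

namespace Gl
variable {Ω : Set E} {h : E → ℝ} {e : E}

lemma int (g : Gl Ω h e) (x : E) (r : ℝ) : IntegrableOn (fun y => h y ^ 2) (ball x r ∩ Ω) := by
  have hK : IsCompact (closedBall x r ∩ closure Ω) := (isCompact_closedBall x r).inter_right isClosed_closure
  refine (ContinuousOn.integrableOn_compact hK ((g.hc.mono inter_subset_right).pow 2)).mono_set 
    (inter_subset_inter ball_subset_closedBall subset_closure)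

lemma mono (g : Gl Ω h e) {x x' : E} {r r' : ℝ} (hs : ball x r ⊆ ball x' r') : HO Ω h x r ≤ HO Ω h x' r' :=
  setIntegral_mono_set (g.int x' r') (Eventually.of_forall fun x => sq_nonneg _)
    (Eventually.of_forall (inter_subset_inter_left _ hs))

lemma pos (g : Gl Ω h e) {x : E} (hx : x ∈ closure Ω) {r : ℝ} (hr : 0 < r) : 0 < HO Ω h x r := by
  refine (HO_nonneg Ω h x r).lt_of_ne fun h0 => ?_
  have ho : IsOpen (ball x r ∩ Ω) := isOpen_ball.inter g.ho
  have h1 := (setIntegral_eq_zero_iff_of_nonneg_ae (Eventually.of_forall fun x => sq_nonneg _) (g.int x r)).1 h0.symm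
  have h2 : EqOn (fun y => h y ^ 2) 0 (ball x r ∩ Ω) := Measure.eqOn_open_of_ae_eq h1 ho 
    ((g.hc.mono (inter_subset_right.trans subset_closure)).pow 2) continuousOn_const
  obtain ⟨a, ha⟩ : (ball x r ∩ Ω).Nonempty := mem_closure_iff.1 hx _ isOpen_ball (mem_ball_self hr)
  obtain ⟨y, hy, hne⟩ := g.hne
  exact hne (harm_uc g.he g.ho g.hconn g.hh ha.2 (by
    filter_upwards [ho.mem_nhds ha] with z hz
    simpa using h2 hz) y hy)

def SD (Ω : Set E) (h : E → ℝ) (s : Set E) : Prop := ∃ B δ : ℝ, 0 < δ ∧ ∀ x ∈ s, x ∈ closure Ω → ∀ r, 0 < r → r < δ → HO Ω h x (2 * r) ≤ B * HO Ω h x r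

lemma sd_int (g : Gl Ω h e) {x : E} (hx : x ∈ Ω) : ∃ s ∈ 𝓝 x, SD Ω h s := by
  obtain ⟨r, hr, hrU⟩ := Metric.isOpen_iff.1 g.ho x hx
  have hcb : closedBall x (r/2) ⊆ Ω := (closedBall_subset_ball (by linarith)).trans hrU
  have c1 : ContinuousOn h (closedBall x (r/2)) := fun y hy => (g.hh y (hcb hy)).LL.continuousAt.continuousWithinAt
  have c2 : ContinuousOn (gr h) (closedBall x (r/2)) := fun y hy => (g.hh y (hcb hy)).LL_gr.continuousAt.continuousWithinAt
  obtain ⟨S1, hS1⟩ := (isCompact_closedBall x (r/2)).exists_bound_of_continuousOn c1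
  obtain ⟨S2, hS2⟩ := (isCompact_closedBall x (r/2)).exists_bound_of_continuousOn c2
  set r1 := r / 4 with hr1
  have hr10 : 0 < r1 := by positivity
  have hκ := g.pos (subset_closure hx) (r := r1/32) (by positivity)
  obtain ⟨D, hD1, hD⟩ := int_doub (E := E) (S := max S1 S2) hr10 hκ
  have hIM : ∀ y ρ, ball y ρ ⊆ Ω → HO Ω h y ρ = IM h y ρ := fun y ρ hy => by
    unfold HO IM; rw [inter_eq_left.2 hy]
  refine ⟨ball x (r1/32), ball_mem_nhds _ (by positivity), D, r1/64, by positivity, ?_⟩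
  intro y hy hyc ρ hρ hρ1
  rw [mem_ball] at hy
  have hsub : ∀ ρ, ρ ≤ r1 → ball y ρ ⊆ closedBall x (r/2) := fun ρ hρ z hz => by
    rw [mem_ball] at hz; rw [mem_closedBall]; have := dist_triangle z y x; linarith
  have gi : IGd h y r1 (max S1 S2) := ⟨fun z hz => g.hh z (hcb (hsub _ le_rfl hz)), fun z hz => (hS1 z (hsub _ le_rfl hz)).trans (le_max_left _ _),
      fun z hz => (hS2 z (hsub _ le_rfl hz)).trans (le_max_right _ _)⟩
  rw [hIM y ρ ((hsub _ (by linarith)).trans hcb), hIM y (2 * ρ) ((hsub _ (by linarith)).trans hcb)]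
  have := (hD h e y g.he gi (by
    rw [← hIM y _ ((hsub _ (by linarith)).trans hcb)]
    refine g.mono fun z hz => ?_
    rw [mem_ball] at hz ⊢; have := dist_triangle z x y; rw [dist_comm x y] at this; linarith) ρ hρ (by linarith)).2
  exact (gi.IM_mono (ball_subset_ball (by linarith)) (by linarith)).trans this

lemma sd_bdry (g : Gl Ω h e) {t : E → ℝ} {n : E → E} {e' x : E} {R τ M : ℝ} (hx : x ∈ closure Ω) (C : Cfg t h n e' x R τ M) (hτ : τ ≤ tau0 E) (hR : 0 < R)
    (htx : t x = 0) (hΩ : Ω ∩ ball x R = {x | 0 < t x} ∩ ball x R) : ∃ s ∈ 𝓝 x, SD Ω h s := by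
  have hHH : ∀ y r, ball y r ⊆ ball x R → HH t h y r = HO Ω h y r := by
    intro y r hs
    unfold HH HO
    congr 2
    have h1 : ball y r = ball x R ∩ ball y r := (inter_eq_right.2 hs).symm
    rw [h1, ← inter_assoc, ← hΩ, inter_right_comm, inter_comm Ω]
    ext z; simp only [mem_inter_iff]; tauto
  obtain ⟨δ, hδ, B, hB⟩ := partA_bdry C hτ hR htx (fun r hr hrR => by
    rw [hHH x r (ball_subset_ball hrR.le)]; exact g.pos hx hr)
  refine ⟨ball x (min δ (R/4)), ball_mem_nhds _ (by positivity), B, min δ (R/4), by positivity, ?_⟩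
  intro y hy hyc r hr hrδ
  have hy1 : y ∈ ball x δ := ball_subset_ball (min_le_left _ _) hy
  have hy2 : dist y x < R/4 := ball_subset_ball (min_le_right _ _) hy
  have hr1 := hrδ.trans_le (min_le_left _ _)
  have hr2 := hrδ.trans_le (min_le_right _ _)
  have hty : 0 ≤ t y := by
    by_contra hneg
    push Not at hneg
    have ho : IsOpen ({z | t z < 0} ∩ ball x R) := (isOpen_lt C.cont continuous_const).inter isOpen_ball
    obtain ⟨z, ⟨hz1, hz2⟩, hz3⟩ := mem_closure_iff.1 hyc _ ho ⟨hneg, by rw [mem_ball]; linarith⟩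
    have : z ∈ Ω ∩ ball x R := ⟨hz3, hz2⟩
    rw [hΩ] at this
    have h1 : 0 < t z := this.1
    have h2 : t z < 0 := hz1
    linarith
  have hsub : ∀ ρ, ρ ≤ R/2 → ball y ρ ⊆ ball x R := fun ρ hρ z hz => by
    rw [mem_ball] at hz ⊢; have := dist_triangle z y x; linarith
  have := (hB y hy1 hty r hr hr1).2
  rwa [hHH y r (hsub _ (by linarith)), hHH y _ (hsub _ (by linarith))] at this

/-- Part A: boundedness of doubling indices -/
lemma partA (g : Gl Ω h e) {K : Set E} (hK : IsCompact K) (hKΩ : K ⊆ closure Ω) (hloc : ∀ x ∈ K, x ∉ Ω → ∃ s ∈ 𝓝 x, SD Ω h s) (L : ℝ) :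
    ∃ B : ℝ, ∀ x ∈ K, ∀ r, 0 < r → r ≤ L → Real.log (HO Ω h x (2 * r) / HO Ω h x r) ≤ B := by
  have hSD : SD Ω h K := by
    refine hK.induction_on (p := SD Ω h) ⟨0, 1, one_pos, by simp⟩ ?_ ?_ ?_
    · rintro s s' hs ⟨B, δ, hδ, hB⟩
      exact ⟨B, δ, hδ, fun x hx => hB x (hs hx)⟩
    · rintro s s' ⟨B, δ, hδ, hB⟩ ⟨B', δ', hδ', hB'⟩
      refine ⟨max B B', min δ δ', by positivity, ?_⟩
      rintro x (hx | hx) hxc r hr hrδ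
      · exact (hB x hx hxc r hr (hrδ.trans_le (min_le_left _ _))).trans (mul_le_mul_of_nonneg_right (le_max_left _ _) (HO_nonneg _ _ _ _))
      · exact (hB' x hx hxc r hr (hrδ.trans_le (min_le_right _ _))).trans (mul_le_mul_of_nonneg_right (le_max_right _ _) (HO_nonneg _ _ _ _))
    · intro x hx
      by_cases hxΩ : x ∈ Ω
      · obtain ⟨s, hs, h1⟩ := g.sd_int hxΩ
        exact ⟨s, mem_nhdsWithin_of_mem_nhds hs, h1⟩
      · obtain ⟨s, hs, h1⟩ := hloc x hx hxΩ
        exact ⟨s, mem_nhdsWithin_of_mem_nhds hs, h1⟩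
  obtain ⟨B, δ, hδ, hB⟩ := hSD
  have hlow : ∃ κ > 0, ∀ x ∈ K, x ∈ closure Ω → κ ≤ HO Ω h x δ := by
    refine hK.induction_on (p := fun s => ∃ κ > 0, ∀ x ∈ s, x ∈ closure Ω → κ ≤ HO Ω h x δ) ⟨1, one_pos, by simp⟩ ?_ ?_ ?_
    · rintro s s' hs ⟨κ, hκ, hB⟩
      exact ⟨κ, hκ, fun x hx => hB x (hs hx)⟩
    · rintro s s' ⟨κ, hκ, hB⟩ ⟨κ', hκ', hB'⟩
      refine ⟨min κ κ', lt_min hκ hκ', ?_⟩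
      rintro x (hx | hx) hxc
      · exact (min_le_left _ _).trans (hB x hx hxc)
      · exact (min_le_right _ _).trans (hB' x hx hxc)
    · intro x hx
      refine ⟨_, mem_nhdsWithin_of_mem_nhds (ball_mem_nhds x (show 0 < δ/2 by positivity)), _, g.pos (hKΩ hx) (show 0 < δ/2 by positivity), fun y hy _ => g.mono fun z hz => ?_⟩
      rw [mem_ball] at *; have := dist_triangle z x y; rw [dist_comm x y] at this; linarith
  obtain ⟨κ, hκ, hlow⟩ := hlow
  obtain ⟨ρ, hρ⟩ := hK.isBounded.subset_ball 0
  set V := HO Ω h 0 (ρ + 2 * L) with hV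
  have hV0 : 0 ≤ V := HO_nonneg _ _ _ _
  refine ⟨Real.log (max B (V / κ)), fun x hx r hr hrL => ?_⟩
  have p1 := g.pos (hKΩ hx) hr
  have p2 := g.pos (hKΩ hx) (show 0 < 2 * r by linarith)
  refine Real.log_le_log (by positivity) ?_
  rw [div_le_iff₀ p1]
  by_cases hc : r < δ
  · exact (hB x hx (hKΩ hx) r hr hc).trans (mul_le_mul_of_nonneg_right (le_max_left _ _) p1.le)
  · push Not at hc
    have h1 : κ ≤ HO Ω h x r := (hlow x hx (hKΩ hx)).trans (g.mono (ball_subset_ball hc))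
    have h2 : HO Ω h x (2 * r) ≤ V := g.mono fun z hz => by
      have := hρ hx
      rw [mem_ball] at *; have := dist_triangle z x 0; linarith
    calc _ ≤ V := h2
      _ = V / κ * κ := by field_simp
      _ ≤ V / κ * HO Ω h x r := by gcongr
      _ ≤ _ := mul_le_mul_of_nonneg_right (le_max_right _ _) p1.le

end Gl
end NodalNeumann

end

noncomputable section
open MeasureTheory Metric Set Filter Asymptotics
open scoped Topology NNReal ENNReal RealInnerProductSpace
namespace NodalNeumann
set_option linter.all false
variable {E : Type*} [NormedAddCommGroup E] [InnerProductSpace ℝ E] [FiniteDimensional ℝ E]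

/-- Laplacian in the standard orthonormal basis -/
def lp (u : E → ℝ) (x : E) : ℝ := ∑ i, fderiv ℝ (fderiv ℝ u) x (stdOrthonormalBasis ℝ E i) (stdOrthonormalBasis ℝ E i)

lemma c2_gr_contDiff {u : E → ℝ} {x : E} (h : ContDiffAt ℝ 2 u x) : ContDiffAt ℝ 1 (gr u) x := by
  have : ContDiffAt ℝ 1 (fderiv ℝ u) x := h.fderiv_right (by norm_num)
  rw [show gr u = fun x => rz E (fderiv ℝ u x) from funext (gr_eq u)]
  exact (rz E).contDiff.contDiffAt.comp x this

lemma c2_dv_gr {u : E → ℝ} {x : E} (h : ContDiffAt ℝ 2 u x) : dv (gr u) x = lp u x := by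
  have h1 : ContDiffAt ℝ 1 (fderiv ℝ u) x := h.fderiv_right (by norm_num)
  have h2 : HasFDerivAt (fderiv ℝ u) (fderiv ℝ (fderiv ℝ u) x) x := (h1.differentiableAt (by norm_num)).hasFDerivAt
  have h3 := (c2_gr_contDiff h).differentiableAt (by norm_num)
  unfold dv lp
  refine Finset.sum_congr rfl fun i _ => ?_
  set v := stdOrthonormalBasis ℝ E i
  have e1 : HasFDerivAt (fun y => ⟪gr u y, v⟫) ((innerSL ℝ v).comp (fderiv ℝ (gr u) x)) x := by
    have := (innerSL ℝ v).hasFDerivAt.comp x h3.hasFDerivAt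
    refine this.congr_of_eventuallyEq (Eventually.of_forall fun y => ?_)
    simp [real_inner_comm]
  have e2 : HasFDerivAt (fun y => ⟪gr u y, v⟫) ((fderiv ℝ (fderiv ℝ u) x).flip v) x := by
    simp_rw [gr_inner]
    exact h2.clm_apply (hasFDerivAt_const v x) |>.congr_fderiv (by ext w; simp)
  have := congrArg (fun L : E →L[ℝ] ℝ => L v) (e1.unique e2)
  simpa [real_inner_comm] using this

lemma dv_sub {V W : E → E} {x : E} (hV : DifferentiableAt ℝ V x) (hW : DifferentiableAt ℝ W x) : dv (fun y => V y - W y) x = dv V x - dv W x := by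
  unfold dv
  rw [fderiv_fun_sub hV hW, ← Finset.sum_sub_distrib]
  simp [inner_sub_left]

variable [MeasurableSpace E] [BorelSpace E]
set_option maxHeartbeats 1000000 in
lemma Cfg.weak {t h : E → ℝ} {n : E → E} {e p : E} {R τ M : ℝ} (C : Cfg t h n e p R τ M) {q : E} {ρ r ε G : ℝ} {φ : E → ℝ}
    (hr : 0 < r) (hsub : closedBall q (ρ + r) ⊆ ball p R) (hφ : ContDiff ℝ 2 φ) (hs : ∀ x, x ∉ closedBall q ρ → φ x = 0) (hG : 0 < G)
    (hφG : ∀ x, ‖fderiv ℝ φ x‖ ≤ G) (hε : 0 < ε) (hb : ∀ b ∈ closedBall q ρ, t b = 0 → |h b| ≤ ε) :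
    |∫ x in {x | 0 < t x}, h x * lp φ x| ≤ Ccut * (3 * ε * G) * volume.real (closedBall q (ρ + 3)) := by
  have hM0 := C.M0
  have hL := LC_pos (E := E)
  set V : E → E := fun x => h x • gr φ x - φ x • gr h x with hV
  have hsub' : closedBall q ρ ⊆ ball p R := (closedBall_subset_closedBall (by linarith)).trans hsub
  have hz : ∀ x, x ∉ closedBall q ρ → φ =ᶠ[𝓝 x] fun _ => 0 := fun x hx => by
    filter_upwards [isClosed_closedBall.isOpen_compl.mem_nhds hx] with y hy using hs y hy
  have hzf : ∀ x, x ∉ closedBall q ρ → fderiv ℝ φ x = 0 := fun x hx => by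
    rw [(hz x hx).fderiv_eq]; simp
  have hzg : ∀ x, x ∉ closedBall q ρ → gr φ x = 0 := fun x hx => by
    rw [← norm_eq_zero, gr_norm, hzf x hx, norm_zero]
  have hV0 : ∀ x, x ∉ closedBall q ρ → V x = 0 := fun x hx => by
    simp only [hV]; rw [hzg x hx, hs x hx]; simp
  have hV0' : ∀ x, x ∉ closedBall q ρ → V =ᶠ[𝓝 x] fun _ => 0 := fun x hx => by
    filter_upwards [isClosed_closedBall.isOpen_compl.mem_nhds hx] with y hy using hV0 y hy
  have hdv : ∀ x, 0 < t x → dv V x = h x * lp φ x := by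
    intro x hx
    by_cases hxb : x ∈ closedBall q ρ
    · have hh := C.hh x (hsub' hxb) hx
      have d1 : DifferentiableAt ℝ h x := hh.1.differentiableAt (by norm_num)
      have d2 : DifferentiableAt ℝ (gr h) x := (c2_gr_contDiff hh.1).differentiableAt (by norm_num)
      have d3 : DifferentiableAt ℝ φ x := hφ.contDiffAt.differentiableAt (by norm_num)
      have d4 : DifferentiableAt ℝ (gr φ) x := (c2_gr_contDiff hφ.contDiffAt).differentiableAt (by norm_num)
      rw [hV, dv_sub (d1.fun_smul d4) (d3.fun_smul d2), dv_smul d1 d4, dv_smul d3 d2, hh.dv_gr, c2_dv_gr hφ.contDiffAt, ← gr_inner, ← gr_inner,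
        real_inner_comm]
      ring
    · have h1 : dv V x = 0 := by unfold dv; rw [(hV0' x hxb).fderiv_eq]; simp
      have h2 : fderiv ℝ (fderiv ℝ φ) x = 0 := by
        have : fderiv ℝ φ =ᶠ[𝓝 x] fun _ => 0 := by
          filter_upwards [isClosed_closedBall.isOpen_compl.mem_nhds hxb] with y hy using hzf y hy
        rw [this.fderiv_eq]; simp
      rw [h1, lp, h2]; simp
  obtain ⟨S, hS0, hS⟩ := C.bdd hsub
  have hKc := isCompact_closedBall q ρ
  obtain ⟨Φ, hΦ⟩ := hKc.exists_bound_of_continuousOn hφ.continuous.continuousOn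
  have hlpc : Continuous (lp φ) := by
    unfold lp
    have h1 : ContDiff ℝ 1 (fderiv ℝ φ) := hφ.fderiv_right (by norm_num)
    have h2 : Continuous (fderiv ℝ (fderiv ℝ φ)) := h1.continuous_fderiv (by norm_num)
    fun_prop
  obtain ⟨Λ, hΛ⟩ := hKc.exists_bound_of_continuousOn hlpc.continuousOn
  obtain ⟨r', hr'0, hr'r, hr'M⟩ : ∃ r' > 0, r' ≤ r ∧ M * r' ≤ 1/20 := by
    refine ⟨min r (1 / (20 * (M + 1))), by positivity, min_le_left _ _, ?_⟩
    calc _ ≤ M * (1 / (20 * (M + 1))) := by gcongr; exact min_le_right _ _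
        _ ≤ 1 / 20 := by rw [mul_one_div, div_le_div_iff₀ (by positivity) (by norm_num)]; nlinarith
  have hintg : ∫ x in {x | 0 < t x}, h x * lp φ x = ∫ x in {x | 0 < t x}, dv V x :=
    setIntegral_congr_fun C.meas_U fun x hx => (hdv x hx).symm
  have ht : LipschitzWith 2 t := LipschitzWith.of_dist_le_mul fun x y => by
    rw [Real.dist_eq, dist_eq_norm]; exact C.tlip' x y
  rw [hintg]
  refine div_bound (B := max 0 (S * G + Φ * (3 * LC E * S / r'))) (B' := max 0 (S * Λ)) C.te C.he ht (fun x hx => ?_) hV0 (fun x hx => ?_) (Eventually.of_forall fun x hx _ => ?_) (by positivity) (fun b hb0 => ?_)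
  · by_cases hxb : x ∈ closedBall q ρ
    · have hh := C.hh x (hsub' hxb) hx
      exact (hh.LL.smul (LL.of_contDiffAt (c2_gr_contDiff hφ.contDiffAt))).sub ((LL.of_contDiffAt (hφ.contDiffAt.of_le (by norm_num))).smul hh.LL_gr)
    · exact (LL.const (0:E)).congr (hV0' x hxb)
  · by_cases hxb : x ∈ closedBall q ρ
    · refine le_max_of_le_right ?_
      have b1 := hS x (closedBall_subset_closedBall (by linarith) hxb) hx.le
      have hbs : ball x r' ⊆ closedBall q (ρ + r) := fun y hy => by
        rw [mem_ball] at hy; rw [mem_closedBall] at hxb ⊢; have := dist_triangle y x q; linarith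
      have b2 := C.grad_M (x := x) hr'0 hS0 hr'M (hbs.trans hsub) (fun y hy => hS y (hbs hy)) hx
      have b3 : |φ x| ≤ Φ := hΦ x hxb
      calc ‖V x‖ ≤ ‖h x • gr φ x‖ + ‖φ x • gr h x‖ := norm_sub_le _ _
        _ = |h x| * ‖fderiv ℝ φ x‖ + |φ x| * ‖fderiv ℝ h x‖ := by rw [norm_smul, norm_smul, gr_norm, gr_norm]; rfl
        _ ≤ _ := by 
          have : 0 ≤ Φ := (abs_nonneg (φ x)).trans b3
          have := hφG x
          gcongr
    · rw [hV0 x hxb, norm_zero]; exact le_max_left _ _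
  · rw [hdv x hx]
    by_cases hxb : x ∈ closedBall q ρ
    · refine le_max_of_le_right ?_
      have b1 := hS x (closedBall_subset_closedBall (by linarith) hxb) hx.le
      rw [abs_mul]
      have : |lp φ x| ≤ Λ := hΛ x hxb
      gcongr
    · rw [← hdv x hx]
      have h1 : dv V x = 0 := by unfold dv; rw [(hV0' x hxb).fderiv_eq]; simp
      rw [h1, abs_zero]; exact le_max_left _ _
  · have hlim : Tendsto (fun s : ℝ => b + s • e) (𝓝[>] 0) (𝓝 b) := by
      have : Continuous fun s : ℝ => b + s • e := by fun_prop
      have := this.tendsto 0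
      rw [zero_smul, add_zero] at this
      exact this.mono_left nhdsWithin_le_nhds
    by_cases hbb : b ∈ closedBall q ρ
    · obtain ⟨ℓ, hℓ, hlt⟩ := C.grad_tendsto (hsub' hbb) hb0
      rw [(C.hasFDerivAt_t (hsub' hbb)).fderiv]
      have l1 : Tendsto (fun s : ℝ => h (b + s • e)) (𝓝[>] 0) (𝓝 (h b)) := by
        refine (C.hc b ⟨hb0.ge, hsub' hbb⟩).tendsto.comp (tendsto_nhdsWithin_iff.2 ⟨hlim, ?_⟩)
        filter_upwards [self_mem_nhdsWithin, hlim (isOpen_ball.mem_nhds (hsub' hbb))] with s hs1 hs2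
        refine ⟨?_, hs2⟩
        show 0 ≤ t _
        rw [C.te, hb0]; have : (0:ℝ) < s := hs1; linarith
      have l2 : Tendsto (fun s : ℝ => fderiv ℝ φ (b + s • e) (n b)) (𝓝[>] 0) (𝓝 (fderiv ℝ φ b (n b))) :=
        ((ContinuousLinearMap.apply ℝ ℝ (n b)).continuous.tendsto _).comp (((hφ.continuous_fderiv (by norm_num)).tendsto b).comp hlim)
      have l3 : Tendsto (fun s : ℝ => φ (b + s • e)) (𝓝[>] 0) (𝓝 (φ b)) := (hφ.continuous.tendsto b).comp hlim
      have l4 : Tendsto (fun s : ℝ => fderiv ℝ h (b + s • e) (n b)) (𝓝[>] 0) (𝓝 (ℓ (n b))) := ((ContinuousLinearMap.apply ℝ ℝ (n b)).continuous.tendsto _).comp hlt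
      have l5 := ((l1.mul l2).sub (l3.mul l4)).abs
      rw [hℓ, mul_zero, sub_zero] at l5
      have hlt : |h b * fderiv ℝ φ b (n b)| < 3 * ε * G := by
        rw [abs_mul]
        have a1 := hb b hbb hb0
        have a2 : |fderiv ℝ φ b (n b)| ≤ G * 2 := by
          have := (fderiv ℝ φ b).le_opNorm (n b)
          have a3 : ‖n b‖ ≤ 2 := (C.n_norm (hsub' hbb)).trans (by linarith [C.τ1])
          calc _ ≤ _ := this
            _ ≤ _ := by have := hφG b; gcongr
        calc _ ≤ ε * (G * 2) := by gcongr
          _ < _ := by nlinarith [mul_pos hε hG]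
      filter_upwards [l5.eventually_lt_const hlt] with s hs
      refine le_of_eq_of_le ?_ hs.le
      simp only [hV, innerSL_apply_apply, inner_sub_right, inner_smul_right]
      rw [real_inner_comm, gr_inner, real_inner_comm, gr_inner]
    · filter_upwards [hlim (isClosed_closedBall.isOpen_compl.mem_nhds hbb)] with s hs
      rw [hV0 _ hs]; simp; positivity
end NodalNeumann

end

noncomputable section
open MeasureTheory Metric Set Filter Asymptotics
open scoped Topology NNReal ENNReal RealInnerProductSpace ContDiff
namespace NodalNeumann
set_option linter.all false
variable {E : Type*} [NormedAddCommGroup E] [InnerProductSpace ℝ E] [FiniteDimensional ℝ E]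

def Nice {F : Type*} [NormedAddCommGroup F] [NormedSpace ℝ F] (ψ : E → F) : Prop := ContDiff ℝ ∞ ψ ∧ HasCompactSupport ψ

section
variable {F : Type*} [NormedAddCommGroup F] [NormedSpace ℝ F] {ψ : E → F}
lemma Nice.fderiv (h : Nice ψ) : Nice (fderiv ℝ ψ) := ⟨h.1.fderiv_right (by norm_num), h.2.fderiv ℝ⟩
lemma Nice.bdd (h : Nice ψ) : ∃ c > 0, ∀ x, ‖ψ x‖ ≤ c := by
  obtain ⟨c, hc⟩ := h.1.continuous.bounded_above_of_compact_support h.2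
  exact ⟨max c 1, by positivity, fun x => (hc x).trans (le_max_left _ _)⟩
lemma Nice.lip (h : Nice ψ) : ∃ K > 0, ∀ x y, ‖ψ y - ψ x‖ ≤ K * ‖y - x‖ := by
  obtain ⟨c, hc0, hc⟩ := h.fderiv.bdd
  exact ⟨c, hc0, fun x y => Convex.norm_image_sub_le_of_norm_fderiv_le (fun z _ => h.1.contDiffAt.differentiableAt (by norm_num)) (fun z _ => hc z) convex_univ (mem_univ _) (mem_univ _)⟩
lemma Nice.quad (h : Nice ψ) : ∃ K > 0, ∀ x y, ‖ψ y - ψ x - (_root_.fderiv ℝ ψ x) (y - x)‖ ≤ K * ‖y - x‖ ^ 2 := by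
  obtain ⟨K, hK0, hK⟩ := h.fderiv.lip
  refine ⟨K, hK0, fun x y => ?_⟩
  have := Convex.norm_image_sub_le_of_norm_fderiv_le' (𝕜 := ℝ) (f := ψ) (φ := _root_.fderiv ℝ ψ x) (C := K * ‖y - x‖) (s := closedBall x ‖y - x‖) (x := x) (y := y)
    (fun z _ => h.1.contDiffAt.differentiableAt (by norm_num)) (fun z hz => (hK x z).trans (by
      rw [mem_closedBall, dist_eq_norm] at hz; gcongr)) (convex_closedBall _ _) (by simp) (by simp [dist_eq_norm])
  rwa [mul_assoc, ← sq] at this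
end

variable [MeasurableSpace E] [BorelSpace E]

structure BF (f : ℕ → E → ℝ) (S : ℝ) : Prop where
  S0 : 0 < S
  hm : ∀ j, AEStronglyMeasurable (f j) volume
  hS : ∀ j x, |f j x| ≤ S
  h0 : ∀ j x, x ∉ ball (0:E) 1 → f j x = 0

section
variable {F : Type*} [NormedAddCommGroup F] [NormedSpace ℝ F]

def II (f : ℕ → E → ℝ) (ψ : E → F) (j : ℕ) (x : E) : F := ∫ y, f j y • ψ (x - y)

def TT (f : ℕ → E → ℝ) (ψ : E → F) (x : E) : F := limUnder (hyperfilter ℕ : Filter ℕ) (fun j => II f ψ j x)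

namespace BF
variable {f : ℕ → E → ℝ} {S : ℝ}

lemma bound (b : BF f S) (j : ℕ) {g : E → F} {c : ℝ} (hg : ∀ y, ‖g y‖ ≤ c) : ‖∫ y, f j y • g y‖ ≤ S * volume.real (ball (0:E) 1) * c := by
  have h1 : ∫ y, (ball (0:E) 1).indicator (fun _ => S * c) y = S * volume.real (ball (0:E) 1) * c := by
    rw [integral_indicator measurableSet_ball, setIntegral_const, smul_eq_mul]; ring
  rw [← h1]
  refine norm_integral_le_of_norm_le ?_ (Eventually.of_forall fun y => ?_)
  · rw [integrable_indicator_iff measurableSet_ball]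
    exact integrableOn_const measure_ball_lt_top.ne
  · by_cases hy : y ∈ ball (0:E) 1
    · rw [indicator_of_mem hy, norm_smul]
      have := b.S0
      have := b.hS j y
      have := hg y
      rw [Real.norm_eq_abs]
      gcongr
    · rw [indicator_of_notMem hy, b.h0 j y hy, zero_smul, norm_zero]

lemma integrable (b : BF f S) (j : ℕ) : Integrable (f j) := by
  have h1 : Integrable ((ball (0:E) 1).indicator (fun _ => S)) := by
    rw [integrable_indicator_iff measurableSet_ball]
    exact integrableOn_const measure_ball_lt_top.ne
  refine h1.mono' (b.hm j) (Eventually.of_forall fun y => ?_)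
  by_cases hy : y ∈ ball (0:E) 1
  · rw [indicator_of_mem hy]; exact b.hS j y
  · rw [indicator_of_notMem hy, b.h0 j y hy, norm_zero]

lemma int (b : BF f S) (j : ℕ) {ψ : E → F} (h : Nice ψ) (x : E) : Integrable (fun y => f j y • ψ (x - y)) := by
  obtain ⟨c, hc0, hc⟩ := h.bdd
  have hcont : Continuous fun y => ψ (x - y) := h.1.continuous.comp (by fun_prop)
  refine ((b.integrable j).norm.mul_const c).mono' ((b.hm j).smul hcont.aestronglyMeasurable) (Eventually.of_forall fun y => ?_)
  rw [norm_smul]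
  have := hc (x - y)
  gcongr

lemma lip (b : BF f S) {ψ : E → F} (h : Nice ψ) : ∃ K > 0, ∀ j x y, ‖II f ψ j y - II f ψ j x‖ ≤ K * ‖y - x‖ := by
  obtain ⟨K, hK0, hK⟩ := h.lip
  have := vol_ball_pos (E := E)
  have := b.S0
  refine ⟨S * volume.real (ball (0:E) 1) * K, by positivity, fun j x y => ?_⟩
  unfold II
  rw [← integral_sub (b.int j h y) (b.int j h x)]
  simp_rw [← smul_sub]
  rw [mul_assoc]
  refine b.bound j fun z => ?_
  have := hK (x - z) (y - z)
  rwa [sub_sub_sub_cancel_right] at this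

variable [FiniteDimensional ℝ F]

lemma tend (b : BF f S) {ψ : E → F} (h : Nice ψ) (x : E) : Tendsto (fun j => II f ψ j x) (hyperfilter ℕ : Filter ℕ) (𝓝 (TT f ψ x)) := by
  refine tendsto_nhds_limUnder ?_
  obtain ⟨c, hc0, hc⟩ := h.bdd
  haveI : ProperSpace F := FiniteDimensional.proper ℝ F
  have hK := isCompact_closedBall (0:F) (S * volume.real (ball (0:E) 1) * c)
  obtain ⟨a, _, ha⟩ := hK.ultrafilter_le_nhds ((hyperfilter ℕ).map (fun j => II f ψ j x)) (by
    rw [le_principal_iff]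
    show ∀ᶠ j in (hyperfilter ℕ : Filter ℕ), II f ψ j x ∈ closedBall (0:F) (S * volume.real (ball (0:E) 1) * c)
    exact Eventually.of_forall fun j => by
      rw [mem_closedBall_zero_iff]; exact b.bound j fun y => hc _)
  exact ⟨a, ha⟩

lemma tend_lin (b : BF f S) {ψ : E → F} (h : Nice ψ) (x : E) (L : F →L[ℝ] ℝ) : 
    Tendsto (fun j => ∫ y, f j y * L (ψ (x - y))) (hyperfilter ℕ : Filter ℕ) (𝓝 (L (TT f ψ x))) := by
  refine ((L.continuous.tendsto _).comp (b.tend h x)).congr fun j => ?_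
  simp only [Function.comp, II]
  haveI : CompleteSpace F := FiniteDimensional.complete ℝ F
  rw [← L.integral_comp_comm (b.int j h x)]
  simp

lemma hasFDerivAt (b : BF f S) {ψ : E → F} (h : Nice ψ) (x : E) : HasFDerivAt (TT f ψ) (TT f (fderiv ℝ ψ) x) x := by
  obtain ⟨K, hK0, hK⟩ := h.quad
  rw [hasFDerivAt_iff_isLittleO]
  haveI : CompleteSpace F := FiniteDimensional.complete ℝ F
  have : (fun y => TT f ψ y - TT f ψ x - TT f (fderiv ℝ ψ) x (y - x)) =O[𝓝 x] fun y => ‖y - x‖ ^ 2 := by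
    refine IsBigO.of_bound (S * volume.real (ball (0:E) 1) * K) (Eventually.of_forall fun y => ?_)
    have t1 := ((b.tend h y).sub (b.tend h x)).sub (((ContinuousLinearMap.apply ℝ F (y - x)).continuous.tendsto _).comp (b.tend h.fderiv x))
    refine le_of_tendsto t1.norm (Eventually.of_forall fun j => ?_)
    simp only [Function.comp, II, ContinuousLinearMap.apply_apply]
    rw [ContinuousLinearMap.integral_apply (b.int j h.fderiv x), ← integral_sub (b.int j h y) (b.int j h x), ← integral_sub]
    · have e1 : ∀ z, f j z • ψ (y - z) - f j z • ψ (x - z) - (f j z • fderiv ℝ ψ (x - z)) (y - x) = f j z • (ψ (y - z) - ψ (x - z) - fderiv ℝ ψ (x - z) (y - x)) := by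
        intro z; simp [smul_sub]
      simp_rw [e1]
      rw [mul_assoc]
      refine b.bound j fun z => ?_
      have := hK (x - z) (y - z)
      rw [sub_sub_sub_cancel_right] at this
      simpa using this
    · exact (b.int j h y).sub (b.int j h x)
    · exact (b.int j h.fderiv x).apply_continuousLinearMap _
  refine this.trans_isLittleO ?_
  have := isLittleO_norm_pow_id (E' := E) one_lt_two
  exact this.comp_tendsto (k := fun y => y - x) (l' := 𝓝 x) (by
    have : Continuous (fun y : E => y - x) := by fun_prop
    simpa using this.tendsto x)

end BF
end

lemma BF.contDiff {f : ℕ → E → ℝ} {S : ℝ} (b : BF f S) {ψ : E → ℝ} (h : Nice ψ) : ContDiff ℝ 2 (TT f ψ) := by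
  have h1 : fderiv ℝ (TT f ψ) = TT f (fderiv ℝ ψ) := funext fun x => (b.hasFDerivAt h x).fderiv
  have h2 : fderiv ℝ (TT f (fderiv ℝ ψ)) = TT f (fderiv ℝ (fderiv ℝ ψ)) := funext fun x => (b.hasFDerivAt h.fderiv x).fderiv
  have c1 : ContDiff ℝ 1 (TT f (fderiv ℝ ψ)) := by
    rw [contDiff_one_iff_fderiv]
    refine ⟨fun x => (b.hasFDerivAt h.fderiv x).differentiableAt, ?_⟩
    rw [h2]
    exact continuous_iff_continuousAt.2 fun x => (b.hasFDerivAt h.fderiv.fderiv x).continuousAt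
  rw [show (2 : WithTop ℕ∞) = 1 + 1 by norm_num, contDiff_succ_iff_fderiv]
  refine ⟨fun x => (b.hasFDerivAt h x).differentiableAt, by simp, ?_⟩
  rw [h1]; exact c1

lemma BF.lp_tend {f : ℕ → E → ℝ} {S : ℝ} (b : BF f S) {ψ : E → ℝ} (h : Nice ψ) (x : E) : 
    Tendsto (fun j => ∫ y, f j y * lp ψ (x - y)) (hyperfilter ℕ : Filter ℕ) (𝓝 (lp (TT f ψ) x)) := by
  have h1 : fderiv ℝ (TT f ψ) = TT f (fderiv ℝ ψ) := funext fun x => (b.hasFDerivAt h x).fderiv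
  have h2 : fderiv ℝ (TT f (fderiv ℝ ψ)) = TT f (fderiv ℝ (fderiv ℝ ψ)) := funext fun x => (b.hasFDerivAt h.fderiv x).fderiv
  set L : (E →L[ℝ] E →L[ℝ] ℝ) →L[ℝ] ℝ := ∑ i, (ContinuousLinearMap.apply ℝ ℝ (stdOrthonormalBasis ℝ E i)).comp (ContinuousLinearMap.apply ℝ (E →L[ℝ] ℝ) (stdOrthonormalBasis ℝ E i)) with hL
  have hL' : ∀ A, L A = ∑ i, A (stdOrthonormalBasis ℝ E i) (stdOrthonormalBasis ℝ E i) := fun A => by simp [hL, ContinuousLinearMap.sum_apply]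
  have := b.tend_lin h.fderiv.fderiv x L
  simp only [hL'] at this
  unfold lp
  rw [h1, h2]
  exact this

lemma lp_refl {ψ : E → ℝ} (h : ContDiff ℝ 2 ψ) (x y : E) : (∀ y, ‖fderiv ℝ (fun y => ψ (x - y)) y‖ = ‖fderiv ℝ ψ (x - y)‖) ∧ lp (fun y => ψ (x - y)) y = lp ψ (x - y) := by
  have h1 : fderiv ℝ (fun y => ψ (x - y)) = fun y => - fderiv ℝ ψ (x - y) := by
    funext y
    have := (h.contDiffAt.differentiableAt (x := x - y) (by norm_num)).hasFDerivAt.comp y ((hasFDerivAt_id y).const_sub x)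
    refine (HasFDerivAt.fderiv (f := fun y => ψ (x - y)) this).trans ?_
    ext; simp
  have hc : ContDiff ℝ 1 (fderiv ℝ ψ) := h.fderiv_right (by norm_num)
  have h2 : fderiv ℝ (fun y => - fderiv ℝ ψ (x - y)) y = fderiv ℝ (fderiv ℝ ψ) (x - y) := by
    have := ((hc.contDiffAt.differentiableAt (x := x - y) (by norm_num)).hasFDerivAt.comp y ((hasFDerivAt_id y).const_sub x)).neg
    refine (HasFDerivAt.fderiv (f := fun y => - fderiv ℝ ψ (x - y)) this).trans ?_
    ext; simp
  refine ⟨fun y => by rw [h1]; simp, ?_⟩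
  unfold lp
  rw [h1, h2]
end NodalNeumann

end

noncomputable section
open MeasureTheory Metric Set Filter Asymptotics
open scoped Topology NNReal ENNReal RealInnerProductSpace ContDiff
namespace NodalNeumann
set_option linter.all false
variable {E : Type*} [NormedAddCommGroup E] [InnerProductSpace ℝ E] [FiniteDimensional ℝ E]
variable [MeasurableSpace E] [BorelSpace E]

lemma lp_zero {ψ : E → ℝ} {v : E} (hv : v ∉ tsupport ψ) : lp ψ v = 0 := by
  have h1 : fderiv ℝ (fderiv ℝ ψ) v = 0 := by
    refine image_eq_zero_of_notMem_tsupport fun hh => hv ?_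
    have h2 : v ∈ tsupport (fderiv ℝ ψ) := tsupport_fderiv_subset ℝ hh
    exact tsupport_fderiv_subset ℝ h2
  simp [lp, h1]

lemma exists_bump {η : ℝ} (hη : 0 < η) : ∃ ψ : E → ℝ, Nice ψ ∧ ContDiff ℝ 2 ψ ∧ (∀ v, η < ‖v‖ → ψ v = 0) ∧ (∀ v, η < ‖v‖ → lp ψ v = 0) ∧
    (∀ v, 0 ≤ ψ v) ∧ ∫ v, ψ v = 1 := by
  let β : ContDiffBump (0:E) := ⟨η / 2, η, by positivity, by linarith⟩
  have hts : tsupport (β.normed volume) = closedBall (0:E) η := β.tsupport_normed_eq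
  have hn : ∀ v : E, η < ‖v‖ → v ∉ tsupport (β.normed volume) := fun v hv => by
    rw [hts, mem_closedBall_zero_iff]; linarith
  have hN : Nice (β.normed volume) := ⟨β.contDiff_normed, β.hasCompactSupport_normed⟩
  exact ⟨β.normed volume, hN, β.contDiff_normed, fun v hv => image_eq_zero_of_notMem_tsupport (hn v hv), fun v hv => lp_zero (hn v hv), β.nonneg_normed, β.integral_normed⟩

set_option maxHeartbeats 1000000 in
lemma partB_seq {e : E} (he : ‖e‖ = 1) (t h : ℕ → E → ℝ) (n : ℕ → E → E) (p : ℕ → E) (R τ M ε : ℕ → ℝ) {S c1 : ℝ}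
    (C : ∀ j, Cfg (t j) (h j) (n j) e (p j) (R j) (τ j) (M j)) (ht0 : ∀ j, t j 0 = 0) (hsub : ∀ j, ball (0:E) 4 ⊆ ball (p j) (R j))
    (hε0 : ∀ j, 0 < ε j) (hε : Tendsto ε atTop (𝓝 0)) (hτ : ∀ j, τ j ≤ ε j) (hS0 : 0 < S)
    (hS : ∀ j, ∀ x ∈ closedBall (0:E) 1, 0 ≤ t j x → |h j x| ≤ S) (hc1 : 0 < c1)
    (hx : ∀ j, ∃ x ∈ ball (0:E) (1/8), 0 < t j x ∧ c1 ≤ |h j x|)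
    (hb : ∀ j, ∀ b ∈ ball (0:E) (1/2), t j b = 0 → |h j b| ≤ ε j) : False := by
  have hL := LC_pos (E := E)
  set f : ℕ → E → ℝ := fun j => ({x | 0 < t j x} ∩ ball (0:E) 1).indicator (h j) with hf
  have hbf : BF f S := by
    refine ⟨hS0, fun j => ?_, fun j x => ?_, fun j x hx => ?_⟩
    · have hm : MeasurableSet ({x | 0 < t j x} ∩ ball (0:E) 1) := (C j).meas_U.inter measurableSet_ball
      rw [hf, aestronglyMeasurable_indicator_iff hm]
      refine ContinuousOn.aestronglyMeasurable ((C j).hc.mono fun x hx => ⟨le_of_lt (show 0 < t j x from hx.1), hsub j (ball_subset_ball (by norm_num) hx.2)⟩) hm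
    · by_cases hx : x ∈ {x | 0 < t j x} ∩ ball (0:E) 1
      · simp only [hf]
        rw [indicator_of_mem hx]; exact hS j x (ball_subset_closedBall hx.2) (le_of_lt hx.1)
      · simp only [hf]
        rw [indicator_of_notMem hx]; simpa using hS0.le
    · exact indicator_of_notMem (fun h => hx h.2) _
  set ε1 : ℝ := min (1/16) (c1 / (4 * (S * LC E * 12))) with hε1
  have hε1p : 0 < ε1 := by positivity
  have hε1a : ε1 ≤ 1/16 := min_le_left _ _
  have hε1b : S * LC E * (12 * ε1) ≤ c1 / 4 := by
    have h1 : ε1 ≤ c1 / (4 * (S * LC E * 12)) := min_le_right _ _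
    rw [le_div_iff₀ (by positivity)] at h1
    linarith
  set η : ℝ := ε1 / 4 with hη
  have hηp : 0 < η := by positivity
  obtain ⟨ψ, hψN, hψ2, hψs, hlps, hψ0, hψ1⟩ := exists_bump (E := E) hηp
  have hhyp : (hyperfilter ℕ : Filter ℕ) ≤ atTop := Nat.hyperfilter_le_atTop
  obtain ⟨G, hG0, hG⟩ := hψN.fderiv.bdd
  have hharm : ∀ x ∈ ball (0:E) (1/4), HarmAt (TT f ψ) x := by
    intro x hx
    rw [mem_ball_zero_iff] at hx
    rw [harmAt_iff (stdOrthonormalBasis ℝ E)]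
    refine ⟨(hbf.contDiff hψN).contDiffAt, ?_⟩
    change lp (TT f ψ) x = 0
    refine tendsto_nhds_unique (hbf.lp_tend hψN x) ?_
    have hlim : Tendsto (fun j => Ccut * (3 * ε j * G) * volume.real (closedBall x (η + 3))) (hyperfilter ℕ : Filter ℕ) (𝓝 0) := by
      have : Tendsto (fun j => Ccut * (3 * ε j * G) * volume.real (closedBall x (η + 3))) atTop (𝓝 (Ccut * (3 * 0 * G) * volume.real (closedBall x (η + 3)))) := by
        refine ((((hε.const_mul 3).mul_const G).const_mul Ccut).mul_const _)
      simp only [mul_zero, zero_mul] at this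
      exact this.mono_left hhyp
    refine squeeze_zero_norm (fun j => ?_) hlim
    have hw := (C j).weak (q := x) (ρ := η) (r := 1) (ε := ε j) (G := G) (φ := fun y => ψ (x - y)) one_pos (fun y hy => hsub j (by
        rw [mem_closedBall, dist_eq_norm] at hy
        rw [mem_ball_zero_iff]
        have : ‖y‖ ≤ ‖y - x‖ + ‖x‖ := by simpa using norm_add_le (y - x) x
        linarith)) (hψ2.comp (contDiff_const.sub contDiff_id)) (fun y hy => hψs _ (by
        rw [mem_closedBall, dist_eq_norm, norm_sub_rev] at hy; linarith)) hG0 (fun y => by rw [(lp_refl hψ2 x y).1]; exact hG _) (hε0 j) (fun b hbb h0 => hb j b (by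
        rw [mem_closedBall, dist_eq_norm] at hbb
        rw [mem_ball_zero_iff]
        have : ‖b‖ ≤ ‖b - x‖ + ‖x‖ := by simpa using norm_add_le (b - x) x
        linarith) h0)
    refine le_of_eq_of_le ?_ hw
    rw [Real.norm_eq_abs, ← integral_indicator (C j).meas_U]
    congr 2
    funext y
    by_cases hy : 0 < t j y
    · rw [indicator_of_mem (by exact hy), (lp_refl hψ2 x y).2]
      by_cases hy1 : y ∈ ball (0:E) 1
      · simp only [hf]
        rw [indicator_of_mem (show y ∈ {x | 0 < t j x} ∩ ball (0:E) 1 from ⟨hy, hy1⟩)]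
      · rw [hlps, mul_zero, mul_zero]
        rw [mem_ball_zero_iff] at hy1
        have : ‖y‖ ≤ ‖x - y‖ + ‖x‖ := by rw [norm_sub_rev]; simpa using norm_add_le (y - x) x
        linarith
    · rw [indicator_of_notMem (by exact hy)]
      simp only [hf]
      rw [indicator_of_notMem (fun h => hy h.1), zero_mul]
  have hnear : ∀ᶠ x in 𝓝 (-(1/8:ℝ) • e), TT f ψ x = 0 := by
    filter_upwards [ball_mem_nhds (-(1/8:ℝ) • e) (show (0:ℝ) < 1/32 by norm_num)] with x hx
    refine tendsto_nhds_unique (hbf.tend hψN x) ?_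
    refine tendsto_const_nhds.congr fun j => ?_
    symm
    refine integral_eq_zero_of_ae (Eventually.of_forall fun y => ?_)
    show f j y • ψ (x - y) = 0
    by_cases hv : η < ‖x - y‖
    · rw [hψs _ hv, smul_zero]
    · have hfy : f j y = 0 := by
        refine indicator_of_notMem (fun h => ?_) _
        have hty : 0 < t j y := h.1
        have h1 := (C j).tlip y 0
        rw [ht0, sub_zero, sub_zero] at h1
        rw [mem_ball, dist_eq_norm] at hx
        have h2 : ‖y - -(1/8:ℝ) • e‖ ≤ 3/64 := by
          have : y - -(1/8:ℝ) • e = (x - -(1/8:ℝ) • e) - (x - y) := by abel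
          rw [this]
          refine (norm_sub_le _ _).trans ?_
          linarith
        have h3 : ⟪y, e⟫ ≤ -1/8 + 3/64 := by
          have h4 := real_inner_le_norm (y - -(1/8:ℝ) • e) e
          rw [inner_sub_left, inner_smul_left, real_inner_self_eq_norm_sq, he] at h4
          rw [mul_one] at h4
          simp only [map_neg, one_pow, mul_one] at h4
          have h40 : (starRingEnd ℝ) (1/8 : ℝ) = 1/8 := rfl
          rw [h40] at h4
          linarith
        have h5 : ‖y‖ ≤ 1 := (mem_ball_zero_iff.1 h.2).le
        have h6 := (C j).τ1
        have h7 := (C j).τ0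
        have h8 := (abs_le.1 h1).2
        have : τ j * ‖y‖ ≤ 1/100 := by nlinarith [norm_nonneg y]
        linarith
      rw [hfy, zero_smul]
  have hz := harm_uc (u := TT f ψ) he isOpen_ball (convex_ball (0:E) (1/4)).isPreconnected hharm (a := -(1/8:ℝ) • e) (by
    rw [mem_ball_zero_iff, norm_smul, he]; norm_num) hnear
  choose x hx1 hx2 hx3 using hx
  have hKc := isCompact_closedBall (0:E) (3/16)
  have hzm : ∀ j, x j + ε1 • e ∈ closedBall (0:E) (3/16) := fun j => by
    have := hx1 j
    rw [mem_ball_zero_iff] at this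
    rw [mem_closedBall_zero_iff]
    refine (norm_add_le _ _).trans ?_
    rw [norm_smul, he, Real.norm_eq_abs, abs_of_pos hε1p]; linarith
  obtain ⟨z, hzc, hzl⟩ := hKc.ultrafilter_le_nhds ((hyperfilter ℕ).map (fun j => x j + ε1 • e)) (by
    rw [le_principal_iff]
    show ∀ᶠ j in (hyperfilter ℕ : Filter ℕ), x j + ε1 • e ∈ closedBall (0:E) (3/16)
    exact Eventually.of_forall hzm)
  have hzl' : Tendsto (fun j => x j + ε1 • e) (hyperfilter ℕ : Filter ℕ) (𝓝 z) := hzl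
  have hTz : TT f ψ z = 0 := hz z (closedBall_subset_ball (by norm_num) hzc)
  obtain ⟨K, hK0, hK⟩ := hbf.lip hψN
  have hl0 : Tendsto (fun j => II f ψ j (x j + ε1 • e)) (hyperfilter ℕ : Filter ℕ) (𝓝 0) := by
    have h1 := hbf.tend hψN z
    rw [hTz] at h1
    have h2 : Tendsto (fun j => II f ψ j (x j + ε1 • e) - II f ψ j z) (hyperfilter ℕ : Filter ℕ) (𝓝 0) := by
      have h3 : Tendsto (fun j => K * ‖x j + ε1 • e - z‖) (hyperfilter ℕ : Filter ℕ) (𝓝 0) := by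
        have := ((hzl'.sub_const z).norm).const_mul K
        simpa using this
      exact squeeze_zero_norm (fun j => hK j z _) h3
    simpa using h2.add h1
  have hev : ∀ᶠ j in (hyperfilter ℕ : Filter ℕ), S * LC E * (18 * ε j) < c1 / 4 := by
    have : Tendsto (fun j => S * LC E * (18 * ε j)) atTop (𝓝 (S * LC E * (18 * 0))) := (hε.const_mul 18).const_mul _
    simp only [mul_zero] at this
    exact (this.mono_left hhyp).eventually_lt_const (by positivity)
  have hev2 : ∀ᶠ j in (hyperfilter ℕ : Filter ℕ), |II f ψ j (x j + ε1 • e)| < c1 / 2 := by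
    have := hl0.abs
    rw [abs_zero] at this
    exact this.eventually_lt_const (by positivity)
  obtain ⟨j, hj1, hj2⟩ := (hev.and hev2).exists
  -- lower bound
  have hxj := hx1 j
  rw [mem_ball_zero_iff] at hxj
  set w := x j + ε1 • e with hw
  have hy : ∀ y, ‖w - y‖ ≤ η → |f j y - h j (x j)| ≤ c1 / 2 := by
    intro y hy
    have hyw : ‖y - x j‖ ≤ 2 * ε1 := by
      have : y - x j = ε1 • e - (w - y) := by rw [hw]; abel
      rw [this]
      refine (norm_sub_le _ _).trans ?_
      rw [norm_smul, he, Real.norm_eq_abs, abs_of_pos hε1p]; linarith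
    have hyn : ‖y‖ < 1 := by
      have : ‖y‖ ≤ ‖y - x j‖ + ‖x j‖ := by simpa using norm_add_le (y - x j) (x j)
      linarith
    have hty : 0 < t j y := by
      have h1 := (C j).tlip' w y
      have h2 : t j w = t j (x j) + ε1 := (C j).te _ _
      have := (abs_le.1 h1).2
      have := hx2 j
      linarith
    have hfy : f j y = h j y := indicator_of_mem (show y ∈ {x | 0 < t j x} ∩ ball (0:E) 1 from ⟨hty, mem_ball_zero_iff.2 hyn⟩) _
    rw [hfy, abs_sub_comm]
    have := (C j).osc_eps (x := x j) (y := y) (r := 1/2) (S := S) (by norm_num) hS0 (fun u hu => hsub j (by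
        rw [mem_ball, dist_eq_norm] at hu
        rw [mem_ball_zero_iff]
        have : ‖u‖ ≤ ‖u - x j‖ + ‖x j‖ := by simpa using norm_add_le (u - x j) (x j)
        linarith)) (fun u hu h0 => hS j u (by
        rw [mem_ball, dist_eq_norm] at hu
        rw [mem_closedBall_zero_iff]
        have : ‖u‖ ≤ ‖u - x j‖ + ‖x j‖ := by simpa using norm_add_le (u - x j) (x j)
        linarith) h0) (hx2 j).le hty.le (by linarith)
    refine this.trans ?_
    have h9 : S * LC E * (3 * ‖y - x j‖ / (1/2) + 18 * τ j) ≤ S * LC E * (12 * ε1 + 18 * ε j) := by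
      have := hτ j
      gcongr
      linarith
    refine h9.trans ?_
    rw [mul_add]; linarith
  have hintg : ∫ y, ψ (w - y) = 1 := by
    rw [integral_sub_left_eq_self ψ volume w]; exact hψ1
  have hii : Integrable (fun y => ψ (w - y)) volume := by
    have : Integrable ψ volume := hψN.1.continuous.integrable_of_hasCompactSupport hψN.2
    exact this.comp_sub_left w
  have hdiff : |II f ψ j w - h j (x j)| ≤ c1 / 2 := by
    have h1 : II f ψ j w - h j (x j) = ∫ y, (f j y - h j (x j)) * ψ (w - y) := by
      have : ∀ y, (f j y - h j (x j)) * ψ (w - y) = f j y • ψ (w - y) - h j (x j) * ψ (w - y) := fun y => by rw [smul_eq_mul]; ring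
      simp_rw [this]
      rw [integral_sub (hbf.int j hψN w) (hii.const_mul _), integral_const_mul, hintg, mul_one]; rfl
    rw [h1, ← Real.norm_eq_abs]
    have h2 : c1 / 2 = ∫ y, c1 / 2 * ψ (w - y) := by rw [integral_const_mul, hintg, mul_one]
    rw [h2]
    refine norm_integral_le_of_norm_le (hii.const_mul _) (Eventually.of_forall fun y => ?_)
    rw [norm_mul, Real.norm_eq_abs, Real.norm_eq_abs, abs_of_nonneg (hψ0 _)]
    by_cases hv : η < ‖w - y‖
    · rw [hψs _ hv]; simp
    · exact mul_le_mul_of_nonneg_right (hy y (not_lt.1 hv)) (hψ0 _)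
  have h3 := hx3 j
  have h4 := abs_sub_abs_le_abs_sub (h j (x j)) (II f ψ j w)
  rw [abs_sub_comm] at h4
  linarith

lemma partB {e : E} (he : ‖e‖ = 1) {κ : ℝ} (hκ : 0 < κ) : ∃ ε > 0, ∀ (t h : E → ℝ) (n : E → E) (p : E) (R τ M : ℝ),
    Cfg t h n e p R τ M → t 0 = 0 → ball (0:E) 4 ⊆ ball p R → τ ≤ ε → τ ≤ tau0 E → HH t h 0 2 ≤ 1 → κ ≤ HH t h 0 (1/8) →
    ∃ b ∈ ball (0:E) (1/2), t b = 0 ∧ ε < |h b| := by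
  by_contra! hcon
  have hpos : ∀ j : ℕ, (0:ℝ) < 1 / ((j:ℝ) + 1) := fun j => by positivity
  choose t h n p R τ M C ht0 hsub hτ hτ0 hH1 hH2 hb using fun j : ℕ => hcon (1 / ((j:ℝ) + 1)) (hpos j)
  have hCG := CG_pos (E := E)
  have hv : 0 < volume.real (ball (0:E) (1/8)) := by rw [vol_ball _ (by norm_num)]; have := vol_ball_pos (E := E); positivity
  refine partB_seq he t h n p R τ M (fun j => 1 / ((j:ℝ) + 1)) (S := √(CG E)) (c1 := √(κ / (2 * volume.real (ball (0:E) (1/8))))) C ht0 hsub hpos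
    tendsto_one_div_add_atTop_nhds_zero_nat hτ (by positivity) (fun j x hx htx => ?_) (by positivity) (fun j => ?_) (fun j b hb1 hb2 => hb j b hb1 hb2)
  · have := (C j).growth (hτ0 j) (q := 0) (r := 1) one_pos ((closedBall_subset_ball (by norm_num)).trans (hsub j)) hx htx
    rw [one_pow, mul_one, mul_one] at this
    refine Real.abs_le_sqrt (this.trans ?_)
    have h1 := hH1 j
    unfold HH at h1
    nlinarith
  · obtain ⟨x, hx, htx, hb⟩ := (C j).exists_big (by norm_num) ((closedBall_subset_ball (by norm_num)).trans (hsub j)) hκ (hH2 j)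
    refine ⟨x, hx, htx, ?_⟩
    rw [← Real.sqrt_sq_eq_abs]
    exact Real.sqrt_le_sqrt hb
end NodalNeumann

end

noncomputable section
open MeasureTheory Metric Set Filter Asymptotics
open scoped Topology NNReal ENNReal RealInnerProductSpace
namespace NodalNeumann
set_option linter.all false
variable {E : Type*} [NormedAddCommGroup E] [InnerProductSpace ℝ E] [FiniteDimensional ℝ E]

/-- level-function description of an open set near `b`. -/
structure Lev (Ω : Set E) (t : E → ℝ) (e b : E) (ρ : ℝ) : Prop where
  ho : IsOpen Ω
  he : ‖e‖ = 1
  te : ∀ x (u : ℝ), t (x + u • e) = t x + u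
  hc : Continuous t
  hΩ : Ω ∩ ball b ρ = {x | 0 < t x} ∩ ball b ρ

namespace Lev
variable {Ω : Set E} {t : E → ℝ} {e b : E} {ρ : ℝ}

lemma mem (L : Lev Ω t e b ρ) {x : E} (hx : x ∈ ball b ρ) : x ∈ Ω ↔ 0 < t x := by
  have : x ∈ Ω ∩ ball b ρ ↔ x ∈ {x | 0 < t x} ∩ ball b ρ := by rw [L.hΩ]
  simpa [mem_inter_iff, hx, -mem_ball] using this

lemma mem_cl (L : Lev Ω t e b ρ) {x : E} (hx : x ∈ ball b ρ) : x ∈ closure Ω ↔ 0 ≤ t x := by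
  constructor
  · intro h
    by_contra! hneg
    rw [_root_.mem_closure_iff] at h
    obtain ⟨y, ⟨hy1, hy2⟩, hy3⟩ := h ({x | t x < 0} ∩ ball b ρ) ((isOpen_lt L.hc continuous_const).inter isOpen_ball) ⟨hneg, hx⟩
    have := (L.mem hy2).1 hy3
    have : t y < 0 := hy1
    linarith
  · intro h
    rw [mem_closure_iff_seq_limit]
    have hl : Tendsto (fun j : ℕ => x + (1 / ((j:ℝ) + 1)) • e) atTop (𝓝 x) := by
      have := (tendsto_one_div_add_atTop_nhds_zero_nat (𝕜 := ℝ)).smul_const e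
      simpa using this.const_add x
    obtain ⟨N, hN⟩ := eventually_atTop.1 (hl.eventually (isOpen_ball.mem_nhds hx))
    refine ⟨fun j => x + (1 / (((j + N : ℕ):ℝ) + 1)) • e, fun j => ?_, hl.comp (tendsto_add_atTop_nat N)⟩
    rw [L.mem (hN _ (by omega)), L.te]
    positivity

lemma mem_fr (L : Lev Ω t e b ρ) {x : E} (hx : x ∈ ball b ρ) : x ∈ frontier Ω ↔ t x = 0 := by
  rw [L.ho.frontier_eq, mem_diff, L.mem_cl hx, L.mem hx]
  constructor
  · rintro ⟨h1, h2⟩; linarith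
  · intro h; rw [h]; simp

/-- tangential estimate for a little-o normal -/
lemma normal (L : Lev Ω t e b ρ) {x ν v : E} {K : ℝ} (hx : x ∈ ball b ρ) (htx : t x = 0) (hK : 0 ≤ K)
    (hν : (fun y : E => (⟪ν, y - x⟫)) =o[𝓝[frontier Ω] x] fun y => ‖y - x‖)
    (hv : ∀ᶠ s : ℝ in 𝓝[>] 0, |t (x + s • v)| ≤ K * s) : |⟪ν, v⟫| ≤ K * |⟪ν, e⟫| := by
  set γ : ℝ → E := fun s => x + s • v - t (x + s • v) • e with hγ
  have hγc : Continuous γ := by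
    have := L.hc
    fun_prop
  have hγ0 : γ 0 = x := by simp [hγ, htx]
  have hγl : Tendsto γ (𝓝[>] 0) (𝓝 x) := by
    have := (hγc.tendsto 0).mono_left (nhdsWithin_le_nhds (s := Ioi 0))
    rwa [hγ0] at this
  have hγf : Tendsto γ (𝓝[>] 0) (𝓝[frontier Ω] x) := by
    rw [tendsto_nhdsWithin_iff]
    refine ⟨hγl, ?_⟩
    filter_upwards [hγl.eventually (isOpen_ball.mem_nhds hx)] with s hs
    rw [L.mem_fr hs]
    have := L.te (x + s • v) (-t (x + s • v))
    rw [neg_smul, ← sub_eq_add_neg] at this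
    simp only [hγ]; rw [this]; ring
  refine le_of_forall_pos_le_add fun δ hδ => ?_
  set c : ℝ := δ / (‖v‖ + K + 1) with hc
  have hcp : 0 < c := by have := norm_nonneg v; positivity
  have h1 := hγf.eventually (hν.def hcp)
  obtain ⟨s, hs1, hs2, hs3⟩ := (h1.and (hv.and self_mem_nhdsWithin)).exists
  have hs3 : 0 < s := hs3
  have hd : γ s - x = s • v - t (x + s • v) • e := by simp only [hγ]; abel
  rw [hd, inner_sub_right, inner_smul_right, inner_smul_right, norm_norm, Real.norm_eq_abs] at hs1
  have h2 : ‖s • v - t (x + s • v) • e‖ ≤ s * ‖v‖ + K * s := by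
    refine (norm_sub_le _ _).trans ?_
    rw [norm_smul, norm_smul, L.he, mul_one, Real.norm_eq_abs, Real.norm_eq_abs, abs_of_pos hs3]
    linarith
  have h3 : |s * ⟪ν, v⟫| ≤ |s * ⟪ν, v⟫ - t (x + s • v) * ⟪ν, e⟫| + |t (x + s • v) * ⟪ν, e⟫| := by
    have := abs_add_le (s * ⟪ν, v⟫ - t (x + s • v) * ⟪ν, e⟫) (t (x + s • v) * ⟪ν, e⟫)
    rwa [sub_add_cancel] at this
  rw [abs_mul, abs_mul (t (x + s • v)), abs_of_pos hs3] at h3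
  have h4 : |t (x + s • v)| * |⟪ν, e⟫| ≤ K * s * |⟪ν, e⟫| := by gcongr
  have h5 : c * (s * ‖v‖ + K * s) ≤ δ * s := by
    have : c * (‖v‖ + K + 1) = δ := by rw [hc]; have := norm_nonneg v; field_simp
    nlinarith
  have h6 : c * ‖s • v - t (x + s • v) • e‖ ≤ c * (s * ‖v‖ + K * s) := by gcongr
  have h7 : s * |⟪ν, v⟫| ≤ s * (K * |⟪ν, e⟫| + δ) := by linarith
  exact le_of_mul_le_mul_left h7 hs3

end Lev

lemma normal_quad {Ω : Set E} {t : E → ℝ} {e b ν : E} {ρ K : ℝ} (L : Lev Ω t e b ρ) (hρ : 0 < ρ) (htb : t b = 0) (A : E →L[ℝ] ℝ) (hA : A e = 1) (hK : 0 ≤ K)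
    (hq : ∀ y, |t y - A (y - b)| ≤ K * ‖y - b‖ ^ 2) (hν1 : ‖ν‖ = 1)
    (hν : (fun y : E => (⟪ν, y - b⟫)) =o[𝓝[frontier Ω] b] fun y => ‖y - b‖) {y : E} (hy : y ∈ frontier Ω) :
    |⟪ν, y - b⟫| ≤ (K + 1 / ρ) * ‖y - b‖ ^ 2 := by
  set a : E := (InnerProductSpace.toDual ℝ E).symm A with ha
  have haA : ∀ w, ⟪a, w⟫ = A w := fun w => InnerProductSpace.toDual_symm_apply
  have ha1 : 1 ≤ ‖a‖ := by
    have := real_inner_le_norm a e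
    rw [haA, hA, L.he, mul_one] at this
    exact this
  set c : ℝ := ⟪ν, a⟫ / ‖a‖ ^ 2 with hc
  set v : E := ν - c • a with hv
  have hav : ⟪a, v⟫ = 0 := by
    rw [hv, inner_sub_right, inner_smul_right, real_inner_self_eq_norm_sq, hc, real_inner_comm a ν]
    field_simp
    ring
  have hv0 : ⟪ν, v⟫ = 0 := by
    have key : ∀ k > 0, |⟪ν, v⟫| ≤ k := by
      intro k hk
      have h1 := L.normal (x := b) (ν := ν) (v := v) (K := k) (mem_ball_self hρ) htb hk.le hν (by
        have h2 : ∀ᶠ s : ℝ in 𝓝[>] 0, s < k / (K * ‖v‖ ^ 2 + 1) := by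
          refine nhdsWithin_le_nhds (eventually_lt_nhds (by positivity))
        filter_upwards [h2, self_mem_nhdsWithin] with s hs hs0
        have hs0 : 0 < s := hs0
        have h3 := hq (b + s • v)
        rw [add_sub_cancel_left, map_smul, ← haA, hav, smul_zero, sub_zero, norm_smul, Real.norm_eq_abs, abs_of_pos hs0] at h3
        refine h3.trans ?_
        rw [lt_div_iff₀ (by positivity)] at hs
        nlinarith)
      have h5 : |⟪ν, e⟫| ≤ 1 := by
        have := abs_real_inner_le_norm ν e
        rwa [hν1, L.he, mul_one] at this
      nlinarith
    have := le_of_forall_pos_le_add (a := |⟪ν, v⟫|) (b := 0) (fun k hk => by simpa using key k hk)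
    exact abs_eq_zero.1 (le_antisymm this (abs_nonneg _))
  have hvz : v = 0 := by
    have : ⟪v, v⟫ = 0 := by
      conv_lhs => rw [hv, inner_sub_left, inner_smul_left]
      rw [← hv, hv0, hav]; simp
    exact inner_self_eq_zero.1 this
  have hνa : ν = c • a := by rw [hv] at hvz; exact sub_eq_zero.1 hvz
  have hc1 : |c| ≤ 1 := by
    have := hν1
    rw [hνa, norm_smul, Real.norm_eq_abs] at this
    nlinarith [abs_nonneg c]
  by_cases hyb : y ∈ ball b ρ
  · have hty := (L.mem_fr hyb).1 hy
    have h1 := hq y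
    rw [hty, zero_sub, abs_neg, ← haA] at h1
    rw [hνa, inner_smul_left, abs_mul]
    have h2 : |(starRingEnd ℝ) c| = |c| := rfl
    rw [h2]
    have h3 : 0 ≤ 1 / ρ * ‖y - b‖ ^ 2 := by positivity
    nlinarith [abs_nonneg c, abs_nonneg ⟪a, y - b⟫]
  · rw [mem_ball, dist_eq_norm, not_lt] at hyb
    have h1 := abs_real_inner_le_norm ν (y - b)
    rw [hν1, one_mul] at h1
    have h2 : ‖y - b‖ ≤ 1 / ρ * ‖y - b‖ ^ 2 := by
      rw [div_mul_eq_mul_div, le_div_iff₀ hρ]; nlinarith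
    have h3 : 0 ≤ K * ‖y - b‖ ^ 2 := by positivity
    linarith
end NodalNeumann

end

noncomputable section
open MeasureTheory Metric Set Filter Asymptotics
open scoped Topology NNReal ENNReal RealInnerProductSpace
namespace NodalNeumann
set_option linter.all false

section
variable {E : Type*} [NormedAddCommGroup E] [InnerProductSpace ℝ E] [FiniteDimensional ℝ E]

lemma mk_cfg {Ω : Set E} {t h : E → ℝ} {ν : E → E} {e x₀ : E} {R τ K : ℝ} (L : Lev Ω t e x₀ R)
    (ht0 : t x₀ = 0) (htl : ∀ x y, |t x - t y - ⟪x - y, e⟫| ≤ τ * ‖x - y‖) (hτ0 : 0 ≤ τ) (hτ1 : τ ≤ 1/100) (hK : 0 ≤ K)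
    (hν1 : ∀ x ∈ frontier Ω ∩ ball x₀ R, ‖ν x‖ = 1)
    (hν : ∀ x ∈ frontier Ω ∩ ball x₀ R, (fun y : E => (⟪ν x, y - x⟫)) =o[𝓝[frontier Ω] x] fun y => ‖y - x‖)
    (hq : ∀ x ∈ frontier Ω ∩ ball x₀ R, ∀ y ∈ frontier Ω, |⟪ν x, y - x⟫| ≤ K * ‖y - x‖ ^ 2)
    (hc : ContinuousOn h (closure Ω)) (hh : ∀ x ∈ Ω, HarmAt h x)
    (hN : ∀ x ∈ frontier Ω ∩ ball x₀ R, DifferentiableWithinAt ℝ h (closure Ω) x ∧ fderivWithin ℝ h (closure Ω) x (ν x) = 0) :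
    ∃ n M', Cfg t h n e x₀ (R / 4) τ M' := by
  have htl' : ∀ x y, |t x - t y| ≤ 2 * ‖x - y‖ := by
    intro x y
    have h1 := abs_le.1 (htl x y)
    have h2 := abs_real_inner_le_norm (x - y) e
    rw [L.he, mul_one] at h2
    have h2 := abs_le.1 h2
    have := norm_nonneg (x - y)
    rw [abs_le]; constructor <;> nlinarith
  have hball : ball x₀ (R/4) ⊆ ball x₀ R := fun x hx => by
    rw [mem_ball] at *; have : 0 ≤ dist x x₀ := dist_nonneg; linarith
  set b : E → E := fun x => x - t x • e with hb
  have htb : ∀ x, t (b x) = 0 := fun x => by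
    have := L.te x (-t x)
    rw [neg_smul, ← sub_eq_add_neg] at this
    rw [hb]; simp only; rw [this]; ring
  have hbb : ∀ x ∈ ball x₀ (R/4), b x ∈ frontier Ω ∩ ball x₀ R := by
    intro x hx
    have hm : b x ∈ ball x₀ R := by
      rw [mem_ball, dist_eq_norm] at *
      have h1 := htl' x x₀
      rw [ht0, sub_zero] at h1
      have : b x - x₀ = (x - x₀) - t x • e := by simp only [hb]; abel
      rw [this]
      refine (norm_sub_le _ _).trans_lt ?_
      rw [norm_smul, L.he, mul_one, Real.norm_eq_abs]
      linarith [norm_nonneg (x - x₀)]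
    exact ⟨(L.mem_fr hm).2 (htb x), hm⟩
  have hin : ∀ x ∈ frontier Ω ∩ ball x₀ R, 1/2 ≤ |⟪ν x, e⟫| := by
    intro x hx
    set v : E := ν x - ⟪ν x, e⟫ • e with hv
    have hve : ⟪v, e⟫ = 0 := by
      rw [hv, inner_sub_left, inner_smul_left, real_inner_self_eq_norm_sq, L.he]; simp
    have h1 := L.normal (x := x) (ν := ν x) (v := v) (K := τ * ‖v‖) hx.2 ((L.mem_fr hx.2).1 hx.1) (by positivity) (hν x hx) (by
      filter_upwards [self_mem_nhdsWithin] with s hs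
      have hs : 0 < s := hs
      have := htl (x + s • v) x
      rw [(L.mem_fr hx.2).1 hx.1, sub_zero, add_sub_cancel_left, inner_smul_left, hve, mul_zero, sub_zero, norm_smul, Real.norm_eq_abs, abs_of_pos hs] at this
      linarith)
    have h2 : ⟪ν x, v⟫ = ‖v‖ ^ 2 := by
      have : ν x = v + ⟪ν x, e⟫ • e := by rw [hv]; abel
      conv_lhs => rw [this]
      rw [inner_add_left, inner_smul_left, real_inner_comm v e, hve, real_inner_self_eq_norm_sq]; simp
    have h3 : |⟪ν x, e⟫| ≤ 1 := by
      have := abs_real_inner_le_norm (ν x) e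
      rwa [hν1 x hx, L.he, mul_one] at this
    have h4 : ‖v‖ ≤ 1/100 := by
      rw [h2, abs_of_nonneg (by positivity)] at h1
      by_contra! hcon
      have : τ * ‖v‖ * |⟪ν x, e⟫| ≤ τ * ‖v‖ * 1 := by gcongr
      nlinarith
    have h5 : ‖ν x‖ ≤ ‖v‖ + |⟪ν x, e⟫| := by
      have : ν x = v + ⟪ν x, e⟫ • e := by rw [hv]; abel
      conv_lhs => rw [this]
      refine (norm_add_le _ _).trans ?_
      rw [norm_smul, L.he, mul_one, Real.norm_eq_abs]
    rw [hν1 x hx] at h5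
    linarith
  refine ⟨fun x => (⟪ν (b x), e⟫)⁻¹ • ν (b x), 2 * (K * 9), L.he, L.te, htl, hτ0, hτ1, by positivity, ?_, ?_, ?_, ?_⟩
  · intro x hx y hy
    have hi := hin _ (hbb x hx)
    have hi0 : ⟪ν (b x), e⟫ ≠ 0 := by intro h; rw [h] at hi; norm_num at hi
    have h1 : t y - t x - ⟪(⟪ν (b x), e⟫)⁻¹ • ν (b x), y - x⟫ = -((⟪ν (b x), e⟫)⁻¹ * ⟪ν (b x), b y - b x⟫) := by
      have : y - x = (b y - b x) + (t y - t x) • e := by simp only [hb]; rw [sub_smul]; abel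
      rw [this, inner_smul_left, inner_add_right, inner_smul_right, mul_add]
      have h40 : ∀ c : ℝ, (starRingEnd ℝ) c = c := fun c => rfl
      rw [h40]
      field_simp
      ring
    rw [h1, abs_neg, abs_mul, abs_inv]
    have h2 := hq _ (hbb x hx) _ (hbb y hy).1
    have h3 : ‖b y - b x‖ ≤ 3 * ‖y - x‖ := by
      have : b y - b x = (y - x) - (t y - t x) • e := by simp only [hb]; rw [sub_smul]; abel
      rw [this]
      refine (norm_sub_le _ _).trans ?_
      rw [norm_smul, L.he, mul_one, Real.norm_eq_abs]
      linarith [htl' y x]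
    have h4 : |⟪ν (b x), e⟫|⁻¹ ≤ 2 := by
      rw [inv_le_comm₀ (by linarith) (by norm_num)]; linarith
    calc |⟪ν (b x), e⟫|⁻¹ * |⟪ν (b x), b y - b x⟫| ≤ 2 * (K * (3 * ‖y - x‖) ^ 2) := by
          refine mul_le_mul h4 (h2.trans ?_) (abs_nonneg _) (by norm_num)
          gcongr
      _ = _ := by ring
  · exact hc.mono fun x hx => (L.mem_cl (hball hx.2)).2 hx.1
  · exact fun x hx htx => hh x ((L.mem (hball hx)).2 htx)
  · intro x hx htx
    have hfr : x ∈ frontier Ω ∩ ball x₀ R := ⟨(L.mem_fr (hball hx)).2 htx, hball hx⟩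
    obtain ⟨h1, h2⟩ := hN x hfr
    have hbx : b x = x := by simp [hb, htx]
    refine ⟨fderivWithin ℝ h (closure Ω) x, h1.hasFDerivWithinAt.mono_of_mem_nhdsWithin ?_, ?_⟩
    · filter_upwards [self_mem_nhdsWithin, nhdsWithin_le_nhds (isOpen_ball.mem_nhds (hball hx))] with y hy1 hy2
      exact (L.mem_cl hy2).2 hy1
    · simp only [hbx, map_smul, h2, smul_zero]
end

variable {n : ℕ}

def eL (n : ℕ) : Euc (n + 1) := EuclideanSpace.single (Fin.last n) 1

lemma eL_norm : ‖eL n‖ = 1 := by simp [eL]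

lemma lastc_inner (x : Euc (n + 1)) : ⟪x, eL n⟫ = lastc x := by
  simp [eL, lastc, EuclideanSpace.inner_single_right]

lemma front_add (x y : Euc (n + 1)) : front (x + y) = front x + front y := by ext i; simp [front]
lemma front_sub (x y : Euc (n + 1)) : front (x - y) = front x - front y := by ext i; simp [front]
lemma front_smul (c : ℝ) (x : Euc (n + 1)) : front (c • x) = c • front x := by ext i; simp [front]
lemma front_eL : front (eL n) = 0 := by
  ext i; simp [front, eL, Fin.castSucc_ne_last]
lemma lastc_add (x y : Euc (n + 1)) : lastc (x + y) = lastc x + lastc y := by simp [lastc]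
lemma lastc_sub (x y : Euc (n + 1)) : lastc (x - y) = lastc x - lastc y := by simp [lastc]
lemma lastc_smul (c : ℝ) (x : Euc (n + 1)) : lastc (c • x) = c * lastc x := by simp [lastc]
lemma lastc_eL : lastc (eL n) = 1 := by simp [lastc, eL]
lemma norm_sq_split (x : Euc (n + 1)) : ‖x‖ ^ 2 = ‖front x‖ ^ 2 + lastc x ^ 2 := by
  rw [EuclideanSpace.norm_sq_eq, EuclideanSpace.norm_sq_eq, Fin.sum_univ_castSucc]
  simp [front, lastc]
lemma front_norm (x : Euc (n + 1)) : ‖front x‖ ≤ ‖x‖ := by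
  refine abs_le_of_sq_le_sq' ?_ (norm_nonneg _) |>.2
  rw [norm_sq_split x]; nlinarith [sq_nonneg (lastc x)]

def frontL (n : ℕ) : Euc (n + 1) →L[ℝ] Euc n :=
  LinearMap.mkContinuous { toFun := front, map_add' := front_add, map_smul' := front_smul } 1 (fun x => by simpa using front_norm x)
lemma frontL_apply (x : Euc (n + 1)) : frontL n x = front x := rfl
def lastL (n : ℕ) : Euc (n + 1) →L[ℝ] ℝ := innerSL ℝ (eL n)
lemma lastL_apply (x : Euc (n + 1)) : lastL n x = lastc x := by
  rw [← lastc_inner, real_inner_comm]; rfl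

lemma harmAt_of {u : Euc n → ℝ} {Ω : Set (Euc n)} (hO : IsOpen Ω) (h : HarmonicOn u Ω) {x : Euc n} (hx : x ∈ Ω) : HarmAt u x := by
  have hc : ContDiffAt ℝ 2 u x := h.1.contDiffAt (hO.mem_nhds hx)
  rw [harmAt_iff (EuclideanSpace.basisFun (Fin n) ℝ)]
  refine ⟨hc, ?_⟩
  rw [← h.2 x hx]
  unfold laplacian
  refine Finset.sum_congr rfl fun i _ => ?_
  have hd : DifferentiableAt ℝ (fderiv ℝ u) x := (hc.fderiv_right (m := 1) (by norm_num)).differentiableAt (by norm_num)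
  rw [EuclideanSpace.basisFun_apply]
  have := (hd.hasFDerivAt.clm_apply (hasFDerivAt_const (EuclideanSpace.single i (1:ℝ)) x)).fderiv
  rw [this]; simp

lemma c11_quad {M : ℝ≥0} {g : Euc n → ℝ} (hg : IsC11FunWith M g) (u w : Euc n) : |g w - g u - fderiv ℝ g u (w - u)| ≤ M * ‖w - u‖ ^ 2 := by
  have := Convex.norm_image_sub_le_of_norm_fderiv_le' (𝕜 := ℝ) (f := g) (φ := fderiv ℝ g u) (C := M * ‖w - u‖) (s := closedBall u ‖w - u‖) (x := u) (y := w)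
    (fun z _ => hg.1 z) (fun z hz => by
      have h1 := hg.2.2.dist_le_mul z u
      rw [dist_eq_norm, dist_eq_norm] at h1
      rw [mem_closedBall, dist_eq_norm] at hz
      exact h1.trans (by gcongr)) (convex_closedBall _ _) (by simp) (by simp [dist_eq_norm])
  rwa [mul_assoc, ← sq] at this

lemma chart {Ω : Set (Euc (n + 1))} {b : Euc (n + 1)} {ρ : ℝ} {M : ℝ≥0} (hO : IsOpen Ω) (H : IsGraphBall Ω b ρ (IsC11FunWith M)) :
    ∃ (t : Euc (n + 1) → ℝ) (e : Euc (n + 1)) (A : Euc (n + 1) →L[ℝ] ℝ), Lev Ω t e b ρ ∧ t b = 0 ∧ A e = 1 ∧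
      ∀ y, |t y - A (y - b)| ≤ M * ‖y - b‖ ^ 2 := by
  obtain ⟨T, g, hg, hT0, hg0, hΩ⟩ := H
  set L := T.symm.linearIsometryEquiv with hL
  have hTs : ∀ y, T.symm y = L (y - b) := by
    intro y
    have h1 := T.symm.map_vsub y b
    have h2 : T.symm b = 0 := by rw [← hT0]; simp
    rw [h2] at h1
    simpa using h1.symm
  set e := L.symm (eL n) with he
  have hLe : L e = eL n := by simp [he]
  refine ⟨fun y => lastc (L (y - b)) - g (front (L (y - b))), e, ((lastL n) - (fderiv ℝ g 0).comp (frontL n)).comp (L.toContinuousLinearEquiv : Euc (n+1) →L[ℝ] Euc (n+1)), ⟨hO, by rw [he, L.symm.norm_map, eL_norm], ?_, ?_, ?_⟩, ?_, ?_, ?_⟩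
  · intro x u
    rw [add_sub_right_comm, map_add, map_smul, hLe, lastc_add, lastc_smul, lastc_eL, front_add, front_smul, front_eL, smul_zero, add_zero]
    ring
  · have h1 : Continuous fun y => lastL n (L (y - b)) := by
      have := L.continuous; fun_prop
    have h2 : Continuous fun y => g (frontL n (L (y - b))) := by
      have := L.continuous
      have := hg.1.continuous
      fun_prop
    simp only [lastL_apply] at h1
    exact h1.sub h2
  · rw [hΩ]
    ext y
    constructor
    · rintro ⟨w, ⟨hw1, hw2⟩, rfl⟩
      have h1 : L (T w - b) = w := by rw [← hTs]; simp
      refine ⟨?_, ?_⟩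
      · show 0 < lastc (L (T w - b)) - g (front (L (T w - b)))
        rw [h1]; linarith
      · rw [mem_ball, dist_eq_norm, ← L.norm_map, h1]; exact mem_ball_zero_iff.1 hw1
    · rintro ⟨h1, h2⟩
      have h1 : 0 < lastc (L (y - b)) - g (front (L (y - b))) := h1
      refine ⟨L (y - b), ⟨?_, by linarith⟩, ?_⟩
      · rw [mem_ball_zero_iff, L.norm_map, ← dist_eq_norm]; exact h2
      · rw [← hTs]; simp
  · have h1 : front (0 : Euc (n+1)) = 0 := by ext i; simp [front]
    simp [h1, hg0, lastc]
  · show lastL n (L e) - fderiv ℝ g 0 (frontL n (L e)) = 1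
    rw [hLe, lastL_apply, frontL_apply, lastc_eL, front_eL]; simp
  · intro y
    show |lastc (L (y - b)) - g (front (L (y - b))) - (lastL n (L (y - b)) - fderiv ℝ g 0 (frontL n (L (y - b))))| ≤ _
    rw [lastL_apply, frontL_apply]
    have h1 := c11_quad hg 0 (front (L (y - b)))
    rw [hg0, sub_zero, sub_zero] at h1
    have h2 : lastc (L (y - b)) - g (front (L (y - b))) - (lastc (L (y - b)) - fderiv ℝ g 0 (front (L (y - b)))) = -(g (front (L (y - b))) - fderiv ℝ g 0 (front (L (y - b)))) := by ring
    rw [h2, abs_neg]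
    refine h1.trans ?_
    have h3 := front_norm (L (y - b))
    rw [L.norm_map] at h3
    gcongr

def tf (x₀ : Euc (n + 1)) (f : Euc n → ℝ) (x : Euc (n + 1)) : ℝ := lastc (x - x₀) - f (front (x - x₀))

lemma tf_lev {Ω : Set (Euc (n + 1))} {x₀ : Euc (n + 1)} {R τ : ℝ} {f : Euc n → ℝ} (hO : IsOpen Ω) (hτ : 0 ≤ τ) (H : AlignedLipGraphOn Ω x₀ R τ f) :
    Lev Ω (tf x₀ f) (eL n) x₀ R ∧ tf x₀ f x₀ = 0 ∧ ∀ x y, |tf x₀ f x - tf x₀ f y - ⟪x - y, eL n⟫| ≤ τ * ‖x - y‖ := by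
  obtain ⟨hf, hf0, hΩ⟩ := H
  refine ⟨⟨hO, eL_norm, ?_, ?_, ?_⟩, ?_, ?_⟩
  · intro x u
    unfold tf
    rw [add_sub_right_comm, lastc_add, lastc_smul, lastc_eL, front_add, front_smul, front_eL, smul_zero, add_zero]
    ring
  · have h1 : Continuous fun y => lastL n (y - x₀) := by fun_prop
    have h2 : Continuous fun y => f (frontL n (y - x₀)) := by
      have := hf.continuous
      fun_prop
    simp only [lastL_apply] at h1
    exact h1.sub h2
  · rw [hΩ]
    ext y
    simp only [tf, mem_setOf_eq, mem_inter_iff, sub_pos]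
    exact and_comm
  · have h1 : front (0 : Euc (n+1)) = 0 := by ext i; simp [front]
    simp [tf, h1, hf0, lastc]
  · intro x y
    rw [lastc_inner]
    unfold tf
    have h1 : lastc (x - x₀) - f (front (x - x₀)) - (lastc (y - x₀) - f (front (y - x₀))) - lastc (x - y) = f (front (y - x₀)) - f (front (x - x₀)) := by
      simp only [lastc_sub]; ring
    rw [h1]
    have h2 := hf.dist_le_mul (front (y - x₀)) (front (x - x₀))
    rw [Real.dist_eq, Real.coe_toNNReal _ hτ, dist_eq_norm, ← front_sub, sub_sub_sub_cancel_right] at h2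
    refine h2.trans ?_
    rw [norm_sub_rev x y]
    have := front_norm (y - x)
    gcongr

lemma thm_cfg {Ω : Set (Euc (n + 1))} {ν : Euc (n + 1) → Euc (n + 1)} {x₀ : Euc (n + 1)} {R τ ρ : ℝ} {M : ℝ≥0} {f : Euc n → ℝ} {h : Euc (n + 1) → ℝ}
    (hD : IsC11DomainWith Ω ρ M) (hτ : 0 < τ) (hτ1 : τ ≤ 1/100) (H : AlignedLipGraphOn Ω x₀ R τ f)
    (hν : OutwardNormalFieldOn Ω ν (ball x₀ R)) (hc : ContinuousOn h (closure Ω)) (hh : HarmonicOn h Ω) (hN : NeumannBC Ω ν h (ball x₀ R)) :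
    ∃ n' M', Cfg (tf x₀ f) h n' (eL n) x₀ (R / 4) τ M' := by
  obtain ⟨hL, h0, htl⟩ := tf_lev hD.1 hτ.le H
  refine mk_cfg (K := M + 1 / ρ) (ν := ν) hL h0 htl hτ.le hτ1 (by have := hD.2.2.1; positivity) (fun x hx => (hν x hx).1) (fun x hx => (hν x hx).2.2.2) ?_ hc (fun x hx => harmAt_of hD.1 hh hx) hN
  intro x hx y hy
  obtain ⟨t, e, A, h1, h2, h3, h4⟩ := chart hD.1 (hD.2.2.2 x hx.1)
  exact normal_quad h1 hD.2.2.1 h2 A h3 M.2 h4 (hν x hx).1 (hν x hx).2.2.2 hy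
end NodalNeumann

end

noncomputable section
open MeasureTheory Metric Set Filter Asymptotics
open scoped Topology NNReal ENNReal RealInnerProductSpace
namespace NodalNeumann
set_option linter.all false

section
variable {E : Type*} [NormedAddCommGroup E] [InnerProductSpace ℝ E] [FiniteDimensional ℝ E]
variable [MeasurableSpace E] [BorelSpace E]

lemma final_scaled {e : E} (he : ‖e‖ = 1) {κ : ℝ} (hκ : 0 < κ) : ∃ τN > 0, τN ≤ 1/100 ∧ τN ≤ tau0 E ∧ ∃ d > 0, ∀ (t h : E → ℝ) (n : E → E) (p : E) (R τ M : ℝ),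
    Cfg t h n e p R τ M → t 0 = 0 → ball (0:E) 4 ⊆ ball p R → τ < τN → HH t h 0 2 ≤ 1 → κ ≤ HH t h 0 (1/8) →
    ∃ b ∈ ball (0:E) (1/2), t b = 0 ∧ ∀ y, 0 < t y → ‖y - b‖ ≤ d → h y ≠ 0 := by
  obtain ⟨ε, hε, hB⟩ := partB he hκ
  have hL := LC_pos (E := E)
  have hCG := CG_pos (E := E)
  have ht0 := tau0_pos (E := E)
  set S := √(CG E) with hS
  have hSp : 0 < S := by positivity
  refine ⟨min (min (1/100) (tau0 E)) (min ε (ε / (36 * (S * LC E)))), by positivity, (min_le_left _ _).trans (min_le_left _ _), (min_le_left _ _).trans (min_le_right _ _),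
    min (1/8) (ε / (12 * (S * LC E))), by positivity, ?_⟩
  intro t h n p R τ M C h0 hsub hτ hH1 hH2
  have hτa : τ ≤ tau0 E := hτ.le.trans ((min_le_left _ _).trans (min_le_right _ _))
  have hτb : τ ≤ ε := hτ.le.trans ((min_le_right _ _).trans (min_le_left _ _))
  have hτc : τ ≤ ε / (36 * (S * LC E)) := hτ.le.trans ((min_le_right _ _).trans (min_le_right _ _))
  obtain ⟨b, hb1, hb2, hb3⟩ := hB t h n p R τ M C h0 hsub hτb hτa hH1 hH2
  refine ⟨b, hb1, hb2, fun y hty hy hy0 => ?_⟩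
  have hyd : ‖y - b‖ ≤ 1/8 := hy.trans (min_le_left _ _)
  have hye : ‖y - b‖ ≤ ε / (12 * (S * LC E)) := hy.trans (min_le_right _ _)
  rw [mem_ball_zero_iff] at hb1
  have hub : ∀ u ∈ ball b (1/2), ‖u‖ < 1 := fun u hu => by
    rw [mem_ball, dist_eq_norm] at hu
    have : ‖u‖ ≤ ‖u - b‖ + ‖b‖ := by simpa using norm_add_le (u - b) b
    linarith
  have h1 := C.osc_eps (x := b) (y := y) (r := 1/2) (S := S) (by norm_num) hSp (fun u hu => hsub (by
      rw [mem_ball_zero_iff]; linarith [hub u hu])) (fun u hu htu => by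
      have := C.growth hτa (q := 0) (r := 1) one_pos ((closedBall_subset_ball (by norm_num)).trans hsub) (mem_closedBall_zero_iff.2 (hub u hu).le) htu
      rw [one_pow, mul_one, mul_one] at this
      refine Real.abs_le_sqrt (this.trans ?_)
      unfold HH at hH1
      nlinarith) hb2.ge hty.le (by linarith)
  rw [hy0, sub_zero] at h1
  rw [le_div_iff₀ (by positivity)] at hye hτc
  nlinarith
end

variable {n : ℕ}

lemma norm_le_coord {m : ℕ} {v : Euc m} {c : ℝ} (hc : 0 ≤ c) (h : ∀ i, |v i| ≤ c) : ‖v‖ ≤ √m * c := by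
  rw [EuclideanSpace.norm_eq]
  have h1 : ∑ i, ‖v i‖ ^ 2 ≤ m * c ^ 2 := by
    have : ∑ i : Fin m, ‖v i‖ ^ 2 ≤ ∑ i : Fin m, c ^ 2 := Finset.sum_le_sum fun i _ => by
      rw [Real.norm_eq_abs]; have := h i; gcongr
    simpa using this
  refine (Real.sqrt_le_sqrt h1).trans ?_
  rw [Real.sqrt_mul (by positivity), Real.sqrt_sq hc]

lemma coord_le {m : ℕ} (v : Euc m) (i : Fin m) : |v i| ≤ ‖v‖ := by
  rw [← Real.norm_eq_abs]; exact PiLp.norm_apply_le v i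

lemma cube_size {m : ℕ} {x₀ c : Euc m} {s r : ℝ} (hs : 0 < s) (h : cube c s ⊆ ball x₀ r) : √m * s ≤ 2 * r := by
  set o : Euc m := WithLp.toLp 2 (fun _ => (1:ℝ)) with ho
  have hoi : ∀ i, o i = 1 := fun i => rfl
  have ho1 : ‖o‖ = √m := by rw [EuclideanSpace.norm_eq]; simp [hoi]
  have h1 : c + (s / 2) • o ∈ ball x₀ r := h fun i => by
    simp [hoi]; rw [abs_of_pos (by positivity)]
  have h2 : c - (s / 2) • o ∈ ball x₀ r := h fun i => by
    simp [hoi]; rw [abs_of_pos (by positivity)]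
  have h3 : ‖(c + (s / 2) • o) - (c - (s / 2) • o)‖ = √m * s := by
    have : (c + (s / 2) • o) - (c - (s / 2) • o) = s • o := by module
    rw [this, norm_smul, ho1, Real.norm_eq_abs, abs_of_pos hs]; ring
  rw [← h3, ← dist_eq_norm]
  rw [mem_ball] at h1 h2
  linarith [dist_triangle_right (c + (s / 2) • o) (c - (s / 2) • o) x₀]

lemma cube_compact {m : ℕ} (c : Euc m) {s : ℝ} (hs : 0 < s) : IsCompact (cube c s) := by
  refine Metric.isCompact_of_isClosed_isBounded ?_ ?_
  · have : cube c s = ⋂ i, {y | |y i - c i| ≤ s / 2} := by ext; simp [cube]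
    rw [this]
    refine isClosed_iInter fun i => isClosed_le ?_ continuous_const
    fun_prop
  · refine (Metric.isBounded_closedBall (x := c) (r := √m * (s / 2))).subset fun y hy => ?_
    rw [mem_closedBall, dist_eq_norm]
    exact norm_le_coord (by positivity) (fun i => by simpa using hy i)

/-- grid selection -/
lemma grid {Ω : Set (Euc (n + 1))} {t : Euc (n + 1) → ℝ} {x₀ xQ b : Euc (n + 1)} {R s : ℝ} (k : ℕ) (L : Lev Ω t (eL n) x₀ R) (htl : ∀ x y, |t x - t y| ≤ 2 * ‖x - y‖)
    (hs : 0 < s) (hb0 : t b = 0) (hb : ‖b - xQ‖ < s / 2) (hR : ∀ w, ‖w - b‖ ≤ 3 * (√((n + 1 : ℕ) : ℝ) * (s / 2 ^ k)) → w ∈ ball x₀ R) :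
    ∃ z, IsBdryCubeCenter Ω xQ s k z ∧ ∀ y ∈ cube z (s / 2 ^ k), ‖y - b‖ ≤ 4 * (√((n + 1 : ℕ) : ℝ) * (s / 2 ^ k)) := by
  set δ := s / 2 ^ k with hδ
  have hδp : 0 < δ := by positivity
  have hδs : δ * 2 ^ k = s := by rw [hδ]; field_simp
  have hbi : ∀ i, |b i - xQ i| < s / 2 := fun i => by
    have := coord_le (b - xQ) i
    simp only [PiLp.sub_apply] at this
    linarith
  set A : Fin n → ℝ := fun i => (b i.castSucc - xQ i.castSucc + s / 2) / δ with hA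
  have hA0 : ∀ i, 0 ≤ A i := fun i => by
    have := (abs_lt.1 (hbi i.castSucc)).1
    exact div_nonneg (by linarith) hδp.le
  have hA1 : ∀ i, A i < 2 ^ k := fun i => by
    have := (abs_lt.1 (hbi i.castSucc)).2
    rw [hA]; simp only
    rw [div_lt_iff₀ hδp]; linarith
  set a : Fin n → ℕ := fun i => ⌊A i⌋₊ with ha
  set w : Euc (n + 1) := WithLp.toLp 2 (Fin.snoc (α := fun _ => ℝ) (fun i : Fin n => xQ i.castSucc - s / 2 + ((a i : ℝ) + 1 / 2) * δ) (b (Fin.last n))) with hw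
  have hwc : ∀ i : Fin n, w i.castSucc = xQ i.castSucc - s / 2 + ((a i : ℝ) + 1 / 2) * δ := fun i => by simp [hw]
  have hwl : w (Fin.last n) = b (Fin.last n) := by simp [hw]
  have hwb : ‖w - b‖ ≤ √((n + 1 : ℕ) : ℝ) * δ := by
    refine norm_le_coord hδp.le fun i => ?_
    refine Fin.lastCases ?_ (fun i => ?_) i
    · simp only [PiLp.sub_apply, hwl, sub_self, abs_zero]; exact hδp.le
    · simp only [PiLp.sub_apply, hwc]
      have h1 : (a i : ℝ) ≤ A i := Nat.floor_le (hA0 i)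
      have h2 : A i < a i + 1 := Nat.lt_floor_add_one _
      have h3 : A i * δ = b i.castSucc - xQ i.castSucc + s / 2 := by simp only [hA]; field_simp
      rw [abs_le]
      constructor <;> nlinarith
  set z : Euc (n + 1) := w - t w • eL n with hz
  have hzb : ‖z - b‖ ≤ 3 * (√((n + 1 : ℕ) : ℝ) * δ) := by
    have h1 : z - b = (w - b) - t w • eL n := by rw [hz]; abel
    have h2 := htl w b
    rw [hb0, sub_zero] at h2
    rw [h1]
    refine (norm_sub_le _ _).trans ?_
    rw [norm_smul, L.he, mul_one, Real.norm_eq_abs]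
    linarith
  refine ⟨z, ⟨?_, a, fun i => ?_, fun i => ?_⟩, fun y hy => ?_⟩
  · rw [L.mem_fr (hR z hzb)]
    have := L.te w (-t w)
    rw [neg_smul, ← sub_eq_add_neg] at this
    rw [hz, this]; ring
  · have : (a i : ℝ) < 2 ^ k := (Nat.floor_le (hA0 i)).trans_lt (hA1 i)
    exact_mod_cast this
  · rw [← hwc i, hz]
    simp [eL, Fin.castSucc_ne_last]
  · have h1 : ‖y - z‖ ≤ √((n + 1 : ℕ) : ℝ) * (δ / 2) := norm_le_coord (by positivity) fun i => by simpa using hy i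
    have h2 : ‖y - b‖ ≤ ‖y - z‖ + ‖z - b‖ := by simpa using norm_add_le (y - z) (z - b)
    have h3 : 0 ≤ √((n + 1 : ℕ) : ℝ) * δ := by positivity
    linarith
end NodalNeumann

end

noncomputable section
open MeasureTheory Metric Set Filter Asymptotics
open scoped Topology NNReal ENNReal RealInnerProductSpace
namespace NodalNeumann

set_option maxHeartbeats 1000000 in
theorem cubes_with_small_doubling_index {n : ℕ} (ρ : ℝ) (M : ℝ≥0) :
    ∀ N : ℝ, 0 < N → ∃ τN : ℝ, 0 < τN ∧ ∃ kN : ℕ,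
    ∀ (Ω : Set (Euc (n + 1))) (ν : Euc (n + 1) → Euc (n + 1))
      (x₀ : Euc (n + 1)) (R τ : ℝ) (f : Euc n → ℝ)
      (xQ : Euc (n + 1)) (s : ℝ) (h : Euc (n + 1) → ℝ) (k : ℕ),
      kN ≤ k →
      IsC11DomainWith Ω ρ M →
      x₀ ∈ frontier Ω → 0 < R → 0 < τ → τ < τN →
      AlignedLipGraphOn Ω x₀ R τ f →
      xQ ∈ frontier Ω → 0 < s → cube xQ s ⊆ ball x₀ (R / 64) →
      OutwardNormalFieldOn Ω ν (ball x₀ R) →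
      ContinuousOn h (closure Ω) → HarmonicOn h Ω → (∃ y ∈ Ω, h y ≠ 0) →
      NeumannBC Ω ν h (ball x₀ R) →
      Nstar Ω h xQ s ≤ N →
      ∃ z : Euc (n + 1), IsBdryCubeCenter Ω xQ s k z ∧
        ∀ y ∈ cube z (s / 2 ^ k), y ∈ Ω → h y ≠ 0 := by
  intro N hN
  obtain ⟨τN, hτN, hτN1, hτN0, d, hd, hfin⟩ := final_scaled (eL_norm (n := n)) (κ := Real.exp (-(4 * N))) (Real.exp_pos _)
  set q : ℝ := √((n + 1 : ℕ) : ℝ) with hq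
  have hq1 : 1 ≤ q := by
    rw [hq, Real.one_le_sqrt]; push_cast; linarith [(Nat.cast_nonneg n : (0:ℝ) ≤ n)]
  obtain ⟨kN, hkN⟩ := exists_pow_lt_of_lt_one (show 0 < d / (4 * q) by positivity) (show (1/2:ℝ) < 1 by norm_num)
  refine ⟨τN, hτN, kN, ?_⟩
  intro Ω ν x₀ R τ f xQ s h k hk hD hx₀ hR hτ hττ hA hxQ hs hcube hν hc hh hne hNB hNs
  obtain ⟨L, ht0, htl⟩ := tf_lev hD.1 hτ.le hA
  obtain ⟨n', M', C⟩ := thm_cfg hD hτ (hττ.le.trans hτN1) hA hν hc hh hNB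
  set t := tf x₀ f with ht
  have hqs : q * s ≤ R / 32 := by have := cube_size hs hcube; linarith
  have hsq : s ≤ q * s := by nlinarith
  have hxQc : xQ ∈ cube xQ s := fun i => by simp; positivity
  have hxQd : ‖xQ - x₀‖ < R / 64 := by rw [← dist_eq_norm]; exact hcube hxQc
  have hxQb : xQ ∈ ball x₀ R := by rw [mem_ball, dist_eq_norm]; linarith
  have htxQ : t xQ = 0 := (L.mem_fr hxQb).1 hxQ
  have hxQcl : xQ ∈ closure Ω := frontier_subset_closure hxQ
  have g : Gl Ω h (eL n) := ⟨eL_norm, hD.1, hD.2.1.isPreconnected, hc, fun x hx => harmAt_of hD.1 hh hx, hne⟩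
  -- doubling
  obtain ⟨B, hB⟩ := g.partA (K := cube xQ s ∩ closure Ω) ((cube_compact xQ hs).inter_right isClosed_closure) inter_subset_right (by
    intro x hx hxΩ
    have hxd : dist x x₀ < R / 64 := hcube hx.1
    have hxf : x ∈ frontier Ω := by rw [hD.1.frontier_eq]; exact ⟨hx.2, hxΩ⟩
    have hxb : x ∈ ball x₀ R := by rw [mem_ball]; linarith
    have hs1 : ball x (R / 8) ⊆ ball x₀ (R / 4) := ball_subset_ball' (by linarith)
    have hs2 : ball x (R / 8) ⊆ ball x₀ R := ball_subset_ball' (by linarith)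
    refine g.sd_bdry hx.2 (C.mono hs1) (hττ.le.trans hτN0) (by positivity) ((L.mem_fr hxb).1 hxf) ?_
    ext y
    constructor
    · exact fun hy => ⟨(L.mem (hs2 hy.2)).1 hy.1, hy.2⟩
    · exact fun hy => ⟨(L.mem (hs2 hy.2)).2 hy.1, hy.2⟩) (q * s)
  have hdoub : ∀ r, 0 < r → r ≤ s → HO Ω h xQ (2 * r) ≤ Real.exp N * HO Ω h xQ r := by
    intro r hr hrs
    have h1 : Nfun Ω h xQ r ≤ N := by
      refine le_trans (le_csSup ⟨B, ?_⟩ ?_) hNs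
      · rintro _ ⟨x, hx, r, hr0, hr1, rfl⟩
        exact hB x hx r hr0 hr1
      · exact ⟨xQ, ⟨hxQc, hxQcl⟩, r, hr, hrs.trans hsq, rfl⟩
    have h1 : Real.log (HO Ω h xQ (2 * r) / HO Ω h xQ r) ≤ N := h1
    have h2 := g.pos hxQcl hr
    have h3 := g.pos hxQcl (show 0 < 2 * r by positivity)
    rw [Real.log_le_iff_le_exp (by positivity), div_le_iff₀ h2] at h1
    exact h1
  have hdoub4 : HO Ω h xQ (s * 2) ≤ Real.exp (4 * N) * HO Ω h xQ (s * (1/8)) := by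
    have e1 := hdoub s hs le_rfl
    have e2 := hdoub (s / 2) (by positivity) (by linarith)
    have e3 := hdoub (s / 4) (by positivity) (by linarith)
    have e4 := hdoub (s / 8) (by positivity) (by linarith)
    rw [show 2 * (s / 2) = s by ring] at e2
    rw [show 2 * (s / 4) = s / 2 by ring] at e3
    rw [show 2 * (s / 8) = s / 4 by ring] at e4
    rw [show s * 2 = 2 * s by ring, show s * (1/8) = s / 8 by ring, show 4 * N = N + (N + (N + N)) by ring, Real.exp_add, Real.exp_add, Real.exp_add]
    have hE := Real.exp_pos N
    calc HO Ω h xQ (2 * s) ≤ Real.exp N * HO Ω h xQ s := e1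
      _ ≤ Real.exp N * (Real.exp N * HO Ω h xQ (s / 2)) := by gcongr
      _ ≤ Real.exp N * (Real.exp N * (Real.exp N * HO Ω h xQ (s / 4))) := by gcongr
      _ ≤ Real.exp N * (Real.exp N * (Real.exp N * (Real.exp N * HO Ω h xQ (s / 8)))) := by gcongr
      _ = _ := by ring
  have hHH : ∀ r, r ≤ R / 2 → HH t h xQ r = HO Ω h xQ r := by
    intro r hr
    unfold HH HO
    congr 2
    ext y
    have hs2 : ball xQ r ⊆ ball x₀ R := ball_subset_ball' (by rw [dist_eq_norm]; linarith)
    constructor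
    · exact fun hy => ⟨hy.2, (L.mem (hs2 hy.2)).2 hy.1⟩
    · exact fun hy => ⟨(L.mem (hs2 hy.1)).1 hy.2, hy.1⟩
  -- scaling
  set P := HO Ω h xQ (s * 2) with hP
  have hPp : 0 < P := g.pos hxQcl (by positivity)
  set D := s ^ Module.finrank ℝ (Euc (n + 1)) with hDD
  have hDp : 0 < D := by positivity
  set κ' := √(D / P) with hκ'
  have hκp : 0 < κ' := by positivity
  have hκs : κ' ^ 2 = D / P := Real.sq_sqrt (by positivity)
  have C' := C.scale xQ hs κ'
  have hsc := fun r => HH_scale t h xQ 0 hs κ' r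
  simp only [smul_zero, add_zero] at hsc
  obtain ⟨b, hb1, hb2, hb3⟩ := hfin _ _ _ _ _ _ _ C' (by simp [htxQ]) (by
    intro y hy
    rw [mem_ball_zero_iff] at hy
    rw [mem_ball, dist_eq_norm, lt_div_iff₀ hs]
    have h1 : ‖y - s⁻¹ • (x₀ - xQ)‖ ≤ ‖y‖ + s⁻¹ * ‖xQ - x₀‖ := by
      refine (norm_sub_le _ _).trans ?_
      rw [norm_smul, norm_inv, Real.norm_eq_abs, abs_of_pos hs, norm_sub_rev x₀]
    have h2 : (s⁻¹ * ‖xQ - x₀‖) * s = ‖xQ - x₀‖ := by field_simp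
    nlinarith) hττ (by
    rw [hsc, hHH _ (by linarith), ← hDD, ← hP, hκs]
    apply le_of_eq; field_simp) (by
    rw [hsc, hHH _ (by linarith), ← hDD, hκs]
    have h1 : D / P * D⁻¹ * HO Ω h xQ (s * (1/8)) = HO Ω h xQ (s * (1/8)) / P := by field_simp
    rw [h1, le_div_iff₀ hPp, Real.exp_neg]
    rw [inv_mul_le_iff₀ (Real.exp_pos _)]
    exact hdoub4)
  have hb2' : t (xQ + s • b) = 0 := by
    rcases div_eq_zero_iff.1 hb2 with h | h
    · exact h
    · exact absurd h hs.ne'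
  rw [mem_ball_zero_iff] at hb1
  have hbn : ‖(xQ + s • b) - xQ‖ < s / 2 := by
    rw [add_sub_cancel_left, norm_smul, Real.norm_eq_abs, abs_of_pos hs]; nlinarith
  have hδs : s / 2 ^ k ≤ s := div_le_self hs.le (one_le_pow₀ (by norm_num))
  have hδ0 : 0 < s / 2 ^ k := by positivity
  have hqδ : q * (s / 2 ^ k) ≤ R / 32 := le_trans (by gcongr) hqs
  have hnear : ∀ w, ‖w - (xQ + s • b)‖ ≤ 4 * (q * (s / 2 ^ k)) → w ∈ ball x₀ R := by
    intro w hw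
    rw [mem_ball, dist_eq_norm]
    have h1 : w - x₀ = (w - (xQ + s • b)) + ((xQ + s • b) - xQ) + (xQ - x₀) := by abel
    rw [h1]
    have := norm_add₃_le (a := w - (xQ + s • b)) (b := (xQ + s • b) - xQ) (c := xQ - x₀)
    linarith
  have hqδ0 : 0 ≤ q * (s / 2 ^ k) := by positivity
  obtain ⟨z, hz1, hz2⟩ := grid (xQ := xQ) k L C.tlip' hs hb2' hbn (fun w hw => hnear w (hw.trans (by linarith)))
  refine ⟨z, hz1, fun y hy hyΩ hy0 => ?_⟩
  have hyb := hz2 y hy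
  have hty : 0 < t y := (L.mem (hnear y hyb)).1 hyΩ
  have hyy : xQ + s • (s⁻¹ • (y - xQ)) = y := by rw [smul_smul, mul_inv_cancel₀ hs.ne', one_smul]; abel
  refine hb3 (s⁻¹ • (y - xQ)) ?_ ?_ ?_
  · show 0 < t (xQ + s • (s⁻¹ • (y - xQ))) / s
    rw [hyy]; positivity
  · have h1 : s⁻¹ • (y - xQ) - b = s⁻¹ • (y - (xQ + s • b)) := by
      rw [← sub_sub, smul_sub s⁻¹ (y - xQ), smul_smul, inv_mul_cancel₀ hs.ne', one_smul]
    rw [h1, norm_smul, norm_inv, Real.norm_eq_abs, abs_of_pos hs, inv_mul_le_iff₀ hs]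
    refine hyb.trans ?_
    have h2 : (1/2:ℝ) ^ k ≤ (1/2) ^ kN := pow_le_pow_of_le_one (by norm_num) (by norm_num) hk
    have h3 : s / 2 ^ k = s * (1/2) ^ k := by rw [one_div, inv_pow]; rfl
    have h4 := h2.trans hkN.le
    rw [le_div_iff₀ (by positivity)] at h4
    rw [h3]
    have : 4 * (q * (s * (1/2) ^ k)) = s * ((1/2) ^ k * (4 * q)) := by ring
    rw [← hq, this]
    gcongr
  · show κ' * h (xQ + s • (s⁻¹ • (y - xQ))) = 0
    rw [hyy, hy0, mul_zero]

end NodalNeumann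

end
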